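/- Let γ ∈ C³_b(ℝ^{n−1}), p ∈ [1,∞), and suppose ρ satisfies Assumptions (A1) and (A2) with M = I, and that ‖γ‖_{C¹_b(ℝ^{n−1})} is sufficiently small. Then there exists a constant C_γ > 0, depending only on γ, ρ and p, such that for all ε ∈ (0,1] and all u ∈ W^{3,p}_I(ℝⁿ_γ): ‖L_ε^{ℝⁿ_γ} u + Δu‖_{L^p(ℝⁿ_γ)} ≤ C_γ ε^{1/p} ‖u‖_{W^{3,p}(ℝⁿ_γ)}. -/

import Mathlib

open MeasureTheory Filter Topology ENNReal Matrix

noncomputable section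

abbrev EV (n : ℕ) := EuclideanSpace ℝ (Fin n)

/-- The kernel `J(x) = ρ(x)/|x|²`. -/
def kernelJ {n : ℕ} (ρ : EV n → ℝ) (x : EV n) : ℝ := ρ x / ‖x‖ ^ 2

/-- The rescaled density `ρ_ε(x) = ε^{-n} ρ(x/ε)`. -/
def scaled {n : ℕ} (ρ : EV n → ℝ) (ε : ℝ) (x : EV n) : ℝ := (ε ^ n)⁻¹ * ρ (ε⁻¹ • x)

/-- Assumption (A1): `ρ` is measurable, nonnegative, not a.e. zero, even,
and `∫ ρ(x)(1+|x|) dx < ∞`. -/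
def A1 {n : ℕ} (ρ : EV n → ℝ) : Prop :=
  Measurable ρ ∧ (∀ x, 0 ≤ ρ x) ∧ ¬ (ρ =ᵐ[volume] (fun _ => (0 : ℝ))) ∧
  (∀ᵐ x : EV n ∂volume, ρ (-x) = ρ x) ∧
  Integrable (fun x : EV n => ρ x * (1 + ‖x‖)) volume

/-- `L_ε u (x) = ∫_{ℝⁿ} J_ε(x-y) (u(x) - u(y) - ∇u(x)·(x-y)) dy`. -/
def nlOp {n : ℕ} (ρ : EV n → ℝ) (ε : ℝ) (u : EV n → ℝ) (x : EV n) : ℝ :=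
  ∫ y : EV n, kernelJ (scaled ρ ε) (x - y) * (u x - u y - fderiv ℝ u x (x - y))

/-- The classical partial derivative `∂ᵢ u`. -/
def partialD {n : ℕ} (i : Fin n) (u : EV n → ℝ) : EV n → ℝ :=
  fun x => fderiv ℝ u x (EuclideanSpace.single i 1)

/-- Iterated classical partial derivatives along a list of directions. -/
def partialDList {n : ℕ} : List (Fin n) → (EV n → ℝ) → (EV n → ℝ)
  | [], u => u
  | i :: l, u => partialD i (partialDList l u)

/-- The momentum matrix `M = (1/2)∫_{ℝⁿ} J(z) z ⊗ z dz`. -/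
def momentum {n : ℕ} (ρ : EV n → ℝ) : Matrix (Fin n) (Fin n) ℝ :=
  Matrix.of fun i j => (1 / 2 : ℝ) * ∫ z : EV n, kernelJ ρ z * z i * z j

/-- Multiplication of a vector of `ℝⁿ` by a matrix. -/
def mulVecE {m : ℕ} (Q : Matrix (Fin m) (Fin m) ℝ) (x : EV m) : EV m :=
  (WithLp.equiv 2 (Fin m → ℝ)).symm (Q.mulVec ((WithLp.equiv 2 (Fin m → ℝ)) x))

/-- The point `(z', zₙ) ∈ ℝⁿ` with first coordinates `z' ∈ ℝ^{n-1}` and last coordinate `zₙ`. -/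
def snocE {n : ℕ} (z' : EV n) (t : ℝ) : EV (n + 1) :=
  (WithLp.equiv 2 (Fin (n + 1) → ℝ)).symm
    (Fin.snoc ((WithLp.equiv 2 (Fin n → ℝ)) z') t)

/-- `v = ∂ᵢ u` weakly on `Ω`. -/
def WeakDerivOn {n : ℕ} (Ω : Set (EV n)) (i : Fin n) (u v : EV n → ℝ) : Prop :=
  ∀ φ : EV n → ℝ, ContDiff ℝ (⊤ : ℕ∞) φ → HasCompactSupport φ → tsupport φ ⊆ Ω →
    ∫ x in Ω, u x * partialD i φ x = - ∫ x in Ω, v x * φ x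

/-- `D` is a system of weak partial derivatives of `u` on `Ω` up to order `k`,
all lying in `L^p(Ω)`; i.e. `D` witnesses that `u ∈ W^{k,p}(Ω)`. -/
def IsSobDerivs {n : ℕ} (Ω : Set (EV n)) (k : ℕ) (p : ℝ≥0∞) (u : EV n → ℝ)
    (D : List (Fin n) → EV n → ℝ) : Prop :=
  D [] = u ∧
  (∀ l : List (Fin n), l.length < k → ∀ i : Fin n, WeakDerivOn Ω i (D l) (D (i :: l))) ∧
  (∀ l : List (Fin n), l.length ≤ k → MemLp (D l) p (volume.restrict Ω))

/-- `u ∈ W^{k,p}(Ω)`. -/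
def MemW {n : ℕ} (Ω : Set (EV n)) (k : ℕ) (p : ℝ≥0∞) (u : EV n → ℝ) : Prop :=
  ∃ D, IsSobDerivs Ω k p u D

/-- The `W^{k,p}`-norm computed from a system `D` of weak derivatives:
the sum of the `L^p` norms of all weak derivatives of order at most `k`. -/
def WNormD {n : ℕ} (k : ℕ) (p : ℝ≥0∞) (μ : Measure (EV n))
    (D : List (Fin n) → EV n → ℝ) : ℝ≥0∞ :=
  ∑' l : List (Fin n), if l.length ≤ k then eLpNorm (D l) p μ else 0

/-- The first `n` coordinates of a point of `ℝ^{n+1}`. -/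
def firstCoords {n : ℕ} (x : EV (n + 1)) : EV n :=
  (WithLp.equiv 2 (Fin n → ℝ)).symm (fun i => x i.castSucc)

/-- The curved half space `ℝⁿ_γ = {x : xₙ > γ(x₁,…,x_{n-1})}`. -/
def halfSpace {n : ℕ} (γ : EV n → ℝ) : Set (EV (n + 1)) :=
  {x : EV (n + 1) | γ (firstCoords x) < x (Fin.last n)}

/-- `γ ∈ C^k_b`: `γ` is `k` times continuously differentiable with bounded derivatives. -/
def Ckb {n : ℕ} (k : ℕ) (γ : EV n → ℝ) : Prop :=
  ContDiff ℝ k γ ∧ ∀ m : ℕ, m ≤ k → ∃ C : ℝ, ∀ x, ‖iteratedFDeriv ℝ m γ x‖ ≤ C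

/-- Assumption (A2): `ρ ∈ C¹(ℝⁿ∖{0})` with singularity bounds
`|ρ(x)| ≤ c₀|x|^{2-α-n}(1+|x|)^{-N}`, `|∇ρ(x)| ≤ c₁|x|^{1-α-n}(1+|x|)^{-N}` for some
`c₀, c₁ > 0`, `α ∈ (0,2)`, `N > 3-α`; and, with `A := √M`, the kernel satisfies
`∫_{ℝ^{n-1}} J(AQ(z', zₙ)) z' dz' = 0` for all `zₙ ∈ ℝ` and `Q ∈ SO(n)`.
(The ambient dimension is `n + 1`.) -/
def A2 {n : ℕ} (ρ : EV (n + 1) → ℝ) : Prop :=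
  ContDiffOn ℝ 1 ρ {(0 : EV (n + 1))}ᶜ ∧
  (∃ c₀ c₁ α N : ℝ, 0 < c₀ ∧ 0 < c₁ ∧ 0 < α ∧ α < 2 ∧ 3 - α < N ∧
    ∀ x : EV (n + 1), x ≠ 0 →
      |ρ x| ≤ c₀ * ‖x‖ ^ ((2 : ℝ) - α - (n + 1 : ℝ)) * (1 + ‖x‖) ^ (-N) ∧
      ‖fderiv ℝ ρ x‖ ≤ c₁ * ‖x‖ ^ ((1 : ℝ) - α - (n + 1 : ℝ)) * (1 + ‖x‖) ^ (-N)) ∧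
  (∃ A : Matrix (Fin (n + 1)) (Fin (n + 1)) ℝ, A.PosDef ∧ A * A = momentum ρ ∧
    ∀ t : ℝ, ∀ Q : Matrix (Fin (n + 1)) (Fin (n + 1)) ℝ, Qᵀ * Q = 1 → Q.det = 1 →
      (∫ z' : EV n, kernelJ ρ (mulVecE (A * Q) (snocE z' t)) • z') = 0)

/-- The homogeneous conormal boundary condition `M∇u · n = 0` on `∂Ω`, formulated weakly:
for any system of weak derivatives of `u ∈ W^{2,p}(Ω)` and any test function
`φ ∈ C_c^∞(ℝⁿ)`, Green's formula holds on `Ω` with no boundary contribution. -/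
def NeumannBC {m : ℕ} (Ω : Set (EV m)) (Mm : Matrix (Fin m) (Fin m) ℝ) (p : ℝ≥0∞)
    (u : EV m → ℝ) : Prop :=
  ∀ D : List (Fin m) → EV m → ℝ, IsSobDerivs Ω 2 p u D →
    ∀ φ : EV m → ℝ, ContDiff ℝ (⊤ : ℕ∞) φ → HasCompactSupport φ →
      (∑ i : Fin m, ∑ j : Fin m, Mm i j * ∫ x in Ω, D [i, j] x * φ x)
        = - ∑ i : Fin m, ∑ j : Fin m, Mm i j * ∫ x in Ω, D [j] x * partialD i φ x

/-- `u ∈ W^{k,p}(Ω)` together with the boundary condition `M∇u · n = 0` on `∂Ω`. -/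
def MemWN {m : ℕ} (Ω : Set (EV m)) (Mm : Matrix (Fin m) (Fin m) ℝ) (k : ℕ) (p : ℝ≥0∞)
    (u : EV m → ℝ) : Prop :=
  MemW Ω k p u ∧ NeumannBC Ω Mm p u

/-- `l` is the principal value `P.V. ∫_Ω J_ε(x-y)(u(x)-u(y)) dy` at the point `x`. -/
def pvAt {m : ℕ} (Ω : Set (EV m)) (ρ : EV m → ℝ) (ε : ℝ) (u : EV m → ℝ) (x : EV m)
    (l : ℝ) : Prop :=
  Tendsto
    (fun r : ℝ =>
      ∫ y in Ω ∩ {y : EV m | r ≤ dist x y}, kernelJ (scaled ρ ε) (x - y) * (u x - u y))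
    (𝓝[>] 0) (𝓝 l)

/-- `L` is a bounded linear extension to `W^{2,p}_M(Ω)` (Sobolev functions with the
boundary condition `M∇u · n = 0`), with operator bound `C`, of the nonlocal operator
`P.V. ∫_Ω J_ε(·-y)(u(·)-u(y)) dy` defined on `C_c²(cl Ω) ∩ W^{2,p}_M(Ω)`. -/
def IsNLExtOn {m : ℕ} (Ω : Set (EV m)) (Mm : Matrix (Fin m) (Fin m) ℝ) (ρ : EV m → ℝ)
    (p : ℝ≥0∞) (ε C : ℝ) (L : (EV m → ℝ) → EV m → ℝ) : Prop :=
  (∀ u : EV m → ℝ, ContDiff ℝ 2 u → HasCompactSupport u → MemWN Ω Mm 2 p u →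
    ∀ᵐ x ∂(volume.restrict Ω), pvAt Ω ρ ε u x (L u x)) ∧
  (∀ u v : EV m → ℝ, MemWN Ω Mm 2 p u → MemWN Ω Mm 2 p v → ∀ a b : ℝ,
    L (fun x => a * u x + b * v x) =ᵐ[volume.restrict Ω] fun x => a * L u x + b * L v x) ∧
  (∀ u : EV m → ℝ, MemWN Ω Mm 2 p u → MemLp (L u) p (volume.restrict Ω)) ∧
  (∀ u D, MemWN Ω Mm 2 p u → IsSobDerivs Ω 2 p u D →
    eLpNorm (L u) p (volume.restrict Ω)
      ≤ ENNReal.ofReal C * WNormD 2 p (volume.restrict Ω) D)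

/-- `Ω ⊆ ℝ^{n+1}` is an open set whose boundary is locally, up to a rotation, the region
above the graph of a `C^k` function with bounded derivatives (a domain of class `C^k`). -/
def IsGraphDomain {n : ℕ} (k : ℕ) (Ω : Set (EV (n + 1))) : Prop :=
  IsOpen Ω ∧ ∀ z ∈ frontier Ω,
    ∃ (U : Set (EV (n + 1))) (Q : Matrix (Fin (n + 1)) (Fin (n + 1)) ℝ) (γ : EV n → ℝ),
      IsOpen U ∧ z ∈ U ∧ Qᵀ * Q = 1 ∧ Q.det = 1 ∧ Ckb k γ ∧
      Ω ∩ U = (mulVecE Q '' halfSpace γ) ∩ U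

noncomputable section

/-- The vertical unit vector. -/
def eL (n : ℕ) : EV (n + 1) := EuclideanSpace.single (Fin.last n) (1 : ℝ)

/-- The vertical distance to the graph. -/
def tf {n : ℕ} (γ : EV n → ℝ) (x : EV (n + 1)) : ℝ := x (Fin.last n) - γ (firstCoords x)

/-- `firstCoords` as a linear map. -/
def PFl (n : ℕ) : EV (n + 1) →ₗ[ℝ] EV n where
  toFun := firstCoords
  map_add' := by
    intro x y
    ext i
    simp [firstCoords]
  map_smul' := by
    intro c x
    ext i
    simp [firstCoords]

/-- `firstCoords` as a continuous linear map. -/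
def PF (n : ℕ) : EV (n + 1) →L[ℝ] EV n := LinearMap.toContinuousLinearMap (PFl n)

theorem PF_apply {n : ℕ} (x : EV (n + 1)) : PF n x = firstCoords x := rfl

theorem firstCoords_apply {n : ℕ} (x : EV (n + 1)) (i : Fin n) : firstCoords x i = x i.castSucc := by
  simp [firstCoords]

theorem firstCoords_add {n : ℕ} (x y : EV (n + 1)) :
    firstCoords (x + y) = firstCoords x + firstCoords y := (PFl n).map_add x y

theorem firstCoords_smul {n : ℕ} (c : ℝ) (y : EV (n + 1)) :
    firstCoords (c • y) = c • firstCoords y := (PFl n).map_smul c y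

theorem firstCoords_eL (n : ℕ) : firstCoords (eL n) = 0 := by
  ext i
  simp [firstCoords_apply, eL, Fin.castSucc_ne_last]

theorem eL_last (n : ℕ) : (eL n) (Fin.last n) = 1 := by simp [eL]

theorem norm_eL (n : ℕ) : ‖eL n‖ = 1 := by simp [eL]

theorem norm_sq_split {n : ℕ} (x : EV (n + 1)) :
    ‖x‖ ^ 2 = ‖firstCoords x‖ ^ 2 + (x (Fin.last n)) ^ 2 := by
  rw [EuclideanSpace.norm_sq_eq, EuclideanSpace.norm_sq_eq, Fin.sum_univ_castSucc]
  simp [firstCoords_apply]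

theorem norm_firstCoords_le {n : ℕ} (x : EV (n + 1)) : ‖firstCoords x‖ ≤ ‖x‖ := by
  have := norm_sq_split x
  nlinarith [norm_nonneg x, norm_nonneg (firstCoords x), sq_nonneg (x (Fin.last n))]

theorem abs_last_le {n : ℕ} (x : EV (n + 1)) : |x (Fin.last n)| ≤ ‖x‖ := by
  have := norm_sq_split x
  refine abs_le_of_sq_le_sq ?_ (norm_nonneg _) 
  nlinarith [sq_nonneg ‖firstCoords x‖]

theorem firstCoords_snocE {n : ℕ} (z : EV n) (t : ℝ) : firstCoords (snocE z t) = z := by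
  ext i
  simp [firstCoords_apply, snocE]

theorem snocE_last {n : ℕ} (z : EV n) (t : ℝ) : (snocE z t) (Fin.last n) = t := by
  simp [snocE]

theorem snocE_split {n : ℕ} (x : EV (n + 1)) : snocE (firstCoords x) (x (Fin.last n)) = x := by
  ext i
  refine Fin.lastCases ?_ (fun i => ?_) i
  · simp [snocE]
  · simp [snocE, firstCoords]

theorem measurable_firstCoords (n : ℕ) : Measurable (firstCoords : EV (n + 1) → EV n) :=
  (PF n).measurable

theorem continuous_firstCoords (n : ℕ) : Continuous (firstCoords : EV (n + 1) → EV n) :=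
  (PF n).continuous

theorem continuous_last (n : ℕ) : Continuous (fun x : EV (n + 1) => x (Fin.last n)) := by
  fun_prop

theorem continuous_snocE (n : ℕ) : Continuous (fun q : EV n × ℝ => snocE q.1 q.2) := by
  unfold snocE
  refine (PiLp.continuous_toLp 2 _).comp ?_
  refine continuous_pi fun i => ?_
  refine Fin.lastCases ?_ (fun i => ?_) i
  · simpa using continuous_snd
  · simp only [WithLp.equiv_apply, Fin.snoc_castSucc]
    fun_prop

/-- Splitting `ℝ^{n+1} = ℝ^n × ℝ`. -/
def splitE (n : ℕ) : EV (n + 1) ≃ᵐ EV n × ℝ where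
  toFun x := (firstCoords x, x (Fin.last n))
  invFun q := snocE q.1 q.2
  left_inv x := snocE_split x
  right_inv q := by simp [firstCoords_snocE, snocE_last]
  measurable_toFun := (measurable_firstCoords n).prodMk (continuous_last n).measurable
  measurable_invFun := (continuous_snocE n).measurable

theorem mp_splitE (n : ℕ) :
    MeasurePreserving (splitE n) (volume : Measure (EV (n + 1))) (volume.prod volume) := by
  have h1 := (EuclideanSpace.volume_preserving_symm_measurableEquiv_toLp (Fin (n + 1)))
  have h2 := volume_preserving_piFinSuccAbove (fun _ : Fin (n + 1) => ℝ) (Fin.last n)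
  have h3 : MeasurePreserving (Prod.swap : ℝ × (Fin n → ℝ) → (Fin n → ℝ) × ℝ)
    (volume.prod volume) (volume.prod volume) := Measure.measurePreserving_swap
  have h4 := (EuclideanSpace.volume_preserving_symm_measurableEquiv_toLp (Fin n)).symm
  have h5 := h4.prod (MeasurePreserving.id (volume : Measure ℝ))
  have h6 := h5.comp (h3.comp (h2.comp h1))
  suffices h : (splitE n : EV (n + 1) → EV n × ℝ) = _ by
    rw [h]; exact h6
  funext x
  refine Prod.ext ?_ ?_
  · ext i
    simp [splitE, firstCoords, MeasurableEquiv.piFinSuccAbove]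
    rfl
  · simp [splitE, MeasurableEquiv.piFinSuccAbove]
    try rfl

theorem mp_splitE_symm (n : ℕ) :
    MeasurePreserving (fun q : EV n × ℝ => snocE q.1 q.2) (volume.prod volume)
      (volume : Measure (EV (n + 1))) := (mp_splitE n).symm

theorem lintegral_split {n : ℕ} (f : EV (n + 1) → ℝ≥0∞) (hf : Measurable f) :
    ∫⁻ x, f x = ∫⁻ z : EV n, ∫⁻ s : ℝ, f (snocE z s) := by
  rw [← (mp_splitE_symm n).lintegral_comp hf, lintegral_prod]
  exact (hf.comp (mp_splitE_symm n).measurable).aemeasurable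

/-- Translations followed by vertical shears are measure preserving. -/
theorem mp_shear {n : ℕ} (z : EV (n + 1)) (κ : EV n → ℝ) (hκ : Measurable κ) :
    MeasurePreserving (fun x : EV (n + 1) => x + z + κ (firstCoords x) • eL n)
      volume volume := by
  have h1 : MeasurePreserving (fun q : EV n × ℝ => (q.1, q.2 + κ q.1))
      (volume.prod volume) (volume.prod volume) := by
    refine (MeasurePreserving.id (volume : Measure (EV n))).skew_product
      (g := fun a b => b + κ a) (by fun_prop) (ae_of_all _ fun a => ?_)
    exact (measurePreserving_add_right volume (κ a)).map_eq
  have h2 := (mp_splitE_symm n).comp (h1.comp (mp_splitE n))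
  have h3 := (measurePreserving_add_right (volume : Measure (EV (n + 1))) z).comp h2
  convert h3 using 1
  funext x
  ext i
  refine Fin.lastCases ?_ (fun i => ?_) i
  · simp [splitE, snocE_last, eL_last]
    ring
  · have : (snocE (firstCoords x) (x (Fin.last n) + κ (firstCoords x))) i.castSucc
       = x i.castSucc := by
      rw [← firstCoords_apply, firstCoords_snocE, firstCoords_apply]
    simp [splitE, this, eL, Fin.castSucc_ne_last]

theorem mem_halfSpace {n : ℕ} (γ : EV n → ℝ) (x : EV (n + 1)) :
    x ∈ halfSpace γ ↔ 0 < tf γ x := by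
  simp [halfSpace, tf]

theorem tf_add_smul_eL {n : ℕ} (γ : EV n → ℝ) (x : EV (n + 1)) (s : ℝ) :
    tf γ (x + s • eL n) = tf γ x + s := by
  simp [tf, firstCoords_add, firstCoords_smul, firstCoords_eL, eL_last]
  ring

theorem tf_contDiff {n : ℕ} {γ : EV n → ℝ} {k : WithTop ℕ∞} (hγ : ContDiff ℝ k γ) :
    ContDiff ℝ k (tf γ) := by
  unfold tf
  refine ContDiff.sub (by fun_prop) ?_
  exact hγ.comp (PF n).contDiff

theorem tf_continuous {n : ℕ} {γ : EV n → ℝ} (hγ : Continuous γ) : Continuous (tf γ) :=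
  (continuous_last n).sub (hγ.comp (continuous_firstCoords n))

theorem isOpen_halfSpace {n : ℕ} {γ : EV n → ℝ} (hγ : Continuous γ) : IsOpen (halfSpace γ) := by
  have : halfSpace γ = tf γ ⁻¹' Set.Ioi 0 := by
    ext x; simp [mem_halfSpace]
  rw [this]
  exact (tf_continuous hγ).isOpen_preimage _ isOpen_Ioi

theorem gamma_lip {n : ℕ} {γ : EV n → ℝ} (hγ : Differentiable ℝ γ)
    (h1 : ∀ x, ‖fderiv ℝ γ x‖ ≤ 1) (x y : EV n) : |γ y - γ x| ≤ ‖y - x‖ := by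
  have := convex_univ.norm_image_sub_le_of_norm_fderiv_le (𝕜 := ℝ) (f := γ) (C := 1)
    (fun x _ => hγ x) (fun x _ => h1 x) (Set.mem_univ x) (Set.mem_univ y)
  simpa using this

theorem tf_lip {n : ℕ} {γ : EV n → ℝ} (hγ : Differentiable ℝ γ)
    (h1 : ∀ x, ‖fderiv ℝ γ x‖ ≤ 1) (x z : EV (n + 1)) : |tf γ (x + z) - tf γ x| ≤ 2 * ‖z‖ := by
  have h := gamma_lip hγ h1 (firstCoords x) (firstCoords (x + z))
  have h2 : firstCoords (x + z) - firstCoords x = firstCoords z := by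
    rw [firstCoords_add]; abel
  rw [h2] at h
  have h3 := norm_firstCoords_le z
  have h4 := abs_last_le z
  have : tf γ (x + z) - tf γ x = z (Fin.last n) - (γ (firstCoords (x + z)) - γ (firstCoords x)) := by
    simp [tf]; ring
  rw [this]
  refine (abs_sub _ _).trans ?_
  linarith
end

noncomputable section

/-- The `L^q` norm of a nonnegative function. -/
def LN {X : Type*} [MeasurableSpace X] (q : ℝ) (μ : Measure X) (f : X → ℝ≥0∞) : ℝ≥0∞ :=
  (∫⁻ x, f x ^ q ∂μ) ^ (1 / q)

section LNsec
variable {X : Type*} [MeasurableSpace X] {q : ℝ} {μ : Measure X}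

theorem LN_mono_ae (hq : 1 ≤ q) {f g : X → ℝ≥0∞} (h : ∀ᵐ x ∂μ, f x ≤ g x) :
    LN q μ f ≤ LN q μ g := by
  unfold LN
  refine ENNReal.rpow_le_rpow (lintegral_mono_ae ?_) (by positivity)
  filter_upwards [h] with x hx
  exact ENNReal.rpow_le_rpow hx (by linarith)

theorem LN_add_le (hq : 1 ≤ q) {f g : X → ℝ≥0∞} (hf : AEMeasurable f μ) (hg : AEMeasurable g μ) :
    LN q μ (fun x => f x + g x) ≤ LN q μ f + LN q μ g :=
  ENNReal.lintegral_Lp_add_le hf hg hq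

theorem LN_const_mul (hq : 1 ≤ q) {f : X → ℝ≥0∞} {c : ℝ≥0∞} (hc : c ≠ ⊤) :
    LN q μ (fun x => c * f x) = c * LN q μ f := by
  unfold LN
  have hq0 : 0 < q := by linarith
  simp_rw [ENNReal.mul_rpow_of_nonneg _ _ hq0.le]
  rw [lintegral_const_mul' _ _ (ENNReal.rpow_ne_top_of_nonneg hq0.le hc),
    ENNReal.mul_rpow_of_nonneg _ _ (by positivity), ← ENNReal.rpow_mul]
  rw [mul_one_div_cancel hq0.ne', ENNReal.rpow_one]

theorem LN_zero (hq : 1 ≤ q) : LN q μ (fun _ => 0) = 0 := by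
  unfold LN
  have hq0 : 0 < q := by linarith
  simp [ENNReal.zero_rpow_of_pos hq0, hq0]

theorem LN_finset_sum_le (hq : 1 ≤ q) {ι : Type*} (s : Finset ι) {f : ι → X → ℝ≥0∞}
    (hf : ∀ i ∈ s, AEMeasurable (f i) μ) :
    LN q μ (fun x => ∑ i ∈ s, f i x) ≤ ∑ i ∈ s, LN q μ (f i) := by
  classical
  induction s using Finset.induction_on with
  | empty => simp [LN_zero hq]
  | insert a s ha ih =>
    simp_rw [Finset.sum_insert ha]
    refine (LN_add_le hq (hf a (by simp)) ?_).trans ?_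
    · exact Finset.aemeasurable_fun_sum _ fun i hi => hf i (by simp [hi])
    · gcongr
      exact ih fun i hi => hf i (by simp [hi])

theorem eLpNorm_eq_LN {p : ℝ≥0∞} (hp1 : 1 ≤ p) (hp : p ≠ ⊤) (u : X → ℝ) :
    eLpNorm u p μ = LN p.toReal μ (fun x => ‖u x‖ₑ) := by
  rw [eLpNorm_eq_lintegral_rpow_enorm_toReal (by positivity) hp]
  rfl

theorem LN_restrict_mono (hq : 1 ≤ q) {s t : Set X} (hst : s ⊆ t) (f : X → ℝ≥0∞) :
    LN q (μ.restrict s) f ≤ LN q (μ.restrict t) f := by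
  unfold LN
  exact ENNReal.rpow_le_rpow (lintegral_mono_set hst) (by positivity)

theorem jensen_rpow (hq : 1 ≤ q) {f : X → ℝ≥0∞} (hf : AEMeasurable f μ) :
    (∫⁻ x, f x ∂μ) ^ q ≤ μ Set.univ ^ (q - 1) * ∫⁻ x, f x ^ q ∂μ := by
  have hq0 : 0 < q := by linarith
  have h := eLpNorm'_le_eLpNorm'_mul_rpow_measure_univ (μ := μ) (f := f) one_pos hq
    hf.aestronglyMeasurable
  simp only [eLpNorm', enorm_eq_self, ENNReal.rpow_one, div_one] at h
  have h2 := ENNReal.rpow_le_rpow h hq0.le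
  refine h2.trans (le_of_eq ?_)
  rw [ENNReal.mul_rpow_of_nonneg _ _ hq0.le, ← ENNReal.rpow_mul, ← ENNReal.rpow_mul,
    one_div, inv_mul_cancel₀ hq0.ne', ENNReal.rpow_one, mul_comm]
  congr 2
  field_simp

theorem LN_minkowski (hq : 1 ≤ q) [SFinite μ] {Y : Type*} [MeasurableSpace Y] {ν : Measure Y}
    [SFinite ν] {f : X → Y → ℝ≥0∞} (hf : Measurable (Function.uncurry f)) {A : ℝ≥0∞}
    (hA : ∀ᵐ y ∂ν, ∫⁻ x, f x y ^ q ∂μ ≤ A ^ q) :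
    LN q μ (fun x => ∫⁻ y, f x y ∂ν) ≤ ν Set.univ * A := by
  have hq0 : 0 < q := by linarith
  unfold LN
  have h1 : ∫⁻ x, (∫⁻ y, f x y ∂ν) ^ q ∂μ ≤ ν Set.univ ^ (q - 1) * (ν Set.univ * A ^ q) := by
    calc ∫⁻ x, (∫⁻ y, f x y ∂ν) ^ q ∂μ
        ≤ ∫⁻ x, ν Set.univ ^ (q - 1) * ∫⁻ y, f x y ^ q ∂ν ∂μ := by
          refine lintegral_mono fun x => jensen_rpow hq ?_
          exact (hf.comp measurable_prodMk_left).aemeasurable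
      _ = ν Set.univ ^ (q - 1) * ∫⁻ x, ∫⁻ y, f x y ^ q ∂ν ∂μ := by
          rw [lintegral_const_mul]
          exact (hf.pow_const q).lintegral_prod_right'
      _ = ν Set.univ ^ (q - 1) * ∫⁻ y, ∫⁻ x, f x y ^ q ∂μ ∂ν := by
          rw [lintegral_lintegral_swap (f := fun x y => f x y ^ q)]
          exact (hf.pow_const q).aemeasurable
      _ ≤ ν Set.univ ^ (q - 1) * ∫⁻ y, A ^ q ∂ν := by
          gcongr 1
          exact lintegral_mono_ae hA
      _ = _ := by rw [lintegral_const, mul_comm (A ^ q)]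
  have h2 : ν Set.univ ^ (q - 1) * (ν Set.univ * A ^ q) = (ν Set.univ * A) ^ q := by
    rw [ENNReal.mul_rpow_of_nonneg _ _ hq0.le, ← mul_assoc]
    congr 1
    conv_lhs => rw [← ENNReal.rpow_one (ν Set.univ), ← ENNReal.rpow_mul]
    rw [← ENNReal.rpow_add_of_nonneg _ _ (by linarith) (by norm_num)]
    congr 1
    ring
  rw [h2] at h1
  calc _ ≤ ((ν Set.univ * A) ^ q) ^ (1 / q) := ENNReal.rpow_le_rpow h1 (by positivity)
    _ = _ := by rw [← ENNReal.rpow_mul, mul_one_div_cancel hq0.ne', ENNReal.rpow_one]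

end LNsec

theorem measurable_transl {n : ℕ} {F : EV (n + 1) → ℝ≥0∞} (hF : Measurable F) :
    Measurable (fun a : EV (n + 1) × ℝ => F (a.1 + a.2 • eL n)) :=
  hF.comp (by fun_prop)

/-- The layer lemma: vertical averages against a weight in the distance to the boundary. -/
theorem layer_lintegral {n : ℕ} {γ : EV n → ℝ} (hγ : Continuous γ) {w : ℝ → ℝ≥0∞}
    (hw : Measurable w) {F : EV (n + 1) → ℝ≥0∞} (hF : Measurable F) :
    ∫⁻ x in halfSpace γ, w (tf γ x) * ∫⁻ s : ℝ, F (x + s • eL n)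
      = (∫⁻ s in Set.Ioi (0 : ℝ), w s) * ∫⁻ x, F x := by
  have hT : Measurable (tf γ) := (tf_continuous hγ).measurable
  set W : ℝ → ℝ≥0∞ := (Set.Ioi (0 : ℝ)).indicator w with hW
  have hWm : Measurable W := hw.indicator measurableSet_Ioi
  have h1 : ∫⁻ x in halfSpace γ, w (tf γ x) * ∫⁻ s : ℝ, F (x + s • eL n)
      = ∫⁻ x, ∫⁻ s : ℝ, W (tf γ x) * F (x + s • eL n) := by
    rw [← lintegral_indicator (isOpen_halfSpace hγ).measurableSet]
    refine lintegral_congr fun x => ?_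
    have hFs : Measurable (fun s : ℝ => F (x + s • eL n)) := hF.comp (by fun_prop)
    rw [lintegral_const_mul _ hFs]
    by_cases hx : x ∈ halfSpace γ
    · have := (mem_halfSpace γ x).1 hx
      simp [hx, hW, this]
    · have h' := hx
      rw [mem_halfSpace] at h'
      simp only [Set.indicator, hx, hW, Set.mem_Ioi, h', if_false, zero_mul]
  rw [h1, lintegral_lintegral_swap]
  swap
  · exact ((hWm.comp (hT.comp measurable_fst)).mul (measurable_transl hF)).aemeasurable
  have h2 : ∀ s : ℝ, ∫⁻ x, W (tf γ x) * F (x + s • eL n) = ∫⁻ x, W (tf γ x - s) * F x := by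
    intro s
    rw [← lintegral_add_right_eq_self (fun x => W (tf γ x - s) * F x) (s • eL n)]
    refine lintegral_congr fun x => ?_
    rw [tf_add_smul_eL]; simp
  simp_rw [h2]
  rw [lintegral_lintegral_swap]
  swap
  · exact ((hWm.comp ((hT.comp measurable_snd).sub measurable_fst)).mul
      (hF.comp measurable_snd)).aemeasurable
  have h3 : ∀ x, ∫⁻ s, W (tf γ x - s) * F x = (∫⁻ s, W s) * F x := by
    intro x
    have hWs : Measurable (fun s : ℝ => W (tf γ x - s)) := hWm.comp (by fun_prop)
    rw [lintegral_mul_const _ hWs, lintegral_sub_left_eq_self W]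
  simp_rw [h3]
  rw [lintegral_const_mul _ hF, lintegral_indicator measurableSet_Ioi]

theorem layer_LN {n : ℕ} {γ : EV n → ℝ} (hγ : Continuous γ) {q : ℝ} (hq : 1 ≤ q) {w : ℝ → ℝ≥0∞}
    (hw : Measurable w) {F : EV (n + 1) → ℝ≥0∞} (hF : Measurable F) {f : EV (n + 1) → ℝ≥0∞}
    (hf : ∀ᵐ x ∂(volume.restrict (halfSpace γ)), f x ^ q ≤ ∫⁻ s : ℝ, F (x + s • eL n) ^ q) :
    LN q (volume.restrict (halfSpace γ)) (fun x => w (tf γ x) * f x)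
      ≤ (∫⁻ s in Set.Ioi (0 : ℝ), w s ^ q) ^ (1 / q) * LN q volume F := by
  have hq0 : 0 < q := by linarith
  unfold LN
  rw [← ENNReal.mul_rpow_of_nonneg _ _ (by positivity),
    ← layer_lintegral hγ (hw.pow_const q) (hF.pow_const q)]
  refine ENNReal.rpow_le_rpow (lintegral_mono_ae ?_) (by positivity)
  filter_upwards [hf] with x hx
  rw [ENNReal.mul_rpow_of_nonneg _ _ hq0.le]
  gcongr
end

noncomputable section

/-- The boundary layer weight. -/
def wt (β s : ℝ) : ℝ := (1 + s) ^ (-(1 + β))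

theorem wt_nonneg {β s : ℝ} (hs : 0 ≤ s) : 0 ≤ wt β s := by unfold wt; positivity

theorem wt_anti {β : ℝ} (hβ : 0 < β) {s s' : ℝ} (hs : 0 ≤ s) (h : s ≤ s') : wt β s' ≤ wt β s := by
  unfold wt
  exact Real.rpow_le_rpow_of_nonpos (by positivity) (by linarith) (by linarith)

theorem wt_le_one {β : ℝ} (hβ : 0 < β) {s : ℝ} (hs : 0 ≤ s) : wt β s ≤ 1 := by
  have := wt_anti hβ le_rfl hs
  simpa [wt] using this

theorem radial_integrable (m : ℕ) {α M : ℝ} (hα : α < 2) (hM : 2 < α + M) (hM0 : 0 ≤ M) :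
    Integrable (fun z : EV m => ‖z‖ ^ ((2 : ℝ) - α - m) * (1 + ‖z‖) ^ (-M)) volume := by
  rcases Nat.eq_zero_or_pos m with rfl | hm
  · have : IsFiniteMeasure (volume : Measure (EV 0)) := by
      refine ⟨?_⟩
      have : (Set.univ : Set (EV 0)) = {0} := by ext x; simp; exact Subsingleton.elim _ _
      rw [this]
      exact isCompact_singleton.measure_lt_top
    have : (fun z : EV 0 => ‖z‖ ^ ((2 : ℝ) - α - (0 : ℕ)) * (1 + ‖z‖) ^ (-M)) = fun _ =>
        ‖(0 : EV 0)‖ ^ ((2 : ℝ) - α - (0 : ℕ)) * (1 + ‖(0 : EV 0)‖) ^ (-M) := by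
      funext z
      rw [Subsingleton.elim z 0]
    rw [this]
    exact integrable_const _
  · haveI : Nonempty (Fin m) := ⟨⟨0, hm⟩⟩
    haveI : Nontrivial (EV m) := inferInstance
    have h := integrable_fun_norm_addHaar (μ := (volume : Measure (EV m)))
      (f := fun r : ℝ => r ^ ((2 : ℝ) - α - m) * (1 + r) ^ (-M))
    rw [h]
    simp only [finrank_euclideanSpace, Fintype.card_fin, smul_eq_mul]
    have hfun : ∀ y : ℝ, y ∈ Set.Ioi (0 : ℝ) → y ^ (m - 1) * (y ^ ((2 : ℝ) - α - m) * (1 + y) ^ (-M))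
        = y ^ (1 - α) * (1 + y) ^ (-M) := by
      intro y hy
      have hy : 0 < y := hy
      rw [← mul_assoc, ← Real.rpow_natCast, ← Real.rpow_add hy]
      congr 2
      rw [Nat.cast_sub hm]; push_cast; ring
    have hmeas : Measurable (fun y : ℝ => y ^ (1 - α) * (1 + y) ^ (-M)) := by fun_prop
    rw [integrableOn_congr_fun hfun measurableSet_Ioi]
    rw [← Set.Ioc_union_Ioi_eq_Ioi (zero_le_one (α := ℝ)), integrableOn_union]
    constructor
    · have h1 : IntegrableOn (fun y : ℝ => y ^ (1 - α)) (Set.Ioc 0 1) := by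
        rw [← intervalIntegrable_iff_integrableOn_Ioc_of_le zero_le_one]
        exact intervalIntegral.intervalIntegrable_rpow' (by linarith)
      refine Integrable.mono' h1 hmeas.aestronglyMeasurable ?_
      refine (ae_restrict_iff' measurableSet_Ioc).2 (ae_of_all _ fun y hy => ?_)
      have hy0 : 0 < y := hy.1
      rw [Real.norm_of_nonneg (by positivity)]
      refine mul_le_of_le_one_right (by positivity) ?_
      exact Real.rpow_le_one_of_one_le_of_nonpos (by linarith) (by linarith)
    · have h1 : IntegrableOn (fun y : ℝ => y ^ (1 - α - M)) (Set.Ioi 1) :=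
        integrableOn_Ioi_rpow_of_lt (by linarith) one_pos
      refine Integrable.mono' h1 hmeas.aestronglyMeasurable ?_
      refine (ae_restrict_iff' measurableSet_Ioi).2 (ae_of_all _ fun y hy => ?_)
      have hy0 : 0 < y := lt_trans one_pos hy
      rw [Real.norm_of_nonneg (by positivity), sub_eq_add_neg (1 - α), Real.rpow_add hy0]
      gcongr ?_ * ?_
      exact Real.rpow_le_rpow_of_nonpos hy0 (by linarith) (by linarith)

section kern
variable {n : ℕ} {ρ : EV n → ℝ}

theorem scaled_nonneg (h : ∀ x, 0 ≤ ρ x) {ε : ℝ} (hε : 0 < ε) (z : EV n) : 0 ≤ scaled ρ ε z := by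
  unfold scaled
  have := h (ε⁻¹ • z)
  positivity

theorem kernelJ_nonneg (h : ∀ x, 0 ≤ ρ x) {ε : ℝ} (hε : 0 < ε) (z : EV n) :
    0 ≤ kernelJ (scaled ρ ε) z := by
  unfold kernelJ
  have := scaled_nonneg h hε z
  positivity

theorem scaled_measurable (h : Measurable ρ) (ε : ℝ) : Measurable (scaled ρ ε) := by
  unfold scaled
  exact (h.comp (by fun_prop)).const_mul _

theorem kernelJ_measurable (h : Measurable ρ) (ε : ℝ) : Measurable (kernelJ (scaled ρ ε)) := by
  unfold kernelJ
  exact (scaled_measurable h ε).div (by fun_prop)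

theorem kernelJ_smul (ε : ℝ) (hε : 0 < ε) (ζ : EV n) :
    kernelJ (scaled ρ ε) (ε • ζ) = (ε ^ n)⁻¹ * (ε ^ 2)⁻¹ * kernelJ ρ ζ := by
  unfold kernelJ scaled
  rw [smul_smul, inv_mul_cancel₀ hε.ne', one_smul, norm_smul, Real.norm_of_nonneg hε.le]
  field_simp

theorem kernelJ_mul_sq (ε : ℝ) (z : EV n) (hz : z ≠ 0) :
    kernelJ (scaled ρ ε) z * ‖z‖ ^ 2 = scaled ρ ε z := by
  unfold kernelJ
  have : ‖z‖ ≠ 0 := by simpa using hz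
  field_simp

theorem lintegral_comp_smulE (f : EV n → ℝ≥0∞) (hf : Measurable f) {ε : ℝ} (hε : 0 < ε) :
    ∫⁻ z, f z = ENNReal.ofReal (ε ^ n) * ∫⁻ ζ, f (ε • ζ) := by
  have h := Measure.map_addHaar_smul (volume : Measure (EV n)) hε.ne'
  have h2 : ∫⁻ ζ, f (ε • ζ) = ∫⁻ z, f z ∂(Measure.map (fun x => ε • x) volume) := by
    rw [lintegral_map hf (by fun_prop)]
  rw [h2, h, lintegral_smul_measure, smul_eq_mul, ← mul_assoc]
  simp only [finrank_euclideanSpace, Fintype.card_fin]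
  rw [← ENNReal.ofReal_mul (by positivity), abs_of_nonneg (by positivity),
    mul_inv_cancel₀ (by positivity)]
  simp

theorem lintegral_scale (hρ : Measurable ρ) (hρ0 : ∀ x, 0 ≤ ρ x) (f : EV n → ℝ) (hf : Measurable f)
    {ε : ℝ} (hε : 0 < ε) :
    ∫⁻ z, ENNReal.ofReal (kernelJ (scaled ρ ε) z * f z)
      = ∫⁻ ζ, ENNReal.ofReal ((ε ^ 2)⁻¹ * kernelJ ρ ζ * f (ε • ζ)) := by
  have hm : Measurable (fun z => ENNReal.ofReal (kernelJ (scaled ρ ε) z * f z)) :=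
    ((kernelJ_measurable hρ ε).mul hf).ennreal_ofReal
  rw [lintegral_comp_smulE _ hm hε,
    ← lintegral_const_mul' _ _ ENNReal.ofReal_ne_top]
  refine lintegral_congr fun ζ => ?_
  rw [← ENNReal.ofReal_mul (by positivity), kernelJ_smul ε hε]
  congr 1
  field_simp

theorem integral_scale (f : EV n → ℝ) {ε : ℝ} (hε : 0 < ε) :
    ∫ z, kernelJ (scaled ρ ε) z * f z = (ε ^ 2)⁻¹ * ∫ ζ, kernelJ ρ ζ * f (ε • ζ) := by
  have h := Measure.integral_comp_smul (volume : Measure (EV n))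
    (fun z => kernelJ (scaled ρ ε) z * f z) ε
  simp only [finrank_euclideanSpace, Fintype.card_fin, kernelJ_smul ε hε, smul_eq_mul] at h
  rw [abs_of_nonneg (by positivity)] at h
  simp_rw [mul_assoc] at h
  rw [integral_const_mul, integral_const_mul] at h
  field_simp at h ⊢
  linarith

end kern

theorem J_bound_aux {n : ℕ} {ρ : EV (n + 1) → ℝ} (hρ0 : ∀ x, 0 ≤ ρ x) {c₀ α N : ℝ}
    (hb : ∀ x : EV (n + 1), x ≠ 0 →
      |ρ x| ≤ c₀ * ‖x‖ ^ ((2 : ℝ) - α - (n + 1 : ℝ)) * (1 + ‖x‖) ^ (-N))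
    (ζ : EV (n + 1)) (hζ : ζ ≠ 0) :
    kernelJ ρ ζ * ‖ζ‖ ≤ c₀ * ‖ζ‖ ^ ((1 : ℝ) - α - (n + 1 : ℝ)) * (1 + ‖ζ‖) ^ (-N) := by
  have hz : 0 < ‖ζ‖ := by simpa using hζ
  have h := hb ζ hζ
  rw [abs_of_nonneg (hρ0 ζ)] at h
  unfold kernelJ
  have e1 : ρ ζ / ‖ζ‖ ^ 2 * ‖ζ‖ = ρ ζ * ‖ζ‖⁻¹ := by field_simp
  rw [e1]
  calc ρ ζ * ‖ζ‖⁻¹ ≤ (c₀ * ‖ζ‖ ^ ((2 : ℝ) - α - (n + 1 : ℝ)) * (1 + ‖ζ‖) ^ (-N)) * ‖ζ‖⁻¹ := by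
        gcongr
    _ = _ := by
        have : ‖ζ‖ ^ ((1 : ℝ) - α - (n + 1 : ℝ)) = ‖ζ‖ ^ ((2 : ℝ) - α - (n + 1 : ℝ)) * ‖ζ‖⁻¹ := by
          rw [← Real.rpow_neg_one ‖ζ‖, ← Real.rpow_add hz]
          congr 1; ring
        rw [this]; ring

theorem kern_tail {n : ℕ} {ρ : EV n → ℝ} (hρ : Measurable ρ) (hρ0 : ∀ x, 0 ≤ ρ x) {β C : ℝ}
    (hβ : 0 < β) (hn : 0 < n)
    (hC : ∫⁻ z, ENNReal.ofReal (ρ z * (1 + ‖z‖) ^ (1 + β)) ≤ ENNReal.ofReal C) {ε : ℝ} (hε : 0 < ε) :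
    (∀ r : ℝ, 0 ≤ r → ∫⁻ z in {z : EV n | r ≤ ‖z‖}, ENNReal.ofReal (scaled ρ ε z)
      ≤ ENNReal.ofReal (C * wt β (r / ε))) ∧
    ∫⁻ z, ENNReal.ofReal (scaled ρ ε z * ‖z‖) ≤ ENNReal.ofReal (C * ε) := by
  haveI : Nonempty (Fin n) := ⟨⟨0, hn⟩⟩
  have hne : ∀ᵐ z : EV n, z ≠ 0 := by
    have : (volume : Measure (EV n)) {(0 : EV n)} = 0 := measure_singleton _
    exact (compl_mem_ae_iff.2 this)
  have hs : ∀ (z : EV n), scaled ρ ε (ε • z) = (ε ^ n)⁻¹ * ρ z := by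
    intro z
    unfold scaled
    rw [smul_smul, inv_mul_cancel₀ hε.ne', one_smul]
  constructor
  · intro r hr
    have hm : MeasurableSet {z : EV n | r ≤ ‖z‖} := measurableSet_le measurable_const measurable_norm
    rw [← lintegral_indicator hm, lintegral_comp_smulE _
      (((scaled_measurable hρ ε).ennreal_ofReal).indicator hm) hε,
      ← lintegral_const_mul' _ _ ENNReal.ofReal_ne_top]
    calc _ ≤ ∫⁻ z, ENNReal.ofReal (wt β (r / ε)) * ENNReal.ofReal (ρ z * (1 + ‖z‖) ^ (1 + β)) := by
          refine lintegral_mono fun z => ?_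
          by_cases hz : r ≤ ‖ε • z‖
          · have hz' : ε • z ∈ {z : EV n | r ≤ ‖z‖} := hz
            rw [Set.indicator_of_mem hz', hs, ← ENNReal.ofReal_mul (by positivity),
              ← ENNReal.ofReal_mul (wt_nonneg (by positivity))]
            refine ENNReal.ofReal_le_ofReal ?_
            rw [← mul_assoc, mul_inv_cancel₀ (by positivity), one_mul]
            have h1 : r / ε ≤ ‖z‖ := by
              rw [norm_smul, Real.norm_of_nonneg hε.le] at hz
              rw [div_le_iff₀ hε]; linarith
            have h2 : wt β ‖z‖ ≤ wt β (r / ε) := wt_anti hβ (by positivity) h1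
            calc ρ z = wt β ‖z‖ * (ρ z * (1 + ‖z‖) ^ (1 + β)) := by
                  unfold wt
                  rw [Real.rpow_neg (by positivity)]
                  field_simp
              _ ≤ _ := by
                  have := hρ0 z
                  gcongr
          · have hz' : ε • z ∉ {z : EV n | r ≤ ‖z‖} := hz
            rw [Set.indicator_of_notMem hz']; simp
      _ ≤ _ := by
          rw [lintegral_const_mul' _ _ ENNReal.ofReal_ne_top, mul_comm C,
            ENNReal.ofReal_mul (wt_nonneg (by positivity))]
          gcongr
  · have hm : Measurable (fun z => ENNReal.ofReal (scaled ρ ε z * ‖z‖)) :=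
      ((scaled_measurable hρ ε).mul measurable_norm).ennreal_ofReal
    rw [lintegral_comp_smulE _ hm hε,
      ← lintegral_const_mul' _ _ ENNReal.ofReal_ne_top]
    calc _ ≤ ∫⁻ z, ENNReal.ofReal ε * ENNReal.ofReal (ρ z * (1 + ‖z‖) ^ (1 + β)) := by
          refine lintegral_mono fun z => ?_
          rw [hs, ← ENNReal.ofReal_mul (by positivity), ← ENNReal.ofReal_mul (by positivity)]
          refine ENNReal.ofReal_le_ofReal ?_
          rw [norm_smul, Real.norm_of_nonneg hε.le]
          have h1 : ‖z‖ ≤ (1 + ‖z‖) ^ (1 + β) := by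
            calc ‖z‖ ≤ (1 + ‖z‖) ^ (1 : ℝ) := by rw [Real.rpow_one]; linarith
              _ ≤ _ := Real.rpow_le_rpow_of_exponent_le (by linarith [norm_nonneg z]) (by linarith)
          have := hρ0 z
          calc _ = ε * (ρ z * ‖z‖) := by field_simp
            _ ≤ _ := by gcongr
      _ ≤ _ := by
          rw [lintegral_const_mul' _ _ ENNReal.ofReal_ne_top, mul_comm C,
            ENNReal.ofReal_mul hε.le]
          gcongr

/-- The estimate (B2) for the kernel on a thin curved layer. -/
theorem kern_layer {n : ℕ} {ρ : EV (n + 1) → ℝ} (hρ : Measurable ρ) (hρ0 : ∀ x, 0 ≤ ρ x)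
    {c₀ α N β M C : ℝ} (hc₀ : 0 < c₀) (hα0 : 0 < α) (hβ : 0 < β) (hM0 : 0 ≤ M) (hMN : M + (1 + β) = N)
    (hb : ∀ x : EV (n + 1), x ≠ 0 →
      |ρ x| ≤ c₀ * ‖x‖ ^ ((2 : ℝ) - α - (n + 1 : ℝ)) * (1 + ‖x‖) ^ (-N))
    (hC : ∫⁻ z : EV n, ENNReal.ofReal (‖z‖ ^ ((2 : ℝ) - α - n) * (1 + ‖z‖) ^ (-M)) ≤ ENNReal.ofReal C)
    {ε : ℝ} (hε : 0 < ε) {C₂ : ℝ} (hC₂ : 0 ≤ C₂) (a : EV n → ℝ) (ha : Measurable a)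
    (has : ∀ z, a (ε • z) = ε * a z)
    {t : ℝ} (ht : 0 ≤ t) :
    ∫⁻ z in {z : EV (n + 1) | |t + z (Fin.last n) - a (firstCoords z)| ≤ C₂ * ‖firstCoords z‖ ^ 2
        ∧ t / 2 ≤ ‖z‖}, ENNReal.ofReal (kernelJ (scaled ρ ε) z * ‖z‖)
      ≤ ENNReal.ofReal (2 * c₀ * C * C₂ * wt β (t / 2 / ε)) := by
  set S : Set (EV (n + 1)) := {z | |t + z (Fin.last n) - a (firstCoords z)| ≤ C₂ * ‖firstCoords z‖ ^ 2
        ∧ t / 2 ≤ ‖z‖} with hS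
  have hSm : MeasurableSet S := by
    refine MeasurableSet.inter (s₁ := {z : EV (n + 1) | |t + z (Fin.last n) - a (firstCoords z)|
      ≤ C₂ * ‖firstCoords z‖ ^ 2}) (s₂ := {z | t / 2 ≤ ‖z‖})
      (measurableSet_le ?_ ?_) (measurableSet_le measurable_const measurable_norm)
    · have := ha.comp (measurable_firstCoords n)
      have h2 := (continuous_last n).measurable
      exact ((measurable_const.add h2).sub this).norm
    · exact ((measurable_firstCoords n).norm.pow_const 2).const_mul _
  set s := t / ε with hs
  have hs0 : 0 ≤ s := by positivity
  have e1 : ∫⁻ z in S, ENNReal.ofReal (kernelJ (scaled ρ ε) z * ‖z‖)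
      = ∫⁻ z, ENNReal.ofReal (kernelJ (scaled ρ ε) z * S.indicator (fun z => ‖z‖) z) := by
    rw [← lintegral_indicator hSm]
    refine lintegral_congr fun z => ?_
    by_cases hz : z ∈ S <;> simp [hz]
  rw [e1, lintegral_scale hρ hρ0 _ (measurable_norm.indicator hSm) hε]
  have hfm : Measurable (fun ζ => ENNReal.ofReal ((ε ^ 2)⁻¹ * kernelJ ρ ζ *
      S.indicator (fun z => ‖z‖) (ε • ζ))) := by
    refine Measurable.ennreal_ofReal (Measurable.mul (Measurable.const_mul ?_ _) ?_)
    · unfold kernelJ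
      exact hρ.div (by fun_prop)
    · exact (measurable_norm.indicator hSm).comp (by fun_prop)
  rw [lintegral_split _ hfm]
  have hw0 : 0 ≤ wt β (t / 2 / ε) := wt_nonneg (by positivity)
  -- pointwise bound on slices
  have key : ∀ z : EV n, ∫⁻ σ : ℝ, ENNReal.ofReal ((ε ^ 2)⁻¹ * kernelJ ρ (snocE z σ) *
      S.indicator (fun z => ‖z‖) (ε • snocE z σ))
      ≤ ENNReal.ofReal (2 * c₀ * C₂ * wt β (t / 2 / ε)) *
        ENNReal.ofReal (‖z‖ ^ ((2 : ℝ) - α - n) * (1 + ‖z‖) ^ (-M)) := by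
    intro z
    set B := c₀ * ‖z‖ ^ ((1 : ℝ) - α - (n + 1 : ℝ)) * ((1 + ‖z‖) ^ (-M) * wt β (t / 2 / ε)) with hB
    have hB0 : 0 ≤ B := by positivity
    set I : Set ℝ := Set.Icc (-s + a z - C₂ * ε * ‖z‖ ^ 2) (-s + a z + C₂ * ε * ‖z‖ ^ 2) with hI
    have hvol : volume I = ENNReal.ofReal (2 * (C₂ * ε * ‖z‖ ^ 2)) := by
      rw [hI, Real.volume_Icc]; congr 1; ring
    have hmem : ∀ σ, ε • snocE z σ ∈ S → σ ∈ I ∧ t / 2 / ε ≤ ‖snocE z σ‖ := by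
      intro σ hσ
      obtain ⟨h1, h2⟩ := hσ
      rw [firstCoords_smul, firstCoords_snocE, has, norm_smul, Real.norm_of_nonneg hε.le] at h1
      have e2 : (ε • snocE z σ) (Fin.last n) = ε * σ := by simp [snocE_last]
      rw [e2, abs_le] at h1
      have e3 : t = ε * s := by rw [hs]; field_simp
      rw [e3] at h1
      constructor
      · rw [hI]
        constructor
        · have : ε * (-s + a z - C₂ * ε * ‖z‖ ^ 2) ≤ ε * σ := by nlinarith [h1.1]
          exact le_of_mul_le_mul_left this hε
        · have : ε * σ ≤ ε * (-s + a z + C₂ * ε * ‖z‖ ^ 2) := by nlinarith [h1.2]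
          exact le_of_mul_le_mul_left this hε
      · rw [norm_smul, Real.norm_of_nonneg hε.le] at h2
        rw [div_le_iff₀ hε]; linarith
    by_cases hz : z = 0
    · have hv0 : volume I = 0 := by rw [hvol, hz]; simp
      have : ∫⁻ σ : ℝ, ENNReal.ofReal ((ε ^ 2)⁻¹ * kernelJ ρ (snocE z σ) *
          S.indicator (fun z => ‖z‖) (ε • snocE z σ)) = 0 := by
        have hae : ∀ᵐ σ : ℝ, σ ∉ I := by
          rw [ae_iff]; simpa using hv0
        rw [lintegral_congr_ae (g := fun _ => 0)]
        · simp
        · filter_upwards [hae] with σ hσ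
          have : ε • snocE z σ ∉ S := fun h => hσ (hmem σ h).1
          simp [this]
      rw [this]; exact zero_le
    · have hz0 : 0 < ‖z‖ := by simpa using hz
      have hpt : ∀ σ, ENNReal.ofReal ((ε ^ 2)⁻¹ * kernelJ ρ (snocE z σ) *
          S.indicator (fun z => ‖z‖) (ε • snocE z σ)) ≤ I.indicator (fun _ => ENNReal.ofReal (ε⁻¹ * B)) σ := by
        intro σ
        by_cases hσ : ε • snocE z σ ∈ S
        · obtain ⟨h1, h2⟩ := hmem σ hσ
          rw [Set.indicator_of_mem hσ, Set.indicator_of_mem h1]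
          refine ENNReal.ofReal_le_ofReal ?_
          have hle : ‖z‖ ≤ ‖snocE z σ‖ := by
            have := norm_firstCoords_le (snocE z σ)
            rwa [firstCoords_snocE] at this
          have hζ : snocE z σ ≠ 0 := by
            intro h
            rw [h] at hle; simp at hle; exact hz hle
          have hJ := J_bound_aux hρ0 hb (snocE z σ) hζ
          set ζ := snocE z σ with hζd
          have h3 : ‖ζ‖ ^ ((1 : ℝ) - α - (n + 1 : ℝ)) ≤ ‖z‖ ^ ((1 : ℝ) - α - (n + 1 : ℝ)) :=
            Real.rpow_le_rpow_of_nonpos hz0 hle (by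
              have : (0 : ℝ) ≤ n := Nat.cast_nonneg n
              linarith)
          have h4 : (1 + ‖ζ‖) ^ (-N) ≤ (1 + ‖z‖) ^ (-M) * wt β (t / 2 / ε) := by
            have : (1 + ‖ζ‖) ^ (-N) = (1 + ‖ζ‖) ^ (-M) * wt β ‖ζ‖ := by
              unfold wt
              rw [← Real.rpow_add (by positivity)]
              congr 1; linarith
            rw [this]
            have h5 : wt β ‖ζ‖ ≤ wt β (t / 2 / ε) := wt_anti hβ (by positivity) h2
            have h6 : (1 + ‖ζ‖) ^ (-M) ≤ (1 + ‖z‖) ^ (-M) :=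
              Real.rpow_le_rpow_of_nonpos (by positivity) (by linarith) (by linarith)
            have := wt_nonneg (β := β) (norm_nonneg ζ)
            gcongr
          have h7 : kernelJ ρ ζ * ‖ζ‖ ≤ B := by
            refine hJ.trans ?_
            rw [hB]
            gcongr
          rw [norm_smul, Real.norm_of_nonneg hε.le]
          calc _ = ε⁻¹ * (kernelJ ρ ζ * ‖ζ‖) := by field_simp
            _ ≤ _ := by gcongr
        · rw [Set.indicator_of_notMem hσ]; simp
      refine (lintegral_mono hpt).trans ?_
      rw [lintegral_indicator measurableSet_Icc, setLIntegral_const, hvol,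
        ← ENNReal.ofReal_mul (by positivity), ← ENNReal.ofReal_mul (by positivity)]
      refine ENNReal.ofReal_le_ofReal (le_of_eq ?_)
      have e4 : ‖z‖ ^ ((2 : ℝ) - α - n) = ‖z‖ ^ ((1 : ℝ) - α - (n + 1 : ℝ)) * ‖z‖ ^ 2 := by
        rw [← Real.rpow_natCast ‖z‖ 2, ← Real.rpow_add hz0]
        congr 1; push_cast; ring
      rw [hB, e4]
      field_simp
  refine (lintegral_mono key).trans ?_
  rw [lintegral_const_mul' _ _ ENNReal.ofReal_ne_top]
  calc _ ≤ ENNReal.ofReal (2 * c₀ * C₂ * wt β (t / 2 / ε)) * ENNReal.ofReal C := by gcongr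
    _ = _ := by
      rw [← ENNReal.ofReal_mul (by positivity)]
      congr 1; ring


/-- All the properties of the rescaled kernel that are needed. -/
structure KB {n : ℕ} (J : EV (n + 1) → ℝ) (ε β C : ℝ) : Prop where
  meas : Measurable J
  nonneg : ∀ z, 0 ≤ J z
  even : ∀ᵐ z : EV (n + 1), J (-z) = J z
  tail : ∀ r : ℝ, 0 ≤ r → ∫⁻ z in {z : EV (n + 1) | r ≤ ‖z‖}, ENNReal.ofReal (J z * ‖z‖ ^ 2)
      ≤ ENNReal.ofReal (C * wt β (r / ε))
  third : ∫⁻ z, ENNReal.ofReal (J z * ‖z‖ ^ 3) ≤ ENNReal.ofReal (C * ε)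
  layer : ∀ (a : EV n →L[ℝ] ℝ) (C₂ t : ℝ), 0 ≤ C₂ → 0 ≤ t →
    ∫⁻ z in {z : EV (n + 1) | |t + z (Fin.last n) - a (firstCoords z)| ≤ C₂ * ‖firstCoords z‖ ^ 2
        ∧ t / 2 ≤ ‖z‖}, ENNReal.ofReal (J z * ‖z‖)
      ≤ ENNReal.ofReal (C * C₂ * wt β (t / 2 / ε))
  mom : ∀ i j, ∫ z, J z * (z i * z j) = if i = j then 2 else 0
  slice : ∀ Q : Matrix (Fin (n + 1)) (Fin (n + 1)) ℝ, Qᵀ * Q = 1 → Q.det = 1 → ∀ s : ℝ,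
    ∫ z' : EV n, J (mulVecE Q (snocE z' s)) • z' = 0

theorem mulVecE_smul {m : ℕ} (Q : Matrix (Fin m) (Fin m) ℝ) (c : ℝ) (x : EV m) :
    mulVecE Q (c • x) = c • mulVecE Q x := by
  ext i
  simp [mulVecE, Matrix.mulVec_smul]

theorem snocE_smul {n : ℕ} (c : ℝ) (z : EV n) (s : ℝ) : snocE (c • z) (c * s) = c • snocE z s := by
  ext i
  refine Fin.lastCases ?_ (fun i => ?_) i <;> simp [snocE]

theorem posDef_sq_eq_one {m : ℕ} {A : Matrix (Fin m) (Fin m) ℝ} (hA : A.PosDef) (h : A * A = 1) :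
    A = 1 := by
  have h1 : (A + 1).PosDef := hA.add Matrix.PosDef.one
  have h2 : IsUnit (A + 1) := h1.isUnit
  have h3 : (A - 1) * (A + 1) = 0 := by
    rw [sub_mul, mul_add, h]; simp; abel
  have h4 : A - 1 = 0 := by
    obtain ⟨u, hu⟩ := h2
    rw [← hu] at h3
    simpa using h3
  exact sub_eq_zero.1 h4

theorem exists_KB {n : ℕ} {ρ : EV (n + 1) → ℝ} (hρ1 : A1 ρ) (hρ2 : A2 ρ) (hM : momentum ρ = 1) :
    ∃ β C : ℝ, 0 < β ∧ 0 < C ∧ ∀ ε : ℝ, 0 < ε → KB (kernelJ (scaled ρ ε)) ε β C := by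
  obtain ⟨hm, h0, -, hev, -⟩ := hρ1
  obtain ⟨-, ⟨c₀, c₁, α, N, hc₀, -, hα0, hα2, hN, hb⟩, A, hA, hAA, hsl⟩ := hρ2
  have hA1 : A = 1 := posDef_sq_eq_one hA (hAA.trans hM)
  subst hA1
  obtain ⟨β, hβ0, hβ1⟩ : ∃ β : ℝ, 0 < β ∧ β < min (α + N - 3) (N - 1) :=
    exists_between (lt_min (by linarith) (by linarith))
  have hβa := lt_of_lt_of_le hβ1 (min_le_left _ _)
  have hβb := lt_of_lt_of_le hβ1 (min_le_right _ _)
  set M := N - 1 - β with hMd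
  have hM0 : 0 ≤ M := by rw [hMd]; linarith
  have hb' := fun x hx => (hb x hx).1
  have i1 := radial_integrable n (α := α) (M := M) hα2 (by rw [hMd]; linarith) hM0
  have i2 := radial_integrable (n + 1) (α := α) (M := M) hα2 (by rw [hMd]; linarith) hM0
  set C1 := ∫ z : EV n, ‖z‖ ^ ((2 : ℝ) - α - n) * (1 + ‖z‖) ^ (-M) with hC1
  set C2 := c₀ * ∫ z : EV (n + 1), ‖z‖ ^ ((2 : ℝ) - α - (n + 1 : ℕ)) * (1 + ‖z‖) ^ (-M) with hC2
  have hC1' : ∫⁻ z : EV n, ENNReal.ofReal (‖z‖ ^ ((2 : ℝ) - α - n) * (1 + ‖z‖) ^ (-M))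
      ≤ ENNReal.ofReal C1 := by
    rw [← ofReal_integral_eq_lintegral_ofReal i1 (ae_of_all _ fun z => by positivity)]
  have hC1n : 0 ≤ C1 := integral_nonneg fun z => by positivity
  have hC2n : 0 ≤ C2 := mul_nonneg hc₀.le (integral_nonneg fun z => by positivity)
  have hne : ∀ᵐ z : EV (n + 1), z ≠ 0 := by
    have : (volume : Measure (EV (n + 1))) {(0 : EV (n + 1))} = 0 := measure_singleton _
    exact (compl_mem_ae_iff.2 this)
  have hC2' : ∫⁻ z, ENNReal.ofReal (ρ z * (1 + ‖z‖) ^ (1 + β)) ≤ ENNReal.ofReal C2 := by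
    rw [hC2, ← integral_const_mul, ofReal_integral_eq_lintegral_ofReal (i2.const_mul c₀)
      (ae_of_all _ fun z => by positivity)]
    refine lintegral_mono_ae ?_
    filter_upwards [hne] with z hz
    refine ENNReal.ofReal_le_ofReal ?_
    have h := hb' z hz
    rw [abs_of_nonneg (h0 z)] at h
    calc ρ z * (1 + ‖z‖) ^ (1 + β)
        ≤ (c₀ * ‖z‖ ^ ((2 : ℝ) - α - (n + 1 : ℝ)) * (1 + ‖z‖) ^ (-N)) * (1 + ‖z‖) ^ (1 + β) := by gcongr
      _ = _ := by
        rw [mul_assoc, mul_assoc, ← Real.rpow_add (by positivity)]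
        push_cast
        congr 3
        rw [hMd]; ring
  set C := max (C2 + 1) (2 * c₀ * C1) with hC
  have hCpos : 0 < C := lt_of_lt_of_le (by linarith) (le_max_left _ _)
  have hCC2 : C2 ≤ C := le_trans (by linarith) (le_max_left _ _)
  refine ⟨β, C, hβ0, hCpos, fun ε hε => ?_⟩
  obtain ⟨ht1, ht2⟩ := kern_tail hm h0 hβ0 (Nat.succ_pos n) hC2' hε
  refine ⟨kernelJ_measurable hm ε, kernelJ_nonneg h0 hε, ?_, ?_, ?_, ?_, ?_, ?_⟩
  · have hq : Measure.QuasiMeasurePreserving (fun z : EV (n + 1) => ε⁻¹ • z) volume volume := by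
      refine ⟨by fun_prop, ?_⟩
      rw [Measure.map_addHaar_smul _ (inv_ne_zero hε.ne')]
      exact Measure.smul_absolutelyContinuous
    filter_upwards [hq.ae hev] with z hz
    unfold kernelJ scaled
    rw [smul_neg, hz, norm_neg]
  · intro r hr
    refine le_trans (le_of_eq ?_) ((ht1 r hr).trans ?_)
    · refine lintegral_congr_ae (ae_restrict_of_ae ?_)
      filter_upwards [hne] with z hz
      rw [kernelJ_mul_sq ε z hz]
    · refine ENNReal.ofReal_le_ofReal ?_
      have := wt_nonneg (β := β) (div_nonneg hr hε.le)
      gcongr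
  · refine le_trans (le_of_eq ?_) (ht2.trans ?_)
    · refine lintegral_congr_ae ?_
      filter_upwards [hne] with z hz
      rw [← kernelJ_mul_sq ε z hz]; congr 1; ring
    · refine ENNReal.ofReal_le_ofReal ?_
      gcongr
  · intro a C₂ t hC₂ ht
    refine (kern_layer hm h0 hc₀ hα0 hβ0 hM0 (by rw [hMd]; ring) hb' hC1' hε hC₂ a
      a.continuous.measurable (fun z => by simp) ht).trans ?_
    refine ENNReal.ofReal_le_ofReal ?_
    have := wt_nonneg (β := β) (div_nonneg (div_nonneg ht zero_le_two) hε.le)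
    have h2 : 2 * c₀ * C1 ≤ C := le_max_right _ _
    gcongr
  · intro i j
    rw [integral_scale _ hε]
    have h := congrFun (congrFun hM i) j
    simp only [momentum, Matrix.of_apply, Matrix.one_apply] at h
    have e : ∀ ζ : EV (n + 1), kernelJ ρ ζ * ((ε • ζ) i * (ε • ζ) j)
        = ε ^ 2 * (kernelJ ρ ζ * ζ i * ζ j) := by
      intro ζ
      simp only [PiLp.smul_apply, smul_eq_mul]; ring
    simp_rw [e]
    rw [integral_const_mul, ← mul_assoc, inv_mul_cancel₀ (by positivity), one_mul]
    split_ifs at h ⊢ <;> linarith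
  · intro Q hQ hQd s
    have h := hsl (s / ε) Q hQ hQd
    rw [one_mul] at h
    have h2 := Measure.integral_comp_smul (volume : Measure (EV n))
      (fun z' : EV n => kernelJ (scaled ρ ε) (mulVecE Q (snocE z' s)) • z') ε
    have e : ∀ z' : EV n, kernelJ (scaled ρ ε) (mulVecE Q (snocE (ε • z') s)) • (ε • z')
        = ((ε ^ (n + 1))⁻¹ * (ε ^ 2)⁻¹ * ε) • (kernelJ ρ (mulVecE Q (snocE z' (s / ε))) • z') := by
      intro z'
      have e1 : snocE (ε • z') s = ε • snocE z' (s / ε) := by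
        rw [← snocE_smul]; congr 1; field_simp
      rw [e1, mulVecE_smul, kernelJ_smul ε hε, smul_smul, smul_smul]
      congr 1; ring
    simp_rw [e] at h2
    rw [integral_smul, h, smul_zero] at h2
    have h3 := h2.symm
    rw [smul_eq_zero] at h3
    rcases h3 with h3 | h3
    · exfalso
      have : (0 : ℝ) < |(ε ^ Module.finrank ℝ (EV n))⁻¹| := by positivity
      exact this.ne' h3
    · exact h3

end

noncomputable section

/-- Householder reflections. -/
def hh {m : ℕ} (w : Fin m → ℝ) : Matrix (Fin m) (Fin m) ℝ :=
  1 + Matrix.vecMulVec ((-(2 / (w ⬝ᵥ w))) • w) w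

theorem hh_transpose {m : ℕ} (w : Fin m → ℝ) : (hh w)ᵀ = hh w := by
  unfold hh
  rw [Matrix.transpose_add, Matrix.transpose_one, Matrix.transpose_vecMulVec,
    Matrix.vecMulVec_smul, Matrix.smul_vecMulVec]

theorem hh_sq {m : ℕ} (w : Fin m → ℝ) (hw : w ⬝ᵥ w ≠ 0) : hh w * hh w = 1 := by
  unfold hh
  rw [add_mul, mul_add, mul_add, Matrix.vecMulVec_mul_vecMulVec]
  simp only [mul_one, one_mul, dotProduct_smul]
  rw [add_assoc, Matrix.smul_vecMulVec, ← add_assoc, ← add_assoc]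
  ext i j
  simp [Matrix.vecMulVec_apply]
  field_simp
  ring

theorem hh_det {m : ℕ} (w : Fin m → ℝ) (hw : w ⬝ᵥ w ≠ 0) : (hh w).det = -1 := by
  unfold hh
  rw [Matrix.vecMulVec_eq Unit, Matrix.det_one_add_replicateCol_mul_replicateRow, dotProduct_smul]
  simp only [smul_eq_mul]
  field_simp
  norm_num

theorem hh_mulVec {m : ℕ} (w x : Fin m → ℝ) :
    (hh w) *ᵥ x = x - (2 * (w ⬝ᵥ x) / (w ⬝ᵥ w)) • w := by
  unfold hh
  rw [Matrix.add_mulVec, Matrix.one_mulVec, Matrix.vecMulVec_mulVec]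
  ext i
  simp
  ring

theorem inner_sumE {m : ℕ} (x y : EV m) : inner ℝ x y = ∑ i, x i * y i := by
  simp [PiLp.inner_apply, mul_comm]

theorem mulVecE_apply {m : ℕ} (Q : Matrix (Fin m) (Fin m) ℝ) (x : EV m) :
    (mulVecE Q x).ofLp = Q *ᵥ x.ofLp := by
  simp [mulVecE]

theorem inner_dot {m : ℕ} (x y : EV m) : inner ℝ x y = x.ofLp ⬝ᵥ y.ofLp := by
  rw [inner_sumE]; rfl

theorem inner_mulVecE {m : ℕ} {Q : Matrix (Fin m) (Fin m) ℝ} (hQ : Qᵀ * Q = 1) (x y : EV m) :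
    inner ℝ (mulVecE Q x) (mulVecE Q y) = inner ℝ x y := by
  rw [inner_dot, inner_dot, mulVecE_apply, mulVecE_apply, Matrix.dotProduct_mulVec,
    ← Matrix.mulVec_transpose, Matrix.mulVec_mulVec, hQ, Matrix.one_mulVec]

/-- The linear isometry defined by an orthogonal matrix. -/
def isoQ {m : ℕ} {Q : Matrix (Fin m) (Fin m) ℝ} (hQ : Qᵀ * Q = 1) : EV m ≃ₗᵢ[ℝ] EV m :=
  LinearIsometry.toLinearIsometryEquiv
    { toFun := mulVecE Q
      map_add' := by
        intro x y
        ext i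
        simp [mulVecE, Matrix.mulVec_add]
      map_smul' := by
        intro c x
        exact mulVecE_smul Q c x
      norm_map' := by
        intro x
        have h := inner_mulVecE hQ x x
        rw [real_inner_self_eq_norm_sq, real_inner_self_eq_norm_sq] at h
        exact (sq_eq_sq₀ (norm_nonneg _) (norm_nonneg _)).1 h }
    rfl

theorem isoQ_apply {m : ℕ} {Q : Matrix (Fin m) (Fin m) ℝ} (hQ : Qᵀ * Q = 1) (x : EV m) :
    isoQ hQ x = mulVecE Q x := rfl

theorem exists_rotation {n : ℕ} (N : EV (n + 1)) (hN : ‖N‖ = 1) (hNe : 0 ≤ N (Fin.last n)) :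
    ∃ Q : Matrix (Fin (n + 1)) (Fin (n + 1)) ℝ, Qᵀ * Q = 1 ∧ Q.det = 1 ∧ mulVecE Q (eL n) = N := by
  set e : Fin (n + 1) → ℝ := (eL n).ofLp with he
  set N' : Fin (n + 1) → ℝ := N.ofLp with hN'
  have hee : e ⬝ᵥ e = 1 := by
    rw [he, ← inner_dot, real_inner_self_eq_norm_sq, norm_eL]; norm_num
  have hNN : N' ⬝ᵥ N' = 1 := by
    rw [hN', ← inner_dot, real_inner_self_eq_norm_sq, hN]; norm_num
  have hNe' : N' ⬝ᵥ e = N (Fin.last n) := by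
    rw [he]
    simp [eL, hN']
  have heN : e ⬝ᵥ N' = N (Fin.last n) := by rw [dotProduct_comm, hNe']
  set w := N' + e with hw
  have hwe : w ⬝ᵥ e = N (Fin.last n) + 1 := by rw [hw, add_dotProduct, hNe', hee]
  have hww : w ⬝ᵥ w = 2 * (N (Fin.last n) + 1) := by
    rw [hw, add_dotProduct, dotProduct_add, dotProduct_add, hee, hNN, hNe', heN]; ring
  have hww0 : w ⬝ᵥ w ≠ 0 := by rw [hww]; positivity
  have hee0 : e ⬝ᵥ e ≠ 0 := by rw [hee]; norm_num
  refine ⟨hh w * hh e, ?_, ?_, ?_⟩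
  · rw [Matrix.transpose_mul, hh_transpose, hh_transpose, mul_assoc, ← mul_assoc (hh w),
      hh_sq w hww0, one_mul, hh_sq e hee0]
  · rw [Matrix.det_mul, hh_det w hww0, hh_det e hee0]; norm_num
  · apply (WithLp.equiv 2 _).injective
    change (mulVecE (hh w * hh e) (eL n)).ofLp = N'
    rw [mulVecE_apply, ← Matrix.mulVec_mulVec, hh_mulVec e, ← he, hee]
    have : e - (2 * 1 / 1 : ℝ) • e = -e := by
      ext i; simp; ring
    rw [this, Matrix.mulVec_neg, hh_mulVec, hwe, hww]
    have : (2 * (N (Fin.last n) + 1) / (2 * (N (Fin.last n) + 1)) : ℝ) = 1 := by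
      apply div_self; positivity
    rw [this, hw]
    ext i; simp

section
variable {n : ℕ} {J : EV (n + 1) → ℝ} {ε β C : ℝ}

theorem measurableSet_normge {m : ℕ} (r : ℝ) : MeasurableSet {z : EV m | r ≤ ‖z‖} :=
  measurableSet_le measurable_const measurable_norm

theorem KB.integrable_sq (hK : KB J ε β C) : Integrable (fun z => J z * ‖z‖ ^ 2) volume := by
  refine ⟨(hK.meas.mul (by fun_prop)).aestronglyMeasurable, ?_⟩
  rw [hasFiniteIntegral_iff_ofReal (ae_of_all _ fun z => mul_nonneg (hK.nonneg z) (by positivity))]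
  have h := hK.tail 0 le_rfl
  have e : {z : EV (n + 1) | 0 ≤ ‖z‖} = Set.univ := by ext z; simp
  rw [e, Measure.restrict_univ] at h
  exact h.trans_lt ENNReal.ofReal_lt_top

theorem KB.integrable_third (hK : KB J ε β C) : Integrable (fun z => J z * ‖z‖ ^ 3) volume := by
  refine ⟨(hK.meas.mul (by fun_prop)).aestronglyMeasurable, ?_⟩
  rw [hasFiniteIntegral_iff_ofReal (ae_of_all _ fun z => mul_nonneg (hK.nonneg z) (by positivity))]
  exact hK.third.trans_lt ENNReal.ofReal_lt_top

theorem KB.integrableOn_one (hK : KB J ε β C) {r : ℝ} (hr : 0 < r) :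
    IntegrableOn (fun z => J z * ‖z‖) {z | r ≤ ‖z‖} volume := by
  refine Integrable.mono' (hK.integrable_sq.const_mul r⁻¹).integrableOn
    (hK.meas.mul (by fun_prop)).aestronglyMeasurable ?_
  refine (ae_restrict_iff' (measurableSet_normge r)).2 (ae_of_all _ fun z hz => ?_)
  have h0 := hK.nonneg z
  have hz : r ≤ ‖z‖ := hz
  rw [Real.norm_of_nonneg (by positivity)]
  have : ‖z‖ ≤ r⁻¹ * ‖z‖ ^ 2 := by
    rw [inv_mul_eq_div, le_div_iff₀ hr]; nlinarith [norm_nonneg z]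
  calc J z * ‖z‖ ≤ J z * (r⁻¹ * ‖z‖ ^ 2) := by gcongr
    _ = _ := by ring

theorem KB.integrableOn_zero (hK : KB J ε β C) {r : ℝ} (hr : 0 < r) :
    IntegrableOn J {z | r ≤ ‖z‖} volume := by
  refine Integrable.mono' ((hK.integrableOn_one hr).const_mul r⁻¹)
    hK.meas.aestronglyMeasurable ?_
  refine (ae_restrict_iff' (measurableSet_normge r)).2 (ae_of_all _ fun z hz => ?_)
  have h0 := hK.nonneg z
  have hz : r ≤ ‖z‖ := hz
  rw [Real.norm_of_nonneg (by positivity)]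
  have : 1 ≤ r⁻¹ * ‖z‖ := by
    rw [inv_mul_eq_div, le_div_iff₀ hr]; linarith
  calc J z = J z * 1 := by ring
    _ ≤ J z * (r⁻¹ * ‖z‖) := by gcongr
    _ = _ := by ring

theorem KB.integrableOn_lin (hK : KB J ε β C) {r : ℝ} (hr : 0 < r) (τ : EV (n + 1)) :
    IntegrableOn (fun z => J z * inner ℝ τ z) {z | r ≤ ‖z‖} volume := by
  refine Integrable.mono' ((hK.integrableOn_one hr).const_mul ‖τ‖)
    (hK.meas.mul (by fun_prop)).aestronglyMeasurable (ae_of_all _ fun z => ?_)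
  have h0 := hK.nonneg z
  rw [norm_mul, Real.norm_of_nonneg h0]
  calc J z * ‖inner ℝ τ z‖ ≤ J z * (‖τ‖ * ‖z‖) := by
        gcongr
        exact norm_inner_le_norm τ z
    _ = _ := by ring

/-- Odd functions integrate to zero over symmetric sets. -/
theorem KB.odd_zero (hK : KB J ε β C) {S : Set (EV (n + 1))} (hS : MeasurableSet S)
    (hsym : ∀ z, -z ∈ S ↔ z ∈ S) (τ : EV (n + 1)) :
    ∫ z in S, J z * inner ℝ τ z = 0 := by
  rw [← integral_indicator hS]
  set g := S.indicator (fun z => J z * inner ℝ τ z) with hg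
  have h1 : ∫ z, g (-z) = ∫ z, g z := integral_neg_eq_self g volume
  have h2 : ∫ z, g (-z) = ∫ z, -g z := by
    refine integral_congr_ae ?_
    filter_upwards [hK.even] with z hz
    by_cases h : z ∈ S
    · have h' : -z ∈ S := (hsym z).2 h
      simp [hg, h, h', hz]
    · have h' : -z ∉ S := fun h' => h ((hsym z).1 h')
      simp [hg, h, h']
  rw [integral_neg] at h2
  linarith

theorem KB.slab_zero (hK : KB J ε β C) (N : EV (n + 1)) (hN : ‖N‖ = 1) (hNe : 0 ≤ N (Fin.last n))
    (τ : EV (n + 1)) (hτ : inner ℝ τ N = 0) {s : ℝ} (hs : 0 < s) :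
    ∫ z in {z : EV (n + 1) | inner ℝ N z ≤ -s}, J z * inner ℝ τ z = 0 := by
  obtain ⟨Q, hQ, hQd, hQe⟩ := exists_rotation N hN hNe
  set I := isoQ hQ with hI
  have hmp : MeasurePreserving I volume volume := I.measurePreserving
  have hS : MeasurableSet {z : EV (n + 1) | inner ℝ N z ≤ -s} :=
    measurableSet_le (by fun_prop) measurable_const
  set τ' := I.symm τ with hτ'
  have hin : ∀ ζ, inner ℝ τ (I ζ) = inner ℝ τ' ζ := by
    intro ζ
    rw [hτ', ← I.inner_map_map (I.symm τ) ζ, I.apply_symm_apply]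
  have hIe : I (eL n) = N := hQe
  have hNI : ∀ ζ, inner ℝ N (I ζ) = ζ (Fin.last n) := by
    intro ζ
    rw [← hIe, I.inner_map_map, eL, EuclideanSpace.inner_single_left]; simp
  have hτl : τ' (Fin.last n) = 0 := by
    have h : inner ℝ τ' (eL n) = 0 := by rw [← hin, hIe, hτ]
    rw [eL, EuclideanSpace.inner_single_right] at h
    simpa using h
  set b := firstCoords τ' with hb
  have hin2 : ∀ ζ : EV (n + 1), inner ℝ τ' ζ = inner ℝ b (firstCoords ζ) := by
    intro ζ
    rw [inner_sumE, inner_sumE, Fin.sum_univ_castSucc, hτl]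
    simp [hb, firstCoords_apply]
  rw [← integral_indicator hS, ← hmp.integral_comp I.toHomeomorph.measurableEmbedding]
  set V : EV (n + 1) → EV n := fun ζ => {ζ : EV (n + 1) | ζ (Fin.last n) ≤ -s}.indicator
    (fun ζ => J (I ζ) • firstCoords ζ) ζ with hV
  have hS' : MeasurableSet {ζ : EV (n + 1) | ζ (Fin.last n) ≤ -s} :=
    measurableSet_le (continuous_last n).measurable measurable_const
  have e1 : ∀ ζ, {z : EV (n + 1) | inner ℝ N z ≤ -s}.indicator (fun z => J z * inner ℝ τ z) (I ζ)
      = inner ℝ b (V ζ) := by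
    intro ζ
    by_cases h : ζ (Fin.last n) ≤ -s
    · have h1 : ζ ∈ {ζ : EV (n + 1) | ζ (Fin.last n) ≤ -s} := h
      have h2 : I ζ ∈ {z : EV (n + 1) | inner ℝ N z ≤ -s} := by
        change inner ℝ N (I ζ) ≤ -s
        rw [hNI]; exact h
      rw [hV, Set.indicator_of_mem h2]
      simp only [Set.indicator_of_mem h1]
      rw [hin, hin2, inner_smul_right]
    · have h1 : ζ ∉ {ζ : EV (n + 1) | ζ (Fin.last n) ≤ -s} := h
      have h2 : I ζ ∉ {z : EV (n + 1) | inner ℝ N z ≤ -s} := by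
        change ¬ inner ℝ N (I ζ) ≤ -s
        rw [hNI]; exact h
      rw [hV, Set.indicator_of_notMem h2]
      simp only [Set.indicator_of_notMem h1]
      simp
  have hVi : Integrable V volume := by
    have h1 : Integrable ({z : EV (n + 1) | s ≤ ‖z‖}.indicator (fun z => J z * ‖z‖)) volume :=
      (integrable_indicator_iff (measurableSet_normge s)).2 (hK.integrableOn_one hs)
    have h2 := hmp.integrable_comp_of_integrable h1
    refine Integrable.mono' h2 ?_ (ae_of_all _ fun ζ => ?_)
    · refine Measurable.aestronglyMeasurable (Measurable.indicator ?_ hS')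
      exact (hK.meas.comp I.continuous.measurable).smul (measurable_firstCoords n)
    · by_cases h : ζ ∈ {ζ : EV (n + 1) | ζ (Fin.last n) ≤ -s}
      · have hn : s ≤ ‖I ζ‖ := by
          rw [I.norm_map]
          have h3 := abs_last_le ζ
          have h4 : ζ (Fin.last n) ≤ -s := h
          have := neg_abs_le (ζ (Fin.last n))
          linarith
        simp only [hV, Set.indicator_of_mem h, Function.comp]
        rw [Set.indicator_of_mem (show I ζ ∈ {z : EV (n + 1) | s ≤ ‖z‖} from hn), norm_smul,
          Real.norm_of_nonneg (hK.nonneg _), I.norm_map]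
        exact mul_le_mul_of_nonneg_left (norm_firstCoords_le ζ) (hK.nonneg _)
      · simp only [hV, Set.indicator_of_notMem h, norm_zero, Function.comp]
        exact Set.indicator_nonneg (fun z _ => mul_nonneg (hK.nonneg z) (norm_nonneg z)) _
  have hV0 : ∫ ζ, V ζ = 0 := by
    have hmp2 := mp_splitE_symm n
    have hemb : MeasurableEmbedding (fun q : EV n × ℝ => snocE q.1 q.2) :=
      (splitE n).symm.measurableEmbedding
    rw [← hmp2.integral_comp hemb, integral_prod_symm]
    · rw [integral_eq_zero_of_ae]
      refine ae_of_all _ fun σ => ?_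
      simp only [Pi.zero_apply]
      by_cases h : σ ≤ -s
      · have : ∀ z : EV n, V (snocE z σ) = J (mulVecE Q (snocE z σ)) • z := by
          intro z
          have h1 : snocE z σ ∈ {ζ : EV (n + 1) | ζ (Fin.last n) ≤ -s} := by
            change (snocE z σ) (Fin.last n) ≤ -s
            rw [snocE_last]; exact h
          simp only [hV, Set.indicator_of_mem h1, firstCoords_snocE]
          rfl
        simp_rw [this]
        exact hK.slice Q hQ hQd σ
      · have : ∀ z : EV n, V (snocE z σ) = 0 := by
          intro z
          have h1 : snocE z σ ∉ {ζ : EV (n + 1) | ζ (Fin.last n) ≤ -s} := by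
            change ¬ (snocE z σ) (Fin.last n) ≤ -s
            rw [snocE_last]; exact h
          simp only [hV, Set.indicator_of_notMem h1]
        simp_rw [this]
        simp
    · exact hmp2.integrable_comp_of_integrable hVi
  calc _ = ∫ ζ, inner ℝ b (V ζ) := integral_congr_ae (ae_of_all _ e1)
    _ = inner ℝ b (∫ ζ, V ζ) := integral_inner hVi b
    _ = 0 := by rw [hV0, inner_zero_right]

theorem KB.tang_zero (hK : KB J ε β C) (N : EV (n + 1)) (hN : ‖N‖ = 1) (hNe : 0 ≤ N (Fin.last n))
    (τ : EV (n + 1)) (hτ : inner ℝ τ N = 0) {r s : ℝ} (hr : 0 < r) (hrs : r ≤ s) :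
    ∫ z in {z : EV (n + 1) | r ≤ ‖z‖ ∧ -s < inner ℝ N z}, J z * inner ℝ τ z = 0 := by
  have hS1 := hK.odd_zero (measurableSet_normge r) (fun z => by simp) τ
  have hS2 := hK.slab_zero N hN hNe τ hτ (hr.trans_le hrs)
  have hm : MeasurableSet {z : EV (n + 1) | inner ℝ N z ≤ -s} :=
    measurableSet_le (by fun_prop) measurable_const
  have hsub : {z : EV (n + 1) | inner ℝ N z ≤ -s} ⊆ {z | r ≤ ‖z‖} := by
    intro z hz
    have hz : inner ℝ N z ≤ -s := hz
    have h1 := abs_real_inner_le_norm N z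
    rw [hN, one_mul] at h1
    have h2 := neg_abs_le (inner ℝ N z)
    change r ≤ ‖z‖
    linarith
  have e : {z : EV (n + 1) | r ≤ ‖z‖ ∧ -s < inner ℝ N z}
      = {z | r ≤ ‖z‖} \ {z | inner ℝ N z ≤ -s} := by
    ext z; simp
  rw [e, setIntegral_sdiff hm (hK.integrableOn_lin hr τ) hsub, hS1, hS2, sub_zero]

end

end

noncomputable section
set_option maxSynthPendingDepth 3

/-- Bounds for the graph function. -/
structure GB {n : ℕ} (γ : EV n → ℝ) (K : ℝ) : Prop where
  cd : ContDiff ℝ 3 γ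
  K1 : 1 ≤ K
  d1 : ∀ x, ‖fderiv ℝ γ x‖ ≤ 1
  d2 : ∀ x, ‖fderiv ℝ (fderiv ℝ γ) x‖ ≤ K
  d3 : ∀ x, ‖fderiv ℝ (fderiv ℝ (fderiv ℝ γ)) x‖ ≤ K

theorem exists_GB {n : ℕ} {γ : EV n → ℝ} (h : Ckb 3 γ) (h1 : ∀ x, ‖fderiv ℝ γ x‖ ≤ 1) :
    ∃ K, GB γ K := by
  obtain ⟨hc, hb⟩ := h
  obtain ⟨C2, h2⟩ := hb 2 (by norm_num)
  obtain ⟨C3, h3⟩ := hb 3 (by norm_num)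
  have e2 : ∀ x, ‖fderiv ℝ (fderiv ℝ γ) x‖ = ‖iteratedFDeriv ℝ 2 γ x‖ := by
    intro x
    rw [← norm_iteratedFDeriv_fderiv, ← norm_iteratedFDeriv_one]
  have e3 : ∀ x, ‖fderiv ℝ (fderiv ℝ (fderiv ℝ γ)) x‖ = ‖iteratedFDeriv ℝ 3 γ x‖ := by
    intro x
    rw [← norm_iteratedFDeriv_fderiv, ← norm_iteratedFDeriv_fderiv, ← norm_iteratedFDeriv_one]
  refine ⟨max 1 (max C2 C3), by exact_mod_cast hc, le_max_left _ _, h1, fun x => ?_, fun x => ?_⟩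
  · rw [e2]; exact (h2 x).trans (le_trans (le_max_left _ _) (le_max_right _ _))
  · rw [e3]; exact (h3 x).trans (le_trans (le_max_right _ _) (le_max_right _ _))

section
variable {n : ℕ} {γ : EV n → ℝ} {K : ℝ}

theorem GB.diff (hG : GB γ K) : Differentiable ℝ γ := hG.cd.differentiable (by norm_num)

theorem GB.cont (hG : GB γ K) : Continuous γ := hG.cd.continuous

theorem GB.K0 (hG : GB γ K) : 0 ≤ K := zero_le_one.trans hG.K1

theorem GB.cd2 (hG : GB γ K) : ContDiff ℝ 2 (fderiv ℝ γ) :=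
  hG.cd.fderiv_right (m := 2) (by norm_num)

theorem GB.cd1 (hG : GB γ K) : ContDiff ℝ 1 (fderiv ℝ (fderiv ℝ γ)) :=
  hG.cd2.fderiv_right (m := 1) (by norm_num)

theorem GB.taylor (hG : GB γ K) (x z : EV n) :
    |γ (x + z) - γ x - fderiv ℝ γ x z| ≤ K * ‖z‖ ^ 2 := by
  have hd2 : Differentiable ℝ (fderiv ℝ γ) := hG.cd2.differentiable (by norm_num)
  have hl : ∀ y, ‖fderiv ℝ γ y - fderiv ℝ γ x‖ ≤ K * ‖y - x‖ := fun y =>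
    convex_univ.norm_image_sub_le_of_norm_fderiv_le (𝕜 := ℝ)
      (fun y _ => hd2 y) (fun y _ => hG.d2 y) (Set.mem_univ x) (Set.mem_univ y)
  have h := (convex_closedBall x ‖z‖).norm_image_sub_le_of_norm_fderiv_le' (𝕜 := ℝ) (f := γ)
    (φ := fderiv ℝ γ x) (C := K * ‖z‖) (x := x) (y := x + z) (fun y _ => hG.diff y)
    (fun y hy => (hl y).trans (mul_le_mul_of_nonneg_left (by
      simpa [dist_eq_norm] using hy) hG.K0)) (by simp) (by simp)
  simp only [add_sub_cancel_left] at h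
  calc _ ≤ _ := h
    _ = _ := by ring

/-- The (non-normalised) inner normal, the gradient of `tf γ`. -/
def nuV (γ : EV n → ℝ) (x : EV (n + 1)) : EV (n + 1) :=
  WithLp.toLp 2 (fun i => partialD i (tf γ) x)

theorem vec_eq_sum {m : ℕ} (z : EV m) : z = ∑ i, z i • EuclideanSpace.single i (1 : ℝ) := by
  ext j
  simp [Pi.single_apply]

theorem clm_eq_sum {m : ℕ} (L : EV m →L[ℝ] ℝ) (z : EV m) :
    L z = ∑ i, L (EuclideanSpace.single i 1) * z i := by
  conv_lhs => rw [vec_eq_sum z]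
  simp [mul_comm]

theorem nuV_inner (x z : EV (n + 1)) : inner ℝ (nuV γ x) z = fderiv ℝ (tf γ) x z := by
  rw [clm_eq_sum, inner_sumE]; rfl

theorem fderiv_tf (hγ : Differentiable ℝ γ) (x z : EV (n + 1)) :
    fderiv ℝ (tf γ) x z = z (Fin.last n) - fderiv ℝ γ (firstCoords x) (firstCoords z) := by
  have h1 : HasFDerivAt (fun x : EV (n + 1) => x (Fin.last n))
      (EuclideanSpace.proj (𝕜 := ℝ) (Fin.last n)) x :=
    (EuclideanSpace.proj (𝕜 := ℝ) (Fin.last n)).hasFDerivAt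
  have h2 : HasFDerivAt (fun x : EV (n + 1) => γ (firstCoords x))
      ((fderiv ℝ γ (firstCoords x)).comp (PF n)) x :=
    (hγ (firstCoords x)).hasFDerivAt.comp x (PF n).hasFDerivAt
  have h3 : HasFDerivAt (tf γ) _ x := h1.sub h2
  rw [h3.fderiv]
  rfl

theorem nuV_last (hγ : Differentiable ℝ γ) (x : EV (n + 1)) : nuV γ x (Fin.last n) = 1 := by
  change fderiv ℝ (tf γ) x (EuclideanSpace.single (Fin.last n) 1) = 1
  rw [fderiv_tf hγ]
  change (eL n) (Fin.last n) - fderiv ℝ γ (firstCoords x) (firstCoords (eL n)) = 1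
  rw [firstCoords_eL, eL_last]; simp

theorem norm_nuV_ge (hγ : Differentiable ℝ γ) (x : EV (n + 1)) : 1 ≤ ‖nuV γ x‖ := by
  have := abs_last_le (nuV γ x)
  rwa [nuV_last hγ, abs_one] at this

theorem norm_nuV_le (hG : GB γ K) (x : EV (n + 1)) : ‖nuV γ x‖ ≤ 2 := by
  have h := nuV_inner (γ := γ) x (nuV γ x)
  rw [real_inner_self_eq_norm_sq, fderiv_tf hG.diff, nuV_last hG.diff] at h
  have h1 : |fderiv ℝ γ (firstCoords x) (firstCoords (nuV γ x))| ≤ ‖nuV γ x‖ := by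
    refine ((fderiv ℝ γ (firstCoords x)).le_opNorm _).trans ?_
    calc _ ≤ 1 * ‖nuV γ x‖ := by
          gcongr
          · exact hG.d1 _
          · exact norm_firstCoords_le _
      _ = _ := one_mul _
  have h2 := norm_nuV_ge hG.diff x
  have h3 := neg_abs_le (fderiv ℝ γ (firstCoords x) (firstCoords (nuV γ x)))
  nlinarith

theorem abs_setIntegral_sub_le {m : ℕ} {f g : EV m → ℝ} {E H D : Set (EV m)} (hE : MeasurableSet E)
    (hH : MeasurableSet H) (hD : MeasurableSet D) (hfE : IntegrableOn f E) (hfH : IntegrableOn f H)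
    (hfg : ∀ z, |f z| ≤ g z) (hg : Measurable g)
    (h1 : ∀ z, z ∈ E → z ∉ H → z ∈ D) (h2 : ∀ z, z ∈ H → z ∉ E → z ∈ D) {B : ℝ} (hB : 0 ≤ B)
    (hgB : ∫⁻ z in D, ENNReal.ofReal (g z) ≤ ENNReal.ofReal B) :
    |(∫ z in E, f z) - ∫ z in H, f z| ≤ B := by
  have hg0 : ∀ z, 0 ≤ g z := fun z => (abs_nonneg _).trans (hfg z)
  rw [← integral_indicator hE, ← integral_indicator hH,
    ← integral_sub ((integrable_indicator_iff hE).2 hfE) ((integrable_indicator_iff hH).2 hfH)]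
  have hle : ∀ z, |E.indicator f z - H.indicator f z| ≤ D.indicator g z := by
    intro z
    by_cases a : z ∈ E <;> by_cases b : z ∈ H
    · simp [a, b]; exact Set.indicator_nonneg (fun z _ => hg0 z) z
    · simp [a, b, h1 z a b, hfg z]
    · simp [a, b, h2 z b a, hfg z]
    · simp [a, b]; exact Set.indicator_nonneg (fun z _ => hg0 z) z
  have hi : Integrable (D.indicator g) volume := by
    refine ⟨(hg.indicator hD).aestronglyMeasurable, ?_⟩
    rw [hasFiniteIntegral_iff_ofReal (ae_of_all _ fun z => Set.indicator_nonneg (fun z _ => hg0 z) z)]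
    have : (fun z => ENNReal.ofReal (D.indicator g z)) = D.indicator (fun z => ENNReal.ofReal (g z)) := by
      funext z; by_cases h : z ∈ D <;> simp [h]
    rw [this, lintegral_indicator hD]
    exact hgB.trans_lt ENNReal.ofReal_lt_top
  calc |∫ z, (E.indicator f z - H.indicator f z)| ≤ ∫ z, |E.indicator f z - H.indicator f z| :=
        abs_integral_le_integral_abs
    _ ≤ ∫ z, D.indicator g z := by
        refine integral_mono_of_nonneg (ae_of_all _ fun z => abs_nonneg _) hi (ae_of_all _ hle)
    _ = ∫ z in D, g z := integral_indicator hD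
    _ = (∫⁻ z in D, ENNReal.ofReal (g z)).toReal :=
        integral_eq_lintegral_of_nonneg_ae (ae_of_all _ hg0) hg.aestronglyMeasurable
    _ ≤ (ENNReal.ofReal B).toReal := ENNReal.toReal_mono ENNReal.ofReal_ne_top hgB
    _ = B := ENNReal.toReal_ofReal hB

/-- The set of admissible increments. -/
def Eset (γ : EV n → ℝ) (x : EV (n + 1)) (r : ℝ) : Set (EV (n + 1)) :=
  {z | r ≤ ‖z‖ ∧ 0 < tf γ (x + z)}

theorem measurableSet_Eset (hγ : Continuous γ) (x : EV (n + 1)) (r : ℝ) :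
    MeasurableSet (Eset γ x r) := by
  refine MeasurableSet.inter (measurableSet_normge r) ?_
  exact measurableSet_lt measurable_const
    ((tf_continuous hγ).comp (continuous_const.add continuous_id)).measurable

variable {J : EV (n + 1) → ℝ} {ε β C : ℝ}

theorem first_order (hG : GB γ K) (hK : KB J ε β C) (hε : 0 < ε) (hC : 0 ≤ C) (x ξ : EV (n + 1))
    (hx : 0 < tf γ x) {r : ℝ} (hr : 0 < r) (hrt : r ≤ tf γ x / 2) :
    |∫ z in Eset γ x r, J z * inner ℝ ξ z| ≤
      C * wt β (tf γ x / 2 / ε) * (2 / tf γ x * |inner ℝ ξ (nuV γ x)| + K * ‖ξ‖) := by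
  set t := tf γ x with ht
  set ν := nuV γ x with hν
  have hν1 : 1 ≤ ‖ν‖ := norm_nuV_ge hG.diff x
  have hν2 : ‖ν‖ ≤ 2 := norm_nuV_le hG x
  have hν0 : 0 < ‖ν‖ := by linarith
  have ht2 : 0 < t / 2 := by positivity
  have hw0 : 0 ≤ wt β (t / 2 / ε) := wt_nonneg (by positivity)
  have hsub : ∀ s, Eset γ x s ⊆ {z | s ≤ ‖z‖} := fun s z hz => hz.1
  have hmE := measurableSet_Eset hG.cont x
  -- remove the annulus
  have hann : ∫ z in Eset γ x r, J z * inner ℝ ξ z = ∫ z in Eset γ x (t / 2), J z * inner ℝ ξ z := by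
    have hs1 : Eset γ x (t / 2) ⊆ Eset γ x r := fun z hz => ⟨hrt.trans hz.1, hz.2⟩
    have hd := setIntegral_sdiff (hmE (t / 2)) (((hK.integrableOn_lin hr ξ).mono_set (hsub r))) hs1
    have he : Eset γ x r \ Eset γ x (t / 2) = {z | r ≤ ‖z‖} \ {z | t / 2 ≤ ‖z‖} := by
      ext z
      simp only [Eset, Set.mem_sdiff, Set.mem_ofPred_eq, not_and, not_lt, not_le]
      constructor
      · rintro ⟨⟨h1, h2⟩, h3⟩
        refine ⟨h1, ?_⟩
        by_contra h4
        exact absurd (h3 (not_lt.1 h4)) (not_le.2 h2)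
      · rintro ⟨h1, h2⟩
        have h3 := tf_lip hG.diff hG.d1 x z
        have h4 := neg_abs_le (tf γ (x + z) - tf γ x)
        exact ⟨⟨h1, by linarith⟩, fun h => by linarith⟩
    rw [he] at hd
    have h0 := hK.odd_zero ((measurableSet_normge r).diff (measurableSet_normge (t / 2)))
      (fun z => by simp) ξ
    rw [h0] at hd
    linarith
  rw [hann]
  -- decomposition of ξ
  set N : EV (n + 1) := ‖ν‖⁻¹ • ν with hN
  have hN1 : ‖N‖ = 1 := by
    rw [hN, norm_smul, norm_inv, norm_norm, inv_mul_cancel₀ hν0.ne']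
  have hNe : 0 ≤ N (Fin.last n) := by
    have : N (Fin.last n) = ‖ν‖⁻¹ * 1 := by
      rw [← nuV_last hG.diff x]; rfl
    rw [this]; positivity
  set c := inner ℝ ξ N with hc
  set τ := ξ - c • N with hτ
  have hτN : inner ℝ τ N = 0 := by
    rw [hτ, inner_sub_left, inner_smul_left, real_inner_self_eq_norm_sq, hN1]
    simp [hc]
  have hτn : ‖τ‖ ≤ ‖ξ‖ := by
    have h1 : ‖ξ‖ ^ 2 = ‖τ‖ ^ 2 + c ^ 2 := by
      have : ξ = τ + c • N := by rw [hτ]; abel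
      conv_lhs => rw [this]
      rw [norm_add_sq_real, inner_smul_right, hτN, norm_smul, hN1]
      simp
    exact abs_le_of_sq_le_sq' (by nlinarith [sq_nonneg c]) (norm_nonneg _) |>.2
  have hsplit : ∀ z, J z * inner ℝ ξ z = J z * inner ℝ τ z + c * (J z * inner ℝ N z) := by
    intro z
    have : ξ = τ + c • N := by rw [hτ]; abel
    conv_lhs => rw [this]
    rw [inner_add_left, inner_smul_left]
    simp; ring
  have hiτ := (hK.integrableOn_lin ht2 τ)
  have hiN := (hK.integrableOn_lin ht2 N)
  simp_rw [hsplit]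
  rw [integral_add (hiτ.mono_set (hsub _)) ((hiN.mono_set (hsub _)).const_mul c), integral_const_mul]
  -- tangential part
  have hT : |∫ z in Eset γ x (t / 2), J z * inner ℝ τ z| ≤ ‖τ‖ * (C * K * wt β (t / 2 / ε)) := by
    set H := {z : EV (n + 1) | t / 2 ≤ ‖z‖ ∧ -(t / ‖ν‖) < inner ℝ N z} with hH
    have hHm : MeasurableSet H := by
      have h1 : MeasurableSet {z : EV (n + 1) | -(t / ‖ν‖) < inner ℝ N z} :=
        measurableSet_lt measurable_const (by fun_prop)
      exact (measurableSet_normge _).inter h1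
    have hH0 : ∫ z in H, J z * inner ℝ τ z = 0 :=
      hK.tang_zero N hN1 hNe τ hτN ht2 (by gcongr)
    have hHin : ∀ z, -(t / ‖ν‖) < inner ℝ N z ↔
        0 < t + z (Fin.last n) - fderiv ℝ γ (firstCoords x) (firstCoords z) := by
      intro z
      rw [hN, inner_smul_left, hν, nuV_inner, fderiv_tf hG.diff]
      simp only [conj_trivial]
      rw [← hν, ← neg_div, div_eq_inv_mul, mul_lt_mul_iff_right₀ (by positivity)]
      constructor <;> intro h <;> linarith
    have htay : ∀ z : EV (n + 1), |tf γ (x + z) - (t + z (Fin.last n)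
        - fderiv ℝ γ (firstCoords x) (firstCoords z))| ≤ K * ‖firstCoords z‖ ^ 2 := by
      intro z
      refine le_trans (le_of_eq ?_) (hG.taylor (firstCoords x) (firstCoords z))
      rw [← abs_neg]
      congr 1
      simp only [ht, tf, firstCoords_add, PiLp.add_apply]
      ring
    have hl := hK.layer (fderiv ℝ γ (firstCoords x)) K t hG.K0 hx.le
    set D := {z : EV (n + 1) | |t + z (Fin.last n) - fderiv ℝ γ (firstCoords x) (firstCoords z)|
      ≤ K * ‖firstCoords z‖ ^ 2 ∧ t / 2 ≤ ‖z‖} with hD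
    have hDm : MeasurableSet D := by
      refine MeasurableSet.inter (s₁ := {z : EV (n + 1) | |t + z (Fin.last n) -
        fderiv ℝ γ (firstCoords x) (firstCoords z)| ≤ K * ‖firstCoords z‖ ^ 2})
        (s₂ := {z | t / 2 ≤ ‖z‖}) (measurableSet_le ?_ ?_) (measurableSet_normge _)
      · have h1 := (fderiv ℝ γ (firstCoords x)).continuous.comp (continuous_firstCoords n)
        have h2 := continuous_last n
        exact ((continuous_const.add h2).sub h1).abs.measurable
      · exact ((measurable_firstCoords n).norm.pow_const 2).const_mul _
    have hmain := abs_setIntegral_sub_le (f := fun z => J z * inner ℝ τ z)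
      (g := fun z => ‖τ‖ * (J z * ‖z‖)) (hmE (t / 2)) hHm hDm (hiτ.mono_set (hsub _))
      (hiτ.mono_set (fun z hz => hz.1)) ?_ ?_ ?_ ?_ (B := ‖τ‖ * (C * K * wt β (t / 2 / ε))) ?_ ?_
    · rw [hH0, sub_zero] at hmain
      exact hmain
    · intro z
      rw [abs_mul, abs_of_nonneg (hK.nonneg z)]
      calc J z * |inner ℝ τ z| ≤ J z * (‖τ‖ * ‖z‖) :=
            mul_le_mul_of_nonneg_left (abs_real_inner_le_norm τ z) (hK.nonneg z)
        _ = _ := by ring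
    · exact (hK.meas.mul measurable_norm).const_mul _
    · rintro z ⟨h1, h2⟩ h3
      refine ⟨?_, h1⟩
      have h4 : ¬ (-(t / ‖ν‖) < inner ℝ N z) := fun h => h3 ⟨h1, h⟩
      rw [hHin, not_lt] at h4
      have h5 := htay z
      rw [abs_of_nonpos h4]
      rw [abs_of_nonneg (by linarith)] at h5
      linarith
    · rintro z ⟨h1, h2⟩ h3
      refine ⟨?_, h1⟩
      have h4 : ¬ (0 < tf γ (x + z)) := fun h => h3 ⟨h1, h⟩
      rw [not_lt] at h4
      rw [hHin] at h2
      have h5 := htay z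
      rw [abs_of_nonneg h2.le]
      rw [abs_of_nonpos (by linarith)] at h5
      linarith
    · have := hG.K0
      positivity
    · simp_rw [ENNReal.ofReal_mul (norm_nonneg τ)]
      rw [lintegral_const_mul' _ _ ENNReal.ofReal_ne_top]
      gcongr
  -- normal part
  have hNp : |∫ z in Eset γ x (t / 2), J z * inner ℝ N z| ≤ 2 / t * (C * wt β (t / 2 / ε)) := by
    have hmain := abs_setIntegral_sub_le (f := fun z => J z * inner ℝ N z)
      (g := fun z => J z * ‖z‖) (hmE (t / 2)) MeasurableSet.empty (measurableSet_normge (t / 2))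
      (hiN.mono_set (hsub _)) (by simp) ?_ (hK.meas.mul measurable_norm) (fun z h _ => h.1)
      (fun z h _ => absurd h (by simp)) (B := 2 / t * (C * wt β (t / 2 / ε))) (by positivity) ?_
    · simpa using hmain
    · intro z
      rw [abs_mul, abs_of_nonneg (hK.nonneg z)]
      refine mul_le_mul_of_nonneg_left ?_ (hK.nonneg z)
      have := abs_real_inner_le_norm N z
      rwa [hN1, one_mul] at this
    · rw [ENNReal.ofReal_mul (by positivity)]
      refine le_trans ?_ (mul_le_mul_right (hK.tail (t / 2) ht2.le) _)
      rw [← lintegral_const_mul' _ _ ENNReal.ofReal_ne_top]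
      refine setLIntegral_mono' (measurableSet_normge _) fun z hz => ?_
      rw [← ENNReal.ofReal_mul (by positivity)]
      refine ENNReal.ofReal_le_ofReal ?_
      have hz : t / 2 ≤ ‖z‖ := hz
      have h0 := hK.nonneg z
      have : ‖z‖ ≤ 2 / t * ‖z‖ ^ 2 := by
        rw [div_mul_eq_mul_div, le_div_iff₀ hx]; nlinarith [norm_nonneg z]
      calc J z * ‖z‖ ≤ J z * (2 / t * ‖z‖ ^ 2) := by gcongr
        _ = _ := by ring
  have hcb : |c| ≤ |inner ℝ ξ ν| := by
    rw [hc, hN, inner_smul_right, abs_mul, abs_of_nonneg (by positivity)]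
    refine mul_le_of_le_one_left (abs_nonneg _) (inv_le_one_of_one_le₀ hν1)
  calc _ ≤ |∫ z in Eset γ x (t / 2), J z * inner ℝ τ z|
        + |c| * |∫ z in Eset γ x (t / 2), J z * inner ℝ N z| := by
        rw [← abs_mul]; exact abs_add_le _ _
    _ ≤ ‖ξ‖ * (C * K * wt β (t / 2 / ε)) + |inner ℝ ξ ν| * (2 / t * (C * wt β (t / 2 / ε))) := by
        have := hG.K0
        gcongr
        exact hT.trans (by gcongr)
    _ = _ := by ring

end

end

noncomputable section
set_option maxSynthPendingDepth 3

theorem abs_clm_le {E : Type*} [NormedAddCommGroup E] [NormedSpace ℝ E] (L : E →L[ℝ] ℝ) (v : E) :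
    |L v| ≤ ‖L‖ * ‖v‖ := by
  rw [← Real.norm_eq_abs]; exact L.le_opNorm v

theorem scalar_taylor {g g1 g2 g3 : ℝ → ℝ} (h0 : ∀ τ, HasDerivAt g (g1 τ) τ)
    (h1 : ∀ τ, HasDerivAt g1 (g2 τ) τ) (h2 : ∀ τ, HasDerivAt g2 (g3 τ) τ) (h3 : Continuous g3) :
    |g 1 - g 0 - g1 0 - 1 / 2 * g2 0| ≤ ∫ τ in (0 : ℝ)..1, |g3 τ| := by
  have hφ : ∀ τ, HasDerivAt (fun τ => g τ + (1 - τ) * g1 τ + 1 / 2 * (1 - τ) ^ 2 * g2 τ)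
      (1 / 2 * (1 - τ) ^ 2 * g3 τ) τ := by
    intro τ
    have ha : HasDerivAt (fun τ : ℝ => 1 - τ) (-1) τ := by
      simpa using (hasDerivAt_id τ).const_sub 1
    have hb := ((ha.pow 2).const_mul (1 / 2)).mul (h2 τ)
    have hc := ((h0 τ).add (ha.mul (h1 τ))).add hb
    refine hc.congr_deriv ?_
    simp
    ring
  have hci : Continuous (fun τ => 1 / 2 * (1 - τ) ^ 2 * g3 τ) := by fun_prop
  have hintg := intervalIntegral.integral_eq_sub_of_hasDerivAt (a := 0) (b := 1)
    (fun τ _ => hφ τ) (hci.intervalIntegrable 0 1)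
  have e : g 1 - g 0 - g1 0 - 1 / 2 * g2 0 = ∫ τ in (0 : ℝ)..1, 1 / 2 * (1 - τ) ^ 2 * g3 τ := by
    rw [hintg]; ring
  rw [e]
  refine (intervalIntegral.abs_integral_le_integral_abs zero_le_one).trans ?_
  refine intervalIntegral.integral_mono_on zero_le_one (hci.abs.intervalIntegrable 0 1)
    (h3.abs.intervalIntegrable 0 1) fun τ hτ => ?_
  rw [abs_mul, abs_of_nonneg (by positivity)]
  refine mul_le_of_le_one_left (abs_nonneg _) ?_
  nlinarith [hτ.1, hτ.2]

section
variable {d : ℕ}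

/-- Sum of the norms of the first three derivatives. -/
def FD (h : EV d → ℝ) (x : EV d) : ℝ :=
  ‖fderiv ℝ h x‖ + ‖fderiv ℝ (fderiv ℝ h) x‖ + ‖fderiv ℝ (fderiv ℝ (fderiv ℝ h)) x‖

theorem FD_nonneg (h : EV d → ℝ) (x : EV d) : 0 ≤ FD h x := by unfold FD; positivity

theorem FD_continuous {h : EV d → ℝ} (hh : ContDiff ℝ 3 h) : Continuous (FD h) := by
  have h2 : ContDiff ℝ 2 (fderiv ℝ h) := hh.fderiv_right (m := 2) (by norm_num)
  have h1 : ContDiff ℝ 1 (fderiv ℝ (fderiv ℝ h)) := h2.fderiv_right (m := 1) (by norm_num)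
  have h0 : ContDiff ℝ 0 (fderiv ℝ (fderiv ℝ (fderiv ℝ h))) := h1.fderiv_right (m := 0) (by norm_num)
  exact (h2.continuous.norm.add h1.continuous.norm).add h0.continuous.norm

theorem chain_taylor {h : EV d → ℝ} (hh : ContDiff ℝ 3 h) {c c1 c2 c3 : ℝ → EV d}
    (hc0 : ∀ τ, HasDerivAt c (c1 τ) τ) (hc1 : ∀ τ, HasDerivAt c1 (c2 τ) τ)
    (hc2 : ∀ τ, HasDerivAt c2 (c3 τ) τ) (hc3 : Continuous c3) {Z B : ℝ} (hZ : 0 ≤ Z) (hB : 1 ≤ B)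
    (b1 : ∀ τ ∈ Set.Icc (0 : ℝ) 1, ‖c1 τ‖ ≤ 3 * Z)
    (b2 : ∀ τ ∈ Set.Icc (0 : ℝ) 1, ‖c2 τ‖ ≤ B * Z ^ 2)
    (b3 : ∀ τ ∈ Set.Icc (0 : ℝ) 1, ‖c3 τ‖ ≤ B * Z ^ 3) :
    |h (c 1) - h (c 0) - fderiv ℝ h (c 0) (c1 0)
      - 1 / 2 * (fderiv ℝ (fderiv ℝ h) (c 0) (c1 0) (c1 0) + fderiv ℝ h (c 0) (c2 0))|
      ≤ 27 * B * Z ^ 3 * ∫ τ in (0 : ℝ)..1, FD h (c τ) := by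
  have h2 : ContDiff ℝ 2 (fderiv ℝ h) := hh.fderiv_right (m := 2) (by norm_num)
  have h1 : ContDiff ℝ 1 (fderiv ℝ (fderiv ℝ h)) := h2.fderiv_right (m := 1) (by norm_num)
  have h0 : ContDiff ℝ 0 (fderiv ℝ (fderiv ℝ (fderiv ℝ h))) := h1.fderiv_right (m := 0) (by norm_num)
  have dh : Differentiable ℝ h := hh.differentiable (by norm_num)
  have dh1 : Differentiable ℝ (fderiv ℝ h) := h2.differentiable (by norm_num)
  have dh2 : Differentiable ℝ (fderiv ℝ (fderiv ℝ h)) := h1.differentiable (by norm_num)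
  set D1 := fderiv ℝ h with hD1
  set D2 := fderiv ℝ D1 with hD2
  set D3 := fderiv ℝ D2 with hD3
  have k0 : ∀ τ, HasDerivAt (fun τ => h (c τ)) (D1 (c τ) (c1 τ)) τ := fun τ =>
    (dh (c τ)).hasFDerivAt.comp_hasDerivAt τ (hc0 τ)
  have kD1 : ∀ τ, HasDerivAt (fun τ => D1 (c τ)) (D2 (c τ) (c1 τ)) τ := fun τ =>
    (dh1 (c τ)).hasFDerivAt.comp_hasDerivAt τ (hc0 τ)
  have kD2 : ∀ τ, HasDerivAt (fun τ => D2 (c τ)) (D3 (c τ) (c1 τ)) τ := fun τ =>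
    (dh2 (c τ)).hasFDerivAt.comp_hasDerivAt τ (hc0 τ)
  have k1 : ∀ τ, HasDerivAt (fun τ => D1 (c τ) (c1 τ)) (D2 (c τ) (c1 τ) (c1 τ) + D1 (c τ) (c2 τ)) τ :=
    fun τ => (kD1 τ).clm_apply (hc1 τ)
  have k2 : ∀ τ, HasDerivAt (fun τ => D2 (c τ) (c1 τ) (c1 τ) + D1 (c τ) (c2 τ))
      (((D3 (c τ) (c1 τ) (c1 τ) + D2 (c τ) (c2 τ)) (c1 τ) + D2 (c τ) (c1 τ) (c2 τ)) +
        (D2 (c τ) (c1 τ) (c2 τ) + D1 (c τ) (c3 τ))) τ := fun τ =>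
    (((kD2 τ).clm_apply (hc1 τ)).clm_apply (hc1 τ)).add ((kD1 τ).clm_apply (hc2 τ))
  have cc : Continuous c := continuous_iff_continuousAt.2 fun τ => (hc0 τ).continuousAt
  have cc1 : Continuous c1 := continuous_iff_continuousAt.2 fun τ => (hc1 τ).continuousAt
  have cc2 : Continuous c2 := continuous_iff_continuousAt.2 fun τ => (hc2 τ).continuousAt
  have cD1 : Continuous (fun τ => D1 (c τ)) := h2.continuous.comp cc
  have cD2 : Continuous (fun τ => D2 (c τ)) := h1.continuous.comp cc
  have cD3 : Continuous (fun τ => D3 (c τ)) := h0.continuous.comp cc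
  have cF : Continuous (fun τ => FD h (c τ)) := (FD_continuous hh).comp cc
  have hcont : Continuous (fun τ => ((D3 (c τ) (c1 τ) (c1 τ) + D2 (c τ) (c2 τ)) (c1 τ)
      + D2 (c τ) (c1 τ) (c2 τ)) + (D2 (c τ) (c1 τ) (c2 τ) + D1 (c τ) (c3 τ))) := by
    refine Continuous.add (Continuous.add ?_ ?_) (Continuous.add ?_ ?_)
    · exact (((cD3.clm_apply cc1).clm_apply cc1).add (cD2.clm_apply cc2)).clm_apply cc1
    · exact (cD2.clm_apply cc1).clm_apply cc2
    · exact (cD2.clm_apply cc1).clm_apply cc2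
    · exact cD1.clm_apply hc3
  refine (scalar_taylor k0 k1 k2 hcont).trans ?_
  rw [← intervalIntegral.integral_const_mul]
  refine intervalIntegral.integral_mono_on zero_le_one (hcont.abs.intervalIntegrable 0 1)
    ((continuous_const.mul cF).intervalIntegrable 0 1) fun τ hτ => ?_
  have e1 := b1 τ hτ
  have e2 := b2 τ hτ
  have e3 := b3 τ hτ
  have n3 : |D3 (c τ) (c1 τ) (c1 τ) (c1 τ)| ≤ ‖D3 (c τ)‖ * (27 * Z ^ 3) := by
    calc |D3 (c τ) (c1 τ) (c1 τ) (c1 τ)| ≤ ‖D3 (c τ) (c1 τ) (c1 τ)‖ * ‖c1 τ‖ := abs_clm_le _ _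
      _ ≤ (‖D3 (c τ) (c1 τ)‖ * ‖c1 τ‖) * ‖c1 τ‖ := by gcongr; exact ContinuousLinearMap.le_opNorm _ _
      _ ≤ ((‖D3 (c τ)‖ * ‖c1 τ‖) * ‖c1 τ‖) * ‖c1 τ‖ := by gcongr; exact ContinuousLinearMap.le_opNorm _ _
      _ ≤ ((‖D3 (c τ)‖ * (3 * Z)) * (3 * Z)) * (3 * Z) := by gcongr
      _ = _ := by ring
  have n2 : ∀ a b, |D2 (c τ) a b| ≤ ‖D2 (c τ)‖ * (‖a‖ * ‖b‖) := by
    intro a b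
    calc |D2 (c τ) a b| ≤ ‖D2 (c τ) a‖ * ‖b‖ := abs_clm_le _ _
      _ ≤ (‖D2 (c τ)‖ * ‖a‖) * ‖b‖ := by gcongr; exact ContinuousLinearMap.le_opNorm _ _
      _ = _ := by ring
  have p1 : ‖c1 τ‖ * ‖c2 τ‖ ≤ 3 * B * Z ^ 3 := by
    calc _ ≤ (3 * Z) * (B * Z ^ 2) := by gcongr
      _ = _ := by ring
  have n2a : |D2 (c τ) (c2 τ) (c1 τ)| ≤ ‖D2 (c τ)‖ * (3 * B * Z ^ 3) :=
    (n2 _ _).trans (by rw [mul_comm ‖c2 τ‖]; gcongr)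
  have n2b : |D2 (c τ) (c1 τ) (c2 τ)| ≤ ‖D2 (c τ)‖ * (3 * B * Z ^ 3) :=
    (n2 _ _).trans (by gcongr)
  have n1 : |D1 (c τ) (c3 τ)| ≤ ‖D1 (c τ)‖ * (B * Z ^ 3) :=
    (abs_clm_le _ _).trans (by gcongr)
  have ab : ∀ a b c d e : ℝ, |((a + b) + c) + (d + e)| ≤ |a| + |b| + |c| + |d| + |e| := by
    intro a b c d e
    have := abs_add_le ((a + b) + c) (d + e)
    have := abs_add_le (a + b) c
    have := abs_add_le a b
    have := abs_add_le d e
    linarith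
  rw [_root_.add_apply]
  refine (ab _ _ _ _ _).trans ?_
  have hZ3 : 0 ≤ Z ^ 3 := by positivity
  have q1 : 0 ≤ ‖D1 (c τ)‖ * Z ^ 3 := by positivity
  have q2 : 0 ≤ ‖D2 (c τ)‖ * Z ^ 3 := by positivity
  have q3 : 0 ≤ ‖D3 (c τ)‖ * Z ^ 3 := by positivity
  have : FD h (c τ) = ‖D1 (c τ)‖ + ‖D2 (c τ)‖ + ‖D3 (c τ)‖ := rfl
  rw [this]
  nlinarith [mul_le_mul_of_nonneg_right hB q1, mul_le_mul_of_nonneg_right hB q2,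
    mul_le_mul_of_nonneg_right hB q3]

end

section
variable {n : ℕ} {γ : EV n → ℝ} {K : ℝ}

/-- The vertical correction of the segment. -/
def kap (γ : EV n → ℝ) (z : EV (n + 1)) (τ : ℝ) (y : EV n) : ℝ :=
  γ (y + τ • firstCoords z) - (1 - τ) * γ y - τ * γ (y + firstCoords z)

/-- The path from `x` to `x + z` inside the half space. -/
def cpath (γ : EV n → ℝ) (z : EV (n + 1)) (τ : ℝ) (x : EV (n + 1)) : EV (n + 1) :=
  x + τ • z + kap γ z τ (firstCoords x) • eL n

theorem cpath_mp (hγ : Continuous γ) (z : EV (n + 1)) (τ : ℝ) :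
    MeasurePreserving (cpath γ z τ) volume volume := by
  refine mp_shear (τ • z) (kap γ z τ) ?_
  unfold kap
  exact Continuous.measurable (by fun_prop)

theorem tf_cpath (x z : EV (n + 1)) (τ : ℝ) :
    tf γ (cpath γ z τ x) = (1 - τ) * tf γ x + τ * tf γ (x + z) := by
  unfold cpath
  rw [tf_add_smul_eL]
  simp only [tf, firstCoords_add, firstCoords_smul, kap, PiLp.add_apply, PiLp.smul_apply, smul_eq_mul]
  ring

theorem tf_cpath_pos {x z : EV (n + 1)} {τ : ℝ} (hx : 0 < tf γ x) (hz : 0 < tf γ (x + z))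
    (hτ : τ ∈ Set.Icc (0 : ℝ) 1) : 0 < tf γ (cpath γ z τ x) := by
  rw [tf_cpath]
  rcases eq_or_lt_of_le hτ.1 with h | h
  · rw [← h]; simpa using hx
  · have := mul_nonneg (sub_nonneg.2 hτ.2) hx.le
    have := mul_pos h hz
    linarith

theorem cpath_continuous (hγ : Continuous γ) :
    Continuous (fun q : EV (n + 1) × EV (n + 1) × ℝ => cpath γ q.2.1 q.2.2 q.1) := by
  have h := continuous_firstCoords n
  unfold cpath kap
  fun_prop

set_option maxHeartbeats 800000 in
theorem taylor_path (hG : GB γ K) {h : EV (n + 1) → ℝ} (hh : ContDiff ℝ 3 h) (x z : EV (n + 1)) :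
    |h (x + z) - h x - fderiv ℝ h x z - 1 / 2 * fderiv ℝ (fderiv ℝ h) x z z|
      ≤ 27 * K * ‖z‖ ^ 3 * ((∫ τ in (0 : ℝ)..1, FD h (cpath γ z τ x)) + FD h x) := by
  set x' := firstCoords x with hx'
  set z' := firstCoords z with hz'
  have hzz : ‖z'‖ ≤ ‖z‖ := norm_firstCoords_le z
  have dγ1 : Differentiable ℝ (fderiv ℝ γ) := hG.cd2.differentiable (by norm_num)
  have dγ2 : Differentiable ℝ (fderiv ℝ (fderiv ℝ γ)) := hG.cd1.differentiable (by norm_num)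
  set γ1 := fderiv ℝ γ with hγ1
  set γ2 := fderiv ℝ γ1 with hγ2
  set γ3 := fderiv ℝ γ2 with hγ3
  have cγ3 : Continuous γ3 := (hG.cd1.fderiv_right (m := 0) (by norm_num)).continuous
  have seg : ∀ τ : ℝ, HasDerivAt (fun τ : ℝ => x' + τ • z') z' τ := by
    intro τ
    simpa using ((hasDerivAt_id τ).smul_const z').const_add x'
  have s0 : ∀ τ, HasDerivAt (fun τ : ℝ => γ (x' + τ • z')) (γ1 (x' + τ • z') z') τ := fun τ =>
    (hG.diff _).hasFDerivAt.comp_hasDerivAt τ (seg τ)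
  have s1 : ∀ τ, HasDerivAt (fun τ : ℝ => γ1 (x' + τ • z') z') (γ2 (x' + τ • z') z' z') τ := by
    intro τ
    have := ((dγ1 _).hasFDerivAt.comp_hasDerivAt τ (seg τ)).clm_apply (hasDerivAt_const τ z')
    simpa using this
  have s2 : ∀ τ, HasDerivAt (fun τ : ℝ => γ2 (x' + τ • z') z' z') (γ3 (x' + τ • z') z' z' z') τ := by
    intro τ
    have := (((dγ2 _).hasFDerivAt.comp_hasDerivAt τ (seg τ)).clm_apply (hasDerivAt_const τ z')).clm_apply
      (hasDerivAt_const τ z')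
    simpa using this
  have m1 : ∀ y, |γ1 y z'| ≤ ‖z‖ := by
    intro y
    calc |γ1 y z'| ≤ ‖γ1 y‖ * ‖z'‖ := abs_clm_le _ _
      _ ≤ 1 * ‖z‖ := by gcongr; exact hG.d1 y
      _ = _ := one_mul _
  have hK0 := hG.K0
  have m2 : ∀ y, |γ2 y z' z'| ≤ K * ‖z‖ ^ 2 := by
    intro y
    calc |γ2 y z' z'| ≤ ‖γ2 y z'‖ * ‖z'‖ := abs_clm_le _ _
      _ ≤ (‖γ2 y‖ * ‖z'‖) * ‖z'‖ := by gcongr; exact ContinuousLinearMap.le_opNorm _ _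
      _ ≤ (K * ‖z‖) * ‖z‖ := by gcongr; exact hG.d2 y
      _ = _ := by ring
  have m3 : ∀ y, |γ3 y z' z' z'| ≤ K * ‖z‖ ^ 3 := by
    intro y
    calc |γ3 y z' z' z'| ≤ ‖γ3 y z' z'‖ * ‖z'‖ := abs_clm_le _ _
      _ ≤ (‖γ3 y z'‖ * ‖z'‖) * ‖z'‖ := by gcongr; exact ContinuousLinearMap.le_opNorm _ _
      _ ≤ ((‖γ3 y‖ * ‖z'‖) * ‖z'‖) * ‖z'‖ := by gcongr; exact ContinuousLinearMap.le_opNorm _ _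
      _ ≤ ((K * ‖z‖) * ‖z‖) * ‖z‖ := by gcongr; exact hG.d3 y
      _ = _ := by ring
  have cs3 : Continuous (fun τ : ℝ => γ3 (x' + τ • z') z' z' z') :=
    (((cγ3.comp (by fun_prop)).clm_apply continuous_const).clm_apply continuous_const).clm_apply
      continuous_const
  set k0 : ℝ := γ x' - γ (x' + z') with hk0
  have hk0b : |k0| ≤ ‖z‖ := by
    have := gamma_lip hG.diff hG.d1 (x' + z') x'
    refine this.trans ?_
    simpa using hzz
  set c1 : ℝ → EV (n + 1) := fun τ => z + (γ1 (x' + τ • z') z' + k0) • eL n with hc1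
  set c2 : ℝ → EV (n + 1) := fun τ => (γ2 (x' + τ • z') z' z') • eL n with hc2
  set c3 : ℝ → EV (n + 1) := fun τ => (γ3 (x' + τ • z') z' z' z') • eL n with hc3
  have d0 : ∀ τ, HasDerivAt (fun τ => cpath γ z τ x) (c1 τ) τ := by
    intro τ
    have hl : HasDerivAt (fun τ : ℝ => (1 - τ) * γ x' + τ * γ (x' + z')) (-k0) τ := by
      have h1 := ((hasDerivAt_id τ).const_sub 1).mul_const (γ x')
      have h2 := (hasDerivAt_id τ).mul_const (γ (x' + z'))
      refine (h1.add h2).congr_deriv ?_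
      rw [hk0]; ring
    have hk := ((s0 τ).sub hl).smul_const (eL n)
    have hz := ((hasDerivAt_id τ).smul_const z).const_add x
    have := hz.add hk
    have hfe : (fun τ => cpath γ z τ x) = fun σ => (x + (id σ) • z)
        + (γ (x' + σ • z') - ((1 - σ) * γ x' + σ * γ (x' + z'))) • eL n := by
      funext σ
      simp only [cpath, kap, id]
      congr 2
      ring
    rw [hfe]
    refine HasDerivAt.congr_deriv this ?_
    simp [hc1]
  have d1 : ∀ τ, HasDerivAt c1 (c2 τ) τ := by
    intro τ
    exact (((s1 τ).add_const k0).smul_const (eL n)).const_add z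
  have d2 : ∀ τ, HasDerivAt c2 (c3 τ) τ := fun τ => (s2 τ).smul_const (eL n)
  have hmain := chain_taylor hh d0 d1 d2 (cs3.smul continuous_const) (norm_nonneg z) hG.K1 ?_ ?_ ?_
  rotate_left
  · intro τ _
    calc ‖c1 τ‖ ≤ ‖z‖ + ‖(γ1 (x' + τ • z') z' + k0) • eL n‖ := norm_add_le _ _
      _ = ‖z‖ + |γ1 (x' + τ • z') z' + k0| := by rw [norm_smul, norm_eL, mul_one]; rfl
      _ ≤ ‖z‖ + (‖z‖ + ‖z‖) := by
          gcongr
          exact (abs_add_le _ _).trans (add_le_add (m1 _) hk0b)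
      _ = _ := by ring
  · intro τ _
    rw [hc2, norm_smul, norm_eL, mul_one]; exact m2 _
  · intro τ _
    rw [hc3, norm_smul, norm_eL, mul_one]; exact m3 _
  have e0 : cpath γ z 0 x = x := by simp [cpath, kap]
  have e1 : cpath γ z 1 x = x + z := by simp [cpath, kap]
  rw [e0, e1] at hmain
  -- corrections
  set a := γ1 x' z' + k0 with ha
  set b := γ2 x' z' z' with hb
  have c10 : c1 0 = z + a • eL n := by simp [hc1, ha]
  have c20 : c2 0 = b • eL n := by simp [hc2, hb]
  rw [c10, c20] at hmain
  have hab : |a + 1 / 2 * b| ≤ K * ‖z‖ ^ 3 := by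
    have := scalar_taylor s0 s1 s2 cs3
    have hle : ∫ τ in (0 : ℝ)..1, |γ3 (x' + τ • z') z' z' z'| ≤ ∫ τ in (0 : ℝ)..1, K * ‖z‖ ^ 3 :=
      intervalIntegral.integral_mono_on zero_le_one (cs3.abs.intervalIntegrable 0 1)
        (continuous_const.intervalIntegrable 0 1) fun τ _ => m3 _
    simp only [intervalIntegral.integral_const, sub_zero, one_smul] at hle
    have h3 := this.trans hle
    rw [← abs_neg] at h3
    refine le_trans (le_of_eq ?_) h3
    congr 1
    simp only [one_smul, zero_smul, add_zero, ha, hb, hk0]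
    ring
  have haz : |a| ≤ K * ‖z‖ ^ 2 := by
    have := hG.taylor x' z'
    rw [← abs_neg] at this
    calc |a| = _ := by congr 1; rw [ha, hk0]; ring
      _ ≤ K * ‖z'‖ ^ 2 := this
      _ ≤ _ := by gcongr
  have haz1 : |a| ≤ 2 * ‖z‖ := by
    have := (abs_add_le (γ1 x' z') k0).trans (add_le_add (m1 x') hk0b)
    linarith
  set D1 := fderiv ℝ h x with hD1
  set D2 := fderiv ℝ (fderiv ℝ h) x with hD2
  set e := eL n with he
  have hne : ‖e‖ = 1 := norm_eL n
  have n1 : |D1 e| ≤ ‖D1‖ := by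
    have := abs_clm_le D1 e
    rwa [hne, mul_one] at this
  have n2 : ∀ a b, |D2 a b| ≤ ‖D2‖ * (‖a‖ * ‖b‖) := by
    intro a b
    calc |D2 a b| ≤ ‖D2 a‖ * ‖b‖ := abs_clm_le _ _
      _ ≤ (‖D2‖ * ‖a‖) * ‖b‖ := by gcongr; exact ContinuousLinearMap.le_opNorm _ _
      _ = _ := by ring
  have hexp : h (x + z) - h x - D1 z - 1 / 2 * D2 z z
      = (h (x + z) - h x - D1 (z + a • e) - 1 / 2 * (D2 (z + a • e) (z + a • e) + D1 (b • e)))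
        + ((a + 1 / 2 * b) * D1 e + 1 / 2 * (a * D2 z e + a * D2 e z + a * a * D2 e e)) := by
    simp only [map_add, map_smul, _root_.add_apply, _root_.smul_apply,
      smul_eq_mul]
    ring
  rw [hexp]
  refine (abs_add_le _ _).trans ?_
  have hcor : |(a + 1 / 2 * b) * D1 e + 1 / 2 * (a * D2 z e + a * D2 e z + a * a * D2 e e)|
      ≤ 27 * K * ‖z‖ ^ 3 * FD h x := by
    have t1 : |(a + 1 / 2 * b) * D1 e| ≤ K * ‖z‖ ^ 3 * ‖D1‖ := by
      rw [abs_mul]; gcongr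
    have t2 : |a * D2 z e| ≤ K * ‖z‖ ^ 2 * (‖D2‖ * ‖z‖) := by
      rw [abs_mul]
      have := n2 z e
      rw [hne, mul_one] at this
      gcongr
    have t3 : |a * D2 e z| ≤ K * ‖z‖ ^ 2 * (‖D2‖ * ‖z‖) := by
      rw [abs_mul]
      have := n2 e z
      rw [hne, one_mul] at this
      gcongr
    have t4 : |a * a * D2 e e| ≤ (K * ‖z‖ ^ 2) * (2 * ‖z‖) * ‖D2‖ := by
      rw [abs_mul, abs_mul]
      have := n2 e e
      rw [hne, one_mul, mul_one] at this
      gcongr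
    have u1 := abs_add_le ((a + 1 / 2 * b) * D1 e) (1 / 2 * (a * D2 z e + a * D2 e z + a * a * D2 e e))
    have u2 := abs_add_le (a * D2 z e + a * D2 e z) (a * a * D2 e e)
    have u3 := abs_add_le (a * D2 z e) (a * D2 e z)
    rw [abs_mul (1 / 2 : ℝ), abs_of_nonneg (by norm_num : (0 : ℝ) ≤ 1 / 2)] at u1
    have hF : ‖D1‖ + ‖D2‖ ≤ FD h x := by
      unfold FD
      have := norm_nonneg (fderiv ℝ (fderiv ℝ (fderiv ℝ h)) x)
      linarith
    have hz3 : 0 ≤ K * ‖z‖ ^ 3 := by positivity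
    calc _ ≤ K * ‖z‖ ^ 3 * ‖D1‖ + 2 * (K * ‖z‖ ^ 3) * ‖D2‖ := by
          have r1 : K * ‖z‖ ^ 2 * (‖D2‖ * ‖z‖) = K * ‖z‖ ^ 3 * ‖D2‖ := by ring
          have r2 : (K * ‖z‖ ^ 2) * (2 * ‖z‖) * ‖D2‖ = 2 * (K * ‖z‖ ^ 3 * ‖D2‖) := by ring
          have r3 : 2 * (K * ‖z‖ ^ 3) * ‖D2‖ = 2 * (K * ‖z‖ ^ 3 * ‖D2‖) := by ring
          rw [r1] at t2 t3
          rw [r2] at t4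
          rw [r3]
          linarith
      _ ≤ 27 * (K * ‖z‖ ^ 3) * (‖D1‖ + ‖D2‖) := by
          nlinarith [mul_nonneg hz3 (norm_nonneg D1), mul_nonneg hz3 (norm_nonneg D2)]
      _ ≤ 27 * (K * ‖z‖ ^ 3) * FD h x := by gcongr
      _ = _ := by ring
  refine (add_le_add hmain hcor).trans (le_of_eq ?_)
  ring

end

end

noncomputable section
set_option maxSynthPendingDepth 3

section
variable {n : ℕ} {γ : EV n → ℝ} {K : ℝ} {J : EV (n + 1) → ℝ} {ε β C : ℝ}

theorem pv_integral (hγ : Continuous γ) (hK : KB J ε β C) (u : EV (n + 1) → ℝ) (x : EV (n + 1)) (r : ℝ) :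
    ∫ y in halfSpace γ ∩ {y | r ≤ dist x y}, J (x - y) * (u x - u y)
      = ∫ z in Eset γ x r, J z * (u x - u (x + z)) := by
  have hm : MeasurableSet (halfSpace γ ∩ {y | r ≤ dist x y}) :=
    (isOpen_halfSpace hγ).measurableSet.inter
      (measurableSet_le measurable_const (by fun_prop))
  rw [← integral_indicator hm, ← integral_indicator (measurableSet_Eset hγ x r),
    ← integral_add_left_eq_self _ x]
  refine integral_congr_ae ?_
  filter_upwards [hK.even] with z hz
  have hiff : x + z ∈ halfSpace γ ∩ {y | r ≤ dist x y} ↔ z ∈ Eset γ x r := by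
    simp only [Set.mem_inter_iff, mem_halfSpace, Set.mem_ofPred_eq, Eset]
    have : dist x (x + z) = ‖z‖ := by simp
    rw [this]
    exact and_comm
  by_cases h : z ∈ Eset γ x r
  · rw [Set.indicator_of_mem h, Set.indicator_of_mem (hiff.2 h)]
    have : x - (x + z) = -z := by abel
    rw [this, hz]
  · rw [Set.indicator_of_notMem h, Set.indicator_of_notMem (fun h' => h (hiff.1 h'))]

/-- the Laplacian -/
def lap {d : ℕ} (h : EV d → ℝ) (x : EV d) : ℝ := ∑ i, partialDList [i, i] h x

theorem partialD_partialD {d : ℕ} {h : EV d → ℝ} (hh : ContDiff ℝ 2 h) (i j : Fin d) (x : EV d) :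
    partialD i (partialD j h) x
      = fderiv ℝ (fderiv ℝ h) x (EuclideanSpace.single i 1) (EuclideanSpace.single j 1) := by
  have h1 : ContDiff ℝ 1 (fderiv ℝ h) := hh.fderiv_right (m := 1) (by norm_num)
  have hd := (h1.differentiable (by norm_num) x).hasFDerivAt
  have := hd.clm_apply (hasFDerivAt_const (EuclideanSpace.single j (1 : ℝ)) x)
  unfold partialD
  rw [this.fderiv]
  simp

theorem bil_eq_sum {m : ℕ} (L : EV m →L[ℝ] EV m →L[ℝ] ℝ) (z : EV m) :
    L z z = ∑ i, ∑ j, L (EuclideanSpace.single i 1) (EuclideanSpace.single j 1) * (z i * z j) := by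
  conv_lhs => rw [clm_eq_sum (L z) z]
  have : ∀ i, L z (EuclideanSpace.single i 1)
      = ∑ j, L (EuclideanSpace.single j 1) (EuclideanSpace.single i 1) * z j := by
    intro i
    exact clm_eq_sum (L.flip (EuclideanSpace.single i 1)) z
  simp_rw [this, Finset.sum_mul]
  rw [Finset.sum_comm]
  refine Finset.sum_congr rfl fun i _ => Finset.sum_congr rfl fun j _ => by ring

theorem abs_coord_le {m : ℕ} (z : EV m) (i : Fin m) : |z i| ≤ ‖z‖ := by
  have := PiLp.norm_apply_le z i
  simpa using this

theorem KB.integrable_coord (hK : KB J ε β C) (i j : Fin (n + 1)) :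
    Integrable (fun z => J z * (z i * z j)) volume := by
  have hm : Measurable (fun z : EV (n + 1) => J z * (z i * z j)) := hK.meas.mul (by fun_prop)
  refine Integrable.mono' hK.integrable_sq hm.aestronglyMeasurable (ae_of_all _ fun z => ?_)
  rw [norm_mul, Real.norm_of_nonneg (hK.nonneg z), norm_mul]
  refine mul_le_mul_of_nonneg_left ?_ (hK.nonneg z)
  rw [pow_two]
  exact mul_le_mul (abs_coord_le z i) (abs_coord_le z j) (norm_nonneg _) (norm_nonneg _)

theorem KB.integrable_bil (hK : KB J ε β C) (L : EV (n + 1) →L[ℝ] EV (n + 1) →L[ℝ] ℝ) :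
    Integrable (fun z => J z * L z z) volume := by
  have : (fun z => J z * L z z) = fun z => ∑ i, ∑ j,
      L (EuclideanSpace.single i 1) (EuclideanSpace.single j 1) * (J z * (z i * z j)) := by
    funext z
    rw [bil_eq_sum, Finset.mul_sum]
    refine Finset.sum_congr rfl fun i _ => ?_
    rw [Finset.mul_sum]
    exact Finset.sum_congr rfl fun j _ => by ring
  rw [this]
  exact integrable_finsetSum _ fun i _ => integrable_finsetSum _ fun j _ =>
    (hK.integrable_coord i j).const_mul _

theorem KB.integral_bil (hK : KB J ε β C) (L : EV (n + 1) →L[ℝ] EV (n + 1) →L[ℝ] ℝ) :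
    ∫ z, J z * L z z = 2 * ∑ i, L (EuclideanSpace.single i 1) (EuclideanSpace.single i 1) := by
  have : (fun z => J z * L z z) = fun z => ∑ i, ∑ j,
      L (EuclideanSpace.single i 1) (EuclideanSpace.single j 1) * (J z * (z i * z j)) := by
    funext z
    rw [bil_eq_sum, Finset.mul_sum]
    refine Finset.sum_congr rfl fun i _ => ?_
    rw [Finset.mul_sum]
    exact Finset.sum_congr rfl fun j _ => by ring
  rw [this, integral_finsetSum _ fun i _ => integrable_finsetSum _ fun j _ =>
    (hK.integrable_coord i j).const_mul _]
  rw [Finset.mul_sum]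
  refine Finset.sum_congr rfl fun i _ => ?_
  rw [integral_finsetSum _ fun j _ => (hK.integrable_coord i j).const_mul _]
  simp_rw [integral_const_mul, hK.mom]
  simp [mul_comm]

theorem lap_eq {d : ℕ} {h : EV d → ℝ} (hh : ContDiff ℝ 2 h) (x : EV d) :
    lap h x = ∑ i, fderiv ℝ (fderiv ℝ h) x (EuclideanSpace.single i 1) (EuclideanSpace.single i 1) := by
  unfold lap
  exact Finset.sum_congr rfl fun i _ => partialD_partialD hh i i x

theorem KB.integral_tail (hK : KB J ε β C) (hC : 0 ≤ C) (hε : 0 < ε) {r : ℝ} (hr : 0 ≤ r) :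
    ∫ z in {z : EV (n + 1) | r ≤ ‖z‖}, J z * ‖z‖ ^ 2 ≤ C * wt β (r / ε) := by
  have h0 : 0 ≤ C * wt β (r / ε) := mul_nonneg hC (wt_nonneg (by positivity))
  have hm : Measurable (fun z : EV (n + 1) => J z * ‖z‖ ^ 2) := hK.meas.mul (by fun_prop)
  rw [integral_eq_lintegral_of_nonneg_ae
    (ae_of_all _ fun z => mul_nonneg (hK.nonneg z) (by positivity)) hm.aestronglyMeasurable]
  exact ENNReal.toReal_le_of_le_ofReal h0 (hK.tail r hr)

theorem KB.small_ball (hK : KB J ε β C) :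
    Tendsto (fun r : ℝ => ∫ z in {z : EV (n + 1) | ‖z‖ < r}, J z * ‖z‖ ^ 2) (𝓝[>] 0) (𝓝 0) := by
  have key : Tendsto (fun r : ℝ => ∫ z, {z : EV (n + 1) | ‖z‖ < r}.indicator (fun z => J z * ‖z‖ ^ 2) z)
      (𝓝[>] 0) (𝓝 (∫ z : EV (n + 1), (0 : ℝ))) := by
    have hm : Measurable (fun z : EV (n + 1) => J z * ‖z‖ ^ 2) := hK.meas.mul (by fun_prop)
    have hms : ∀ r : ℝ, MeasurableSet {z : EV (n + 1) | ‖z‖ < r} := fun r =>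
      measurableSet_lt measurable_norm measurable_const
    refine tendsto_integral_filter_of_dominated_convergence (fun z => J z * ‖z‖ ^ 2) ?_ ?_
      hK.integrable_sq ?_
    · exact Eventually.of_forall fun r => (hm.indicator (hms r)).aestronglyMeasurable
    · refine Eventually.of_forall fun r => ae_of_all _ fun z => ?_
      have h0 : 0 ≤ J z * ‖z‖ ^ 2 := mul_nonneg (hK.nonneg z) (by positivity)
      by_cases h : z ∈ {z : EV (n + 1) | ‖z‖ < r}
      · rw [Set.indicator_of_mem h, Real.norm_of_nonneg h0]
      · rw [Set.indicator_of_notMem h, norm_zero]; exact h0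
    · refine ae_of_all _ fun z => ?_
      by_cases hz : z = 0
      · subst hz
        refine tendsto_const_nhds.congr fun r => ?_
        simp [Set.indicator]
      · have hp : 0 < ‖z‖ := norm_pos_iff.2 hz
        refine tendsto_const_nhds.congr' ?_
        filter_upwards [Ioo_mem_nhdsGT hp] with r hr
        rw [Set.indicator_of_notMem]
        simp only [Set.mem_ofPred_eq, not_lt]
        exact hr.2.le
  have hms : ∀ r : ℝ, MeasurableSet {z : EV (n + 1) | ‖z‖ < r} := fun r =>
      measurableSet_lt measurable_norm measurable_const
  simp only [integral_zero] at key
  refine key.congr fun r => ?_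
  rw [integral_indicator (hms r)]

end

end

noncomputable section
set_option maxSynthPendingDepth 3

section
variable {n : ℕ} {γ : EV n → ℝ} {K : ℝ} {J : EV (n + 1) → ℝ} {ε β C : ℝ}

/-- The gradient as a vector. -/
def gradV {d : ℕ} (h : EV d → ℝ) (x : EV d) : EV d := WithLp.toLp 2 (fun i => partialD i h x)

theorem gradV_inner {d : ℕ} (h : EV d → ℝ) (x z : EV d) : inner ℝ (gradV h x) z = fderiv ℝ h x z := by
  rw [clm_eq_sum, inner_sumE]; rfl

theorem norm_gradV_le {d : ℕ} (h : EV d → ℝ) (x : EV d) : ‖gradV h x‖ ≤ ‖fderiv ℝ h x‖ := by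
  have h1 : ‖gradV h x‖ ^ 2 = fderiv ℝ h x (gradV h x) := by
    rw [← gradV_inner, real_inner_self_eq_norm_sq]
  have h2 := (le_abs_self _).trans (abs_clm_le (fderiv ℝ h x) (gradV h x))
  rw [← h1, pow_two] at h2
  rcases eq_or_lt_of_le (norm_nonneg (gradV h x)) with h0 | h0
  · rw [← h0]; positivity
  · exact le_of_mul_le_mul_right h2 h0

theorem bdd_of_compact {d : ℕ} {h : EV d → ℝ} (hc : Continuous h) (hs : HasCompactSupport h) :
    ∃ B : ℝ, 0 ≤ B ∧ ∀ x, |h x| ≤ B := by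
  obtain ⟨B, hB⟩ := hs.exists_bound_of_continuous hc
  exact ⟨B, (norm_nonneg _).trans (hB 0), hB⟩

theorem KB.integrableOn_bdd (hK : KB J ε β C) (hγ : Continuous γ) {r : ℝ} (hr : 0 < r) (x : EV (n + 1))
    {f : EV (n + 1) → ℝ} (hf : Continuous f) {B : ℝ} (hB : ∀ z, |f z| ≤ B) :
    IntegrableOn (fun z => J z * f z) (Eset γ x r) volume := by
  have h1 : IntegrableOn J (Eset γ x r) volume :=
    (hK.integrableOn_zero hr).mono_set fun z hz => hz.1
  have hm : Measurable (fun z => J z * f z) := hK.meas.mul hf.measurable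
  refine Integrable.mono' (h1.mul_const B) hm.aestronglyMeasurable (ae_of_all _ fun z => ?_)
  rw [norm_mul, Real.norm_of_nonneg (hK.nonneg z)]
  exact mul_le_mul_of_nonneg_left (hB z) (hK.nonneg z)

theorem pointwise_r (hG : GB γ K) (hK : KB J ε β C) (hε : 0 < ε) (hβ : 0 < β) (hC : 0 ≤ C)
    {h w : EV (n + 1) → ℝ} (hh : ContDiff ℝ 3 h) (hhc : HasCompactSupport h) (hw : Continuous w)
    (hwc : HasCompactSupport w) {κ : ℝ} (hκ : 0 < κ) (x : EV (n + 1)) (hx : κ < tf γ x)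
    (hw0 : ∀ y, κ / 2 ≤ tf γ y → w y = 0) {r : ℝ} (hr : 0 < r) (hrκ : r ≤ κ / 4) :
    ENNReal.ofReal |(∫ z in Eset γ x r, J z * ((h x - w x) - (h (x + z) - w (x + z)))) + lap h x|
      ≤ ENNReal.ofReal (C * wt β (tf γ x / 2 / ε) * (2 / tf γ x * |inner ℝ (gradV h x) (nuV γ x)|
            + K * ‖fderiv ℝ h x‖ + ‖fderiv ℝ (fderiv ℝ h) x‖))
        + (∫⁻ z, ∫⁻ τ in Set.Icc (0 : ℝ) 1, ENNReal.ofReal (27 * K * (J z * ‖z‖ ^ 3))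
            * (halfSpace γ).indicator (fun y => ENNReal.ofReal (FD h y)) (cpath γ z τ x))
        + ENNReal.ofReal (27 * K * C * ε * FD h x)
        + (∫⁻ z in {z : EV (n + 1) | κ / 4 ≤ ‖z‖}, ENNReal.ofReal (J z)
            * (halfSpace γ).indicator (fun y => ENNReal.ofReal |w y|) (x + z))
        + ENNReal.ofReal (‖fderiv ℝ (fderiv ℝ h) x‖ *
            ∫ z in {z : EV (n + 1) | ‖z‖ < r}, J z * ‖z‖ ^ 2) := by
  have hx0 : 0 < tf γ x := hκ.trans hx
  have hrt : r ≤ tf γ x / 2 := by linarith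
  have hwx : w x = 0 := hw0 x (by linarith)
  have hK0 := hG.K0
  have hE := measurableSet_Eset hG.cont x r
  set E := Eset γ x r with hEdef
  set D1 := fderiv ℝ h x with hD1
  set D2 := fderiv ℝ (fderiv ℝ h) x with hD2
  set R : EV (n + 1) → ℝ := fun z => h (x + z) - h x - D1 z - 1 / 2 * D2 z z with hR
  obtain ⟨Bh, hBh0, hBh⟩ := bdd_of_compact hh.continuous hhc
  obtain ⟨Bw, hBw0, hBw⟩ := bdd_of_compact hw hwc
  have iw : IntegrableOn (fun z => J z * w (x + z)) E volume :=
    hK.integrableOn_bdd hG.cont hr x (by fun_prop) fun z => hBw _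
  have ih : IntegrableOn (fun z => J z * (h (x + z) - h x)) E volume := by
    have := hh.continuous
    refine hK.integrableOn_bdd hG.cont hr x (by fun_prop) (B := 2 * Bh) fun z => ?_
    have := abs_sub (h (x + z)) (h x)
    linarith [hBh x, hBh (x + z)]
  have i1 : IntegrableOn (fun z => J z * D1 z) E volume := by
    have := (hK.integrableOn_lin hr (gradV h x)).mono_set (s := E) fun z hz => hz.1
    refine this.congr (ae_of_all _ fun z => ?_)
    simp only [gradV_inner]; rfl
  have i2all := hK.integrable_bil D2
  have i2 : IntegrableOn (fun z => J z * D2 z z) E volume := i2all.integrableOn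
  have iR : IntegrableOn (fun z => J z * R z) E volume := by
    refine ((ih.sub i1).sub (i2.const_mul (1 / 2))).congr (ae_of_all _ fun z => ?_)
    simp only [hR, Pi.sub_apply]; ring
  have hsplit : ∫ z in E, J z * ((h x - w x) - (h (x + z) - w (x + z)))
      = (((∫ z in E, J z * w (x + z)) - ∫ z in E, J z * D1 z) - (1 / 2) * ∫ z in E, J z * D2 z z)
        - ∫ z in E, J z * R z := by
    have j1 : IntegrableOn (fun z => J z * w (x + z) - J z * D1 z) E volume := iw.sub i1
    have j2 : IntegrableOn (fun z => 1 / 2 * (J z * D2 z z)) E volume := i2.const_mul _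
    have j3 : IntegrableOn (fun z => J z * w (x + z) - J z * D1 z - 1 / 2 * (J z * D2 z z)) E volume :=
      j1.sub j2
    rw [← integral_const_mul, ← integral_sub iw i1, ← integral_sub j1 j2, ← integral_sub j3 iR]
    refine integral_congr_ae (ae_of_all _ fun z => ?_)
    simp only [hR, hwx]; ring
  have hlap : lap h x = 1 / 2 * ((∫ z in E, J z * D2 z z) + ∫ z in Eᶜ, J z * D2 z z) := by
    rw [integral_add_compl hE i2all, hK.integral_bil, lap_eq (hh.of_le (by norm_num))]
    ring
  have hid : (∫ z in E, J z * ((h x - w x) - (h (x + z) - w (x + z)))) + lap h x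
      = ((∫ z in E, J z * w (x + z)) - (∫ z in E, J z * D1 z)) + 1 / 2 * (∫ z in Eᶜ, J z * D2 z z)
        - ∫ z in E, J z * R z := by
    rw [hsplit, hlap]; ring
  have b1 : |∫ z in E, J z * D1 z| ≤ C * wt β (tf γ x / 2 / ε) * (2 / tf γ x * |inner ℝ (gradV h x) (nuV γ x)|
            + K * ‖D1‖) := by
    have := first_order hG hK hε hC x (gradV h x) hx0 hr hrt
    simp only [gradV_inner] at this ⊢
    refine this.trans ?_
    have h0 : 0 ≤ wt β (tf γ x / 2 / ε) := wt_nonneg (by positivity)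
    gcongr
    exact norm_gradV_le h x
  have b2 : |∫ z in Eᶜ, J z * D2 z z| ≤ ‖D2‖ * (C * wt β (tf γ x / 2 / ε)
      + ∫ z in {z : EV (n + 1) | ‖z‖ < r}, J z * ‖z‖ ^ 2) := by
    have hsub : Eᶜ ⊆ {z : EV (n + 1) | tf γ x / 2 ≤ ‖z‖} ∪ {z : EV (n + 1) | ‖z‖ < r} := by
      intro z hz
      by_contra hcon
      simp only [Set.mem_union, Set.mem_ofPred_eq, not_or, not_le, not_lt] at hcon
      refine hz ⟨hcon.2, ?_⟩
      have := tf_lip hG.diff hG.d1 x z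
      have := (abs_le.1 this).1
      linarith [hcon.1]
    have hms : MeasurableSet {z : EV (n + 1) | ‖z‖ < r} := measurableSet_lt measurable_norm measurable_const
    have isq := hK.integrable_sq
    calc |∫ z in Eᶜ, J z * D2 z z| ≤ ∫ z in Eᶜ, ‖D2‖ * (J z * ‖z‖ ^ 2) := by
          refine (Real.norm_eq_abs _).symm ▸ norm_integral_le_of_norm_le (isq.const_mul _).integrableOn ?_
          refine ae_of_all _ fun z => ?_
          rw [norm_mul, Real.norm_of_nonneg (hK.nonneg z)]
          have : |D2 z z| ≤ ‖D2‖ * ‖z‖ ^ 2 := by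
            calc |D2 z z| ≤ ‖D2 z‖ * ‖z‖ := abs_clm_le _ _
              _ ≤ (‖D2‖ * ‖z‖) * ‖z‖ := by gcongr; exact ContinuousLinearMap.le_opNorm _ _
              _ = _ := by ring
          calc J z * ‖D2 z z‖ ≤ J z * (‖D2‖ * ‖z‖ ^ 2) := mul_le_mul_of_nonneg_left this (hK.nonneg z)
            _ = _ := by ring
      _ = ‖D2‖ * ∫ z in Eᶜ, J z * ‖z‖ ^ 2 := integral_const_mul _ _
      _ ≤ ‖D2‖ * ((∫ z in {z : EV (n + 1) | tf γ x / 2 ≤ ‖z‖}, J z * ‖z‖ ^ 2)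
          + ∫ z in {z : EV (n + 1) | ‖z‖ < r}, J z * ‖z‖ ^ 2) := by
          gcongr
          have hdis : Disjoint {z : EV (n + 1) | tf γ x / 2 ≤ ‖z‖} {z : EV (n + 1) | ‖z‖ < r} := by
            rw [Set.disjoint_left]
            intro z hz hz'
            simp only [Set.mem_ofPred_eq] at hz hz'
            linarith
          rw [← setIntegral_union hdis hms isq.integrableOn isq.integrableOn]
          exact setIntegral_mono_set isq.integrableOn
            (ae_of_all _ fun z => mul_nonneg (hK.nonneg z) (by positivity)) (LE.le.eventuallyLE hsub)
      _ ≤ _ := by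
          gcongr
          exact hK.integral_tail hC hε (by positivity)
  have b3 : ENNReal.ofReal |∫ z in E, J z * w (x + z)| ≤
      ∫⁻ z in {z : EV (n + 1) | κ / 4 ≤ ‖z‖}, ENNReal.ofReal (J z)
            * (halfSpace γ).indicator (fun y => ENNReal.ofReal |w y|) (x + z) := by
    rw [← Real.norm_eq_abs, ofReal_norm]
    refine (enorm_integral_le_lintegral_enorm _).trans ?_
    rw [← lintegral_indicator hE, ← lintegral_indicator (measurableSet_normge _)]
    refine lintegral_mono fun z => ?_
    by_cases hz : z ∈ E
    · rw [Set.indicator_of_mem hz]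
      by_cases hwz : w (x + z) = 0
      · simp [hwz]
      · have hz4 : z ∈ {z : EV (n + 1) | κ / 4 ≤ ‖z‖} := by
          simp only [Set.mem_ofPred_eq]
          by_contra hcon
          refine hwz (hw0 _ ?_)
          have := tf_lip hG.diff hG.d1 x z
          have := (abs_le.1 this).1
          linarith [not_le.1 hcon]
        rw [Set.indicator_of_mem hz4, Set.indicator_of_mem ((mem_halfSpace γ _).2 hz.2),
          ← ofReal_norm, norm_mul, Real.norm_of_nonneg (hK.nonneg z),
          ENNReal.ofReal_mul (hK.nonneg z), Real.norm_eq_abs]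
    · rw [Set.indicator_of_notMem hz]; exact zero_le
  have b4 : ENNReal.ofReal |∫ z in E, J z * R z| ≤
      (∫⁻ z, ∫⁻ τ in Set.Icc (0 : ℝ) 1, ENNReal.ofReal (27 * K * (J z * ‖z‖ ^ 3))
            * (halfSpace γ).indicator (fun y => ENNReal.ofReal (FD h y)) (cpath γ z τ x))
        + ENNReal.ofReal (27 * K * C * ε * FD h x) := by
    rw [← Real.norm_eq_abs, ofReal_norm]
    refine (enorm_integral_le_lintegral_enorm _).trans ?_
    have hFDc := FD_continuous hh
    have hFx := FD_nonneg h x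
    have hpt : ∀ z, E.indicator (fun z => ‖J z * R z‖ₑ) z ≤
        (∫⁻ τ in Set.Icc (0 : ℝ) 1, ENNReal.ofReal (27 * K * (J z * ‖z‖ ^ 3))
            * (halfSpace γ).indicator (fun y => ENNReal.ofReal (FD h y)) (cpath γ z τ x))
        + ENNReal.ofReal (27 * K * FD h x) * ENNReal.ofReal (J z * ‖z‖ ^ 3) := by
      intro z
      by_cases hz : z ∈ E
      · rw [Set.indicator_of_mem hz]
        have hT := taylor_path hG hh x z
        have hJ := hK.nonneg z
        have hcc : Continuous (fun τ => FD h (cpath γ z τ x)) :=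
          hFDc.comp ((cpath_continuous hG.cont).comp (by fun_prop : Continuous fun τ : ℝ => (x, z, τ)))
        have e1 : ∫⁻ τ in Set.Icc (0 : ℝ) 1, ENNReal.ofReal (27 * K * (J z * ‖z‖ ^ 3))
            * (halfSpace γ).indicator (fun y => ENNReal.ofReal (FD h y)) (cpath γ z τ x)
            = ENNReal.ofReal (27 * K * (J z * ‖z‖ ^ 3)) *
              ENNReal.ofReal (∫ τ in (0 : ℝ)..1, FD h (cpath γ z τ x)) := by
          rw [lintegral_const_mul' _ _ ENNReal.ofReal_ne_top]
          congr 1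
          rw [intervalIntegral.integral_of_le zero_le_one, ← integral_Icc_eq_integral_Ioc,
            ofReal_integral_eq_lintegral_ofReal]
          · refine setLIntegral_congr_fun measurableSet_Icc fun τ hτ => ?_
            rw [Set.indicator_of_mem ((mem_halfSpace γ _).2 (tf_cpath_pos hx0 hz.2 hτ))]
          · exact hcc.continuousOn.integrableOn_Icc
          · exact ae_of_all _ fun τ => FD_nonneg h _
        have hI0 : 0 ≤ ∫ τ in (0 : ℝ)..1, FD h (cpath γ z τ x) :=
          intervalIntegral.integral_nonneg zero_le_one fun τ _ => FD_nonneg h _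
        rw [e1, ← ENNReal.ofReal_mul (by positivity), ← ENNReal.ofReal_mul (by positivity),
          ← ENNReal.ofReal_add (by positivity) (by positivity), ← ofReal_norm]
        refine ENNReal.ofReal_le_ofReal ?_
        rw [norm_mul, Real.norm_of_nonneg hJ, Real.norm_eq_abs]
        calc J z * |R z| ≤ J z * (27 * K * ‖z‖ ^ 3 * ((∫ τ in (0 : ℝ)..1, FD h (cpath γ z τ x)) + FD h x)) :=
              mul_le_mul_of_nonneg_left hT hJ
          _ = _ := by ring
      · rw [Set.indicator_of_notMem hz]; exact zero_le
    rw [← lintegral_indicator hE]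
    refine (lintegral_mono hpt).trans ?_
    have hm3 : Measurable (fun z : EV (n + 1) => J z * ‖z‖ ^ 3) := hK.meas.mul (by fun_prop)
    rw [lintegral_add_right _ (hm3.ennreal_ofReal.const_mul _), lintegral_const_mul _ hm3.ennreal_ofReal]
    gcongr
    refine (mul_le_mul_right hK.third _).trans (le_of_eq ?_)
    rw [← ENNReal.ofReal_mul (by positivity)]
    congr 1; ring
  rw [hid]
  have habs : ∀ a b c d : ℝ, |a - b + 1 / 2 * c - d| ≤ (|b| + |c|) + |d| + |a| := by
    intro a b c d
    have h1 := abs_sub (a - b + 1 / 2 * c) d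
    have h2 := abs_add_le (a - b) (1 / 2 * c)
    have h3 := abs_sub a b
    rw [abs_mul (1 / 2 : ℝ), abs_of_nonneg (by norm_num : (0 : ℝ) ≤ 1 / 2)] at h2
    have := abs_nonneg c
    linarith
  refine (ENNReal.ofReal_le_ofReal (habs _ _ _ _)).trans ?_
  rw [ENNReal.ofReal_add (by positivity) (by positivity), ENNReal.ofReal_add (by positivity) (by positivity)]
  have ho : 0 ≤ ∫ z in {z : EV (n + 1) | ‖z‖ < r}, J z * ‖z‖ ^ 2 :=
    integral_nonneg fun z => mul_nonneg (hK.nonneg z) (by positivity)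
  have b12 : ENNReal.ofReal (|∫ z in E, J z * D1 z| + |∫ z in Eᶜ, J z * D2 z z|) ≤
      ENNReal.ofReal (C * wt β (tf γ x / 2 / ε) * (2 / tf γ x * |inner ℝ (gradV h x) (nuV γ x)|
            + K * ‖D1‖ + ‖D2‖)) + ENNReal.ofReal (‖D2‖ *
            ∫ z in {z : EV (n + 1) | ‖z‖ < r}, J z * ‖z‖ ^ 2) := by
    have h0 : 0 ≤ wt β (tf γ x / 2 / ε) := wt_nonneg (by positivity)
    rw [← ENNReal.ofReal_add (by positivity) (by positivity)]
    refine ENNReal.ofReal_le_ofReal ((add_le_add b1 b2).trans (le_of_eq ?_))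
    ring
  refine (add_le_add (add_le_add b12 b4) b3).trans (le_of_eq ?_)
  ring

theorem pointwise_est (hG : GB γ K) (hK : KB J ε β C) (hε : 0 < ε) (hβ : 0 < β) (hC : 0 ≤ C)
    {h w : EV (n + 1) → ℝ} (hh : ContDiff ℝ 3 h) (hhc : HasCompactSupport h) (hw : Continuous w)
    (hwc : HasCompactSupport w) {κ : ℝ} (hκ : 0 < κ) (x : EV (n + 1)) (hx : κ < tf γ x)
    (hw0 : ∀ y, κ / 2 ≤ tf γ y → w y = 0) {l : ℝ}
    (hl : Tendsto (fun r : ℝ => ∫ y in halfSpace γ ∩ {y | r ≤ dist x y},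
      J (x - y) * ((h x - w x) - (h y - w y))) (𝓝[>] 0) (𝓝 l)) :
    ENNReal.ofReal |l + lap h x|
      ≤ ENNReal.ofReal (C * wt β (tf γ x / 2 / ε) * (2 / tf γ x * |inner ℝ (gradV h x) (nuV γ x)|
            + K * ‖fderiv ℝ h x‖ + ‖fderiv ℝ (fderiv ℝ h) x‖))
        + (∫⁻ z, ∫⁻ τ in Set.Icc (0 : ℝ) 1, ENNReal.ofReal (27 * K * (J z * ‖z‖ ^ 3))
            * (halfSpace γ).indicator (fun y => ENNReal.ofReal (FD h y)) (cpath γ z τ x))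
        + ENNReal.ofReal (27 * K * C * ε * FD h x)
        + (∫⁻ z in {z : EV (n + 1) | κ / 4 ≤ ‖z‖}, ENNReal.ofReal (J z)
            * (halfSpace γ).indicator (fun y => ENNReal.ofReal |w y|) (x + z)) := by
  set B := ENNReal.ofReal (C * wt β (tf γ x / 2 / ε) * (2 / tf γ x * |inner ℝ (gradV h x) (nuV γ x)|
            + K * ‖fderiv ℝ h x‖ + ‖fderiv ℝ (fderiv ℝ h) x‖))
        + (∫⁻ z, ∫⁻ τ in Set.Icc (0 : ℝ) 1, ENNReal.ofReal (27 * K * (J z * ‖z‖ ^ 3))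
            * (halfSpace γ).indicator (fun y => ENNReal.ofReal (FD h y)) (cpath γ z τ x))
        + ENNReal.ofReal (27 * K * C * ε * FD h x)
        + (∫⁻ z in {z : EV (n + 1) | κ / 4 ≤ ‖z‖}, ENNReal.ofReal (J z)
            * (halfSpace γ).indicator (fun y => ENNReal.ofReal |w y|) (x + z)) with hB
  have t1 : Tendsto (fun r : ℝ => ENNReal.ofReal
      |(∫ z in Eset γ x r, J z * ((h x - w x) - (h (x + z) - w (x + z)))) + lap h x|) (𝓝[>] 0)
      (𝓝 (ENNReal.ofReal |l + lap h x|)) := by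
    refine (ENNReal.continuous_ofReal.tendsto _).comp ?_
    refine Tendsto.abs (Tendsto.add_const _ ?_)
    refine hl.congr fun r => ?_
    exact pv_integral hG.cont hK (fun y => h y - w y) x r
  have t2 : Tendsto (fun r : ℝ => B + ENNReal.ofReal (‖fderiv ℝ (fderiv ℝ h) x‖ *
            ∫ z in {z : EV (n + 1) | ‖z‖ < r}, J z * ‖z‖ ^ 2)) (𝓝[>] 0)
      (𝓝 (B + ENNReal.ofReal (‖fderiv ℝ (fderiv ℝ h) x‖ * 0))) := by
    refine Tendsto.const_add _ ?_
    exact (ENNReal.continuous_ofReal.tendsto _).comp (hK.small_ball.const_mul _)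
  rw [mul_zero, ENNReal.ofReal_zero, add_zero] at t2
  refine le_of_tendsto_of_tendsto t1 t2 ?_
  filter_upwards [Ioo_mem_nhdsGT (show (0 : ℝ) < κ / 4 by positivity)] with r hr
  exact pointwise_r hG hK hε hβ hC hh hhc hw hwc hκ x hx hw0 hr.1 hr.2.le

end

end

noncomputable section
set_option maxSynthPendingDepth 3

section
variable {d : ℕ}

/-- lists of length at most `k` -/
def LS (d k : ℕ) : Finset (List (Fin d)) := (List.finite_length_le (Fin d) k).toFinset

theorem mem_LS {k : ℕ} {l : List (Fin d)} : l ∈ LS d k ↔ l.length ≤ k := by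
  simp [LS]

theorem WNormD_eq (k : ℕ) (p : ℝ≥0∞) (μ : Measure (EV d)) (D : List (Fin d) → EV d → ℝ) :
    WNormD k p μ D = ∑ l ∈ LS d k, eLpNorm (D l) p μ := by
  unfold WNormD
  rw [tsum_eq_sum (s := LS d k)]
  · exact Finset.sum_congr rfl fun l hl => if_pos (mem_LS.1 hl)
  · intro l hl
    exact if_neg (fun h => hl (mem_LS.2 h))

theorem partialDList_eq_iter {f : EV d → ℝ} (l : List (Fin d)) (hf : ContDiff ℝ l.length f) (x : EV d) :
    partialDList l f x
      = iteratedFDeriv ℝ l.length f x (fun i => EuclideanSpace.single (l.get i) (1 : ℝ)) := by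
  induction l generalizing x with
  | nil => simp [partialDList]
  | cons i l ih =>
    have hf' : ContDiff ℝ l.length f := hf.of_le (by simp)
    have hfun : partialDList l f = fun y => iteratedFDeriv ℝ l.length f y
        (fun i => EuclideanSpace.single (l.get i) (1 : ℝ)) := funext fun y => ih hf' y
    have hd : DifferentiableAt ℝ (iteratedFDeriv ℝ l.length f) x :=
      (hf.differentiable_iteratedFDeriv (m := l.length) (by simp; exact_mod_cast Nat.lt_succ_self _)) x
    simp only [partialDList, partialD]
    rw [hfun, fderiv_continuousMultilinear_apply_const_apply hd]
    simp only [List.length_cons]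
    rw [iteratedFDeriv_succ_apply_left]
    rfl

theorem partialDList_cd {f : EV d → ℝ} (m : ℕ) (l : List (Fin d)) (hf : ContDiff ℝ (m + l.length : ℕ) f) :
    ContDiff ℝ m (partialDList l f) := by
  induction l generalizing m with
  | nil => simpa [partialDList] using hf
  | cons i l ih =>
    have h1 : ContDiff ℝ (m + 1 : ℕ) (partialDList l f) := by
      apply ih
      convert hf using 2
      simp; ring
    have h2 : ContDiff ℝ m (fderiv ℝ (partialDList l f)) := h1.fderiv_right (by push_cast; rfl)
    exact h2.clm_apply contDiff_const

theorem abs_partialDList_le {f : EV d → ℝ} (l : List (Fin d)) (hf : ContDiff ℝ l.length f) (x : EV d) :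
    |partialDList l f x| ≤ ‖iteratedFDeriv ℝ l.length f x‖ := by
  rw [partialDList_eq_iter l hf]
  have := (iteratedFDeriv ℝ l.length f x).le_opNorm (fun i => EuclideanSpace.single (l.get i) (1 : ℝ))
  simpa using this

theorem multi_norm_le {m : ℕ} (M : ContinuousMultilinearMap ℝ (fun _ : Fin m => EV d) ℝ) :
    ‖M‖ ≤ ∑ r : Fin m → Fin d, |M (fun i => EuclideanSpace.single (r i) (1 : ℝ))| := by
  refine ContinuousMultilinearMap.opNorm_le_bound (Finset.sum_nonneg fun _ _ => abs_nonneg _) fun v => ?_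
  have hv : M v = ∑ r : Fin m → Fin d, (∏ i, v i (r i)) * M (fun i => EuclideanSpace.single (r i) (1 : ℝ)) := by
    have h1 : v = fun i => ∑ j, v i j • EuclideanSpace.single j (1 : ℝ) := funext fun i => vec_eq_sum (v i)
    conv_lhs => rw [h1]
    rw [ContinuousMultilinearMap.map_sum]
    refine Finset.sum_congr rfl fun r _ => ?_
    rw [M.map_smul_univ (fun i => v i (r i)) (fun i => EuclideanSpace.single (r i) (1 : ℝ))]
    rfl
  rw [hv, Finset.sum_mul, Real.norm_eq_abs]
  refine (Finset.abs_sum_le_sum_abs _ _).trans (Finset.sum_le_sum fun r _ => ?_)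
  rw [abs_mul, mul_comm, Finset.abs_prod]
  gcongr with i
  exact abs_coord_le _ _

/-- sum of absolute values of all derivatives up to order `k` -/
def SD (k : ℕ) (f : EV d → ℝ) (x : EV d) : ℝ := ∑ l ∈ LS d k, |partialDList l f x|

theorem SD_nonneg (k : ℕ) (f : EV d → ℝ) (x : EV d) : 0 ≤ SD k f x :=
  Finset.sum_nonneg fun _ _ => abs_nonneg _

theorem abs_le_SD {k : ℕ} (f : EV d → ℝ) {l : List (Fin d)} (hl : l.length ≤ k) (x : EV d) :
    |partialDList l f x| ≤ SD k f x :=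
  Finset.single_le_sum (f := fun l => |partialDList l f x|) (fun _ _ => abs_nonneg _) (mem_LS.2 hl)

theorem norm_iter_le_SD {k m : ℕ} (hm : m ≤ k) {f : EV d → ℝ} (hf : ContDiff ℝ m f) (x : EV d) :
    ‖iteratedFDeriv ℝ m f x‖ ≤ SD k f x := by
  refine (multi_norm_le _).trans ?_
  have h1 : ∀ r : Fin m → Fin d, |iteratedFDeriv ℝ m f x (fun i => EuclideanSpace.single (r i) (1 : ℝ))|
      = |partialDList (List.ofFn r) f x| := by
    intro r
    rw [partialDList_eq_iter _ (by simpa using hf)]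
    congr 1
    have key : ∀ (m' : ℕ) (e : m' = m) (s : Fin m' → Fin d) (hs : ∀ i, s i = r (Fin.cast e i)),
        iteratedFDeriv ℝ m f x (fun i => EuclideanSpace.single (r i) (1 : ℝ))
          = iteratedFDeriv ℝ m' f x (fun i => EuclideanSpace.single (s i) (1 : ℝ)) := by
      intro m' e s hs
      subst e
      congr 1
      ext1 i
      rw [hs i]; rfl
    exact key _ (by simp) _ (fun i => by simp; rfl)
  simp_rw [h1]
  rw [← Finset.sum_image (s := Finset.univ) (g := fun r : Fin m → Fin d => List.ofFn r)
    (f := fun l => |partialDList l f x|) (fun a _ b _ h => List.ofFn_injective h)]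
  refine Finset.sum_le_sum_of_subset_of_nonneg ?_ fun _ _ _ => abs_nonneg _
  intro l hl
  obtain ⟨r, -, rfl⟩ := Finset.mem_image.1 hl
  exact mem_LS.2 (by simpa using hm)

theorem norm_fderiv_le_SD {k : ℕ} (hk : 1 ≤ k) {f : EV d → ℝ} (hf : ContDiff ℝ 1 f) (x : EV d) :
    ‖fderiv ℝ f x‖ ≤ SD k f x := by
  rw [← norm_iteratedFDeriv_one]
  exact norm_iter_le_SD hk hf x

theorem norm_fderiv2_le_SD {k : ℕ} (hk : 2 ≤ k) {f : EV d → ℝ} (hf : ContDiff ℝ 2 f) (x : EV d) :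
    ‖fderiv ℝ (fderiv ℝ f) x‖ ≤ SD k f x := by
  rw [← norm_iteratedFDeriv_one, norm_iteratedFDeriv_fderiv]
  exact norm_iter_le_SD hk hf x

theorem norm_fderiv3_le_SD {k : ℕ} (hk : 3 ≤ k) {f : EV d → ℝ} (hf : ContDiff ℝ 3 f) (x : EV d) :
    ‖fderiv ℝ (fderiv ℝ (fderiv ℝ f)) x‖ ≤ SD k f x := by
  rw [← norm_iteratedFDeriv_one, norm_iteratedFDeriv_fderiv, norm_iteratedFDeriv_fderiv]
  exact norm_iter_le_SD hk hf x

theorem FD_le_SD {f : EV d → ℝ} (hf : ContDiff ℝ 3 f) (x : EV d) : FD f x ≤ 3 * SD 3 f x := by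
  have h1 := norm_fderiv_le_SD (k := 3) (by norm_num) (hf.of_le (by norm_num)) x
  have h2 := norm_fderiv2_le_SD (k := 3) (by norm_num) (hf.of_le (by norm_num)) x
  have h3 := norm_fderiv3_le_SD (k := 3) le_rfl hf x
  unfold FD
  linarith

theorem partialD_hcs {f : EV d → ℝ} (i : Fin d) (hf : HasCompactSupport f) :
    HasCompactSupport (partialD i f) :=
  hf.fderiv_apply ℝ (EuclideanSpace.single i 1)

theorem partialDList_hcs {f : EV d → ℝ} (l : List (Fin d)) (hf : HasCompactSupport f) :
    HasCompactSupport (partialDList l f) := by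
  induction l with
  | nil => exact hf
  | cons i l ih => exact partialD_hcs i ih

theorem partialD_sub {f g : EV d → ℝ} (i : Fin d) (hf : Differentiable ℝ f) (hg : Differentiable ℝ g) :
    partialD i (fun x => f x - g x) = fun x => partialD i f x - partialD i g x := by
  funext x
  unfold partialD
  rw [fderiv_fun_sub (hf x) (hg x)]
  rfl

theorem partialDList_sub {f g : EV d → ℝ} (l : List (Fin d)) (hf : ContDiff ℝ l.length f)
    (hg : ContDiff ℝ l.length g) :
    partialDList l (fun x => f x - g x) = fun x => partialDList l f x - partialDList l g x := by
  induction l with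
  | nil => rfl
  | cons i l ih =>
    have e1 : ContDiff ℝ (1 + l.length : ℕ) f := by rw [add_comm]; simpa using hf
    have e2 : ContDiff ℝ (1 + l.length : ℕ) g := by rw [add_comm]; simpa using hg
    simp only [partialDList]
    rw [ih (hf.of_le (by simp)) (hg.of_le (by simp)), partialD_sub]
    · exact (partialDList_cd 1 l e1).differentiable (by norm_num)
    · exact (partialDList_cd 1 l e2).differentiable (by norm_num)

/-- integration by parts on the whole space -/
theorem ibp {f g : EV d → ℝ} (i : Fin d) (hf : ContDiff ℝ 1 f) (hg : ContDiff ℝ 1 g)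
    (hgc : HasCompactSupport g) :
    ∫ x, f x * partialD i g x = - ∫ x, partialD i f x * g x := by
  unfold partialD
  have cf : Continuous (fderiv ℝ f) := hf.continuous_fderiv (by norm_num)
  have cg : Continuous (fderiv ℝ g) := hg.continuous_fderiv (by norm_num)
  have hg' : HasCompactSupport (fun x => fderiv ℝ g x (EuclideanSpace.single i 1)) := partialD_hcs i hgc
  refine integral_mul_fderiv_eq_neg_fderiv_mul_of_integrable (v := EuclideanSpace.single i (1 : ℝ)) ?_ ?_ ?_
    (fun x _ => hf.differentiable (by norm_num) x) (fun x _ => hg.differentiable (by norm_num) x)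
  · refine Continuous.integrable_of_hasCompactSupport ?_ (hgc.mul_left)
    exact (cf.clm_apply continuous_const).mul hg.continuous
  · refine Continuous.integrable_of_hasCompactSupport ?_ (hg'.mul_left)
    exact hf.continuous.mul (cg.clm_apply continuous_const)
  · exact Continuous.integrable_of_hasCompactSupport (hf.continuous.mul hg.continuous) (hgc.mul_left)

theorem weak_of_classical {Ω : Set (EV d)} (i : Fin d) {f : EV d → ℝ} (hf : ContDiff ℝ 1 f) :
    WeakDerivOn Ω i f (partialD i f) := by
  intro φ hφ hc hs
  have h1 : Function.support (fun x => f x * partialD i φ x) ⊆ Ω := by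
    intro x hx
    refine hs ((tsupport_fderiv_subset ℝ) (subset_tsupport _ ?_))
    intro h0
    apply hx
    simp [partialD, h0]
  have h2 : Function.support (fun x => partialD i f x * φ x) ⊆ Ω := by
    intro x hx
    refine hs (subset_tsupport _ ?_)
    intro h0
    apply hx
    simp [h0]
  rw [setIntegral_eq_integral_of_forall_compl_eq_zero, setIntegral_eq_integral_of_forall_compl_eq_zero]
  · exact ibp i hf (hφ.of_le (by exact_mod_cast le_top)) hc
  · intro x hx
    by_contra h
    exact hx (h2 h)
  · intro x hx
    by_contra h
    exact hx (h1 h)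

theorem sob_of_classical {Ω : Set (EV d)} {k : ℕ} {p : ℝ≥0∞} {f : EV d → ℝ} (hf : ContDiff ℝ k f)
    (hc : HasCompactSupport f) : IsSobDerivs Ω k p f (fun l => partialDList l f) := by
  refine ⟨rfl, ?_, ?_⟩
  · intro l hl i
    exact weak_of_classical i (partialDList_cd 1 l (hf.of_le (by exact_mod_cast (by omega))))
  · intro l hl
    have := (partialDList_cd 0 l (f := f) (hf.of_le (by exact_mod_cast (by omega)))).continuous
    exact (this.memLp_of_hasCompactSupport (partialDList_hcs l hc)).restrict _

end
end

noncomputable section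
set_option maxSynthPendingDepth 3

section
variable {d : ℕ}

theorem transl_cont {p : ℝ≥0∞} (hp1 : 1 ≤ p) (hp : p ≠ ⊤) {g : EV d → ℝ} (hg : MemLp g p volume)
    {η : ℝ≥0∞} (hη : η ≠ 0) :
    ∃ δ : ℝ, 0 < δ ∧ ∀ t : EV d, ‖t‖ < δ → eLpNorm (fun x => g (t + x) - g x) p volume ≤ η := by
  haveI : Fact (1 ≤ p) := ⟨hp1⟩
  haveI : Fact (p ≠ ∞) := ⟨hp⟩
  have hc : Continuous (fun t : EV d => (DomAddAct.mk t) +ᵥ hg.toLp g) := by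
    have h1 : Continuous (fun a : (EV d)ᵈᵃᵃ => a +ᵥ hg.toLp g) := continuous_id.vadd continuous_const
    exact h1.comp (by fun_prop)
  have h0 : (DomAddAct.mk (0 : EV d)) +ᵥ hg.toLp g = hg.toLp g := by
    simp
  have ht := hc.tendsto 0
  rw [h0] at ht
  have hev := (EMetric.tendsto_nhds.1 ht) η (pos_iff_ne_zero.2 hη)
  obtain ⟨δ, hδ, hb⟩ := Metric.eventually_nhds_iff.1 hev
  refine ⟨δ, hδ, fun t htδ => ?_⟩
  have h2 := hb (show dist t 0 < δ by simpa using htδ)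
  rw [DomAddAct.mk_vadd_toLp, Lp.edist_toLp_toLp] at h2
  exact h2.le

theorem conv_approx {p : ℝ≥0∞} (hp1 : 1 ≤ p) (hp : p ≠ ⊤) {g : EV d → ℝ} (hg : MemLp g p volume)
    {η : ℝ≥0∞} (hη : η ≠ 0) :
    ∃ δ : ℝ, 0 < δ ∧ ∀ Φ : EV d → ℝ, Continuous Φ → HasCompactSupport Φ → (∀ t, 0 ≤ Φ t) →
      ∫ t, Φ t = 1 → (∀ t, Φ t ≠ 0 → ‖t‖ < δ) →
      eLpNorm (fun x => (∫ t, Φ t * g (x - t)) - g x) p volume ≤ η := by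
  obtain ⟨δ, hδ, hb⟩ := transl_cont hp1 hp hg hη
  refine ⟨δ, hδ, fun Φ hc hcs h0 h1 hs => ?_⟩
  have hq : 1 ≤ p.toReal := by
    rw [← ENNReal.toReal_one]; exact ENNReal.toReal_mono hp hp1
  set g' := hg.1.mk g with hg'
  have hm : Measurable g' := hg.1.stronglyMeasurable_mk.measurable
  have hae : g =ᵐ[volume] g' := hg.1.ae_eq_mk
  have hLp' : MemLp g' p volume := hg.ae_eq hae
  have hloc : LocallyIntegrable g' volume := hLp'.locallyIntegrable hp1
  have hi : Integrable Φ volume := hc.integrable_of_hasCompactSupport hcs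
  have hcong : ∀ x, ∫ t, Φ t * g (x - t) = ∫ t, Φ t * g' (x - t) := by
    intro x
    refine integral_congr_ae ?_
    have := (quasiMeasurePreserving_sub_left_of_right_invariant volume x).ae hae
    filter_upwards [this] with t ht
    rw [ht]
  have hintg : ∀ x, Integrable (fun t => Φ t * g' (x - t)) volume := by
    intro x
    have := (HasCompactSupport.convolutionExists_left (μ := volume) (ContinuousLinearMap.lsmul ℝ ℝ) hcs hc hloc) x
    simpa [ConvolutionExistsAt] using this
  set ν : Measure (EV d) := volume.withDensity (fun t => ENNReal.ofReal (Φ t)) with hν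
  have hνm : Measurable (fun t => ENNReal.ofReal (Φ t)) := hc.measurable.ennreal_ofReal
  have hν1 : ν Set.univ = 1 := by
    rw [hν, withDensity_apply _ MeasurableSet.univ, Measure.restrict_univ,
      ← ofReal_integral_eq_lintegral_ofReal hi (ae_of_all _ h0), h1, ENNReal.ofReal_one]
  haveI : IsFiniteMeasure ν := ⟨by rw [hν1]; exact ENNReal.one_lt_top⟩
  rw [eLpNorm_eq_LN hp1 hp]
  have step : LN p.toReal volume (fun x => ‖(∫ t, Φ t * g (x - t)) - g x‖ₑ)
      ≤ LN p.toReal volume (fun x => ∫⁻ t, ‖g' (x - t) - g' x‖ₑ ∂ν) := by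
    refine LN_mono_ae hq ?_
    filter_upwards [hae] with x hx
    rw [hcong x, hx]
    have e1 : (∫ t, Φ t * g' (x - t)) - g' x = ∫ t, Φ t * (g' (x - t) - g' x) := by
      have j2 : Integrable (fun t => Φ t * g' x) volume := hi.mul_const _
      simp_rw [mul_sub]
      rw [integral_sub (hintg x) j2, integral_mul_const, h1, one_mul]
    rw [e1, hν, lintegral_withDensity_eq_lintegral_mul _ hνm (by fun_prop)]
    refine (enorm_integral_le_lintegral_enorm _).trans (lintegral_mono fun t => ?_)
    simp only [Pi.mul_apply, enorm_mul]
    gcongr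
    rw [Real.enorm_of_nonneg (h0 t)]
  refine step.trans ?_
  have hmeas : Measurable (Function.uncurry (fun x t : EV d => ‖g' (x - t) - g' x‖ₑ)) := by
    unfold Function.uncurry
    fun_prop
  refine (LN_minkowski hq (ν := ν) hmeas (A := η) ?_).trans (by rw [hν1, one_mul])
  have hz : ∀ᵐ t ∂ν, ‖t‖ < δ := by
    rw [hν, ae_withDensity_iff hνm]
    refine ae_of_all _ fun t ht => hs t ?_
    intro h; apply ht; rw [h]; simp
  filter_upwards [hz] with t ht
  have h3 := hb (-t) (by simpa using ht)
  rw [eLpNorm_eq_LN hp1 hp] at h3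
  have h4 : LN p.toReal volume (fun x => ‖g (-t + x) - g x‖ₑ)
      = LN p.toReal volume (fun x => ‖g' (x - t) - g' x‖ₑ) := by
    unfold LN
    congr 1
    refine lintegral_congr_ae ?_
    have := (quasiMeasurePreserving_add_left (volume : Measure (EV d)) (-t)).ae hae
    filter_upwards [hae, this] with x hx hx2
    rw [hx, hx2, neg_add_eq_sub]
  rw [h4] at h3
  have h5 := ENNReal.rpow_le_rpow h3 (by linarith : 0 ≤ p.toReal)
  unfold LN at h5
  rwa [← ENNReal.rpow_mul, one_div_mul_cancel (by linarith), ENNReal.rpow_one] at h5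

end
end

noncomputable section
set_option maxSynthPendingDepth 3

section
variable {d : ℕ}

/-- convolution -/
def cv (Φ g : EV d → ℝ) (x : EV d) : ℝ := ∫ t, Φ t * g (x - t)

theorem cv_eq (Φ g : EV d → ℝ) : cv Φ g = convolution Φ g (ContinuousLinearMap.lsmul ℝ ℝ) volume := by
  funext x
  simp [cv, convolution]

theorem cv_cd {Φ g : EV d → ℝ} (hΦ : ContDiff ℝ (⊤ : ℕ∞) Φ) (hc : HasCompactSupport Φ)
    (hg : LocallyIntegrable g volume) : ContDiff ℝ (⊤ : ℕ∞) (cv Φ g) := by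
  rw [cv_eq]
  exact hc.contDiff_convolution_left _ hΦ hg

theorem cv_int {Φ g : EV d → ℝ} (hΦ : Continuous Φ) (hc : HasCompactSupport Φ)
    (hg : LocallyIntegrable g volume) (x : EV d) : Integrable (fun t => Φ t * g (x - t)) volume := by
  have := (HasCompactSupport.convolutionExists_left (μ := volume) (ContinuousLinearMap.lsmul ℝ ℝ) hc hΦ hg) x
  simpa [ConvolutionExistsAt] using this

theorem cv_partialD {Φ g : EV d → ℝ} (hΦ : ContDiff ℝ (⊤ : ℕ∞) Φ) (hc : HasCompactSupport Φ)
    (hg : LocallyIntegrable g volume) (i : Fin d) (x : EV d) :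
    partialD i (cv Φ g) x = cv (partialD i Φ) g x := by
  have h1 : ContDiff ℝ 1 Φ := hΦ.of_le (by exact_mod_cast le_top)
  have h := hc.hasFDerivAt_convolution_left (μ := volume) (ContinuousLinearMap.lsmul ℝ ℝ) h1 hg x
  unfold partialD
  rw [cv_eq, h.fderiv, cv, convolution, ContinuousLinearMap.integral_apply]
  · simp
  · have := (HasCompactSupport.convolutionExists_left (μ := volume)
      ((ContinuousLinearMap.lsmul ℝ ℝ).precompL (EV d)) (hc.fderiv ℝ)
      (h1.continuous_fderiv (by norm_num)) hg) x
    exact this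

theorem cv_weak {Ω : Set (EV d)} (hΩ : IsOpen Ω) {Φ u v : EV d → ℝ} (hΦ : ContDiff ℝ (⊤ : ℕ∞) Φ)
    (hc : HasCompactSupport Φ) (i : Fin d) (hw : WeakDerivOn Ω i u v) (x : EV d)
    (hs : ∀ t ∈ tsupport Φ, x - t ∈ Ω) :
    cv (partialD i Φ) (Ω.indicator u) x = cv Φ (Ω.indicator v) x := by
  have hΦx : ContDiff ℝ (⊤ : ℕ∞) (fun y => Φ (x - y)) := hΦ.comp (contDiff_const.sub contDiff_id)
  have hcx : HasCompactSupport (fun y => Φ (x - y)) := hc.comp_homeomorph (Homeomorph.subLeft x)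
  have hsx : tsupport (fun y => Φ (x - y)) ⊆ Ω := by
    have h1 : tsupport (fun y => Φ (x - y)) ⊆ (fun y => x - y) ⁻¹' (tsupport Φ) := by
      refine closure_minimal ?_ ((isClosed_tsupport Φ).preimage (by fun_prop))
      intro y hy
      exact subset_tsupport _ hy
    intro y hy
    have := hs _ (h1 hy)
    simpa using this
  have key := hw _ hΦx hcx hsx
  have hpd : ∀ y, partialD i (fun y => Φ (x - y)) y = - partialD i Φ (x - y) := by
    intro y
    unfold partialD
    have hd : HasFDerivAt (fun y => Φ (x - y)) _ y :=
      ((hΦ.differentiable (by simp) (x - y)).hasFDerivAt).comp y ((hasFDerivAt_id y).const_sub x)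
    rw [hd.fderiv]
    simp
  simp_rw [hpd] at key
  have e : ∀ (Ψ w : EV d → ℝ), cv Ψ (Ω.indicator w) x = ∫ y in Ω, w y * Ψ (x - y) := by
    intro Ψ w
    rw [cv, ← integral_indicator hΩ.measurableSet, ← integral_sub_left_eq_self _ volume x]
    refine integral_congr_ae (ae_of_all _ fun y => ?_)
    by_cases hy : y ∈ Ω
    · simp [hy, mul_comm]
    · simp [hy]
  rw [e, e]
  have k2 : ∫ y in Ω, u y * -partialD i Φ (x - y) = - ∫ y in Ω, u y * partialD i Φ (x - y) := by
    rw [← integral_neg]; simp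
  rw [k2] at key
  linarith

theorem cv_list {Ω : Set (EV d)} (hΩ : IsOpen Ω) {p : ℝ≥0∞} (hp1 : 1 ≤ p) {k : ℕ} {Φ u : EV d → ℝ}
    {D : List (Fin d) → EV d → ℝ} (hD : IsSobDerivs Ω k p u D) (hΦ : ContDiff ℝ (⊤ : ℕ∞) Φ)
    (hc : HasCompactSupport Φ) (hs : ∀ x ∈ Ω, ∀ t ∈ tsupport Φ, x - t ∈ Ω)
    (l : List (Fin d)) (hl : l.length ≤ k) (x : EV d) (hx : x ∈ Ω) :
    partialDList l (cv Φ (Ω.indicator u)) x = cv Φ (Ω.indicator (D l)) x := by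
  induction l generalizing x with
  | nil => rw [hD.1]; rfl
  | cons i l ih =>
    have hl' : l.length ≤ k := by simp at hl; omega
    have hloc : LocallyIntegrable (Ω.indicator (D l)) volume :=
      ((memLp_indicator_iff_restrict hΩ.measurableSet).2 (hD.2.2 l hl')).locallyIntegrable hp1
    have heq : partialDList l (cv Φ (Ω.indicator u)) =ᶠ[𝓝 x] cv Φ (Ω.indicator (D l)) := by
      filter_upwards [hΩ.mem_nhds hx] with y hy
      exact ih hl' y hy
    have : partialD i (partialDList l (cv Φ (Ω.indicator u))) x = partialD i (cv Φ (Ω.indicator (D l))) x := by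
      unfold partialD
      rw [heq.fderiv_eq]
    simp only [partialDList]
    rw [this, cv_partialD hΦ hc hloc, cv_weak hΩ hΦ hc i (hD.2.1 l (by simpa using hl) i) x (hs x hx)]

end

section
variable {n : ℕ} {γ : EV n → ℝ} {K : ℝ}

/-- smooth approximation without compact support -/
theorem smooth_approx0 (hG : GB γ K) {p : ℝ≥0∞} (hp1 : 1 ≤ p) (hp : p ≠ ⊤) {k : ℕ} {u : EV (n + 1) → ℝ}
    {D : List (Fin (n + 1)) → EV (n + 1) → ℝ} (hD : IsSobDerivs (halfSpace γ) k p u D)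
    {η : ℝ≥0∞} (hη : η ≠ 0) :
    ∃ v : EV (n + 1) → ℝ, ContDiff ℝ (⊤ : ℕ∞) v ∧ ∀ l ∈ LS (n + 1) k,
      eLpNorm (fun x => partialDList l v x - D l x) p (volume.restrict (halfSpace γ)) ≤ η := by
  set Ω := halfSpace γ with hΩd
  have hΩ : IsOpen Ω := isOpen_halfSpace hG.cont
  have hLp : ∀ l : List (Fin (n + 1)), l.length ≤ k → MemLp (Ω.indicator (D l)) p volume :=
    fun l hl => (memLp_indicator_iff_restrict hΩ.measurableSet).2 (hD.2.2 l hl)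
  have hex : ∀ l : List (Fin (n + 1)), ∃ δ : ℝ, 0 < δ ∧ (l.length ≤ k → ∀ Φ : EV (n + 1) → ℝ, Continuous Φ → HasCompactSupport Φ → (∀ t, 0 ≤ Φ t) →
      ∫ t, Φ t = 1 → (∀ t, Φ t ≠ 0 → ‖t‖ < δ) →
      eLpNorm (fun x => (∫ t, Φ t * (Ω.indicator (D l)) (x - t)) - (Ω.indicator (D l)) x) p volume ≤ η) := by
    intro l
    by_cases hl : l.length ≤ k
    · obtain ⟨δ, h1, h2⟩ := conv_approx hp1 hp (hLp l hl) hη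
      exact ⟨δ, h1, fun _ => h2⟩
    · exact ⟨1, one_pos, fun h => absurd h hl⟩
  choose δ hδ hb using hex
  obtain ⟨δ0, hδ0, hmin⟩ : ∃ δ0 : ℝ, 0 < δ0 ∧ ∀ l ∈ LS (n + 1) k, δ0 ≤ δ l := by
    have hne : (LS (n + 1) k).Nonempty := ⟨[], mem_LS.2 (by simp)⟩
    refine ⟨(LS (n + 1) k).inf' hne δ, ?_, fun l hl => Finset.inf'_le _ hl⟩
    rw [Finset.lt_inf'_iff]
    exact fun l _ => hδ l
  set s := δ0 / 2 with hs
  have hs0 : 0 < s := by positivity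
  let B : ContDiffBump (-(s • eL n)) := ⟨s / 8, s / 4, by positivity, by linarith⟩
  set Φ : EV (n + 1) → ℝ := B.normed volume with hΦ
  have hΦs : ContDiff ℝ (⊤ : ℕ∞) Φ := B.contDiff_normed
  have hΦc : HasCompactSupport Φ := B.hasCompactSupport_normed
  have hts : tsupport Φ = Metric.closedBall (-(s • eL n)) (s / 4) := B.tsupport_normed_eq
  have hnorm : ‖s • eL n‖ = s := by rw [norm_smul, norm_eL, mul_one, Real.norm_of_nonneg hs0.le]
  have hshift : ∀ x ∈ Ω, ∀ t ∈ tsupport Φ, x - t ∈ Ω := by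
    intro x hx t ht
    rw [hts, Metric.mem_closedBall, dist_eq_norm] at ht
    rw [hΩd, mem_halfSpace] at hx ⊢
    have h1 := tf_lip hG.diff hG.d1 (x + s • eL n) (-(t - -(s • eL n)))
    rw [norm_neg, tf_add_smul_eL] at h1
    have e : x + s • eL n + -(t - -(s • eL n)) = x - t := by abel
    rw [e] at h1
    have := (abs_le.1 h1).1
    linarith
  have hloc : LocallyIntegrable (Ω.indicator u) volume := by
    have := (hLp [] (by simp)).locallyIntegrable hp1
    rwa [hD.1] at this
  refine ⟨cv Φ (Ω.indicator u), cv_cd hΦs hΦc hloc, fun l hl => ?_⟩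
  have hl' := mem_LS.1 hl
  have hbl := hb l hl' Φ hΦs.continuous hΦc (fun t => B.nonneg_normed t) B.integral_normed ?_
  · refine le_trans ?_ ((eLpNorm_mono_measure _ (Measure.restrict_le_self (s := Ω))).trans hbl)
    refine le_of_eq (eLpNorm_congr_ae ?_)
    filter_upwards [ae_restrict_mem hΩ.measurableSet] with x hx
    rw [cv_list hΩ hp1 hD hΦs hΦc hshift l hl' x hx, Set.indicator_of_mem hx]
    rfl
  · intro t ht
    have h1 : t ∈ tsupport Φ := subset_tsupport _ ht
    rw [hts, Metric.mem_closedBall, dist_eq_norm] at h1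
    have h2 : ‖t‖ ≤ ‖t - -(s • eL n)‖ + ‖-(s • eL n)‖ := by
      simpa using norm_add_le (t - -(s • eL n)) (-(s • eL n))
    rw [norm_neg, hnorm] at h2
    have := hmin l hl
    linarith

end
end

noncomputable section
set_option maxSynthPendingDepth 3

section
theorem LN_tendsto_zero {X : Type*} [MeasurableSpace X] {q : ℝ} (hq : 1 ≤ q) {μ : Measure X}
    {f : X → ℝ≥0∞} (hf : AEMeasurable f μ) (hfin : LN q μ f ≠ ⊤) {A : ℕ → Set X}
    (hA : ∀ j, MeasurableSet (A j)) (hout : ∀ᵐ x ∂μ, ∀ᶠ j in atTop, x ∉ A j) :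
    Tendsto (fun j => LN q (μ.restrict (A j)) f) atTop (𝓝 0) := by
  have hq0 : 0 < q := by linarith
  have h1 : ∫⁻ x, f x ^ q ∂μ ≠ ⊤ := by
    intro h
    apply hfin
    unfold LN
    rw [h, ENNReal.top_rpow_of_pos (by positivity)]
  have h2 : Tendsto (fun j => ∫⁻ x, (A j).indicator (fun x => f x ^ q) x ∂μ) atTop (𝓝 (∫⁻ x, 0 ∂μ)) := by
    refine tendsto_lintegral_of_dominated_convergence' (fun x => f x ^ q)
      (fun j => (hf.pow_const q).indicator (hA j))
      (fun j => ae_of_all _ fun x => Set.indicator_le_self _ _ x) h1 ?_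
    filter_upwards [hout] with x hx
    refine tendsto_const_nhds.congr' ?_
    filter_upwards [hx] with j hj
    rw [Set.indicator_of_notMem hj]
  simp only [lintegral_zero] at h2
  have h3 : Tendsto (fun a : ℝ≥0∞ => a ^ (1 / q)) (𝓝 0) (𝓝 0) := by
    have := (ENNReal.continuous_rpow_const (y := 1 / q)).tendsto 0
    rwa [ENNReal.zero_rpow_of_pos (by positivity)] at this
  refine (h3.comp h2).congr fun j => ?_
  simp only [Function.comp, LN]
  rw [lintegral_indicator (hA j)]

theorem iter_bound {E : Type*} [NormedAddCommGroup E] [NormedSpace ℝ E] {f : E → ℝ}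
    (hf : ContDiff ℝ (⊤ : ℕ∞) f) (hc : HasCompactSupport f) (k : ℕ) :
    ∃ C : ℝ, 0 ≤ C ∧ ∀ i ≤ k, ∀ x, ‖iteratedFDeriv ℝ i f x‖ ≤ C := by
  have h : ∀ i : ℕ, ∃ C : ℝ, ∀ x, ‖iteratedFDeriv ℝ i f x‖ ≤ C := fun i =>
    (hc.iteratedFDeriv i).exists_bound_of_continuous (hf.continuous_iteratedFDeriv (by exact_mod_cast le_top))
  choose C hC using h
  refine ⟨∑ i ∈ Finset.range (k + 1), |C i|, Finset.sum_nonneg fun _ _ => abs_nonneg _, fun i hi x => ?_⟩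
  refine (hC i x).trans ((le_abs_self _).trans ?_)
  exact Finset.single_le_sum (f := fun i => |C i|) (fun _ _ => abs_nonneg _)
    (Finset.mem_range.2 (by omega))

variable {d : ℕ}

theorem partialDList_congr {f g : EV d → ℝ} {x : EV d} (h : f =ᶠ[𝓝 x] g) (l : List (Fin d)) :
    partialDList l f =ᶠ[𝓝 x] partialDList l g := by
  induction l with
  | nil => exact h
  | cons i l ih =>
    have := ih.fderiv (𝕜 := ℝ)
    filter_upwards [this] with y hy
    simp only [partialDList, partialD, hy]

theorem mul_bound {f g : EV d → ℝ} {k : ℕ} {N : WithTop ℕ∞} (hN : k ≤ N) (hf : ContDiff ℝ N f) (hg : ContDiff ℝ N g) {x : EV d}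
    {A B : ℝ} (hA0 : 0 ≤ A) (hA : ∀ i ≤ k, ‖iteratedFDeriv ℝ i f x‖ ≤ A)
    (hB : ∀ i ≤ k, ‖iteratedFDeriv ℝ i g x‖ ≤ B) {m : ℕ} (hm : m ≤ k) :
    ‖iteratedFDeriv ℝ m (fun y => f y * g y) x‖ ≤ 2 ^ k * (A * B) := by
  have hB0 : 0 ≤ B := (norm_nonneg _).trans (hB 0 (Nat.zero_le _))
  refine (norm_iteratedFDeriv_mul_le hf hg x (le_trans (by exact_mod_cast hm) hN)).trans ?_
  have h1 : ∑ i ∈ Finset.range (m + 1), (m.choose i : ℝ) * ‖iteratedFDeriv ℝ i f x‖ * ‖iteratedFDeriv ℝ (m - i) g x‖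
      ≤ ∑ i ∈ Finset.range (m + 1), (m.choose i : ℝ) * (A * B) := by
    refine Finset.sum_le_sum fun i hi => ?_
    have hi' := Finset.mem_range.1 hi
    rw [mul_assoc]
    have := hA i (by omega)
    have := hB (m - i) (by omega)
    gcongr
  refine h1.trans ?_
  rw [← Finset.sum_mul]
  have h2 : ∑ i ∈ Finset.range (m + 1), (m.choose i : ℝ) = 2 ^ m := by
    exact_mod_cast Nat.sum_range_choose m
  rw [h2]
  gcongr
  norm_num

theorem cutoff_bound (k : ℕ) : ∃ C : ℝ, 0 ≤ C ∧ ∀ v : EV d → ℝ, ContDiff ℝ (⊤ : ℕ∞) v → ∀ R : ℝ, 1 ≤ R →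
    ∃ h : EV d → ℝ, ContDiff ℝ (⊤ : ℕ∞) h ∧ HasCompactSupport h ∧ ∀ l ∈ LS d k, ∀ x,
      |partialDList l h x - partialDList l v x| ≤ {x : EV d | R ≤ ‖x‖}.indicator (fun x => C * SD k v x) x := by
  let B : ContDiffBump (0 : EV d) := ⟨1, 2, one_pos, one_lt_two⟩
  obtain ⟨C, hC0, hC⟩ := iter_bound (f := B) B.contDiff B.hasCompactSupport k
  refine ⟨2 ^ k * C + 1, by positivity, fun v hv R hR => ?_⟩
  have hR0 : 0 < R := by linarith
  set χ : EV d → ℝ := fun x => B (R⁻¹ • x) with hχ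
  have hχs : ContDiff ℝ (⊤ : ℕ∞) χ := B.contDiff.comp (contDiff_const_smul _)
  have hχc : HasCompactSupport χ :=
    B.hasCompactSupport.comp_homeomorph (Homeomorph.smulOfNeZero R⁻¹ (by positivity))
  have hχb : ∀ i ≤ k, ∀ x, ‖iteratedFDeriv ℝ i χ x‖ ≤ C := by
    intro i hi x
    have e : χ = B ∘ (R⁻¹ • ContinuousLinearMap.id ℝ (EV d)) := by funext x; simp [hχ]
    rw [e, ContinuousLinearMap.iteratedFDeriv_comp_right (n := (⊤ : ℕ∞)) _ B.contDiff x (by exact_mod_cast le_top)]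
    refine (ContinuousMultilinearMap.norm_compContinuousLinearMap_le _ _).trans ?_
    have h1 : ‖R⁻¹ • ContinuousLinearMap.id ℝ (EV d)‖ ≤ 1 := by
      rw [norm_smul, Real.norm_of_nonneg (by positivity)]
      have : R⁻¹ ≤ 1 := inv_le_one_of_one_le₀ hR
      calc R⁻¹ * ‖ContinuousLinearMap.id ℝ (EV d)‖ ≤ 1 * 1 := by
            gcongr
            exact ContinuousLinearMap.norm_id_le
        _ = 1 := one_mul 1
    rw [Finset.prod_const]
    calc _ ≤ C * 1 := by
          gcongr
          · exact hC i hi _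
          · exact pow_le_one₀ (norm_nonneg _) h1
      _ = C := mul_one C
  refine ⟨fun x => χ x * v x, hχs.mul hv, hχc.mul_right, fun l hl x => ?_⟩
  have hl' := mem_LS.1 hl
  by_cases hx : R ≤ ‖x‖
  · rw [Set.indicator_of_mem (by exact hx)]
    have h1 : |partialDList l (fun x => χ x * v x) x| ≤ 2 ^ k * (C * SD k v x) := by
      refine (abs_partialDList_le l ((hχs.mul hv).of_le (by exact_mod_cast le_top)) x).trans ?_
      exact mul_bound (N := (⊤ : ℕ∞)) (by exact_mod_cast le_top) hχs hv hC0 (fun i hi => hχb i hi x)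
        (fun i hi => norm_iter_le_SD hi (hv.of_le (by exact_mod_cast le_top)) x) hl'
    have h2 := abs_le_SD v hl' x
    calc _ ≤ |partialDList l (fun x => χ x * v x) x| + |partialDList l v x| := abs_sub _ _
      _ ≤ 2 ^ k * (C * SD k v x) + SD k v x := add_le_add h1 h2
      _ = _ := by ring
  · rw [Set.indicator_of_notMem (by exact hx)]
    have hev : (fun x => χ x * v x) =ᶠ[𝓝 x] v := by
      have : {y : EV d | ‖y‖ < R} ∈ 𝓝 x := (isOpen_lt continuous_norm continuous_const).mem_nhds (not_le.1 hx)
      filter_upwards [this] with y hy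
      have h1 : χ y = 1 := by
        refine B.one_of_mem_closedBall ?_
        rw [Metric.mem_closedBall, dist_zero_right, norm_smul, Real.norm_of_nonneg (by positivity)]
        change R⁻¹ * ‖y‖ ≤ 1
        rw [inv_mul_le_iff₀ hR0, mul_one]
        exact le_of_lt hy
      rw [h1, one_mul]
    rw [(partialDList_congr hev l).eq_of_nhds]
    simp

end

section
variable {n : ℕ} {γ : EV n → ℝ} {K : ℝ}

theorem SD_meas {d k : ℕ} {v : EV d → ℝ} (hv : ContDiff ℝ k v) : Continuous (SD k v) := by
  unfold SD
  refine continuous_finsetSum _ fun l hl => ?_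
  exact (partialDList_cd 0 l (hv.of_le (by have := mem_LS.1 hl; exact_mod_cast (by omega)))).continuous.abs

/-- smooth approximation -/
theorem smooth_approx (hG : GB γ K) {p : ℝ≥0∞} (hp1 : 1 ≤ p) (hp : p ≠ ⊤) {k : ℕ} {u : EV (n + 1) → ℝ}
    {D : List (Fin (n + 1)) → EV (n + 1) → ℝ} (hD : IsSobDerivs (halfSpace γ) k p u D)
    {η : ℝ≥0∞} (hη : η ≠ 0) :
    ∃ h : EV (n + 1) → ℝ, ContDiff ℝ (⊤ : ℕ∞) h ∧ HasCompactSupport h ∧ ∀ l ∈ LS (n + 1) k,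
      eLpNorm (fun x => partialDList l h x - D l x) p (volume.restrict (halfSpace γ)) ≤ η := by
  have hq : 1 ≤ p.toReal := by
    rw [← ENNReal.toReal_one]; exact ENNReal.toReal_mono hp hp1
  set μ := (volume : Measure (EV (n + 1))).restrict (halfSpace γ) with hμ
  have hη2 : η / 2 ≠ 0 := by simp [hη]
  obtain ⟨v, hv, hvb⟩ := smooth_approx0 hG hp1 hp hD (η := min (η / 2) 1) (by simp [hη])
  have hvl : ∀ l ∈ LS (n + 1) k, Continuous (partialDList l v) := fun l hl =>
    (partialDList_cd 0 l (hv.of_le (by exact_mod_cast le_top))).continuous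
  have hvLp : ∀ l ∈ LS (n + 1) k, MemLp (partialDList l v) p μ := by
    intro l hl
    have h1 := hD.2.2 l (mem_LS.1 hl)
    have h2 : MemLp (fun x => partialDList l v x - D l x) p μ := by
      refine ⟨(hvl l hl).aestronglyMeasurable.sub h1.1, ?_⟩
      exact lt_of_le_of_lt ((hvb l hl).trans (min_le_right _ _)) ENNReal.one_lt_top
    have := h2.add h1
    refine this.ae_eq (ae_of_all _ fun x => ?_)
    simp
  have hSD : MemLp (SD k v) p μ := by
    unfold SD
    exact memLp_finsetSum _ fun l hl => (hvLp l hl).abs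
  obtain ⟨C, hC0, hC⟩ := cutoff_bound (d := n + 1) k
  have hfLp : MemLp (fun x => C * SD k v x) p μ := hSD.const_mul C
  have hfin := hfLp.2.ne
  rw [eLpNorm_eq_LN hp1 hp] at hfin
  have hlim := LN_tendsto_zero hq (μ := μ) (f := fun x => ‖C * SD k v x‖ₑ) hfLp.1.enorm hfin
    (A := fun j : ℕ => {x | (j : ℝ) ≤ ‖x‖}) (fun j => measurableSet_le measurable_const (by fun_prop))
    (ae_of_all _ fun x => by
      obtain ⟨N, hN⟩ := exists_nat_gt ‖x‖
      filter_upwards [eventually_ge_atTop N] with j hj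
      have : (N : ℝ) ≤ j := by exact_mod_cast hj
      simp only [Set.mem_ofPred_eq, not_le]
      linarith)
  have hev := (hlim.eventually (gt_mem_nhds (pos_iff_ne_zero.2 hη2))).and (eventually_ge_atTop 1)
  obtain ⟨j, hj, hj1⟩ := hev.exists
  obtain ⟨h, hh, hhc, hb⟩ := hC v hv j (by exact_mod_cast hj1)
  refine ⟨h, hh, hhc, fun l hl => ?_⟩
  have hhl : Continuous (partialDList l h) :=
    (partialDList_cd 0 l (hh.of_le (by exact_mod_cast le_top))).continuous
  have e : (fun x => partialDList l h x - D l x)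
      = (fun x => partialDList l h x - partialDList l v x) + (fun x => partialDList l v x - D l x) := by
    funext x; simp
  rw [e]
  refine (eLpNorm_add_le (hhl.sub (hvl l hl)).aestronglyMeasurable
    ((hvl l hl).aestronglyMeasurable.sub (hD.2.2 l (mem_LS.1 hl)).1) hp1).trans ?_
  rw [← ENNReal.add_halves η]
  refine add_le_add ?_ ((hvb l hl).trans (min_le_left _ _))
  refine le_trans ?_ hj.le
  have hms : MeasurableSet {x : EV (n + 1) | (j : ℝ) ≤ ‖x‖} := measurableSet_le measurable_const (by fun_prop)
  rw [← eLpNorm_eq_LN hp1 hp, ← eLpNorm_indicator_eq_eLpNorm_restrict hms]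
  refine eLpNorm_mono fun x => ?_
  have := hb l hl x
  rw [Real.norm_eq_abs, Real.norm_eq_abs]
  exact this.trans (le_abs_self _)

end
end

noncomputable section
set_option maxSynthPendingDepth 3

section
variable {n : ℕ} {γ : EV n → ℝ} {K : ℝ}

theorem partialD_cd {d : ℕ} {f : EV d → ℝ} {m : ℕ} (i : Fin d) (hf : ContDiff ℝ (m + 1 : ℕ) f) :
    ContDiff ℝ m (partialD i f) :=
  (hf.fderiv_right (m := m) (by push_cast; rfl)).clm_apply contDiff_const

theorem smoothTransition_deriv_bdd : ∃ M : ℝ, 0 ≤ M ∧ ∀ s, |deriv Real.smoothTransition s| ≤ M := by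
  have hc : HasCompactSupport (deriv Real.smoothTransition) := by
    refine HasCompactSupport.intro (isCompact_Icc (a := (0 : ℝ)) (b := 1)) fun s hs => ?_
    rw [Set.mem_Icc, not_and_or, not_le, not_le] at hs
    rcases hs with hs | hs
    · have : Real.smoothTransition =ᶠ[𝓝 s] fun _ => (0 : ℝ) := by
        filter_upwards [Iio_mem_nhds hs] with y hy
        exact Real.smoothTransition.zero_of_nonpos (le_of_lt hy)
      rw [this.deriv_eq]; simp
    · have : Real.smoothTransition =ᶠ[𝓝 s] fun _ => (1 : ℝ) := by
        filter_upwards [Ioi_mem_nhds hs] with y hy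
        exact Real.smoothTransition.one_of_one_le (le_of_lt hy)
      rw [this.deriv_eq]; simp
  obtain ⟨M, hM⟩ := hc.exists_bound_of_continuous
    ((Real.smoothTransition.contDiff (n := 1)).continuous_deriv (by norm_num))
  exact ⟨M, (norm_nonneg _).trans (hM 0), fun s => hM s⟩

theorem smoothTransition_deriv_zero {s : ℝ} (hs : s < 0 ∨ 1 < s) : deriv Real.smoothTransition s = 0 := by
  rcases hs with hs | hs
  · have : Real.smoothTransition =ᶠ[𝓝 s] fun _ => (0 : ℝ) := by
      filter_upwards [Iio_mem_nhds hs] with y hy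
      exact Real.smoothTransition.zero_of_nonpos (le_of_lt hy)
    rw [this.deriv_eq]; simp
  · have : Real.smoothTransition =ᶠ[𝓝 s] fun _ => (1 : ℝ) := by
      filter_upwards [Ioi_mem_nhds hs] with y hy
      exact Real.smoothTransition.one_of_one_le (le_of_lt hy)
    rw [this.deriv_eq]; simp

theorem div_lemma (hG : GB γ K) {X : Fin (n + 1) → EV (n + 1) → ℝ} (hX : ∀ i, ContDiff ℝ 1 (X i))
    (hXc : ∀ i, HasCompactSupport (X i))
    (h0 : ∀ x, tf γ x = 0 → ∑ i, X i x * nuV γ x i = 0) :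
    ∫ x in halfSpace γ, ∑ i, partialD i (X i) x = 0 := by
  have ht3 : ContDiff ℝ 3 (tf γ) := tf_contDiff hG.cd
  have htd : Differentiable ℝ (tf γ) := ht3.differentiable (by norm_num)
  have htc : Continuous (tf γ) := ht3.continuous
  set Y : EV (n + 1) → ℝ := fun x => ∑ i, X i x * nuV γ x i with hY
  have hν : ∀ i, ContDiff ℝ 1 (fun x => nuV γ x i) := fun i =>
    partialD_cd (m := 1) i (ht3.of_le (by norm_num))
  have hYcd : ContDiff ℝ 1 Y := ContDiff.sum fun i _ => (hX i).mul (hν i)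
  have hYc : HasCompactSupport Y := by
    have : ∀ s : Finset (Fin (n + 1)), HasCompactSupport (fun x => ∑ i ∈ s, X i x * nuV γ x i) := by
      intro s
      classical
      induction s using Finset.induction_on with
      | empty => simp only [Finset.sum_empty]; exact HasCompactSupport.zero
      | insert a s ha ih =>
        simp_rw [Finset.sum_insert ha]
        exact ((hXc a).mul_right).add ih
    exact this _
  obtain ⟨Λ, hΛ⟩ := hYcd.lipschitzWith_of_hasCompactSupport hYc (by norm_num)
  have hYt : ∀ x, |Y x| ≤ Λ * |tf γ x| := by
    intro x
    have h1 := hΛ.dist_le_mul x (x + (-tf γ x) • eL n)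
    have h2 : Y (x + (-tf γ x) • eL n) = 0 := by
      apply h0
      rw [tf_add_smul_eL]; ring
    rw [h2, Real.dist_eq, sub_zero, dist_eq_norm] at h1
    have : x - (x + (-tf γ x) • eL n) = tf γ x • eL n := by module
    rwa [this, norm_smul, norm_eL, mul_one, Real.norm_eq_abs] at h1
  obtain ⟨M, hM0, hM⟩ := smoothTransition_deriv_bdd
  have hXd : ∀ i, Continuous (partialD i (X i)) := fun i => (partialD_cd (m := 0) i (hX i)).continuous
  -- cutoffs
  set ψ : ℕ → EV (n + 1) → ℝ := fun j x => Real.smoothTransition ((j + 1 : ℝ) * tf γ x - 1) with hψ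
  have hψcd : ∀ j, ContDiff ℝ 1 (ψ j) := fun j =>
    (Real.smoothTransition.contDiff (n := 1)).comp
      ((contDiff_const.mul (ht3.of_le (by norm_num))).sub contDiff_const)
  have hψd : ∀ j i x, partialD i (ψ j) x
      = deriv Real.smoothTransition ((j + 1 : ℝ) * tf γ x - 1) * ((j + 1 : ℝ) * nuV γ x i) := by
    intro j i x
    have hs : HasDerivAt Real.smoothTransition (deriv Real.smoothTransition ((j + 1 : ℝ) * tf γ x - 1))
        ((j + 1 : ℝ) * tf γ x - 1) :=
      ((Real.smoothTransition.contDiff (n := 1)).differentiable (by norm_num) _).hasDerivAt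
    have hf : HasFDerivAt (fun x => (j + 1 : ℝ) * tf γ x - 1) ((j + 1 : ℝ) • fderiv ℝ (tf γ) x) x :=
      ((htd x).hasFDerivAt.const_mul _).sub_const _
    have := hs.comp_hasFDerivAt x hf
    unfold partialD
    have e : fderiv ℝ (ψ j) x = _ := this.fderiv
    rw [e]
    rfl
  have hintg : ∀ i, Integrable (partialD i (X i)) volume := fun i =>
    (hXd i).integrable_of_hasCompactSupport (partialD_hcs i (hXc i))
  have key : ∀ j, ∫ x, ψ j x * ∑ i, partialD i (X i) x
      = - ∫ x, deriv Real.smoothTransition ((j + 1 : ℝ) * tf γ x - 1) * ((j + 1 : ℝ) * Y x) := by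
    intro j
    have c1 : ∀ i, Integrable (fun x => ψ j x * partialD i (X i) x) volume := fun i =>
      ((hψcd j).continuous.mul (hXd i)).integrable_of_hasCompactSupport ((partialD_hcs i (hXc i)).mul_left)
    have c2 : ∀ i, Integrable (fun x => partialD i (ψ j) x * X i x) volume := fun i =>
      ((partialD_cd (m := 0) i (hψcd j)).continuous.mul (hX i).continuous).integrable_of_hasCompactSupport
        ((hXc i).mul_left)
    have e1 : ∫ x, ψ j x * ∑ i, partialD i (X i) x = ∑ i, ∫ x, ψ j x * partialD i (X i) x := by
      rw [← integral_finsetSum _ fun i _ => c1 i]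
      simp_rw [Finset.mul_sum]
    have e2 : ∫ x, deriv Real.smoothTransition ((j + 1 : ℝ) * tf γ x - 1) * ((j + 1 : ℝ) * Y x)
        = ∑ i, ∫ x, partialD i (ψ j) x * X i x := by
      rw [← integral_finsetSum _ fun i _ => c2 i]
      refine integral_congr_ae (ae_of_all _ fun x => ?_)
      simp only [hY, Finset.mul_sum]
      refine Finset.sum_congr rfl fun i _ => ?_
      rw [hψd]; ring
    rw [e1, e2, ← Finset.sum_neg_distrib]
    exact Finset.sum_congr rfl fun i _ => ibp i (hψcd j) (hX i) (hXc i)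
  have hdiv : Integrable (fun x => ∑ i, partialD i (X i) x) volume := integrable_finsetSum _ fun i _ => hintg i
  have hlim : Tendsto (fun j : ℕ => (j + 1 : ℝ)) atTop atTop :=
    tendsto_atTop_add_const_right _ _ tendsto_natCast_atTop_atTop
  have L1 : Tendsto (fun j => ∫ x, ψ j x * ∑ i, partialD i (X i) x) atTop
      (𝓝 (∫ x in halfSpace γ, ∑ i, partialD i (X i) x)) := by
    rw [← integral_indicator (isOpen_halfSpace hG.cont).measurableSet]
    refine tendsto_integral_of_dominated_convergence (fun x => ‖∑ i, partialD i (X i) x‖) ?_ hdiv.norm ?_ ?_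
    · intro j
      exact (hψcd j).continuous.aestronglyMeasurable.mul hdiv.1
    · intro j
      refine ae_of_all _ fun x => ?_
      rw [norm_mul]
      refine mul_le_of_le_one_left (norm_nonneg _) ?_
      rw [Real.norm_of_nonneg (Real.smoothTransition.nonneg _)]
      exact Real.smoothTransition.le_one _
    · refine ae_of_all _ fun x => ?_
      refine tendsto_const_nhds.congr' ?_
      by_cases hx : x ∈ halfSpace γ
      · rw [mem_halfSpace] at hx
        filter_upwards [hlim.eventually_ge_atTop (2 / tf γ x)] with j hj
        rw [Set.indicator_of_mem (by rwa [mem_halfSpace])]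
        have : ψ j x = 1 := by
          apply Real.smoothTransition.one_of_one_le
          rw [div_le_iff₀ hx] at hj
          linarith
        rw [this, one_mul]
      · rw [Set.indicator_of_notMem hx]
        rw [mem_halfSpace, not_lt] at hx
        refine Eventually.of_forall fun j => ?_
        have : ψ j x = 0 := by
          apply Real.smoothTransition.zero_of_nonpos
          have : (j + 1 : ℝ) * tf γ x ≤ 0 := mul_nonpos_of_nonneg_of_nonpos (by positivity) hx
          linarith
        simp only [this, zero_mul]
  have L2 : Tendsto (fun j : ℕ => - ∫ x, deriv Real.smoothTransition ((j + 1 : ℝ) * tf γ x - 1) * ((j + 1 : ℝ) * Y x))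
      atTop (𝓝 (- ∫ x : EV (n + 1), (0 : ℝ))) := by
    refine Tendsto.neg ?_
    refine tendsto_integral_of_dominated_convergence ((tsupport Y).indicator fun _ => M * (2 * Λ)) ?_ ?_ ?_ ?_
    · intro j
      have : Continuous (deriv Real.smoothTransition) :=
        (Real.smoothTransition.contDiff (n := 1)).continuous_deriv (by norm_num)
      refine Continuous.aestronglyMeasurable ?_
      exact (this.comp (by fun_prop)).mul (continuous_const.mul hYcd.continuous)
    · rw [integrable_indicator_iff (isClosed_tsupport Y).measurableSet]
      exact integrableOn_const hYc.isCompact.measure_lt_top.ne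
    · intro j
      refine ae_of_all _ fun x => ?_
      by_cases hx : x ∈ tsupport Y
      · rw [Set.indicator_of_mem hx]
        by_cases hz : (j + 1 : ℝ) * tf γ x - 1 < 0 ∨ 1 < (j + 1 : ℝ) * tf γ x - 1
        · rw [smoothTransition_deriv_zero hz, zero_mul, norm_zero]
          positivity
        · push Not at hz
          rw [norm_mul, Real.norm_eq_abs, Real.norm_eq_abs]
          have hj : (0 : ℝ) < j + 1 := by positivity
          have ht : 0 ≤ tf γ x := by
            by_contra hneg
            have := mul_neg_of_pos_of_neg hj (not_le.1 hneg)
            linarith [hz.1]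
          have h1 := hYt x
          rw [abs_of_nonneg ht] at h1
          have h2 : |(j + 1 : ℝ) * Y x| ≤ 2 * Λ := by
            rw [abs_mul, abs_of_pos hj]
            calc (j + 1 : ℝ) * |Y x| ≤ (j + 1 : ℝ) * (Λ * tf γ x) := by gcongr
              _ = Λ * ((j + 1 : ℝ) * tf γ x) := by ring
              _ ≤ Λ * 2 := by gcongr; linarith [hz.2]
              _ = 2 * Λ := by ring
          exact mul_le_mul (hM _) h2 (abs_nonneg _) hM0
      · have : Y x = 0 := image_eq_zero_of_notMem_tsupport hx
        rw [Set.indicator_of_notMem hx, this]; simp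
    · refine ae_of_all _ fun x => ?_
      refine tendsto_const_nhds.congr' ?_
      by_cases hx : 0 < tf γ x
      · filter_upwards [hlim.eventually_ge_atTop (3 / tf γ x)] with j hj
        rw [div_le_iff₀ hx] at hj
        rw [smoothTransition_deriv_zero (Or.inr (by linarith)), zero_mul]
      · refine Eventually.of_forall fun j => ?_
        have : (j + 1 : ℝ) * tf γ x ≤ 0 := mul_nonpos_of_nonneg_of_nonpos (by positivity) (not_lt.1 hx)
        have h5 : deriv Real.smoothTransition ((j + 1 : ℝ) * tf γ x - 1) = 0 :=
          smoothTransition_deriv_zero (Or.inl (by linarith))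
        simp only [h5, zero_mul]
  have := tendsto_nhds_unique L1 (L2.congr fun j => (key j).symm)
  rw [this]; simp

end
end

noncomputable section
set_option maxSynthPendingDepth 3

section
variable {n : ℕ} {γ : EV n → ℝ} {K : ℝ}

theorem holder_b {d : ℕ} {Ω : Set (EV d)} {p : ℝ≥0∞} (hp1 : 1 ≤ p) {b : EV d → ℝ} (hb : Continuous b)
    (hbc : HasCompactSupport b) : ∃ C : ℝ≥0∞, C ≠ ⊤ ∧ ∀ f : EV d → ℝ,
      AEStronglyMeasurable f (volume.restrict Ω) →
      ∫⁻ x in Ω, ‖b x * f x‖ₑ ≤ C * eLpNorm f p (volume.restrict Ω) := by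
  haveI := ENNReal.HolderConjugate.conjExponent hp1
  haveI : (ENNReal.conjExponent p).HolderConjugate p := this.symm
  have hm : MemLp b (ENNReal.conjExponent p) volume := hb.memLp_of_hasCompactSupport hbc
  refine ⟨eLpNorm b (ENNReal.conjExponent p) (volume.restrict Ω), (hm.restrict Ω).2.ne, fun f hf => ?_⟩
  have := eLpNorm_smul_le_mul_eLpNorm (r := 1) (p := ENNReal.conjExponent p) (q := p) hf
    (hm.restrict Ω).1
  rw [eLpNorm_one_eq_lintegral_enorm] at this
  exact this

theorem integrable_b {d : ℕ} {Ω : Set (EV d)} {p : ℝ≥0∞} (hp1 : 1 ≤ p) {b f : EV d → ℝ} (hb : Continuous b)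
    (hbc : HasCompactSupport b) (hf : MemLp f p (volume.restrict Ω)) :
    IntegrableOn (fun x => b x * f x) Ω := by
  obtain ⟨C, hC, h⟩ := holder_b (Ω := Ω) hp1 hb hbc
  exact ⟨hb.aestronglyMeasurable.mul hf.1, (h f hf.1).trans_lt (ENNReal.mul_lt_top hC.lt_top hf.2)⟩

theorem tendsto_b {d : ℕ} {Ω : Set (EV d)} {p : ℝ≥0∞} (hp1 : 1 ≤ p) {b f : EV d → ℝ} {g : ℕ → EV d → ℝ}
    (hb : Continuous b) (hbc : HasCompactSupport b) (hf : MemLp f p (volume.restrict Ω))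
    (hg : ∀ j, MemLp (g j) p (volume.restrict Ω))
    (hl : Tendsto (fun j => eLpNorm (fun x => g j x - f x) p (volume.restrict Ω)) atTop (𝓝 0)) :
    Tendsto (fun j => ∫ x in Ω, b x * g j x) atTop (𝓝 (∫ x in Ω, b x * f x)) := by
  obtain ⟨C, hC, h⟩ := holder_b (Ω := Ω) hp1 hb hbc
  refine tendsto_integral_of_L1 _ (integrable_b hp1 hb hbc hf).1
    (Eventually.of_forall fun j => integrable_b hp1 hb hbc (hg j)) ?_
  have h0 : Tendsto (fun j => C * eLpNorm (fun x => g j x - f x) p (volume.restrict Ω)) atTop (𝓝 0) := by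
    have := ENNReal.Tendsto.const_mul hl (Or.inr hC)
    rwa [mul_zero] at this
  refine tendsto_of_tendsto_of_tendsto_of_le_of_le tendsto_const_nhds h0 (fun _ => zero_le) fun j => ?_
  refine le_trans (le_of_eq ?_) (h (fun x => g j x - f x) ((hg j).1.sub hf.1))
  refine lintegral_congr fun x => ?_
  rw [mul_sub]

theorem natc_le_top (k : ℕ) : (k : WithTop ℕ∞) ≤ ((⊤ : ℕ∞) : WithTop ℕ∞) := by
  exact_mod_cast le_top

theorem three_le_top : (3 : WithTop ℕ∞) ≤ ((⊤ : ℕ∞) : WithTop ℕ∞) := natc_le_top 3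

theorem nuV_add_smul (hγ : Differentiable ℝ γ) (x : EV (n + 1)) (s : ℝ) :
    nuV γ (x + s • eL n) = nuV γ x := by
  ext i
  change fderiv ℝ (tf γ) _ _ = fderiv ℝ (tf γ) _ _
  rw [fderiv_tf hγ, fderiv_tf hγ, firstCoords_add, firstCoords_smul, firstCoords_eL, smul_zero, add_zero]

theorem nuV_cd (hG : GB γ K) (i : Fin (n + 1)) : ContDiff ℝ 2 (fun x => nuV γ x i) :=
  partialD_cd (m := 2) i (tf_contDiff hG.cd)

theorem partialD_last_nuV (hG : GB γ K) (i : Fin (n + 1)) (x : EV (n + 1)) :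
    partialD (Fin.last n) (fun x => nuV γ x i) x = 0 := by
  have hd : DifferentiableAt ℝ (fun x => nuV γ x i) x := (nuV_cd hG i).differentiable (by norm_num) x
  change fderiv ℝ _ x (eL n) = 0
  rw [← hd.lineDeriv_eq_fderiv, lineDeriv]
  have : (fun s : ℝ => nuV γ (x + s • eL n) i) = fun _ => nuV γ x i := by
    funext s; rw [nuV_add_smul hG.diff]
  rw [this]; simp

theorem partialD_mul {d : ℕ} {f g : EV d → ℝ} (i : Fin d) {x : EV d} (hf : DifferentiableAt ℝ f x)
    (hg : DifferentiableAt ℝ g x) :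
    partialD i (fun y => f y * g y) x = f x * partialD i g x + partialD i f x * g x := by
  have h : HasFDerivAt (fun y => f y * g y) _ x := hf.hasFDerivAt.mul hg.hasFDerivAt
  unfold partialD
  rw [h.fderiv]
  simp [mul_comm]

theorem partialD_sum {d : ℕ} {ι : Type*} (s : Finset ι) {f : ι → EV d → ℝ} (i : Fin d) {x : EV d}
    (hf : ∀ k ∈ s, DifferentiableAt ℝ (f k) x) :
    partialD i (fun y => ∑ k ∈ s, f k y) x = ∑ k ∈ s, partialD i (f k) x := by
  unfold partialD
  rw [fderiv_fun_sum hf]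
  simp

/-- The normal derivative and its vertical derivative, of a system. -/
def GD (γ : EV n → ℝ) (D : List (Fin (n + 1)) → EV (n + 1) → ℝ) (x : EV (n + 1)) : ℝ :=
  ∑ i, nuV γ x i * D [i] x

def GDn (γ : EV n → ℝ) (D : List (Fin (n + 1)) → EV (n + 1) → ℝ) (x : EV (n + 1)) : ℝ :=
  ∑ i, nuV γ x i * D [Fin.last n, i] x

theorem GD_smooth_cd (hG : GB γ K) {h : EV (n + 1) → ℝ} (hh : ContDiff ℝ 3 h) :
    ContDiff ℝ 2 (GD γ (fun l => partialDList l h)) :=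
  ContDiff.sum fun i _ => (nuV_cd hG i).mul (partialD_cd (m := 2) i hh)

theorem partialD_last_GD (hG : GB γ K) {h : EV (n + 1) → ℝ} (hh : ContDiff ℝ 3 h) (x : EV (n + 1)) :
    partialD (Fin.last n) (GD γ (fun l => partialDList l h)) x = GDn γ (fun l => partialDList l h) x := by
  have h1 : ∀ i, DifferentiableAt ℝ (fun x => nuV γ x i) x := fun i =>
    (nuV_cd hG i).differentiable (by norm_num) x
  have h2 : ∀ i, DifferentiableAt ℝ (partialD i h) x := fun i =>
    (partialD_cd (m := 2) i hh).differentiable (by norm_num) x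
  unfold GD GDn
  refine (partialD_sum _ _ (f := fun i x => nuV γ x i * partialD i h x) fun i _ => (h1 i).mul (h2 i)).trans ?_
  refine Finset.sum_congr rfl fun i _ => ?_
  refine (partialD_mul _ (h1 i) (h2 i)).trans ?_
  rw [partialD_last_nuV hG, zero_mul, add_zero]
  rfl

theorem green_smooth (hG : GB γ K) {h φ : EV (n + 1) → ℝ} (hh : ContDiff ℝ 3 h)
    (hφ : ContDiff ℝ 3 φ) (hφc : HasCompactSupport φ) :
    ∫ x in halfSpace γ, ((∑ i, (φ x * partialDList [i, i] h x + partialD i φ x * partialDList [i] h x))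
      - (φ x * GDn γ (fun l => partialDList l h) x
        + partialD (Fin.last n) φ x * GD γ (fun l => partialDList l h) x)) = 0 := by
  have hGc := GD_smooth_cd hG hh
  set X : Fin (n + 1) → EV (n + 1) → ℝ := fun i x => φ x * partialD i h x -
    (if i = Fin.last n then φ x * GD γ (fun l => partialDList l h) x else 0) with hX
  have h1 : ∀ i, ContDiff ℝ 1 (fun x => φ x * partialD i h x) := fun i =>
    (hφ.of_le (by norm_num)).mul ((partialD_cd (m := 2) i hh).of_le (by norm_num))
  have h2 : ContDiff ℝ 1 (fun x => φ x * GD γ (fun l => partialDList l h) x) :=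
    (hφ.of_le (by norm_num)).mul (hGc.of_le (by norm_num))
  have h3 : ∀ i, ContDiff ℝ 1 (X i) := by
    intro i
    refine (h1 i).sub ?_
    split_ifs
    · exact h2
    · exact contDiff_const
  have key := div_lemma hG h3 (fun i => by
      refine HasCompactSupport.intro hφc.isCompact fun x hx => ?_
      have : φ x = 0 := image_eq_zero_of_notMem_tsupport hx
      simp [hX, this]) (fun x _ => by
      simp only [hX, sub_mul, Finset.sum_sub_distrib, ite_mul, zero_mul]
      rw [Finset.sum_ite_eq' Finset.univ (Fin.last n)]
      simp only [Finset.mem_univ, if_true, nuV_last hG.diff, mul_one]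
      unfold GD
      rw [Finset.mul_sum, sub_eq_zero]
      exact Finset.sum_congr rfl fun i _ => by simp only [partialDList]; ring)
  rw [← key]
  refine integral_congr_ae (ae_of_all _ fun x => ?_)
  have hφd : DifferentiableAt ℝ φ x := hφ.differentiable (by norm_num) x
  have hd : ∀ i, partialD i (X i) x = (φ x * partialDList [i, i] h x + partialD i φ x * partialDList [i] h x)
     - (if i = Fin.last n then (φ x * GDn γ (fun l => partialDList l h) x
        + partialD (Fin.last n) φ x * GD γ (fun l => partialDList l h) x) else 0) := by
    intro i
    have hs : partialD i (X i) x = partialD i (fun x => φ x * partialD i h x) x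
       - partialD i (fun x => if i = Fin.last n then φ x * GD γ (fun l => partialDList l h) x else 0) x := by
      unfold partialD
      rw [← _root_.sub_apply, ← fderiv_sub]
      · rfl
      · exact (h1 i).differentiable (by norm_num) x
      · split_ifs
        · exact h2.differentiable (by norm_num) x
        · exact differentiableAt_const _
    rw [hs]
    congr 1
    · rw [partialD_mul i hφd ((partialD_cd (m := 2) i hh).differentiable (by norm_num) x)]
      rfl
    · split_ifs with hi
      · rw [hi, partialD_mul _ hφd (hGc.differentiable (by norm_num) x), partialD_last_GD hG hh]
      · simp [partialD]
  simp only [hd, Finset.sum_sub_distrib]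
  rw [Finset.sum_ite_eq' Finset.univ (Fin.last n)]
  simp

theorem IsSobDerivs.mono {d : ℕ} {Ω : Set (EV d)} {k m : ℕ} (hkm : m ≤ k) {p : ℝ≥0∞} {u : EV d → ℝ}
    {D : List (Fin d) → EV d → ℝ} (h : IsSobDerivs Ω k p u D) : IsSobDerivs Ω m p u D :=
  ⟨h.1, fun l hl => h.2.1 l (hl.trans_le hkm), fun l hl => h.2.2 l (hl.trans hkm)⟩

theorem partialDList_memLp {d : ℕ} {p : ℝ≥0∞} {Ω : Set (EV d)} {h : EV d → ℝ} (hh : ContDiff ℝ (⊤ : ℕ∞) h)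
    (hc : HasCompactSupport h) (l : List (Fin d)) : MemLp (partialDList l h) p (volume.restrict Ω) :=
  ((partialDList_cd 0 l (hh.of_le (by exact_mod_cast le_top))).continuous.memLp_of_hasCompactSupport
    (partialDList_hcs l hc)).restrict Ω

theorem green_weak (hG : GB γ K) {p : ℝ≥0∞} (hp1 : 1 ≤ p) (hp : p ≠ ⊤) {u : EV (n + 1) → ℝ}
    {D : List (Fin (n + 1)) → EV (n + 1) → ℝ} (hD : IsSobDerivs (halfSpace γ) 3 p u D)
    (hN : NeumannBC (halfSpace γ) (1 : Matrix (Fin (n + 1)) (Fin (n + 1)) ℝ) p u)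
    {φ : EV (n + 1) → ℝ} (hφ : ContDiff ℝ (⊤ : ℕ∞) φ) (hφc : HasCompactSupport φ) :
    (∫ x in halfSpace γ, φ x * GDn γ D x) + ∫ x in halfSpace γ, partialD (Fin.last n) φ x * GD γ D x = 0 := by
  set Ω := halfSpace γ with hΩ
  have hφ3 : ContDiff ℝ 3 φ := hφ.of_le three_le_top
  have hφ0 := hφ3.continuous
  have hφ1 : ∀ i, Continuous (partialD i φ) := fun i => (partialD_cd (m := 2) i hφ3).continuous
  have hφdc : ∀ i, HasCompactSupport (partialD i φ) := fun i => partialD_hcs i hφc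
  have hν : ∀ i, Continuous (fun x => nuV γ x i) := fun i => (nuV_cd hG i).continuous
  -- functional
  set I : (List (Fin (n + 1)) → EV (n + 1) → ℝ) → ℝ := fun E =>
    (∑ i, ((∫ x in Ω, φ x * E [i, i] x) + ∫ x in Ω, partialD i φ x * E [i] x))
    - ((∑ i, ∫ x in Ω, (φ x * nuV γ x i) * E [Fin.last n, i] x)
      + ∑ i, ∫ x in Ω, (partialD (Fin.last n) φ x * nuV γ x i) * E [i] x) with hI
  have e1 : ∀ E : List (Fin (n + 1)) → EV (n + 1) → ℝ,
      (∀ l, l.length ≤ 2 → MemLp (E l) p (volume.restrict Ω)) →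
      (∫ x in Ω, φ x * GDn γ E x = ∑ i, ∫ x in Ω, (φ x * nuV γ x i) * E [Fin.last n, i] x) ∧
      (∫ x in Ω, partialD (Fin.last n) φ x * GD γ E x
         = ∑ i, ∫ x in Ω, (partialD (Fin.last n) φ x * nuV γ x i) * E [i] x) ∧
      IntegrableOn (fun x => φ x * GDn γ E x) Ω ∧
      IntegrableOn (fun x => partialD (Fin.last n) φ x * GD γ E x) Ω := by
    intro E hE
    have i1 : ∀ i, IntegrableOn (fun x => (φ x * nuV γ x i) * E [Fin.last n, i] x) Ω := fun i =>
      integrable_b hp1 (hφ0.mul (hν i)) hφc.mul_right (hE _ (by simp))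
    have i2 : ∀ i, IntegrableOn (fun x => (partialD (Fin.last n) φ x * nuV γ x i) * E [i] x) Ω := fun i =>
      integrable_b hp1 ((hφ1 _).mul (hν i)) (hφdc _).mul_right (hE _ (by simp))
    have f1 : (fun x => φ x * GDn γ E x) = fun x => ∑ i, (φ x * nuV γ x i) * E [Fin.last n, i] x := by
      funext x
      unfold GDn; rw [Finset.mul_sum]
      exact Finset.sum_congr rfl fun i _ => by ring
    have f2 : (fun x => partialD (Fin.last n) φ x * GD γ E x)
        = fun x => ∑ i, (partialD (Fin.last n) φ x * nuV γ x i) * E [i] x := by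
      funext x
      unfold GD; rw [Finset.mul_sum]
      exact Finset.sum_congr rfl fun i _ => by ring
    rw [f1, f2]
    exact ⟨integral_finsetSum _ fun i _ => i1 i, integral_finsetSum _ fun i _ => i2 i,
      integrable_finsetSum _ fun i _ => i1 i, integrable_finsetSum _ fun i _ => i2 i⟩
  have hI0 : ∀ h, ContDiff ℝ (⊤ : ℕ∞) h → HasCompactSupport h → I (fun l => partialDList l h) = 0 := by
    intro h hh hc
    have hE : ∀ l : List (Fin (n + 1)), l.length ≤ 2 →
      MemLp (partialDList l h) p (volume.restrict Ω) := fun l _ => partialDList_memLp hh hc l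
    obtain ⟨a1, a2, a3, a4⟩ := e1 (fun l => partialDList l h) hE
    have g := green_smooth hG (hh.of_le three_le_top) hφ3 hφc
    have b1 : ∀ i, IntegrableOn (fun x => φ x * partialDList [i, i] h x) Ω := fun i =>
      integrable_b hp1 hφ0 hφc (hE _ (by simp))
    have b2 : ∀ i, IntegrableOn (fun x => partialD i φ x * partialDList [i] h x) Ω := fun i =>
      integrable_b hp1 (hφ1 i) (hφdc i) (hE _ (by simp))
    have b3 : ∀ i, IntegrableOn (fun x => φ x * partialDList [i, i] h x + partialD i φ x * partialDList [i] h x) Ω :=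
      fun i => (b1 i).add (b2 i)
    have b4 : IntegrableOn (fun x => ∑ i, (φ x * partialDList [i, i] h x + partialD i φ x * partialDList [i] h x)) Ω :=
      integrable_finsetSum _ fun i _ => b3 i
    have b5 : IntegrableOn (fun x => φ x * GDn γ (fun l => partialDList l h) x
        + partialD (Fin.last n) φ x * GD γ (fun l => partialDList l h) x) Ω := a3.add a4
    rw [integral_sub b4 b5, integral_finsetSum _ fun i _ => b3 i, integral_add a3 a4, a1, a2] at g
    simp only [hI]
    rw [← g]
    congr 1
    exact Finset.sum_congr rfl fun i _ => (integral_add (b1 i) (b2 i)).symm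
  have happ : ∀ j : ℕ, ∃ h, ContDiff ℝ (⊤ : ℕ∞) h ∧ HasCompactSupport h ∧ ∀ l ∈ LS (n + 1) 3,
      eLpNorm (fun x => partialDList l h x - D l x) p (volume.restrict Ω) ≤ ((j : ℝ≥0∞) + 1)⁻¹ := fun j =>
    smooth_approx hG hp1 hp hD (by simp)
  choose h hh hhc happ using happ
  have hl : ∀ l : List (Fin (n + 1)), l.length ≤ 3 →
      Tendsto (fun j => eLpNorm (fun x => partialDList l (h j) x - D l x) p (volume.restrict Ω)) atTop (𝓝 0) := by
    intro l hl
    refine tendsto_of_tendsto_of_tendsto_of_le_of_le tendsto_const_nhds ?_ (fun _ => zero_le)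
      (fun j => happ j l (mem_LS.2 hl))
    have := (tendsto_add_atTop_iff_nat 1).2 ENNReal.tendsto_inv_nat_nhds_zero
    simpa using this
  have T : ∀ (b : EV (n + 1) → ℝ), Continuous b → HasCompactSupport b → ∀ l : List (Fin (n + 1)), l.length ≤ 3 →
      Tendsto (fun j => ∫ x in Ω, b x * partialDList l (h j) x) atTop (𝓝 (∫ x in Ω, b x * D l x)) := by
    intro b hb hbc l hll
    exact tendsto_b hp1 hb hbc (hD.2.2 l hll) (fun j => partialDList_memLp (hh j) (hhc j) l) (hl l hll)
  have TI : Tendsto (fun j => I (fun l => partialDList l (h j))) atTop (𝓝 (I D)) := by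
    simp only [hI]
    refine Tendsto.sub ?_ (Tendsto.add ?_ ?_)
    · exact tendsto_finsetSum _ fun i _ =>
        (T φ hφ0 hφc [i, i] (by simp)).add (T _ (hφ1 i) (hφdc i) [i] (by simp))
    · exact tendsto_finsetSum _ fun i _ =>
        T (fun x => φ x * nuV γ x i) (hφ0.mul (hν i)) hφc.mul_right [Fin.last n, i] (by simp)
    · exact tendsto_finsetSum _ fun i _ =>
        T (fun x => partialD (Fin.last n) φ x * nuV γ x i) ((hφ1 _).mul (hν i)) (hφdc _).mul_right [i] (by simp)
  have hID : I D = 0 := by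
    refine tendsto_nhds_unique TI ?_
    simp only [hI0 _ (hh _) (hhc _)]
    exact tendsto_const_nhds
  obtain ⟨a1, a2, -, -⟩ := e1 D (fun l hl => hD.2.2 l (by omega))
  have hn := hN D (hD.mono (by norm_num)) φ hφ hφc
  simp only [Matrix.one_apply, ite_mul, one_mul, zero_mul, Finset.sum_ite_eq, Finset.mem_univ, if_true] at hn
  simp only [hI, Finset.sum_add_distrib] at hID
  rw [a1, a2]
  simp only [mul_comm (φ _) (D _ _), mul_comm (partialD _ φ _) (D _ _)] at hID
  linarith

end
end

noncomputable section
set_option maxSynthPendingDepth 3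

section
variable {n : ℕ} {γ : EV n → ℝ} {K : ℝ}

theorem memLp_shift {d : ℕ} {p : ℝ≥0∞} {f : EV d → ℝ} (hf : MemLp f p volume) (v : EV d) :
    MemLp (fun x => f (x + v)) p volume ∧ eLpNorm (fun x => f (x + v)) p volume = eLpNorm f p volume := by
  have h := measurePreserving_add_right (volume : Measure (EV d)) v
  exact ⟨hf.comp_measurePreserving h, eLpNorm_comp_measurePreserving hf.1 h⟩

theorem shift_int {d : ℕ} {p : ℝ≥0∞} (hp1 : 1 ≤ p) {b f : EV d → ℝ} (hb : Continuous b)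
    (hbc : HasCompactSupport b) (hf : MemLp f p volume) (hfm : Measurable f) (a c s : ℝ) (e : EV d) :
    Integrable (fun q : EV d × ℝ => b (q.1 + (a * q.2) • e) * f (q.1 + (c * q.2) • e))
      ((volume : Measure (EV d)).prod (volume.restrict (Set.Ioc 0 s))) := by
  haveI := ENNReal.HolderConjugate.conjExponent hp1
  haveI : (ENNReal.conjExponent p).HolderConjugate p := this.symm
  have hm : MemLp b (ENNReal.conjExponent p) volume := hb.memLp_of_hasCompactSupport hbc
  have hmeas : Measurable (fun q : EV d × ℝ => b (q.1 + (a * q.2) • e) * f (q.1 + (c * q.2) • e)) := by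
    refine Measurable.mul ?_ ?_
    · exact hb.measurable.comp (by fun_prop)
    · exact hfm.comp (by fun_prop)
  have key : ∀ σ : ℝ, ∫⁻ x, ‖b (x + (a * σ) • e) * f (x + (c * σ) • e)‖ₑ
      ≤ eLpNorm b (ENNReal.conjExponent p) volume * eLpNorm f p volume := by
    intro σ
    obtain ⟨b1, b2⟩ := memLp_shift hm ((a * σ) • e)
    obtain ⟨f1, f2⟩ := memLp_shift hf ((c * σ) • e)
    have := eLpNorm_smul_le_mul_eLpNorm (r := 1) (p := ENNReal.conjExponent p) (q := p) f1.1 b1.1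
    rw [eLpNorm_one_eq_lintegral_enorm, b2, f2] at this
    exact this
  have hfin := ENNReal.mul_lt_top hm.2 hf.2
  refine (integrable_prod_iff' hmeas.aestronglyMeasurable).2 ⟨ae_of_all _ fun σ => ?_, ?_⟩
  · exact ⟨(hmeas.comp (measurable_id.prodMk measurable_const)).aestronglyMeasurable,
      (key σ).trans_lt hfin⟩
  · have : ∀ᵐ σ ∂(volume.restrict (Set.Ioc 0 s)),
        ‖∫ x, ‖b (x + (a * σ) • e) * f (x + (c * σ) • e)‖‖
        ≤ (eLpNorm b (ENNReal.conjExponent p) volume * eLpNorm f p volume).toReal := by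
      refine ae_of_all _ fun σ => ?_
      rw [Real.norm_of_nonneg (integral_nonneg fun _ => norm_nonneg _)]
      have hms : Measurable (fun x => b (x + (a * σ) • e) * f (x + (c * σ) • e)) :=
        hmeas.comp (measurable_id.prodMk measurable_const)
      rw [integral_norm_eq_lintegral_enorm hms.aestronglyMeasurable]
      exact ENNReal.toReal_mono hfin.ne (key σ)
    exact Integrable.of_bound (hmeas.norm.stronglyMeasurable.integral_prod_left').aestronglyMeasurable _ this

theorem hardy_id {p : ℝ≥0∞} (hp1 : 1 ≤ p) {f g : EV (n + 1) → ℝ} (hf : MemLp f p volume)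
    (hfm : Measurable f) (hg : MemLp g p volume) (hgm : Measurable g)
    (H : ∀ φ : EV (n + 1) → ℝ, ContDiff ℝ (⊤ : ℕ∞) φ → HasCompactSupport φ →
      (∫ x, φ x * g x) + ∫ x, partialD (Fin.last n) φ x * f x = 0) {s : ℝ} (hs : 0 < s) :
    ∀ᵐ x : EV (n + 1), f x - f (x + (-s) • eL n) = ∫ σ in Set.Ioc 0 s, g (x + (-σ) • eL n) := by
  set e := eL n with he
  set F2 : EV (n + 1) → ℝ := fun x => ∫ σ in Set.Ioc 0 s, g (x + (-σ) • e) with hF2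
  have hloc2 : LocallyIntegrable F2 volume := by
    intro x0
    refine ⟨Metric.ball x0 1, Metric.ball_mem_nhds _ one_pos, ?_⟩
    let b : ContDiffBump x0 := ⟨1, 2, one_pos, one_lt_two⟩
    have h := (shift_int hp1 (b.contDiff (n := 1)).continuous b.hasCompactSupport hg hgm 0 (-1) s e).integral_prod_left
    refine (h.integrableOn (s := Metric.ball x0 1)).congr_fun ?_ Metric.isOpen_ball.measurableSet
    intro x hx
    have hbx : b x = 1 := b.one_of_mem_closedBall (Metric.ball_subset_closedBall hx)
    simp only [zero_mul, zero_smul, add_zero, hbx, one_mul, neg_one_mul, hF2]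
  have hlocf : LocallyIntegrable f volume := hf.locallyIntegrable hp1
  have hlocfs : LocallyIntegrable (fun x => f (x + (-s) • e)) volume :=
    (memLp_shift hf ((-s) • e)).1.locallyIntegrable hp1
  have hloc : LocallyIntegrable (fun x => f x - f (x + (-s) • e) - F2 x) volume :=
    (hlocf.sub hlocfs).sub hloc2
  have key : ∀ᵐ x : EV (n + 1), f x - f (x + (-s) • e) - F2 x = 0 := by
    refine ae_eq_zero_of_integral_contDiff_smul_eq_zero hloc fun φ hφ hφc => ?_
    have hφ' : ContDiff ℝ (⊤ : ℕ∞) φ := hφ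
    have hφ3 : ContDiff ℝ 3 φ := hφ'.of_le three_le_top
    have hφ0 := hφ3.continuous
    have hφd : Differentiable ℝ φ := hφ3.differentiable (by norm_num)
    have hdφ := (partialD_cd (m := 2) (Fin.last n) hφ3).continuous
    have hdφc := partialD_hcs (Fin.last n) hφc
    -- translated Green
    have G : ∀ σ : ℝ, (∫ x, φ (x + σ • e) * g x) + ∫ x, partialD (Fin.last n) φ (x + σ • e) * f x = 0 := by
      intro σ
      have h := H (fun x => φ (x + σ • e)) (hφ'.comp (contDiff_id.add contDiff_const))
        (hφc.comp_homeomorph (Homeomorph.addRight (σ • e)))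
      have hp : partialD (Fin.last n) (fun x => φ (x + σ • e)) = fun x => partialD (Fin.last n) φ (x + σ • e) := by
        funext x
        unfold partialD
        rw [fderiv_comp_add_right]
      rwa [hp] at h
    have I1 := shift_int hp1 hφ0 hφc hg hgm 0 (-1) s e
    have I2 := shift_int hp1 hdφ hdφc hf hfm 1 0 s e
    have E1 : ∫ x, φ x * F2 x = ∫ σ in Set.Ioc 0 s, ∫ x, φ (x + σ • e) * g x := by
      have h := integral_integral_swap (f := fun x σ => φ (x + (0 * σ) • e) * g (x + (-1 * σ) • e)) I1
      simp only [zero_mul, zero_smul, add_zero, neg_one_mul] at h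
      simp only [hF2, ← integral_const_mul]
      rw [h]
      refine integral_congr_ae (ae_of_all _ fun σ => ?_)
      have := integral_add_right_eq_self (μ := (volume : Measure (EV (n + 1)))) (fun x => φ x * g (x + (-σ) • e)) (σ • e)
      simp only at this ⊢
      rw [← this]
      refine integral_congr_ae (ae_of_all _ fun x => ?_)
      simp only
      congr 2
      module
    have E2 : ∫ x, (φ (x + s • e) - φ x) * f x = ∫ σ in Set.Ioc 0 s, ∫ x, partialD (Fin.last n) φ (x + σ • e) * f x := by
      have h := integral_integral_swap (f := fun x σ => partialD (Fin.last n) φ (x + (1 * σ) • e) * f (x + (0 * σ) • e)) I2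
      simp only [zero_mul, zero_smul, add_zero, one_mul] at h
      rw [← h]
      refine integral_congr_ae (ae_of_all _ fun x => ?_)
      simp only
      rw [integral_mul_const]
      congr 1
      have hd : ∀ σ ∈ Set.uIcc 0 s, HasDerivAt (fun σ : ℝ => φ (x + σ • e)) (partialD (Fin.last n) φ (x + σ • e)) σ := by
        intro σ _
        have h1 : HasDerivAt (fun σ : ℝ => x + σ • e) e σ := by
          simpa using ((hasDerivAt_id σ).smul_const e).const_add x
        exact (hφd _).hasFDerivAt.comp_hasDerivAt σ h1
      have := intervalIntegral.integral_eq_sub_of_hasDerivAt hd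
        (Continuous.intervalIntegrable (hdφ.comp (by fun_prop)) _ _)
      rw [intervalIntegral.integral_of_le hs.le] at this
      rw [this]; simp
    have E3 : (∫ x, φ x * F2 x) + ∫ x, (φ (x + s • e) - φ x) * f x = 0 := by
      rw [E1, E2]
      have : ∀ σ, ∫ x, partialD (Fin.last n) φ (x + σ • e) * f x = - ∫ x, φ (x + σ • e) * g x :=
        fun σ => by linarith [G σ]
      simp only [this, integral_neg]
      ring
    have J1 : Integrable (fun x => φ x * f x) volume := by
      have := integrable_b (Ω := Set.univ) hp1 hφ0 hφc (f := f) (by rwa [Measure.restrict_univ])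
      rwa [integrableOn_univ] at this
    have J2 : Integrable (fun x => φ x * f (x + (-s) • e)) volume := by
      have := integrable_b (Ω := Set.univ) hp1 hφ0 hφc (f := fun x => f (x + (-s) • e))
        (by rw [Measure.restrict_univ]; exact (memLp_shift hf ((-s) • e)).1)
      rwa [integrableOn_univ] at this
    have J3 : Integrable (fun x => φ x * F2 x) volume := by
      have h := I1.integral_prod_left
      simp only [zero_mul, zero_smul, add_zero, neg_one_mul, integral_const_mul] at h
      exact h
    have J4 : Integrable (fun x => φ (x + s • e) * f x) volume := by
      have := J2.comp_add_right (s • e)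
      refine this.congr (ae_of_all _ fun x => ?_)
      simp only
      congr 2
      module
    have E4 : ∫ x, φ x * f (x + (-s) • e) = ∫ x, φ (x + s • e) * f x := by
      rw [← integral_add_right_eq_self (μ := (volume : Measure (EV (n + 1)))) (fun x => φ x * f (x + (-s) • e)) (s • e)]
      refine integral_congr_ae (ae_of_all _ fun x => ?_)
      simp only
      congr 2
      module
    have E5 : ∫ x, (φ (x + s • e) - φ x) * f x = (∫ x, φ (x + s • e) * f x) - ∫ x, φ x * f x := by
      simp only [sub_mul]
      exact integral_sub J4 J1
    have E6 : ∫ x, φ x • (f x - f (x + (-s) • e) - F2 x)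
        = (∫ x, φ x * f x) - (∫ x, φ x * f (x + (-s) • e)) - ∫ x, φ x * F2 x := by
      simp only [smul_eq_mul, mul_sub]
      rw [integral_sub (f := fun x => φ x * f x - φ x * f (x + (-s) • e)) (J1.sub J2) J3, integral_sub J1 J2]
    rw [E6, E4]
    linarith
  filter_upwards [key] with x hx
  simp only [hF2] at hx
  linarith

theorem hardy (hG : GB γ K) {p : ℝ≥0∞} (hp1 : 1 ≤ p) (hp : p ≠ ⊤) {u : EV (n + 1) → ℝ}
    {D : List (Fin (n + 1)) → EV (n + 1) → ℝ} (hD : IsSobDerivs (halfSpace γ) 3 p u D)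
    (hN : NeumannBC (halfSpace γ) (1 : Matrix (Fin (n + 1)) (Fin (n + 1)) ℝ) p u) :
    ∃ g : EV (n + 1) → ℝ, Measurable g ∧ (∀ x, x ∉ halfSpace γ → g x = 0) ∧
      g =ᵐ[volume.restrict (halfSpace γ)] GDn γ D ∧
      ∀ᵐ x ∂(volume.restrict (halfSpace γ)),
        ‖GD γ D x‖ₑ ≤ ∫⁻ σ in Set.Ioi (0 : ℝ), ‖g (x + (-σ) • eL n)‖ₑ := by
  set Ω := halfSpace γ with hΩ
  have hΩm : MeasurableSet Ω := (isOpen_halfSpace hG.cont).measurableSet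
  have hνb : ∀ i x, ‖nuV γ x i‖ ≤ 2 := fun i x => (PiLp.norm_apply_le (nuV γ x) i).trans (norm_nuV_le hG x)
  have hmul : ∀ (i : Fin (n + 1)) (f : EV (n + 1) → ℝ), MemLp f p (volume.restrict Ω) →
      MemLp (fun x => nuV γ x i * f x) p (volume.restrict Ω) := by
    intro i f hf
    refine MemLp.of_le_mul (c := 2) hf ((nuV_cd hG i).continuous.aestronglyMeasurable.mul hf.1) (ae_of_all _ fun x => ?_)
    rw [norm_mul]
    exact mul_le_mul_of_nonneg_right (hνb i x) (norm_nonneg _)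
  have m1 : MemLp (GD γ D) p (volume.restrict Ω) :=
    memLp_finsetSum _ fun i _ => hmul i _ (hD.2.2 _ (by simp))
  have m2 : MemLp (GDn γ D) p (volume.restrict Ω) :=
    memLp_finsetSum _ fun i _ => hmul i _ (hD.2.2 _ (by simp))
  set f := Ω.indicator (m1.1.mk _) with hf
  set g := Ω.indicator (m2.1.mk _) with hg
  have hfm : Measurable f := m1.1.stronglyMeasurable_mk.measurable.indicator hΩm
  have hgm : Measurable g := m2.1.stronglyMeasurable_mk.measurable.indicator hΩm
  have hfe : f =ᵐ[volume.restrict Ω] GD γ D :=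
    (indicator_ae_eq_restrict hΩm).trans m1.1.ae_eq_mk.symm
  have hge : g =ᵐ[volume.restrict Ω] GDn γ D :=
    (indicator_ae_eq_restrict hΩm).trans m2.1.ae_eq_mk.symm
  have hfL : MemLp f p volume := by
    rw [hf, memLp_indicator_iff_restrict hΩm]
    exact m1.ae_eq m1.1.ae_eq_mk
  have hgL : MemLp g p volume := by
    rw [hg, memLp_indicator_iff_restrict hΩm]
    exact m2.ae_eq m2.1.ae_eq_mk
  have hf0 : ∀ x, x ∉ Ω → f x = 0 := fun x hx => Set.indicator_of_notMem hx _
  have hg0 : ∀ x, x ∉ Ω → g x = 0 := fun x hx => Set.indicator_of_notMem hx _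
  refine ⟨g, hgm, hg0, hge, ?_⟩
  have H : ∀ φ : EV (n + 1) → ℝ, ContDiff ℝ (⊤ : ℕ∞) φ → HasCompactSupport φ →
      (∫ x, φ x * g x) + ∫ x, partialD (Fin.last n) φ x * f x = 0 := by
    intro φ hφ hφc
    rw [← green_weak hG hp1 hp hD hN hφ hφc]
    congr 1
    · rw [← setIntegral_eq_integral_of_forall_compl_eq_zero (s := Ω) fun x hx => by rw [hg0 x hx, mul_zero]]
      refine integral_congr_ae ?_
      filter_upwards [hge] with x hx
      rw [hx]
    · rw [← setIntegral_eq_integral_of_forall_compl_eq_zero (s := Ω) fun x hx => by rw [hf0 x hx, mul_zero]]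
      refine integral_congr_ae ?_
      filter_upwards [hfe] with x hx
      rw [hx]
  have hall : ∀ᵐ x : EV (n + 1), ∀ m : ℕ, f x - f (x + (-((m : ℝ) + 1)) • eL n)
      = ∫ σ in Set.Ioc 0 ((m : ℝ) + 1), g (x + (-σ) • eL n) := by
    rw [ae_all_iff]
    exact fun m => hardy_id hp1 hfL hfm hgL hgm H (by positivity)
  filter_upwards [hfe, ae_restrict_of_ae hall] with x hx hx2
  rw [← hx]
  obtain ⟨m, hm⟩ := exists_nat_ge (tf γ x)
  have h := hx2 m
  have hz : f (x + (-((m : ℝ) + 1)) • eL n) = 0 := by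
    apply hf0
    rw [hΩ, mem_halfSpace, tf_add_smul_eL]
    linarith
  rw [hz, sub_zero] at h
  rw [h]
  refine (enorm_integral_le_lintegral_enorm _).trans ?_
  exact lintegral_mono_set Set.Ioc_subset_Ioi_self

end
end

noncomputable section
set_option maxSynthPendingDepth 3

section
variable {n : ℕ} {γ : EV n → ℝ} {K : ℝ}

theorem weak_unique {d : ℕ} {Ω : Set (EV d)} (hΩ : IsOpen Ω) {p : ℝ≥0∞} (hp1 : 1 ≤ p) {i : Fin d}
    {u u' v v' : EV d → ℝ} (hu : u =ᵐ[volume.restrict Ω] u') (h : WeakDerivOn Ω i u v)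
    (h' : WeakDerivOn Ω i u' v') (hv : MemLp v p (volume.restrict Ω)) (hv' : MemLp v' p (volume.restrict Ω)) :
    v =ᵐ[volume.restrict Ω] v' := by
  have hm := hv.sub hv'
  have hl : LocallyIntegrableOn (fun x => v x - v' x) Ω volume :=
    locallyIntegrableOn_of_locallyIntegrable_restrict (hm.locallyIntegrable hp1)
  have key := hΩ.ae_eq_zero_of_integral_contDiff_smul_eq_zero hl fun φ hφ hφc hs => by
    have hφ0 := hφ.continuous
    have e1 : ∫ x in Ω, φ x • (v x - v' x) = 0 := by
      simp only [smul_eq_mul, mul_sub]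
      rw [integral_sub (integrable_b hp1 hφ0 hφc hv) (integrable_b hp1 hφ0 hφc hv')]
      have a := h φ hφ hφc hs
      have b := h' φ hφ hφc hs
      have c : ∫ x in Ω, u x * partialD i φ x = ∫ x in Ω, u' x * partialD i φ x := by
        refine integral_congr_ae ?_
        filter_upwards [hu] with x hx
        rw [hx]
      simp only [mul_comm (φ _)]
      linarith
    rw [setIntegral_eq_integral_of_forall_compl_eq_zero] at e1
    · exact e1
    · intro x hx
      have : φ x = 0 := image_eq_zero_of_notMem_tsupport fun h => hx (hs h)
      rw [this, zero_smul]
  rw [Filter.EventuallyEq, ae_restrict_iff' hΩ.measurableSet]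
  filter_upwards [key] with x hx h1
  linarith [hx h1]

theorem neumann_classical (hG : GB γ K) {p : ℝ≥0∞} (hp1 : 1 ≤ p) {v : EV (n + 1) → ℝ} (hv : ContDiff ℝ 2 v)
    (hvc : HasCompactSupport v) (h0 : ∀ x, tf γ x = 0 → ∑ i, partialD i v x * nuV γ x i = 0) :
    MemWN (halfSpace γ) (1 : Matrix (Fin (n + 1)) (Fin (n + 1)) ℝ) 2 p v := by
  have hS : IsSobDerivs (halfSpace γ) 2 p v (fun l => partialDList l v) :=
    sob_of_classical (k := 2) (by exact_mod_cast hv) hvc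
  refine ⟨⟨_, hS⟩, ?_⟩
  set Ω := halfSpace γ with hΩ
  have hΩo : IsOpen Ω := isOpen_halfSpace hG.cont
  intro D hD φ hφ hφc
  have d1 : ∀ i, D [i] =ᵐ[volume.restrict Ω] partialDList [i] v := fun i =>
    weak_unique hΩo hp1 (by rw [hD.1]; rfl) (hD.2.1 [] (by simp) i) (hS.2.1 [] (by simp) i)
      (hD.2.2 _ (by simp)) (hS.2.2 _ (by simp))
  have d2 : ∀ i j, D [i, j] =ᵐ[volume.restrict Ω] partialDList [i, j] v := fun i j =>
    weak_unique hΩo hp1 (d1 j) (hD.2.1 [j] (by simp) i) (hS.2.1 [j] (by simp) i)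
      (hD.2.2 _ (by simp)) (hS.2.2 _ (by simp))
  simp only [Matrix.one_apply, ite_mul, one_mul, zero_mul, Finset.sum_ite_eq, Finset.mem_univ, if_true]
  have hφ3 : ContDiff ℝ 3 φ := hφ.of_le three_le_top
  have hφ0 := hφ3.continuous
  have hφ1 : ∀ i, Continuous (partialD i φ) := fun i => (partialD_cd (m := 2) i hφ3).continuous
  have hφdc : ∀ i, HasCompactSupport (partialD i φ) := fun i => partialD_hcs i hφc
  have hv1 : ∀ i, ContDiff ℝ 1 (partialD i v) := fun i => partialD_cd (m := 1) i (by exact_mod_cast hv)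
  have key := div_lemma hG (X := fun i x => φ x * partialD i v x)
    (fun i => (hφ3.of_le (by norm_num)).mul (hv1 i)) (fun i => hφc.mul_right) (fun x hx => by
      simp only [mul_assoc]
      rw [← Finset.mul_sum, h0 x hx, mul_zero])
  have hd : ∀ x, ∑ i, partialD i (fun x => φ x * partialD i v x) x
      = ∑ i, (φ x * partialDList [i, i] v x + partialD i φ x * partialDList [i] v x) := by
    intro x
    refine Finset.sum_congr rfl fun i _ => ?_
    rw [partialD_mul i (hφ3.differentiable (by norm_num) x) ((hv1 i).differentiable (by norm_num) x)]
    rfl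
  simp only [hd] at key
  have b1 : ∀ i, IntegrableOn (fun x => φ x * partialDList [i, i] v x) Ω := fun i =>
    integrable_b hp1 hφ0 hφc (hS.2.2 _ (by simp))
  have b2 : ∀ i, IntegrableOn (fun x => partialD i φ x * partialDList [i] v x) Ω := fun i =>
    integrable_b hp1 (hφ1 i) (hφdc i) (hS.2.2 _ (by simp))
  have b3 : ∀ i, IntegrableOn (fun x => φ x * partialDList [i, i] v x + partialD i φ x * partialDList [i] v x) Ω :=
    fun i => (b1 i).add (b2 i)
  rw [integral_finsetSum _ fun i _ => b3 i] at key
  have b4 : ∀ i, ∫ x in Ω, (φ x * partialDList [i, i] v x + partialD i φ x * partialDList [i] v x)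
      = (∫ x in Ω, D [i, i] x * φ x) + ∫ x in Ω, D [i] x * partialD i φ x := by
    intro i
    rw [integral_add (b1 i) (b2 i)]
    congr 1
    · refine integral_congr_ae ?_
      filter_upwards [d2 i i] with x hx
      rw [hx, mul_comm]
    · refine integral_congr_ae ?_
      filter_upwards [d1 i] with x hx
      rw [hx, mul_comm]
  simp only [b4, Finset.sum_add_distrib] at key
  linarith

theorem G_small (hG : GB γ K) {p : ℝ≥0∞} (hp1 : 1 ≤ p) (hp : p ≠ ⊤) {u : EV (n + 1) → ℝ}
    {D : List (Fin (n + 1)) → EV (n + 1) → ℝ} (hD : IsSobDerivs (halfSpace γ) 3 p u D)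
    (hN : NeumannBC (halfSpace γ) (1 : Matrix (Fin (n + 1)) (Fin (n + 1)) ℝ) p u) {δ : ℝ} (hδ : 0 < δ) :
    LN p.toReal ((volume.restrict (halfSpace γ)).restrict {x | tf γ x < δ}) (fun x => ‖GD γ D x‖ₑ)
      ≤ ENNReal.ofReal δ * LN p.toReal ((volume.restrict (halfSpace γ)).restrict {x | tf γ x < δ})
          (fun x => ‖GDn γ D x‖ₑ) := by
  obtain ⟨g, hgm, hg0, hge, hh⟩ := hardy hG hp1 hp hD hN
  set Ω := halfSpace γ with hΩ
  have hΩm : MeasurableSet Ω := (isOpen_halfSpace hG.cont).measurableSet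
  have hq : 1 ≤ p.toReal := by
    rw [← ENNReal.toReal_one]
    exact (ENNReal.toReal_le_toReal ENNReal.one_ne_top hp).2 hp1
  have hq0 : 0 < p.toReal := by linarith
  have hTm : MeasurableSet {x : EV (n + 1) | tf γ x < δ} :=
    measurableSet_lt (tf_continuous hG.cont).measurable measurable_const
  set gδ : EV (n + 1) → ℝ≥0∞ := {x : EV (n + 1) | tf γ x < δ}.indicator (fun x => ‖g x‖ₑ) with hgδ
  have hgδm : Measurable gδ := hgm.enorm.indicator hTm
  set A := LN p.toReal ((volume.restrict Ω).restrict {x | tf γ x < δ}) (fun x => ‖GDn γ D x‖ₑ) with hA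
  have hAq : ∫⁻ x, gδ x ^ p.toReal = A ^ p.toReal := by
    rw [hA, LN, ← ENNReal.rpow_mul, one_div, inv_mul_cancel₀ hq0.ne', ENNReal.rpow_one]
    have e1 : ∫⁻ x in {x | tf γ x < δ}, ‖GDn γ D x‖ₑ ^ p.toReal ∂(volume.restrict Ω)
        = ∫⁻ x in {x | tf γ x < δ}, ‖g x‖ₑ ^ p.toReal ∂(volume.restrict Ω) := by
      refine lintegral_congr_ae ?_
      filter_upwards [ae_restrict_of_ae hge] with x hx
      rw [hx]
    rw [e1, ← lintegral_indicator hTm, ← lintegral_indicator hΩm]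
    refine lintegral_congr fun x => ?_
    by_cases hx : x ∈ Ω
    · rw [Set.indicator_of_mem hx]
      by_cases hx2 : x ∈ {x : EV (n + 1) | tf γ x < δ}
      · rw [hgδ, Set.indicator_of_mem hx2, Set.indicator_of_mem hx2]
      · rw [hgδ, Set.indicator_of_notMem hx2, Set.indicator_of_notMem hx2, ENNReal.zero_rpow_of_pos hq0]
    · rw [Set.indicator_of_notMem hx, hgδ]
      by_cases hx2 : x ∈ {x : EV (n + 1) | tf γ x < δ}
      · rw [Set.indicator_of_mem hx2, hg0 x hx, enorm_zero, ENNReal.zero_rpow_of_pos hq0]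
      · rw [Set.indicator_of_notMem hx2, ENNReal.zero_rpow_of_pos hq0]
  have hmink := LN_minkowski hq (μ := (volume.restrict Ω).restrict {x | tf γ x < δ})
    (ν := volume.restrict (Set.Ioo 0 δ))
    (f := fun (x : EV (n + 1)) (σ : ℝ) => gδ (x + (-σ) • eL n))
    (hgδm.comp (by fun_prop : Measurable fun q : EV (n + 1) × ℝ => q.1 + (-q.2) • eL n)) (A := A)
    (ae_of_all _ fun σ => by
      rw [← hAq]
      refine (lintegral_mono' (Measure.restrict_le_self.trans Measure.restrict_le_self) le_rfl).trans ?_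
      rw [lintegral_add_right_eq_self (fun x => gδ x ^ p.toReal)])
  rw [Measure.restrict_apply_univ, Real.volume_Ioo, sub_zero] at hmink
  refine le_trans (LN_mono_ae (by linarith) ?_) hmink
  rw [ae_restrict_iff' hTm]
  filter_upwards [hh, ae_restrict_mem hΩm] with x hx hxΩ hxδ
  refine hx.trans ?_
  rw [← lintegral_indicator measurableSet_Ioi, ← lintegral_indicator measurableSet_Ioo]
  refine lintegral_mono fun σ => ?_
  have hxδ' : tf γ x < δ := hxδ
  by_cases hσ : σ ∈ Set.Ioo 0 δ
  · rw [Set.indicator_of_mem hσ, Set.indicator_of_mem (Set.mem_Ioi.2 hσ.1), hgδ, Set.indicator_of_mem]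
    rw [Set.mem_ofPred_eq, tf_add_smul_eL]
    linarith [hσ.1]
  · rw [Set.indicator_of_notMem hσ]
    by_cases hσ2 : σ ∈ Set.Ioi (0 : ℝ)
    · rw [Set.indicator_of_mem hσ2, hg0, enorm_zero]
      rw [hΩ, mem_halfSpace, tf_add_smul_eL]
      intro h5
      exact hσ ⟨hσ2, by linarith⟩
    · rw [Set.indicator_of_notMem hσ2]

end
end

noncomputable section
set_option maxSynthPendingDepth 3

section
variable {n : ℕ} {γ : EV n → ℝ} {K : ℝ}

theorem clm_iter_le {E : Type*} [NormedAddCommGroup E] [NormedSpace ℝ E] (L : E →L[ℝ] ℝ) {i : ℕ} (hi : 1 ≤ i)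
    (x : E) : ‖iteratedFDeriv ℝ i L x‖ ≤ ‖L‖ := by
  obtain ⟨j, rfl⟩ : ∃ j, i = j + 1 := ⟨i - 1, by omega⟩
  rw [← norm_iteratedFDeriv_fderiv]
  have : fderiv ℝ L = fun _ => L := by funext y; exact L.fderiv
  rw [this]
  rcases Nat.eq_zero_or_pos j with rfl | hj
  · rw [norm_iteratedFDeriv_zero]
  · rw [iteratedFDeriv_const_of_ne hj.ne']
    simp

theorem gamma_iter (hG : GB γ K) {i : ℕ} (hi : 1 ≤ i) (hi3 : i ≤ 3) (x : EV n) :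
    ‖iteratedFDeriv ℝ i γ x‖ ≤ K := by
  interval_cases i
  · rw [norm_iteratedFDeriv_one]; exact (hG.d1 x).trans hG.K1
  · rw [← norm_iteratedFDeriv_fderiv, norm_iteratedFDeriv_one]; exact hG.d2 x
  · rw [← norm_iteratedFDeriv_fderiv, ← norm_iteratedFDeriv_fderiv, norm_iteratedFDeriv_one]; exact hG.d3 x

theorem tf_iter (hG : GB γ K) {i : ℕ} (hi : 1 ≤ i) (hi3 : i ≤ 3) (x : EV (n + 1)) :
    ‖iteratedFDeriv ℝ i (tf γ) x‖ ≤ 1 + K := by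
  set P : EV (n + 1) →L[ℝ] ℝ := EuclideanSpace.proj (𝕜 := ℝ) (Fin.last n) with hP
  have hcd : ContDiff ℝ 3 (fun y => γ (PF n y)) := hG.cd.comp (PF n).contDiff
  have e : tf γ = fun y => P y - γ (PF n y) := rfl
  have hi' : (i : WithTop ℕ∞) ≤ 3 := by exact_mod_cast hi3
  have hs : iteratedFDeriv ℝ i (fun y => P y - γ (PF n y)) x
      = iteratedFDeriv ℝ i P x - iteratedFDeriv ℝ i (fun y => γ (PF n y)) x :=
    iteratedFDeriv_sub_apply (P.contDiff.contDiffAt) ((hcd.of_le hi').contDiffAt)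
  rw [e, hs]
  refine (norm_sub_le _ _).trans (add_le_add ?_ ?_)
  · refine (clm_iter_le P hi x).trans ?_
    refine ContinuousLinearMap.opNorm_le_bound _ zero_le_one fun v => ?_
    rw [one_mul]
    exact PiLp.norm_apply_le v (Fin.last n)
  · have h1 := ContinuousLinearMap.iteratedFDeriv_comp_right (PF n) hG.cd x hi'
    have h2 : (fun y => γ (PF n y)) = γ ∘ PF n := rfl
    rw [h2, h1]
    refine (ContinuousMultilinearMap.norm_compContinuousLinearMap_le _ _).trans ?_
    have h3 : ‖PF n‖ ≤ 1 := ContinuousLinearMap.opNorm_le_bound _ zero_le_one fun v => by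
      rw [one_mul]; exact norm_firstCoords_le v
    calc _ ≤ K * 1 := by
          refine mul_le_mul (gamma_iter hG hi hi3 _) ?_ (Finset.prod_nonneg fun _ _ => norm_nonneg _) hG.K0
          exact Finset.prod_le_one (fun _ _ => norm_nonneg _) fun _ _ => h3
      _ = K := mul_one K

theorem partialD_iter_le {d : ℕ} {f : EV d → ℝ} {i : ℕ} (k : Fin d) (hf : ContDiff ℝ (i + 1 : ℕ) f) (x : EV d) :
    ‖iteratedFDeriv ℝ i (partialD k f) x‖ ≤ ‖iteratedFDeriv ℝ (i + 1) f x‖ := by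
  have h1 : ContDiff ℝ i (fderiv ℝ f) := hf.fderiv_right (m := i) (by push_cast; rfl)
  have := norm_iteratedFDeriv_clm_apply_const (c := EuclideanSpace.single k (1 : ℝ)) (x := x) (n := i)
    h1.contDiffAt le_rfl
  refine this.trans ?_
  rw [norm_iteratedFDeriv_fderiv]
  simp

/-- `ℓ ↦ 1/(1+∑ ℓ(eᵢ)²)`. -/
def qf (n : ℕ) (L : EV (n + 1) →L[ℝ] ℝ) : ℝ :=
  (1 + ∑ i : Fin n, (L (EuclideanSpace.single i.castSucc 1)) ^ 2)⁻¹

theorem qf_pos (L : EV (n + 1) →L[ℝ] ℝ) : 0 < 1 + ∑ i : Fin n, (L (EuclideanSpace.single i.castSucc 1)) ^ 2 := by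
  have : 0 ≤ ∑ i : Fin n, (L (EuclideanSpace.single i.castSucc 1)) ^ 2 := Finset.sum_nonneg fun _ _ => sq_nonneg _
  linarith

theorem qf_cd : ContDiff ℝ (⊤ : ℕ∞) (qf n) := by
  refine ContDiff.inv ?_ fun L => (qf_pos L).ne'
  refine contDiff_const.add (ContDiff.sum fun i _ => ContDiff.pow ?_ 2)
  exact contDiff_id.clm_apply contDiff_const

theorem qf_abs (L : EV (n + 1) →L[ℝ] ℝ) : |qf n L| ≤ 1 := by
  rw [qf, abs_of_pos (inv_pos.2 (qf_pos L))]
  refine inv_le_one_of_one_le₀ ?_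
  have : 0 ≤ ∑ i : Fin n, (L (EuclideanSpace.single i.castSucc 1)) ^ 2 := Finset.sum_nonneg fun _ _ => sq_nonneg _
  linarith

theorem qf_nu (hG : GB γ K) (x : EV (n + 1)) : (∑ i, nuV γ x i * nuV γ x i) * qf n (fderiv ℝ (tf γ) x) = 1 := by
  have : ∑ i, nuV γ x i * nuV γ x i
      = 1 + ∑ i : Fin n, (fderiv ℝ (tf γ) x (EuclideanSpace.single i.castSucc 1)) ^ 2 := by
    rw [Fin.sum_univ_castSucc, nuV_last hG.diff, add_comm, one_mul]
    congr 1
    refine Finset.sum_congr rfl fun i _ => ?_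
    rw [sq]; rfl
  rw [this, qf]
  exact mul_inv_cancel₀ (qf_pos _).ne'

theorem qf_iter (hG : GB γ K) : ∃ C : ℝ, 0 ≤ C ∧ ∀ i ≤ 2, ∀ x : EV (n + 1),
    ‖iteratedFDeriv ℝ i (fun x => qf n (fderiv ℝ (tf γ) x)) x‖ ≤ C := by
  haveI : ProperSpace (EV (n + 1) →L[ℝ] ℝ) := FiniteDimensional.proper ℝ _
  have h1 : ∀ i : ℕ, ∃ C : ℝ, ∀ L ∈ Metric.closedBall (0 : EV (n + 1) →L[ℝ] ℝ) (1 + K),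
      ‖iteratedFDeriv ℝ i (qf n) L‖ ≤ C := fun i =>
    (isCompact_closedBall _ _).exists_bound_of_continuousOn
      (qf_cd.continuous_iteratedFDeriv (by exact_mod_cast le_top)).continuousOn
  choose c hc using h1
  set C0 := |c 0| + |c 1| + |c 2| with hC0
  have hK1 : 1 ≤ 1 + K := by linarith [hG.K0]
  refine ⟨2 * C0 * (1 + K) ^ 2, by positivity, fun i hi x => ?_⟩
  have ht : ContDiff ℝ 3 (tf γ) := tf_contDiff hG.cd
  have hF : ContDiff ℝ 2 (fderiv ℝ (tf γ)) := ht.fderiv_right (m := 2) (by norm_num)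
  have hFx : fderiv ℝ (tf γ) x ∈ Metric.closedBall (0 : EV (n + 1) →L[ℝ] ℝ) (1 + K) := by
    rw [mem_closedBall_zero_iff, ← norm_iteratedFDeriv_one]
    exact tf_iter hG le_rfl (by norm_num) x
  have key := norm_iteratedFDeriv_comp_le (g := qf n) (f := fderiv ℝ (tf γ)) (n := i) (N := 2)
    (qf_cd.of_le (natc_le_top 2)) hF (by exact_mod_cast hi) x (C := C0) (D := 1 + K)
    (fun j hj => (hc j _ hFx).trans (by
      have : j ≤ 2 := hj.trans hi
      have := abs_nonneg (c 0); have := abs_nonneg (c 1); have := abs_nonneg (c 2)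
      interval_cases j
      · linarith [le_abs_self (c 0)]
      · linarith [le_abs_self (c 1)]
      · linarith [le_abs_self (c 2)]))
    (fun j hj1 hj => by
      rw [norm_iteratedFDeriv_fderiv]
      refine (tf_iter hG (by omega) (by omega) x).trans ?_
      exact le_self_pow₀ hK1 (by omega))
  refine key.trans ?_
  have hf : (i.factorial : ℝ) ≤ 2 := by
    interval_cases i <;> norm_num [Nat.factorial]
  have hp : (1 + K) ^ i ≤ (1 + K) ^ 2 := pow_le_pow_right₀ hK1 hi
  have : 0 ≤ C0 := by positivity
  gcongr

/-- cutoff times identity. -/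
def thb : ContDiffBump (0 : ℝ) := ⟨1 / 2, 3 / 4, by norm_num, by norm_num⟩

def th1 (s : ℝ) : ℝ := s * thb s

theorem th1_cd : ContDiff ℝ (⊤ : ℕ∞) th1 := contDiff_id.mul thb.contDiff

theorem th1_hcs : HasCompactSupport th1 := thb.hasCompactSupport.mul_left

theorem th1_zero : th1 0 = 0 := by simp [th1]

theorem th1_deriv : HasDerivAt th1 1 0 := by
  have h : th1 =ᶠ[𝓝 0] fun s => s := by
    filter_upwards [thb.eventuallyEq_one] with s hs
    simp [th1, hs]
  exact (hasDerivAt_id (0 : ℝ)).congr_of_eventuallyEq h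

theorem th1_out {s : ℝ} (hs : 3 / 4 ≤ s) : th1 s = 0 := by
  have : thb s = 0 := thb.zero_of_le_dist (by
    rw [Real.dist_eq, sub_zero, abs_of_nonneg (by linarith)]; exact hs)
  rw [th1, this, mul_zero]

theorem thd_iter (hG : GB γ K) : ∃ C : ℝ, 0 ≤ C ∧ ∀ δ : ℝ, 0 < δ → δ ≤ 1 → ∀ x : EV (n + 1),
    (∀ i ≤ 1, ‖iteratedFDeriv ℝ i (fun x => δ * th1 (δ⁻¹ * tf γ x)) x‖ ≤ C) ∧
    ‖iteratedFDeriv ℝ 2 (fun x => δ * th1 (δ⁻¹ * tf γ x)) x‖ ≤ C / δ := by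
  obtain ⟨C1, hC1, hb⟩ := iter_bound th1_cd th1_hcs 2
  have hK1 : 1 ≤ 1 + K := by linarith [hG.K0]
  have ht : ContDiff ℝ 3 (tf γ) := tf_contDiff hG.cd
  have main : ∀ δ : ℝ, 0 < δ → δ ≤ 1 → ∀ x : EV (n + 1), ∀ i ≤ 2,
      ‖iteratedFDeriv ℝ i (fun x => δ * th1 (δ⁻¹ * tf γ x)) x‖ ≤ δ * (2 * C1 * ((1 + K) * δ⁻¹) ^ i) := by
    intro δ hδ hδ1 x i hi
    have hδi : 1 ≤ δ⁻¹ := (one_le_inv₀ hδ).2 hδ1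
    have hf : ContDiff ℝ 3 (fun x => δ⁻¹ * tf γ x) := contDiff_const.mul ht
    have hg : ContDiff ℝ 3 (fun x => th1 (δ⁻¹ * tf γ x)) := (th1_cd.of_le three_le_top).comp hf
    have hi3 : (i : WithTop ℕ∞) ≤ 3 := by exact_mod_cast (by omega : i ≤ 3)
    have e1 : iteratedFDeriv ℝ i (fun x => δ * th1 (δ⁻¹ * tf γ x)) x
        = δ • iteratedFDeriv ℝ i (fun x => th1 (δ⁻¹ * tf γ x)) x :=
      iteratedFDeriv_const_smul_apply (a := δ) (hg.of_le hi3).contDiffAt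
    rw [e1, norm_smul, Real.norm_of_nonneg hδ.le]
    refine mul_le_mul_of_nonneg_left ?_ hδ.le
    have key := norm_iteratedFDeriv_comp_le (g := th1) (f := fun x => δ⁻¹ * tf γ x) (n := i) (N := 3)
      (th1_cd.of_le three_le_top) hf hi3 x (C := C1) (D := (1 + K) * δ⁻¹)
      (fun j hj => hb j (hj.trans hi) _)
      (fun j hj1 hj => by
        have e2 : iteratedFDeriv ℝ j (fun x => δ⁻¹ * tf γ x) x = δ⁻¹ • iteratedFDeriv ℝ j (tf γ) x :=
          iteratedFDeriv_const_smul_apply (a := δ⁻¹)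
            (ht.of_le (le_trans (by exact_mod_cast hj) hi3)).contDiffAt
        rw [e2, norm_smul, Real.norm_of_nonneg (by positivity)]
        calc δ⁻¹ * ‖iteratedFDeriv ℝ j (tf γ) x‖ ≤ δ⁻¹ * (1 + K) := by
              gcongr
              exact tf_iter hG hj1 (by omega) x
          _ = (1 + K) * δ⁻¹ := mul_comm _ _
          _ ≤ ((1 + K) * δ⁻¹) ^ j := le_self_pow₀ (by nlinarith) (by omega))
    refine key.trans ?_
    have hfac : (i.factorial : ℝ) ≤ 2 := by
      interval_cases i <;> norm_num [Nat.factorial]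
    have : 0 ≤ ((1 + K) * δ⁻¹) ^ i := by positivity
    gcongr
  refine ⟨2 * C1 * (1 + K) ^ 2, by positivity, fun δ hδ hδ1 x => ⟨fun i hi => ?_, ?_⟩⟩
  · refine (main δ hδ hδ1 x i (by omega)).trans ?_
    interval_cases i
    · rw [pow_zero, mul_one]
      have h1 : 1 ≤ (1 + K) ^ 2 := one_le_pow₀ hK1
      nlinarith
    · rw [pow_one]
      have : δ * (2 * C1 * ((1 + K) * δ⁻¹)) = 2 * C1 * (1 + K) := by field_simp
      rw [this]
      have : 1 + K ≤ (1 + K) ^ 2 := le_self_pow₀ hK1 (by norm_num)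
      gcongr
  · refine (main δ hδ hδ1 x 2 le_rfl).trans (le_of_eq ?_)
    field_simp

end
end

noncomputable section
set_option maxSynthPendingDepth 3

section
variable {n : ℕ} {γ : EV n → ℝ} {K : ℝ}

theorem H_iter (hG : GB γ K) : ∃ C : ℝ, 0 ≤ C ∧ ∀ h : EV (n + 1) → ℝ, ContDiff ℝ (⊤ : ℕ∞) h → ∀ x, ∀ j ≤ 2,
    ‖iteratedFDeriv ℝ j (fun x => qf n (fderiv ℝ (tf γ) x) * GD γ (fun l => partialDList l h) x) x‖
      ≤ C * SD 3 h x := by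
  obtain ⟨Cq, hCq, hq⟩ := qf_iter hG
  have hK0 := hG.K0
  have ht : ContDiff ℝ 3 (tf γ) := tf_contDiff hG.cd
  have hF : ContDiff ℝ 2 (fderiv ℝ (tf γ)) := ht.fderiv_right (m := 2) (by norm_num)
  have hqc : ContDiff ℝ 2 (fun x => qf n (fderiv ℝ (tf γ) x)) := (qf_cd.of_le (natc_le_top 2)).comp hF
  refine ⟨2 ^ 2 * (Cq * ((n + 1) * (2 ^ 2 * (1 + K)))), by positivity, fun h hh x j hj => ?_⟩
  have hh3 : ContDiff ℝ 3 h := hh.of_le three_le_top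
  have hGb : ∀ i ≤ 2, ‖iteratedFDeriv ℝ i (GD γ (fun l => partialDList l h)) x‖
      ≤ (n + 1) * (2 ^ 2 * (1 + K)) * SD 3 h x := by
    intro i hi
    have hi2 : (i : WithTop ℕ∞) ≤ 2 := by exact_mod_cast hi
    have hcd : ∀ k : Fin (n + 1), ContDiff ℝ 2 (fun x => nuV γ x k * partialD k h x) := fun k =>
      (nuV_cd hG k).mul (partialD_cd (m := 2) k hh3)
    have e : GD γ (fun l => partialDList l h) = fun x => ∑ k, (fun k x => nuV γ x k * partialD k h x) k x := rfl
    rw [e, iteratedFDeriv_fun_sum_apply (fun k _ => ((hcd k).of_le hi2).contDiffAt)]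
    refine (norm_sum_le _ _).trans ?_
    have : ∀ k ∈ Finset.univ, ‖iteratedFDeriv ℝ i (fun x => nuV γ x k * partialD k h x) x‖
        ≤ 2 ^ 2 * ((1 + K) * SD 3 h x) := fun k _ => by
      refine mul_bound (k := 2) (N := 2) (by norm_num) (nuV_cd hG k) (partialD_cd (m := 2) k hh3)
        (by linarith) ?_ ?_ hi
      · intro a ha
        refine (partialD_iter_le k (ht.of_le (by exact_mod_cast (by omega : a + 1 ≤ 3))) x).trans ?_
        exact tf_iter hG (by omega) (by omega) x
      · intro a ha
        have hc : ContDiff ℝ (a + 1 : ℕ) h := hh3.of_le (by exact_mod_cast (by omega : a + 1 ≤ 3))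
        refine (partialD_iter_le k hc x).trans ?_
        exact norm_iter_le_SD (by omega) hc x
    refine (Finset.sum_le_card_nsmul _ _ _ this).trans (le_of_eq ?_)
    simp
    ring
  refine (mul_bound (k := 2) (N := 2) (by norm_num) hqc (GD_smooth_cd hG hh3) hCq (fun i hi => hq i hi x) hGb hj).trans
    (le_of_eq ?_)
  ring

theorem corrector (hG : GB γ K) : ∃ C : ℝ, 0 ≤ C ∧ ∀ δ : ℝ, 0 < δ → δ ≤ 1 → ∀ h : EV (n + 1) → ℝ,
    ContDiff ℝ (⊤ : ℕ∞) h → HasCompactSupport h → ∃ w : EV (n + 1) → ℝ, ContDiff ℝ 2 w ∧ HasCompactSupport w ∧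
      (∀ y, δ ≤ tf γ y → w y = 0) ∧
      (∀ x, tf γ x = 0 → ∑ i, partialD i (fun y => h y - w y) x * nuV γ x i = 0) ∧
      ∀ l : List (Fin (n + 1)), l.length ≤ 2 → ∀ x, (δ ≤ tf γ x → partialDList l w x = 0) ∧
        |partialDList l w x| ≤ C * (|GD γ (fun l => partialDList l h) x| / δ + SD 3 h x) := by
  obtain ⟨CH, hCH, hH⟩ := H_iter hG
  obtain ⟨CT, hCT, hT⟩ := thd_iter hG
  have ht : ContDiff ℝ 3 (tf γ) := tf_contDiff hG.cd
  have hF : ContDiff ℝ 2 (fderiv ℝ (tf γ)) := ht.fderiv_right (m := 2) (by norm_num)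
  have hqc : ContDiff ℝ 2 (fun x => qf n (fderiv ℝ (tf γ) x)) := (qf_cd.of_le (natc_le_top 2)).comp hF
  refine ⟨CT + 4 * CT * CH, by positivity, fun δ hδ hδ1 h hh hhc => ?_⟩
  have hh3 : ContDiff ℝ 3 h := hh.of_le three_le_top
  set G := GD γ (fun l => partialDList l h) with hGd
  set H := fun x => qf n (fderiv ℝ (tf γ) x) * G x with hHd
  set T := fun x => δ * th1 (δ⁻¹ * tf γ x) with hTd
  have hGc : ContDiff ℝ 2 G := GD_smooth_cd hG hh3
  have hHc : ContDiff ℝ 2 H := hqc.mul hGc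
  have hTc : ContDiff ℝ 2 T :=
    contDiff_const.mul ((th1_cd.of_le (natc_le_top 2)).comp (contDiff_const.mul (ht.of_le (by norm_num))))
  have hGs : HasCompactSupport G := by
    have : ∀ s : Finset (Fin (n + 1)), HasCompactSupport (fun x => ∑ i ∈ s, nuV γ x i * partialD i h x) := by
      intro s
      induction s using Finset.induction_on with
      | empty =>
        simp only [Finset.sum_empty]
        exact HasCompactSupport.zero
      | insert a s ha ih =>
        simp only [Finset.sum_insert ha]
        exact HasCompactSupport.add (HasCompactSupport.mul_left (partialD_hcs a hhc)) ih
    exact this Finset.univ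
  have hwc : ContDiff ℝ 2 (fun x => T x * H x) := hTc.mul hHc
  have hzero : ∀ x, δ ≤ tf γ x → (fun x => T x * H x) =ᶠ[𝓝 x] fun _ => 0 := by
    intro x hx
    have : {y | 3 / 4 * δ < tf γ y} ∈ 𝓝 x :=
      (isOpen_lt continuous_const (tf_continuous hG.cont)).mem_nhds (by
        show 3 / 4 * δ < tf γ x
        linarith)
    filter_upwards [this] with y hy
    have hy' : 3 / 4 * δ < tf γ y := hy
    have : th1 (δ⁻¹ * tf γ y) = 0 := th1_out (by
      rw [inv_mul_eq_div, le_div_iff₀ hδ]; exact hy'.le)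
    simp only [hTd, this, mul_zero, zero_mul]
  refine ⟨fun x => T x * H x, hwc, HasCompactSupport.mul_left (HasCompactSupport.mul_left hGs),
    fun y hy => (hzero y hy).self_of_nhds, ?_, ?_⟩
  · intro x hx
    have hTx : T x = 0 := by simp only [hTd, hx, mul_zero, th1_zero]
    have hTD : HasFDerivAt T (fderiv ℝ (tf γ) x) x := by
      have h1 : HasFDerivAt (fun y => δ⁻¹ * tf γ y) (δ⁻¹ • fderiv ℝ (tf γ) x) x :=
        ((ht.differentiable (by norm_num)) x).hasFDerivAt.const_mul δ⁻¹
      have h2 : HasDerivAt th1 1 (δ⁻¹ * tf γ x) := by rw [hx, mul_zero]; exact th1_deriv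
      have h3 := (h2.comp_hasFDerivAt x h1).const_mul δ
      refine h3.congr_fderiv ?_
      rw [one_smul, smul_smul, mul_inv_cancel₀ hδ.ne', one_smul]
    have hd : ∀ i, partialD i (fun y => h y - T y * H y) x = partialD i h x - nuV γ x i * H x := by
      intro i
      rw [partialD_sub i (hh3.differentiable (by norm_num)) (hwc.differentiable (by norm_num))]
      simp only []
      rw [partialD_mul i ((hTc.differentiable (by norm_num)) x) ((hHc.differentiable (by norm_num)) x), hTx,
        zero_mul, zero_add]
      congr 2
      show fderiv ℝ T x _ = _
      rw [hTD.fderiv]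
      rfl
    simp only [hd, sub_mul, Finset.sum_sub_distrib]
    have h1 : ∑ i, partialD i h x * nuV γ x i = G x := by
      simp only [hGd, GD]
      exact Finset.sum_congr rfl fun i _ => mul_comm _ _
    have h2 : ∑ i, nuV γ x i * H x * nuV γ x i = G x := by
      have : ∑ i, nuV γ x i * H x * nuV γ x i = ((∑ i, nuV γ x i * nuV γ x i) * qf n (fderiv ℝ (tf γ) x)) * G x := by
        simp only [hHd, Finset.sum_mul]
        exact Finset.sum_congr rfl fun i _ => by ring
      rw [this, qf_nu hG, one_mul]
    rw [h1, h2, sub_self]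
  · intro l hl x
    refine ⟨fun hx => ?_, ?_⟩
    · have h1 := (partialDList_congr (hzero x hx) l).self_of_nhds
      rw [h1]
      clear h1 hl
      have : ∀ l : List (Fin (n + 1)), partialDList l (fun _ : EV (n + 1) => (0 : ℝ)) = fun _ => 0 := by
        intro l
        induction l with
        | nil => rfl
        | cons i l ih =>
          show partialD i (partialDList l _) = _
          rw [ih]
          funext y
          simp [partialD]
      rw [this]
    · have hl2 : (l.length : WithTop ℕ∞) ≤ 2 := by exact_mod_cast hl
      refine (abs_partialDList_le l (hwc.of_le hl2) x).trans ?_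
      refine (norm_iteratedFDeriv_mul_le hTc hHc x hl2).trans ?_
      have hSD : 0 ≤ SD 3 h x := SD_nonneg _ _ _
      have hT0 := (hT δ hδ hδ1 x).1 0 (by norm_num)
      have hT1 := (hT δ hδ hδ1 x).1 1 le_rfl
      have hT2 := (hT δ hδ hδ1 x).2
      have hH0 := hH h hh x 0 (by norm_num)
      have hH1 := hH h hh x 1 (by norm_num)
      have hH2 := hH h hh x 2 (by norm_num)
      have hHG : ‖iteratedFDeriv ℝ 0 H x‖ ≤ |G x| := by
        rw [norm_iteratedFDeriv_zero, Real.norm_eq_abs]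
        simp only [hHd, abs_mul]
        exact mul_le_of_le_one_left (abs_nonneg _) (qf_abs _)
      set S := SD 3 h x
      set g := |G x|
      have hg : 0 ≤ g := abs_nonneg _
      have hS : 0 ≤ CH * S := by positivity
      have hgd : 0 ≤ g / δ := by positivity
      have m : ∀ {a b A B : ℝ}, 0 ≤ b → 0 ≤ A → a ≤ A → b ≤ B → a * b ≤ A * B := fun hb hA h1 h2 =>
        mul_le_mul h1 h2 hb hA
      have m00 := m (norm_nonneg _) hCT hT0 hH0
      have m01 := m (norm_nonneg _) hCT hT0 hH1
      have m02 := m (norm_nonneg _) hCT hT0 hH2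
      have m10 := m (norm_nonneg _) hCT hT1 hH0
      have m11 := m (norm_nonneg _) hCT hT1 hH1
      have m20 := m (norm_nonneg _) (by positivity) hT2 hHG
      have e : CT / δ * g = CT * (g / δ) := by ring
      rw [e] at m20
      have p1 : 0 ≤ CT * (g / δ) := by positivity
      have p2 : 0 ≤ CT * S := by positivity
      have p3 : 0 ≤ CT * (CH * S) := by positivity
      have p4 : 0 ≤ CT * CH * (g / δ) := by positivity
      set k := l.length
      have goal_ge : CT * (g / δ) + 4 * (CT * (CH * S)) ≤ (CT + 4 * CT * CH) * (g / δ + S) := by nlinarith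
      refine le_trans ?_ goal_ge
      have m00a : ‖iteratedFDeriv ℝ 0 T x‖ * ‖iteratedFDeriv ℝ 0 H x‖ ≤ CT * (CH * S) := m00
      have m01a : ‖iteratedFDeriv ℝ 0 T x‖ * ‖iteratedFDeriv ℝ 1 H x‖ ≤ CT * (CH * S) := m01
      have m02a : ‖iteratedFDeriv ℝ 0 T x‖ * ‖iteratedFDeriv ℝ 2 H x‖ ≤ CT * (CH * S) := m02
      have m10a : ‖iteratedFDeriv ℝ 1 T x‖ * ‖iteratedFDeriv ℝ 0 H x‖ ≤ CT * (CH * S) := m10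
      have m11a : ‖iteratedFDeriv ℝ 1 T x‖ * ‖iteratedFDeriv ℝ 1 H x‖ ≤ CT * (CH * S) := m11
      have m20a : ‖iteratedFDeriv ℝ 2 T x‖ * ‖iteratedFDeriv ℝ 0 H x‖ ≤ CT * (g / δ) := m20
      interval_cases k
      · simp only [Finset.sum_range_succ, Finset.sum_range_zero, Nat.choose_self, Nat.cast_one, one_mul, zero_add,
          Nat.sub_self]
        linarith
      · simp only [Finset.sum_range_succ, Finset.sum_range_zero, Nat.choose_self, Nat.cast_one, one_mul, zero_add,
          Nat.sub_self, Nat.choose_zero_right, Nat.sub_zero]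
        linarith
      · simp only [Finset.sum_range_succ, Finset.sum_range_zero, Nat.choose_self, Nat.cast_one, one_mul, zero_add,
          Nat.sub_self, Nat.choose_zero_right, Nat.sub_zero, Nat.choose_one_right, Nat.cast_ofNat]
        have e1 : 1 + 1 - 1 = 1 := rfl
        have e2 : 1 + 1 = 2 := rfl
        simp only [e1, e2, Nat.reduceSub]
        linarith

end
end

noncomputable section
set_option maxSynthPendingDepth 3

section
variable {n : ℕ} {γ : EV n → ℝ} {K : ℝ}

theorem nu_mul_memLp (hG : GB γ K) {p : ℝ≥0∞} {Ω : Set (EV (n + 1))} (i : Fin (n + 1)) {f : EV (n + 1) → ℝ}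
    (hf : MemLp f p (volume.restrict Ω)) : MemLp (fun x => nuV γ x i * f x) p (volume.restrict Ω) := by
  have hνb : ∀ i x, ‖nuV γ x i‖ ≤ 2 := fun i x => (PiLp.norm_apply_le (nuV γ x) i).trans (norm_nuV_le hG x)
  refine MemLp.of_le_mul (c := 2) hf ((nuV_cd hG i).continuous.aestronglyMeasurable.mul hf.1) (ae_of_all _ fun x => ?_)
  rw [norm_mul]
  exact mul_le_mul_of_nonneg_right (hνb i x) (norm_nonneg _)

theorem GD_memLp (hG : GB γ K) {p : ℝ≥0∞} {Ω : Set (EV (n + 1))} {D : List (Fin (n + 1)) → EV (n + 1) → ℝ}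
    (hD : ∀ i, MemLp (D [i]) p (volume.restrict Ω)) : MemLp (GD γ D) p (volume.restrict Ω) :=
  memLp_finsetSum _ fun i _ => nu_mul_memLp hG i (hD i)

theorem GDn_memLp (hG : GB γ K) {p : ℝ≥0∞} {Ω : Set (EV (n + 1))} {D : List (Fin (n + 1)) → EV (n + 1) → ℝ}
    (hD : ∀ i, MemLp (D [Fin.last n, i]) p (volume.restrict Ω)) : MemLp (GDn γ D) p (volume.restrict Ω) :=
  memLp_finsetSum _ fun i _ => nu_mul_memLp hG i (hD i)

theorem sum_enorm_eq {ι : Type*} (s : Finset ι) (f : ι → ℝ) :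
    ∑ i ∈ s, ‖f i‖ₑ = ENNReal.ofReal (∑ i ∈ s, |f i|) := by
  rw [ENNReal.ofReal_sum_of_nonneg fun _ _ => abs_nonneg _]
  exact Finset.sum_congr rfl fun i _ => Real.enorm_eq_ofReal_abs _

/-- `|G_h - G_u| ≤ 2(n+1) ∑ |∂h - D|`. -/
theorem GD_diff_le (hG : GB γ K) (D D' : List (Fin (n + 1)) → EV (n + 1) → ℝ) (x : EV (n + 1)) {k : ℕ} (hk : 1 ≤ k) :
    |GD γ D' x - GD γ D x| ≤ 2 * (n + 1) * ∑ l ∈ LS (n + 1) k, |D' l x - D l x| := by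
  have hνb : ∀ i x, |nuV γ x i| ≤ 2 := fun i x => (PiLp.norm_apply_le (nuV γ x) i).trans (norm_nuV_le hG x)
  have e : GD γ D' x - GD γ D x = ∑ i, nuV γ x i * (D' [i] x - D [i] x) := by
    simp only [GD, ← Finset.sum_sub_distrib, mul_sub]
  rw [e]
  refine (Finset.abs_sum_le_sum_abs _ _).trans ?_
  have : ∀ i ∈ (Finset.univ : Finset (Fin (n + 1))), |nuV γ x i * (D' [i] x - D [i] x)|
      ≤ 2 * ∑ l ∈ LS (n + 1) k, |D' l x - D l x| := fun i _ => by
    rw [abs_mul]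
    refine mul_le_mul (hνb i x) ?_ (abs_nonneg _) zero_le_two
    exact Finset.single_le_sum (f := fun l => |D' l x - D l x|) (fun _ _ => abs_nonneg _)
      (mem_LS.2 (by simpa using hk))
  refine (Finset.sum_le_card_nsmul _ _ _ this).trans (le_of_eq ?_)
  simp
  ring

theorem GDn_diff_le (hG : GB γ K) (D D' : List (Fin (n + 1)) → EV (n + 1) → ℝ) (x : EV (n + 1)) {k : ℕ} (hk : 2 ≤ k) :
    |GDn γ D' x - GDn γ D x| ≤ 2 * (n + 1) * ∑ l ∈ LS (n + 1) k, |D' l x - D l x| := by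
  have hνb : ∀ i x, |nuV γ x i| ≤ 2 := fun i x => (PiLp.norm_apply_le (nuV γ x) i).trans (norm_nuV_le hG x)
  have e : GDn γ D' x - GDn γ D x = ∑ i, nuV γ x i * (D' [Fin.last n, i] x - D [Fin.last n, i] x) := by
    simp only [GDn, ← Finset.sum_sub_distrib, mul_sub]
  rw [e]
  refine (Finset.abs_sum_le_sum_abs _ _).trans ?_
  have : ∀ i ∈ (Finset.univ : Finset (Fin (n + 1))), |nuV γ x i * (D' [Fin.last n, i] x - D [Fin.last n, i] x)|
      ≤ 2 * ∑ l ∈ LS (n + 1) k, |D' l x - D l x| := fun i _ => by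
    rw [abs_mul]
    refine mul_le_mul (hνb i x) ?_ (abs_nonneg _) zero_le_two
    exact Finset.single_le_sum (f := fun l => |D' l x - D l x|) (fun _ _ => abs_nonneg _)
      (mem_LS.2 (by simpa using hk))
  refine (Finset.sum_le_card_nsmul _ _ _ this).trans (le_of_eq ?_)
  simp
  ring

theorem hcs_sub {f g : EV (n + 1) → ℝ} (hf : HasCompactSupport f) (hg : HasCompactSupport g) :
    HasCompactSupport (fun x => f x - g x) := by
  have h1 : HasCompactSupport (fun x => (-1 : ℝ) * g x) := hg.mul_left (f := fun _ => (-1 : ℝ))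
  have h2 : HasCompactSupport (fun x => f x + (-1 : ℝ) * g x) := hf.add h1
  have e : (fun x => f x - g x) = fun x => f x + (-1 : ℝ) * g x := by funext x; ring
  rw [e]; exact h2

theorem approx_pair (hG : GB γ K) {p : ℝ≥0∞} (hp1 : 1 ≤ p) (hp : p ≠ ⊤) {u : EV (n + 1) → ℝ}
    {D : List (Fin (n + 1)) → EV (n + 1) → ℝ} (hD : IsSobDerivs (halfSpace γ) 3 p u D)
    (hN : NeumannBC (halfSpace γ) (1 : Matrix (Fin (n + 1)) (Fin (n + 1)) ℝ) p u) {κ η : ℝ} (hκ : 0 < κ)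
    (hη : 0 < η) :
    ∃ h w : EV (n + 1) → ℝ, ContDiff ℝ (⊤ : ℕ∞) h ∧ HasCompactSupport h ∧ ContDiff ℝ 2 w ∧ HasCompactSupport w ∧
      (∀ y, κ / 2 ≤ tf γ y → w y = 0) ∧
      MemWN (halfSpace γ) (1 : Matrix (Fin (n + 1)) (Fin (n + 1)) ℝ) 2 p (fun x => h x - w x) ∧
      (∀ l ∈ LS (n + 1) 3, eLpNorm (fun x => partialDList l h x - D l x) p (volume.restrict (halfSpace γ))
        ≤ ENNReal.ofReal η) ∧
      (∀ l ∈ LS (n + 1) 2, eLpNorm (partialDList l w) p (volume.restrict (halfSpace γ)) ≤ ENNReal.ofReal η) := by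
  have hΩm : MeasurableSet (halfSpace γ) := (isOpen_halfSpace hG.cont).measurableSet
  set Ω := halfSpace γ with hΩ
  set μ := (volume : Measure (EV (n + 1))).restrict Ω with hμ
  have hq : 1 ≤ p.toReal := by
    rw [← ENNReal.toReal_one]
    exact (ENNReal.toReal_le_toReal ENNReal.one_ne_top hp).2 hp1
  have hq0 : 0 < p.toReal := by linarith
  set q := p.toReal with hqd
  obtain ⟨C, hC, hcor⟩ := corrector hG
  have mGn : MemLp (GDn γ D) p μ := GDn_memLp hG fun i => hD.2.2 _ (by simp)
  have mG : MemLp (GD γ D) p μ := GD_memLp hG fun i => hD.2.2 _ (by simp)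
  have mD : ∀ l ∈ LS (n + 1) 3, MemLp (D l) p μ := fun l hl => hD.2.2 _ (mem_LS.1 hl)
  set Su : EV (n + 1) → ℝ≥0∞ := fun x => ∑ l ∈ LS (n + 1) 3, ‖D l x‖ₑ with hSu
  have mSu : AEMeasurable Su μ := Finset.aemeasurable_fun_sum _ fun l hl => (mD l hl).1.enorm
  set A : ℕ → Set (EV (n + 1)) := fun j => {x | tf γ x < 1 / ((j : ℝ) + 1)} with hA
  have hAm : ∀ j, MeasurableSet (A j) := fun j =>
    measurableSet_lt (tf_continuous hG.cont).measurable measurable_const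
  have hout : ∀ᵐ x ∂μ, ∀ᶠ j in atTop, x ∉ A j := by
    filter_upwards [ae_restrict_mem hΩm] with x hx
    have hx' : 0 < tf γ x := by rwa [hΩ, mem_halfSpace] at hx
    have := tendsto_one_div_add_atTop_nhds_zero_nat (𝕜 := ℝ)
    filter_upwards [this.eventually (gt_mem_nhds hx')] with j hj hxj
    have : tf γ x < 1 / ((j : ℝ) + 1) := hxj
    linarith
  have t1 := LN_tendsto_zero hq mGn.1.enorm (by rw [← eLpNorm_eq_LN hp1 hp]; exact mGn.2.ne) hAm hout
  have t2 := LN_tendsto_zero hq mSu (by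
    refine ne_of_lt ((LN_finset_sum_le hq _ fun l hl => (mD l hl).1.enorm).trans_lt ?_)
    refine ENNReal.sum_lt_top.2 fun l hl => ?_
    rw [← eLpNorm_eq_LN hp1 hp]; exact (mD l hl).2) hAm hout
  have t3 : Tendsto (fun j => ENNReal.ofReal C * (LN q (μ.restrict (A j)) (fun x => ‖GDn γ D x‖ₑ)
      + LN q (μ.restrict (A j)) Su)) atTop (𝓝 0) := by
    have := ENNReal.Tendsto.const_mul (a := ENNReal.ofReal C) (t1.add t2) (Or.inr ENNReal.ofReal_ne_top)
    simpa using this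
  have e1 := t3.eventually (gt_mem_nhds (ENNReal.ofReal_pos.2 (half_pos hη)))
  have e2 := (tendsto_one_div_add_atTop_nhds_zero_nat (𝕜 := ℝ)).eventually
    (gt_mem_nhds (lt_min one_pos (half_pos hκ)))
  obtain ⟨j, hj1, hj2⟩ := (e1.and e2).exists
  set δ : ℝ := 1 / ((j : ℝ) + 1) with hδd
  have hδ : 0 < δ := by positivity
  have hδ1 : δ ≤ 1 := (hj2.trans_le (min_le_left _ _)).le
  have hδκ : δ ≤ κ / 2 := (hj2.trans_le (min_le_right _ _)).le
  set c : ℝ := C * (2 * (n + 1) / δ + 1) with hc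
  have hc0 : 0 ≤ c := by positivity
  set N : ℝ := ((LS (n + 1) 3).card : ℝ) with hNd
  have hN0 : 0 ≤ N := Nat.cast_nonneg _
  set η' : ℝ := min η (η / 2 / (c * N + 1)) with hη'
  have hη'0 : 0 < η' := by
    refine lt_min hη ?_
    positivity
  obtain ⟨h, hh, hhc, happ⟩ := smooth_approx hG hp1 hp hD (ENNReal.ofReal_pos.2 hη'0).ne'
  obtain ⟨w, hwc, hws, hw0, hwN, hwb⟩ := hcor δ hδ hδ1 h hh hhc
  refine ⟨h, w, hh, hhc, hwc, hws, fun y hy => hw0 y (hδκ.trans hy), ?_, ?_, ?_⟩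
  · refine neumann_classical hG hp1 ((hh.of_le (natc_le_top 2)).sub hwc) ?_ hwN
    exact hcs_sub hhc hws
  · intro l hl
    exact (happ l hl).trans (ENNReal.ofReal_le_ofReal (min_le_left _ _))
  · intro l hl
    have hl2 := mem_LS.1 hl
    set E : EV (n + 1) → ℝ≥0∞ := fun x => ∑ l ∈ LS (n + 1) 3, ‖partialDList l h x - D l x‖ₑ with hE
    have mE1 : ∀ l ∈ LS (n + 1) 3, AEMeasurable (fun x => ‖partialDList l h x - D l x‖ₑ) μ := fun l hl =>
      ((partialDList_cd 0 l (hh.of_le (by exact_mod_cast le_top))).continuous.aestronglyMeasurable.sub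
        (mD l hl).1).enorm
    have mE : AEMeasurable E μ := Finset.aemeasurable_fun_sum _ mE1
    have hEb : LN q μ E ≤ ENNReal.ofReal (N * η') := by
      refine (LN_finset_sum_le hq _ mE1).trans ?_
      refine (Finset.sum_le_card_nsmul _ _ (ENNReal.ofReal η') fun l hl => ?_).trans (le_of_eq ?_)
      · rw [← eLpNorm_eq_LN hp1 hp (fun x => partialDList l h x - D l x)]
        exact happ l hl
      · rw [nsmul_eq_mul, ENNReal.ofReal_mul hN0, hNd, ENNReal.ofReal_natCast]
    have hle : μ.restrict (A j) ≤ μ := Measure.restrict_le_self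
    have hLN : ∀ f : EV (n + 1) → ℝ≥0∞, LN q (μ.restrict (A j)) f ≤ LN q μ f := fun f =>
      ENNReal.rpow_le_rpow (lintegral_mono' hle le_rfl) (by positivity)
    have step1 : eLpNorm (partialDList l w) p μ ≤ LN q (μ.restrict (A j)) (fun x => ‖partialDList l w x‖ₑ) := by
      rw [eLpNorm_eq_LN hp1 hp]
      unfold LN
      refine ENNReal.rpow_le_rpow ?_ (by positivity)
      rw [← lintegral_indicator (hAm j)]
      refine lintegral_mono fun x => ?_
      by_cases hx : x ∈ A j
      · rw [Set.indicator_of_mem hx]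
      · have : partialDList l w x = 0 := (hwb l hl2 x).1 (not_lt.1 hx)
        have hz : (0 : ℝ≥0∞) ^ p.toReal = 0 := ENNReal.zero_rpow_of_pos hq0
        simp only [this, enorm_zero, hz, zero_le]
    have step2 : ∀ x, ‖partialDList l w x‖ₑ ≤ ENNReal.ofReal (C / δ) * ‖GD γ D x‖ₑ + ENNReal.ofReal C * Su x
        + ENNReal.ofReal c * E x := by
      intro x
      simp only [hSu, hE, sum_enorm_eq]
      rw [Real.enorm_eq_ofReal_abs, Real.enorm_eq_ofReal_abs, ← ENNReal.ofReal_mul (by positivity),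
        ← ENNReal.ofReal_mul (by positivity), ← ENNReal.ofReal_mul (by positivity),
        ← ENNReal.ofReal_add (by positivity) (by positivity), ← ENNReal.ofReal_add (by positivity) (by positivity)]
      refine ENNReal.ofReal_le_ofReal (((hwb l hl2 x).2).trans ?_)
      have a1 := GD_diff_le hG D (fun l => partialDList l h) x (k := 3) (by norm_num)
      have a2 : |GD γ (fun l => partialDList l h) x| ≤ |GD γ D x|
          + 2 * (n + 1) * ∑ l ∈ LS (n + 1) 3, |partialDList l h x - D l x| := by
        have := abs_sub_abs_le_abs_sub (GD γ (fun l => partialDList l h) x) (GD γ D x)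
        linarith
      have a3 : SD 3 h x ≤ ∑ l ∈ LS (n + 1) 3, |D l x| + ∑ l ∈ LS (n + 1) 3, |partialDList l h x - D l x| := by
        unfold SD
        rw [← Finset.sum_add_distrib]
        refine Finset.sum_le_sum fun l _ => ?_
        have := abs_sub_abs_le_abs_sub (partialDList l h x) (D l x)
        linarith
      calc C * (|GD γ (fun l => partialDList l h) x| / δ + SD 3 h x)
          ≤ C * ((|GD γ D x| + 2 * (n + 1) * ∑ l ∈ LS (n + 1) 3, |partialDList l h x - D l x|) / δ
              + (∑ l ∈ LS (n + 1) 3, |D l x| + ∑ l ∈ LS (n + 1) 3, |partialDList l h x - D l x|)) := by gcongr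
        _ = _ := by rw [hc]; ring
    refine step1.trans ((LN_mono_ae hq (ae_of_all _ step2)).trans ?_)
    have mGr : AEMeasurable (fun x => ‖GD γ D x‖ₑ) (μ.restrict (A j)) := mG.1.enorm.mono_measure hle
    have mSr : AEMeasurable Su (μ.restrict (A j)) := mSu.mono_measure hle
    have mEr : AEMeasurable E (μ.restrict (A j)) := mE.mono_measure hle
    refine (LN_add_le hq ((mGr.const_mul _).add (mSr.const_mul _)) (mEr.const_mul _)).trans ?_
    refine (add_le_add_left (LN_add_le hq (mGr.const_mul _) (mSr.const_mul _)) _).trans ?_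
    rw [LN_const_mul hq ENNReal.ofReal_ne_top, LN_const_mul hq ENNReal.ofReal_ne_top,
      LN_const_mul hq ENNReal.ofReal_ne_top]
    have s1 : ENNReal.ofReal (C / δ) * LN q (μ.restrict (A j)) (fun x => ‖GD γ D x‖ₑ)
        ≤ ENNReal.ofReal C * LN q (μ.restrict (A j)) (fun x => ‖GDn γ D x‖ₑ) := by
      refine (mul_le_mul_right (G_small hG hp1 hp hD hN hδ) _).trans ?_
      rw [← mul_assoc, ← ENNReal.ofReal_mul (by positivity), div_mul_cancel₀ _ hδ.ne']
    have s2 : ENNReal.ofReal c * LN q (μ.restrict (A j)) E ≤ ENNReal.ofReal (η / 2) := by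
      refine (mul_le_mul_right ((hLN E).trans hEb) _).trans ?_
      rw [← ENNReal.ofReal_mul hc0]
      refine ENNReal.ofReal_le_ofReal ?_
      calc c * (N * η') ≤ c * (N * (η / 2 / (c * N + 1))) := by
            gcongr
            exact min_le_right _ _
        _ = c * N / (c * N + 1) * (η / 2) := by ring
        _ ≤ 1 * (η / 2) := by
            gcongr
            rw [div_le_one (by positivity)]
            linarith
        _ = η / 2 := one_mul _
    calc _ ≤ ENNReal.ofReal C * LN q (μ.restrict (A j)) (fun x => ‖GDn γ D x‖ₑ)
          + ENNReal.ofReal C * LN q (μ.restrict (A j)) Su + ENNReal.ofReal (η / 2) := by gcongr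
      _ = ENNReal.ofReal C * (LN q (μ.restrict (A j)) (fun x => ‖GDn γ D x‖ₑ)
          + LN q (μ.restrict (A j)) Su) + ENNReal.ofReal (η / 2) := by rw [mul_add]
      _ ≤ ENNReal.ofReal (η / 2) + ENNReal.ofReal (η / 2) := by gcongr
      _ = ENNReal.ofReal η := by rw [← ENNReal.ofReal_add (by positivity) (by positivity), add_halves]

end
end

noncomputable section
set_option maxSynthPendingDepth 3
section
variable {n : ℕ} {γ : EV n → ℝ} {K : ℝ}

theorem one_le_toReal {p : ℝ≥0∞} (hp1 : 1 ≤ p) (hp : p ≠ ⊤) : 1 ≤ p.toReal := by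
  rw [← ENNReal.toReal_one]
  exact (ENNReal.toReal_le_toReal ENNReal.one_ne_top hp).2 hp1

/-- The integral of the boundary layer weight. -/
theorem wt_lintegral {β ε : ℝ} (hβ : 0 < β) (hε : 0 < ε) :
    ∫⁻ s in Set.Ioi (0 : ℝ), ENNReal.ofReal (wt β (s / 2 / ε)) ≤ ENNReal.ofReal (2 * ε / β) := by
  have hd : ∀ s ∈ Set.Ici (0 : ℝ), HasDerivAt (fun s : ℝ => -(2 * ε / β) * (1 + s / 2 / ε) ^ (-β))
      (wt β (s / 2 / ε)) s := by
    intro s hs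
    have hs0 : 0 ≤ s := hs
    have h1 : 0 < 1 + s / 2 / ε := by positivity
    have h2 : HasDerivAt (fun s : ℝ => 1 + s / 2 / ε) (1 / 2 / ε) s :=
      (((hasDerivAt_id s).div_const 2).div_const ε).const_add 1
    have h3 := (h2.rpow_const (p := -β) (Or.inl h1.ne')).const_mul (-(2 * ε / β))
    refine h3.congr_deriv ?_
    unfold wt
    rw [show -β - 1 = -(1 + β) by ring]
    field_simp
  have ht : Tendsto (fun s : ℝ => -(2 * ε / β) * (1 + s / 2 / ε) ^ (-β)) atTop (𝓝 0) := by
    have h1 : Tendsto (fun s : ℝ => 1 + s / 2 / ε) atTop atTop :=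
      tendsto_atTop_add_const_left _ _ ((tendsto_id.atTop_div_const (by norm_num)).atTop_div_const hε)
    have h2 := ((tendsto_rpow_neg_atTop hβ).comp h1).const_mul (-(2 * ε / β))
    simpa using h2
  have hn : ∀ s ∈ Set.Ioi (0 : ℝ), 0 ≤ wt β (s / 2 / ε) := fun s hs =>
    wt_nonneg (by have : (0 : ℝ) < s := hs; positivity)
  have hi := integrableOn_Ioi_deriv_of_nonneg (hd 0 Set.self_mem_Ici).continuousAt.continuousWithinAt
    (fun s hs => hd s (Set.Ioi_subset_Ici_self hs)) hn ht
  have hv := integral_Ioi_of_hasDerivAt_of_nonneg (hd 0 Set.self_mem_Ici).continuousAt.continuousWithinAt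
    (fun s hs => hd s (Set.Ioi_subset_Ici_self hs)) hn ht
  rw [← ofReal_integral_eq_lintegral_ofReal hi ((ae_restrict_iff' measurableSet_Ioi).2 (ae_of_all _ hn)), hv]
  refine ENNReal.ofReal_le_ofReal ?_
  simp

theorem wt_lintegral_rpow {β ε q : ℝ} (hβ : 0 < β) (hε : 0 < ε) (hq : 1 ≤ q) :
    ∫⁻ s in Set.Ioi (0 : ℝ), ENNReal.ofReal (wt β (s / 2 / ε)) ^ q ≤ ENNReal.ofReal (2 * ε / β) := by
  refine (setLIntegral_mono' measurableSet_Ioi fun s hs => ?_).trans (wt_lintegral hβ hε)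
  have hs0 : 0 ≤ s / 2 / ε := by have : (0 : ℝ) < s := hs; positivity
  have h1 : ENNReal.ofReal (wt β (s / 2 / ε)) ≤ 1 := by
    rw [← ENNReal.ofReal_one]; exact ENNReal.ofReal_le_ofReal (wt_le_one hβ hs0)
  calc _ ≤ ENNReal.ofReal (wt β (s / 2 / ε)) ^ (1 : ℝ) := ENNReal.rpow_le_rpow_of_exponent_ge h1 hq
    _ = _ := ENNReal.rpow_one _

theorem wt_measurable (β : ℝ) : Measurable (wt β) := by
  unfold wt; fun_prop

/-- `L^p` norm of the sum of absolute values of derivatives. -/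
theorem SD_LN {m k : ℕ} {p : ℝ≥0∞} (hp1 : 1 ≤ p) (hp : p ≠ ⊤) {f : EV m → ℝ} (hf : ContDiff ℝ k f)
    (μ : Measure (EV m)) :
    LN p.toReal μ (fun x => ENNReal.ofReal (SD k f x)) ≤ WNormD k p μ (fun l => partialDList l f) := by
  have hq := one_le_toReal hp1 hp
  rw [WNormD_eq]
  have e1 : (fun x => ENNReal.ofReal (SD k f x)) = fun x => ∑ l ∈ LS m k, ‖partialDList l f x‖ₑ := by
    funext x; rw [sum_enorm_eq]; rfl
  rw [e1]
  refine (LN_finset_sum_le hq (LS m k) (f := fun l x => ‖partialDList l f x‖ₑ) ?_).trans ?_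
  · intro l hl
    have h1 : ContDiff ℝ 0 (partialDList l f) := partialDList_cd 0 l
      (hf.of_le (by have := mem_LS.1 hl; simp only [zero_add]; exact_mod_cast this))
    exact h1.continuous.measurable.enorm.aemeasurable
  · refine Finset.sum_le_sum fun l _ => ?_
    rw [eLpNorm_eq_LN hp1 hp]

/-- The density used in the trace estimate. -/
def FH (γ : EV n → ℝ) (h : EV (n + 1) → ℝ) : EV (n + 1) → ℝ≥0∞ :=
  (halfSpace γ).indicator (fun x => ENNReal.ofReal (2 * SD 3 h x))

/-- The vertical maximal quantity in the trace estimate. -/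
def AH (γ : EV n → ℝ) (q : ℝ) (h : EV (n + 1) → ℝ) (x : EV (n + 1)) : ℝ≥0∞ :=
  (∫⁻ s : ℝ, FH γ h (x + s • eL n) ^ q) ^ (1 / q)

theorem FH_meas (hG : GB γ K) {h : EV (n + 1) → ℝ} (hh : ContDiff ℝ 3 h) : Measurable (FH γ h) := by
  have h1 : Continuous (SD 3 h) := SD_meas hh
  exact (by fun_prop : Measurable fun x => ENNReal.ofReal (2 * SD 3 h x)).indicator
    (isOpen_halfSpace hG.cont).measurableSet

theorem AH_meas (hG : GB γ K) {h : EV (n + 1) → ℝ} (hh : ContDiff ℝ 3 h) (q : ℝ) :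
    Measurable (AH γ q h) := by
  have h1 := Measurable.lintegral_prod_right' (ν := (volume : Measure ℝ)) ((measurable_transl (FH_meas hG hh)).pow_const q)
  exact h1.pow_const _

theorem AH_inv (q : ℝ) (h : EV (n + 1) → ℝ) (x : EV (n + 1)) (r : ℝ) :
    AH γ q h (x + r • eL n) = AH γ q h x := by
  unfold AH
  congr 1
  rw [← lintegral_add_left_eq_self (fun s : ℝ => FH γ h (x + s • eL n) ^ q) r]
  refine lintegral_congr fun s => ?_
  rw [add_smul, add_assoc]

theorem AH_rpow {q : ℝ} (hq : 1 ≤ q) (h : EV (n + 1) → ℝ) (x : EV (n + 1)) :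
    AH γ q h x ^ q = ∫⁻ s : ℝ, FH γ h (x + s • eL n) ^ q := by
  unfold AH
  rw [← ENNReal.rpow_mul, one_div, inv_mul_cancel₀ (by linarith : q ≠ 0), ENNReal.rpow_one]

theorem le_AH {q : ℝ} (hq : 1 ≤ q) (hG : GB γ K) {h : EV (n + 1) → ℝ} (hh : ContDiff ℝ 3 h)
    {x : EV (n + 1)} (hx : x ∈ halfSpace γ) {l : List (Fin (n + 1))} (hl : l.length ≤ 2) :
    ‖partialDList l h x‖ₑ ≤ AH γ q h x := by
  set f := partialDList l h with hf
  have hfc : ContDiff ℝ 1 f := partialDList_cd 1 l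
    (hh.of_le (by exact_mod_cast (by omega : 1 + l.length ≤ 3)))
  have hf' : ContDiff ℝ 0 (partialD (Fin.last n) f) :=
    partialDList_cd 0 (Fin.last n :: l)
      (hh.of_le (by simp only [List.length_cons]; exact_mod_cast (by omega : 0 + (l.length + 1) ≤ 3)))
  have hfd := hfc.differentiable (by simp)
  have hd : ∀ s : ℝ, HasDerivAt (fun s : ℝ => f (x + s • eL n)) (partialD (Fin.last n) f (x + s • eL n)) s := by
    intro s
    have h1 : HasDerivAt (fun s : ℝ => x + s • eL n) (eL n) s := by
      have := ((hasDerivAt_id s).smul_const (eL n)).const_add x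
      simpa using this
    exact ((hfd _).hasFDerivAt.comp_hasDerivAt s h1)
  have hc1 : Continuous fun s : ℝ => f (x + s • eL n) := hfc.continuous.comp (by fun_prop)
  have hc2 : Continuous fun s : ℝ => partialD (Fin.last n) f (x + s • eL n) := hf'.continuous.comp (by fun_prop)
  have hftc : ∫ s in (0 : ℝ)..1, ((1 - s) * partialD (Fin.last n) f (x + s • eL n) - f (x + s • eL n)) = - f x := by
    have hd2 : ∀ s ∈ Set.uIcc (0 : ℝ) 1, HasDerivAt (fun s : ℝ => (1 - s) * f (x + s • eL n))
        ((1 - s) * partialD (Fin.last n) f (x + s • eL n) - f (x + s • eL n)) s := by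
      intro s _
      have h1 : HasDerivAt (fun s : ℝ => 1 - s) (-1) s := by
        simpa using (hasDerivAt_id s).const_sub 1
      refine (h1.mul (hd s)).congr_deriv ?_
      ring
    rw [intervalIntegral.integral_eq_sub_of_hasDerivAt hd2 (Continuous.intervalIntegrable (by fun_prop) _ _)]
    simp
  have hb : ‖f x‖ₑ ≤ ∫⁻ s in Set.Ioc (0 : ℝ) 1, FH γ h (x + s • eL n) := by
    rw [← enorm_neg, ← hftc, intervalIntegral.integral_of_le zero_le_one]
    refine (enorm_integral_le_lintegral_enorm _).trans (setLIntegral_mono' measurableSet_Ioc fun s hs => ?_)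
    have hm : x + s • eL n ∈ halfSpace γ := by
      rw [mem_halfSpace] at hx ⊢
      rw [tf_add_smul_eL]; linarith [hs.1]
    unfold FH
    rw [Set.indicator_of_mem hm, Real.enorm_eq_ofReal_abs]
    refine ENNReal.ofReal_le_ofReal ?_
    have h1 := abs_le_SD (k := 3) h (l := l) (by omega) (x + s • eL n)
    have h2 := abs_le_SD (k := 3) h (l := Fin.last n :: l) (by simp; omega) (x + s • eL n)
    have h3 : |(1 - s) * partialD (Fin.last n) f (x + s • eL n)| ≤ |partialD (Fin.last n) f (x + s • eL n)| := by
      rw [abs_mul]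
      refine mul_le_of_le_one_left (abs_nonneg _) ?_
      rw [abs_le]; constructor <;> linarith [hs.1, hs.2]
    have h4 : |partialD (Fin.last n) f (x + s • eL n)| ≤ SD 3 h (x + s • eL n) := h2
    have h5 : |f (x + s • eL n)| ≤ SD 3 h (x + s • eL n) := h1
    have h6 := abs_sub ((1 - s) * partialD (Fin.last n) f (x + s • eL n)) (f (x + s • eL n))
    linarith
  have hFm : Measurable fun s : ℝ => FH γ h (x + s • eL n) := (FH_meas hG hh).comp (by fun_prop)
  have hj := jensen_rpow hq (μ := volume.restrict (Set.Ioc (0 : ℝ) 1)) hFm.aemeasurable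
  rw [Measure.restrict_apply_univ, Real.volume_Ioc, sub_zero, ENNReal.ofReal_one, ENNReal.one_rpow, one_mul] at hj
  have hq0 : 0 < q := by linarith
  rw [← ENNReal.rpow_le_rpow_iff hq0, AH_rpow hq]
  exact ((ENNReal.rpow_le_rpow hb hq0.le).trans hj).trans (lintegral_mono' Measure.restrict_le_self le_rfl)

theorem SD2_le_AH {q : ℝ} (hq : 1 ≤ q) (hG : GB γ K) {h : EV (n + 1) → ℝ} (hh : ContDiff ℝ 3 h)
    {x : EV (n + 1)} (hx : x ∈ halfSpace γ) :
    ENNReal.ofReal (SD 2 h x) ≤ ENNReal.ofReal ((LS (n + 1) 2).card) * AH γ q h x := by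
  unfold SD
  rw [← sum_enorm_eq]
  refine (Finset.sum_le_sum fun l hl => le_AH hq hG hh hx (mem_LS.1 hl)).trans ?_
  rw [Finset.sum_const, nsmul_eq_mul, ENNReal.ofReal_natCast]

theorem AH_layer (hG : GB γ K) {p : ℝ≥0∞} (hp1 : 1 ≤ p) (hp : p ≠ ⊤) {β ε : ℝ} (hβ : 0 < β) (hε : 0 < ε)
    {h : EV (n + 1) → ℝ} (hh : ContDiff ℝ 3 h) :
    LN p.toReal (volume.restrict (halfSpace γ))
        (fun x => ENNReal.ofReal (wt β (tf γ x / 2 / ε)) * AH γ p.toReal h x)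
      ≤ ENNReal.ofReal (2 * (2 * ε / β) ^ (1 / p.toReal)) *
        WNormD 3 p (volume.restrict (halfSpace γ)) (fun l => partialDList l h) := by
  have hq := one_le_toReal hp1 hp
  have hq0 : 0 < p.toReal := by linarith
  have h1 := layer_LN hG.cont hq (w := fun s => ENNReal.ofReal (wt β (s / 2 / ε)))
    ((wt_measurable β).comp (by fun_prop) |>.ennreal_ofReal) (FH_meas hG hh) (f := AH γ p.toReal h)
    (ae_of_all _ fun x => (AH_rpow hq h x).le)
  refine h1.trans ?_
  have h2 : LN p.toReal volume (FH γ h) ≤ 2 * WNormD 3 p (volume.restrict (halfSpace γ)) (fun l => partialDList l h) := by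
    have e : LN p.toReal volume (FH γ h)
        = LN p.toReal (volume.restrict (halfSpace γ)) (fun x => 2 * ENNReal.ofReal (SD 3 h x)) := by
      unfold LN FH
      rw [← lintegral_indicator (isOpen_halfSpace hG.cont).measurableSet]
      congr 1
      refine lintegral_congr fun x => ?_
      by_cases hx : x ∈ halfSpace γ
      · rw [Set.indicator_of_mem hx, Set.indicator_of_mem hx, ENNReal.ofReal_mul (by norm_num)]; simp
      · rw [Set.indicator_of_notMem hx, Set.indicator_of_notMem hx, ENNReal.zero_rpow_of_pos hq0]
    rw [e]
    rw [LN_const_mul hq (by simp)]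
    gcongr
    exact SD_LN hp1 hp hh _
  have h3 : (∫⁻ s in Set.Ioi (0 : ℝ), ENNReal.ofReal (wt β (s / 2 / ε)) ^ p.toReal) ^ (1 / p.toReal)
      ≤ ENNReal.ofReal ((2 * ε / β) ^ (1 / p.toReal)) := by
    rw [← ENNReal.ofReal_rpow_of_pos (by positivity)]
    exact ENNReal.rpow_le_rpow (wt_lintegral_rpow hβ hε hq) (by positivity)
  refine (mul_le_mul' h3 h2).trans ?_
  rw [ENNReal.ofReal_mul (by norm_num), ENNReal.ofReal_ofNat, ← mul_assoc, mul_comm (ENNReal.ofReal _) 2]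
end
end

noncomputable section
set_option maxSynthPendingDepth 3
section
variable {n : ℕ} {γ : EV n → ℝ} {K : ℝ}

/-- Pointwise distance between the derivatives of `h` and the system `D`. -/
def EE (h : EV (n + 1) → ℝ) (D : List (Fin (n + 1)) → EV (n + 1) → ℝ) (x : EV (n + 1)) : ℝ :=
  ∑ l ∈ LS (n + 1) 3, |partialDList l h x - D l x|

theorem EE_nonneg (h : EV (n + 1) → ℝ) (D : List (Fin (n + 1)) → EV (n + 1) → ℝ) (x : EV (n + 1)) :
    0 ≤ EE h D x := Finset.sum_nonneg fun _ _ => abs_nonneg _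

/-- Norm of the distance. -/
def EN (γ : EV n → ℝ) (p : ℝ≥0∞) (h : EV (n + 1) → ℝ) (D : List (Fin (n + 1)) → EV (n + 1) → ℝ) : ℝ≥0∞ :=
  ∑ l ∈ LS (n + 1) 3, eLpNorm (fun x => partialDList l h x - D l x) p (volume.restrict (halfSpace γ))

theorem diff_aesm {p : ℝ≥0∞} {u : EV (n + 1) → ℝ}
    {D : List (Fin (n + 1)) → EV (n + 1) → ℝ} (hD : IsSobDerivs (halfSpace γ) 3 p u D)
    {h : EV (n + 1) → ℝ} (hh : ContDiff ℝ 3 h) {l : List (Fin (n + 1))} (hl : l ∈ LS (n + 1) 3) :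
    AEStronglyMeasurable (fun x => partialDList l h x - D l x) (volume.restrict (halfSpace γ)) := by
  have h1 : ContDiff ℝ 0 (partialDList l h) := partialDList_cd 0 l
    (hh.of_le (by have := mem_LS.1 hl; simp only [zero_add]; exact_mod_cast this))
  exact h1.continuous.aestronglyMeasurable.sub (hD.2.2 l (mem_LS.1 hl)).1

theorem EE_aem {p : ℝ≥0∞} {u : EV (n + 1) → ℝ}
    {D : List (Fin (n + 1)) → EV (n + 1) → ℝ} (hD : IsSobDerivs (halfSpace γ) 3 p u D)
    {h : EV (n + 1) → ℝ} (hh : ContDiff ℝ 3 h) :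
    AEMeasurable (fun x => ENNReal.ofReal (EE h D x)) (volume.restrict (halfSpace γ)) := by
  have e1 : (fun x => ENNReal.ofReal (EE h D x)) = fun x => ∑ l ∈ LS (n + 1) 3, ‖partialDList l h x - D l x‖ₑ := by
    funext x; rw [sum_enorm_eq]; rfl
  rw [e1]
  exact Finset.aemeasurable_fun_sum _ fun l hl => (diff_aesm hD hh hl).enorm

theorem EE_LN {p : ℝ≥0∞} (hp1 : 1 ≤ p) (hp : p ≠ ⊤) {u : EV (n + 1) → ℝ}
    {D : List (Fin (n + 1)) → EV (n + 1) → ℝ} (hD : IsSobDerivs (halfSpace γ) 3 p u D)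
    {h : EV (n + 1) → ℝ} (hh : ContDiff ℝ 3 h) :
    LN p.toReal (volume.restrict (halfSpace γ)) (fun x => ENNReal.ofReal (EE h D x)) ≤ EN γ p h D := by
  have hq := one_le_toReal hp1 hp
  have e1 : (fun x => ENNReal.ofReal (EE h D x)) = fun x => ∑ l ∈ LS (n + 1) 3, ‖partialDList l h x - D l x‖ₑ := by
    funext x; rw [sum_enorm_eq]; rfl
  rw [e1]
  refine (LN_finset_sum_le hq (LS (n + 1) 3) (f := fun l x => ‖partialDList l h x - D l x‖ₑ)
    fun l hl => (diff_aesm hD hh hl).enorm).trans ?_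
  unfold EN
  refine Finset.sum_le_sum fun l _ => ?_
  rw [eLpNorm_eq_LN hp1 hp]

theorem GDn_le_AH {q : ℝ} (hq : 1 ≤ q) (hG : GB γ K) {h : EV (n + 1) → ℝ} (hh : ContDiff ℝ 3 h)
    {x : EV (n + 1)} (hx : x ∈ halfSpace γ) :
    ‖GDn γ (fun l => partialDList l h) x‖ₑ ≤ ENNReal.ofReal (2 * (n + 1)) * AH γ q h x := by
  have hνb : ∀ i, |nuV γ x i| ≤ 2 := fun i => (PiLp.norm_apply_le (nuV γ x) i).trans (norm_nuV_le hG x)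
  unfold GDn
  refine (enorm_sum_le _ _).trans ?_
  have h1 : ∀ i ∈ Finset.univ, ‖nuV γ x i * partialDList [Fin.last n, i] h x‖ₑ
      ≤ ENNReal.ofReal 2 * AH γ q h x := by
    intro i _
    rw [enorm_mul, Real.enorm_eq_ofReal_abs (nuV γ x i)]
    exact mul_le_mul' (ENNReal.ofReal_le_ofReal (hνb i)) (le_AH hq hG hh hx (by simp))
  refine (Finset.sum_le_sum h1).trans ?_
  rw [Finset.sum_const, Finset.card_univ, Fintype.card_fin, nsmul_eq_mul, ← mul_assoc,
    mul_comm 2 ((n : ℝ) + 1), ENNReal.ofReal_mul (by positivity)]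
  gcongr
  rw [← ENNReal.ofReal_natCast]
  push_cast
  exact le_rfl

theorem GDn_meas (hG : GB γ K) {h : EV (n + 1) → ℝ} (hh : ContDiff ℝ 3 h) :
    Continuous (GDn γ (fun l => partialDList l h)) := by
  unfold GDn
  refine continuous_finset_sum _ fun i _ => ?_
  have h1 : ContDiff ℝ 1 (partialDList [Fin.last n, i] h) := partialDList_cd 1 [Fin.last n, i]
    (hh.of_le (by norm_num))
  exact (nuV_cd hG i).continuous.mul h1.continuous

/-- The weighted Hardy type splitting. -/
theorem weighted_split {q : ℝ} (hq : 1 ≤ q) (hG : GB γ K) {h : EV (n + 1) → ℝ} (hh : ContDiff ℝ 3 h)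
    {β ε : ℝ} (hβ : 0 < β) (hε : 0 < ε) {g : EV (n + 1) → ℝ} (hgm : Measurable g)
    (hg0 : ∀ x, x ∉ halfSpace γ → g x = 0) {x : EV (n + 1)} (hx : x ∈ halfSpace γ) :
    ENNReal.ofReal (wt β (tf γ x / 2 / ε)) * ∫⁻ σ in Set.Ioi (0 : ℝ), ‖g (x + (-σ) • eL n)‖ₑ
      ≤ ENNReal.ofReal (tf γ x) * (ENNReal.ofReal (wt β (tf γ x / 2 / ε)) *
          (ENNReal.ofReal (2 * (n + 1)) * AH γ q h x))
        + ∫⁻ σ in Set.Ioi (0 : ℝ), ENNReal.ofReal (wt β (σ / 2 / ε)) *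
          (halfSpace γ).indicator (fun y => ‖g y - GDn γ (fun l => partialDList l h) y‖ₑ) (x + (-σ) • eL n) := by
  set t := tf γ x with ht
  have ht0 : 0 < t := by rw [mem_halfSpace] at hx; exact hx
  set c := ENNReal.ofReal (wt β (t / 2 / ε)) * (ENNReal.ofReal (2 * (n + 1)) * AH γ q h x) with hc
  rw [← lintegral_const_mul' _ _ ENNReal.ofReal_ne_top]
  have e1 : ENNReal.ofReal t * c = ∫⁻ σ in Set.Ioi (0 : ℝ), (Set.Iio t).indicator (fun _ => c) σ := by
    rw [lintegral_indicator measurableSet_Iio, lintegral_const, Measure.restrict_restrict measurableSet_Iio,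
      Measure.restrict_apply_univ, Set.inter_comm, Set.Ioi_inter_Iio, Real.volume_Ioo, sub_zero, mul_comm]
  rw [e1, ← lintegral_add_left (measurable_const.indicator measurableSet_Iio)]
  refine setLIntegral_mono' measurableSet_Ioi fun σ hσ => ?_
  have hσ0 : (0 : ℝ) < σ := hσ
  by_cases h1 : σ < t
  · have hy : x + (-σ) • eL n ∈ halfSpace γ := by
      rw [mem_halfSpace, tf_add_smul_eL]; linarith
    rw [Set.indicator_of_mem (Set.mem_Iio.2 h1), Set.indicator_of_mem hy]
    have h2 : ‖g (x + (-σ) • eL n)‖ₑ ≤ ENNReal.ofReal (2 * (n + 1)) * AH γ q h x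
        + ‖g (x + (-σ) • eL n) - GDn γ (fun l => partialDList l h) (x + (-σ) • eL n)‖ₑ := by
      have h3 := GDn_le_AH hq hG hh hy
      rw [AH_inv] at h3
      calc ‖g (x + (-σ) • eL n)‖ₑ = ‖GDn γ (fun l => partialDList l h) (x + (-σ) • eL n)
            + (g (x + (-σ) • eL n) - GDn γ (fun l => partialDList l h) (x + (-σ) • eL n))‖ₑ := by
              congr 1; ring
        _ ≤ _ := enorm_add_le _ _
        _ ≤ _ := by gcongr
    calc _ ≤ ENNReal.ofReal (wt β (t / 2 / ε)) * (ENNReal.ofReal (2 * (n + 1)) * AH γ q h x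
        + ‖g (x + (-σ) • eL n) - GDn γ (fun l => partialDList l h) (x + (-σ) • eL n)‖ₑ) := by gcongr
      _ = c + ENNReal.ofReal (wt β (t / 2 / ε)) *
          ‖g (x + (-σ) • eL n) - GDn γ (fun l => partialDList l h) (x + (-σ) • eL n)‖ₑ := by rw [mul_add]
      _ ≤ _ := by
        gcongr
        exact wt_anti hβ (by positivity) (by gcongr)
  · rw [hg0, enorm_zero, mul_zero]
    · exact zero_le
    · rw [mem_halfSpace, tf_add_smul_eL]; linarith

/-- The error part of the Hardy estimate. -/
theorem weighted_err (hG : GB γ K) {p : ℝ≥0∞} (hp1 : 1 ≤ p) (hp : p ≠ ⊤) {u : EV (n + 1) → ℝ}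
    {D : List (Fin (n + 1)) → EV (n + 1) → ℝ} (hD : IsSobDerivs (halfSpace γ) 3 p u D)
    {h : EV (n + 1) → ℝ} (hh : ContDiff ℝ 3 h)
    {β ε : ℝ} (hβ : 0 < β) (hε : 0 < ε) {g : EV (n + 1) → ℝ} (hgm : Measurable g)
    (hge : g =ᵐ[volume.restrict (halfSpace γ)] GDn γ D) :
    LN p.toReal (volume.restrict (halfSpace γ)) (fun x =>
      ∫⁻ σ in Set.Ioi (0 : ℝ), ENNReal.ofReal (wt β (σ / 2 / ε)) *
          (halfSpace γ).indicator (fun y => ‖g y - GDn γ (fun l => partialDList l h) y‖ₑ) (x + (-σ) • eL n))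
      ≤ ENNReal.ofReal (2 * ε / β) * (ENNReal.ofReal (2 * (n + 1)) * EN γ p h D) := by
  have hq := one_le_toReal hp1 hp
  have hq0 : 0 < p.toReal := by linarith
  have hΩm : MeasurableSet (halfSpace γ) := (isOpen_halfSpace hG.cont).measurableSet
  set k := (halfSpace γ).indicator (fun y => ‖g y - GDn γ (fun l => partialDList l h) y‖ₑ) with hk
  have hkm : Measurable k := (hgm.sub (GDn_meas hG hh).measurable).enorm.indicator hΩm
  set A := ENNReal.ofReal (2 * (n + 1)) * EN γ p h D with hA
  have hkA : LN p.toReal volume k ≤ A := by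
    have e : LN p.toReal volume k = LN p.toReal (volume.restrict (halfSpace γ))
        (fun y => ‖g y - GDn γ (fun l => partialDList l h) y‖ₑ) := by
      unfold LN
      rw [← lintegral_indicator hΩm]
      congr 1
      refine lintegral_congr fun x => ?_
      by_cases hx : x ∈ halfSpace γ
      · rw [hk, Set.indicator_of_mem hx, Set.indicator_of_mem hx]
      · rw [hk, Set.indicator_of_notMem hx, Set.indicator_of_notMem hx, ENNReal.zero_rpow_of_pos hq0]
    rw [e]
    calc _ ≤ LN p.toReal (volume.restrict (halfSpace γ)) (fun x => ENNReal.ofReal (2 * (n + 1)) * ENNReal.ofReal (EE h D x)) := by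
          refine LN_mono_ae hq ?_
          filter_upwards [hge] with x hx
          rw [hx, ← ENNReal.ofReal_mul (by positivity), Real.enorm_eq_ofReal_abs, abs_sub_comm]
          exact ENNReal.ofReal_le_ofReal (GDn_diff_le hG D (fun l => partialDList l h) x (k := 3) (by norm_num))
      _ = ENNReal.ofReal (2 * (n + 1)) * LN p.toReal (volume.restrict (halfSpace γ)) (fun x => ENNReal.ofReal (EE h D x)) :=
          LN_const_mul hq ENNReal.ofReal_ne_top
      _ ≤ _ := by rw [hA]; gcongr; exact EE_LN hp1 hp hD hh
  have hkAq : ∫⁻ x, k x ^ p.toReal ≤ A ^ p.toReal := by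
    refine le_trans (le_of_eq ?_) (ENNReal.rpow_le_rpow hkA hq0.le)
    rw [LN, ← ENNReal.rpow_mul, one_div, inv_mul_cancel₀ hq0.ne', ENNReal.rpow_one]
  have hwm : Measurable fun σ : ℝ => ENNReal.ofReal (wt β (σ / 2 / ε)) :=
    ((wt_measurable β).comp (by fun_prop)).ennreal_ofReal
  have hmink := LN_minkowski hq (μ := volume.restrict (halfSpace γ))
    (ν := (volume.restrict (Set.Ioi (0 : ℝ))).withDensity (fun σ => ENNReal.ofReal (wt β (σ / 2 / ε))))
    (f := fun (x : EV (n + 1)) (σ : ℝ) => k (x + (-σ) • eL n))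
    (hkm.comp (by fun_prop : Measurable fun q : EV (n + 1) × ℝ => q.1 + (-q.2) • eL n)) (A := A)
    (ae_of_all _ fun σ => by
      refine (lintegral_mono' Measure.restrict_le_self le_rfl).trans ?_
      rw [lintegral_add_right_eq_self (fun x => k x ^ p.toReal)]
      exact hkAq)
  have e2 : ∀ x : EV (n + 1), ∫⁻ σ, k (x + (-σ) • eL n) ∂((volume.restrict (Set.Ioi (0 : ℝ))).withDensity
        (fun σ => ENNReal.ofReal (wt β (σ / 2 / ε))))
      = ∫⁻ σ in Set.Ioi (0 : ℝ), ENNReal.ofReal (wt β (σ / 2 / ε)) * k (x + (-σ) • eL n) := by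
    intro x
    have hm : Measurable fun σ : ℝ => k (x + (-σ) • eL n) := hkm.comp (by fun_prop)
    rw [lintegral_withDensity_eq_lintegral_mul _ hwm hm]
    rfl
  simp only [e2] at hmink
  refine hmink.trans ?_
  gcongr
  rw [withDensity_apply _ MeasurableSet.univ, Measure.restrict_univ]
  exact wt_lintegral hβ hε

end
end

noncomputable section
set_option maxSynthPendingDepth 3
section
variable {n : ℕ} {γ : EV n → ℝ} {K : ℝ}

theorem LN_measure_mono {X : Type*} [MeasurableSpace X] {μ ν : Measure X} {q : ℝ} (hq : 1 ≤ q) (h : μ ≤ ν)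
    (f : X → ℝ≥0∞) : LN q μ f ≤ LN q ν f := by
  unfold LN
  exact ENNReal.rpow_le_rpow (lintegral_mono' h le_rfl) (by positivity)

theorem boundary_pt (hG : GB γ K) {q : ℝ} (hq : 1 ≤ q) {D : List (Fin (n + 1)) → EV (n + 1) → ℝ}
    {h : EV (n + 1) → ℝ} (hh : ContDiff ℝ 3 h)
    {β ε C κ : ℝ} (hβ : 0 < β) (hε : 0 < ε) (hC : 0 ≤ C) (hκ : 0 < κ) {g : EV (n + 1) → ℝ} (hgm : Measurable g)
    (hg0 : ∀ x, x ∉ halfSpace γ → g x = 0) {x : EV (n + 1)} (hx : κ < tf γ x)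
    (hu : ‖GD γ D x‖ₑ ≤ ∫⁻ σ in Set.Ioi (0 : ℝ), ‖g (x + (-σ) • eL n)‖ₑ) :
    ENNReal.ofReal (C * wt β (tf γ x / 2 / ε) * (2 / tf γ x * |inner ℝ (gradV h x) (nuV γ x)|
        + K * ‖fderiv ℝ h x‖ + ‖fderiv ℝ (fderiv ℝ h) x‖))
      ≤ ENNReal.ofReal C * (ENNReal.ofReal (4 * (n + 1) + (K + 1) * (LS (n + 1) 2).card) *
          (ENNReal.ofReal (wt β (tf γ x / 2 / ε)) * AH γ q h x)
        + ENNReal.ofReal (2 / κ) * (∫⁻ σ in Set.Ioi (0 : ℝ), ENNReal.ofReal (wt β (σ / 2 / ε)) *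
          (halfSpace γ).indicator (fun y => ‖g y - GDn γ (fun l => partialDList l h) y‖ₑ) (x + (-σ) • eL n))
        + ENNReal.ofReal (4 * (n + 1) / κ) * ENNReal.ofReal (EE h D x)) := by
  have ht0 : 0 < tf γ x := hκ.trans hx
  have hxΩ : x ∈ halfSpace γ := by rw [mem_halfSpace]; exact ht0
  have hK := hG.K0
  have hsp := weighted_split hq hG hh hβ hε hgm hg0 hxΩ
  set I := ∫⁻ σ in Set.Ioi (0 : ℝ), ENNReal.ofReal (wt β (σ / 2 / ε)) *
          (halfSpace γ).indicator (fun y => ‖g y - GDn γ (fun l => partialDList l h) y‖ₑ) (x + (-σ) • eL n) with hI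
  set t := tf γ x with ht
  have hw0 : 0 ≤ wt β (t / 2 / ε) := wt_nonneg (by positivity)
  have hw1 : wt β (t / 2 / ε) ≤ 1 := wt_le_one hβ (by positivity)
  set Wr := wt β (t / 2 / ε) with hWr
  have hin : inner ℝ (gradV h x) (nuV γ x) = GD γ (fun l => partialDList l h) x := by
    rw [inner_sumE]
    unfold GD
    refine Finset.sum_congr rfl fun i _ => ?_
    rw [mul_comm]; rfl
  have h1 : |GD γ (fun l => partialDList l h) x| ≤ |GD γ D x| + 2 * (n + 1) * EE h D x := by
    have h2 : |GD γ (fun l => partialDList l h) x - GD γ D x| ≤ 2 * (n + 1) * EE h D x :=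
      GD_diff_le hG D (fun l => partialDList l h) x (k := 3) (by norm_num)
    have h3 := abs_sub_abs_le_abs_sub (GD γ (fun l => partialDList l h) x) (GD γ D x)
    linarith
  have hd1 : ‖fderiv ℝ h x‖ ≤ SD 2 h x := norm_fderiv_le_SD (by norm_num) (hh.of_le (by norm_num)) x
  have hd2 : ‖fderiv ℝ (fderiv ℝ h) x‖ ≤ SD 2 h x := norm_fderiv2_le_SD le_rfl (hh.of_le (by norm_num)) x
  have hE := EE_nonneg h D x
  have hS := SD_nonneg 2 h x
  have hreal : C * Wr * (2 / t * |inner ℝ (gradV h x) (nuV γ x)| + K * ‖fderiv ℝ h x‖ + ‖fderiv ℝ (fderiv ℝ h) x‖)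
      ≤ C * (2 / t * (Wr * |GD γ D x|) + 4 * (n + 1) / κ * EE h D x + (K + 1) * (Wr * SD 2 h x)) := by
    rw [mul_assoc]
    refine mul_le_mul_of_nonneg_left ?_ hC
    rw [hin]
    have a1 : 2 / t * |GD γ (fun l => partialDList l h) x| ≤ 2 / t * |GD γ D x| + 4 * (n + 1) / κ * EE h D x := by
      calc _ ≤ 2 / t * (|GD γ D x| + 2 * (n + 1) * EE h D x) := by gcongr
        _ = 2 / t * |GD γ D x| + 2 / t * (2 * (n + 1) * EE h D x) := by ring
        _ ≤ 2 / t * |GD γ D x| + 2 / κ * (2 * (n + 1) * EE h D x) := by gcongr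
        _ = _ := by ring
    have a2 : K * ‖fderiv ℝ h x‖ + ‖fderiv ℝ (fderiv ℝ h) x‖ ≤ (K + 1) * SD 2 h x := by
      have := mul_le_mul_of_nonneg_left hd1 hK
      linarith
    have a3 : 0 ≤ 4 * (n + 1) / κ * EE h D x := by positivity
    calc _ ≤ Wr * (2 / t * |GD γ D x| + 4 * (n + 1) / κ * EE h D x + (K + 1) * SD 2 h x) := by
          refine mul_le_mul_of_nonneg_left ?_ hw0
          linarith
      _ = 2 / t * (Wr * |GD γ D x|) + Wr * (4 * (n + 1) / κ * EE h D x) + (K + 1) * (Wr * SD 2 h x) := by ring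
      _ ≤ _ := by
        have := mul_le_mul_of_nonneg_right hw1 a3
        linarith
  refine (ENNReal.ofReal_le_ofReal hreal).trans ?_
  rw [ENNReal.ofReal_mul hC]
  gcongr
  rw [ENNReal.ofReal_add (by positivity) (by positivity), ENNReal.ofReal_add (by positivity) (by positivity),
    ENNReal.ofReal_mul (by positivity : 0 ≤ 2 / t), ENNReal.ofReal_mul hw0,
    ENNReal.ofReal_mul (by positivity : 0 ≤ 4 * ((n : ℝ) + 1) / κ),
    ENNReal.ofReal_mul (by positivity : 0 ≤ K + 1), ENNReal.ofReal_mul hw0, ← Real.enorm_eq_ofReal_abs]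
  have b1 : ENNReal.ofReal (2 / t) * (ENNReal.ofReal Wr * ‖GD γ D x‖ₑ)
      ≤ ENNReal.ofReal (4 * (n + 1)) * (ENNReal.ofReal Wr * AH γ q h x) + ENNReal.ofReal (2 / κ) * I := by
    calc _ ≤ ENNReal.ofReal (2 / t) * (ENNReal.ofReal t * (ENNReal.ofReal Wr * (ENNReal.ofReal (2 * (n + 1)) * AH γ q h x)) + I) := by
          gcongr
          exact (mul_le_mul' le_rfl hu).trans hsp
      _ = (ENNReal.ofReal (2 / t) * ENNReal.ofReal t * ENNReal.ofReal (2 * (n + 1))) * (ENNReal.ofReal Wr * AH γ q h x)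
          + ENNReal.ofReal (2 / t) * I := by ring
      _ ≤ _ := by
        gcongr
        rw [← ENNReal.ofReal_mul (by positivity), ← ENNReal.ofReal_mul (by positivity)]
        refine ENNReal.ofReal_le_ofReal (le_of_eq ?_)
        field_simp
        norm_num
  have b2 : ENNReal.ofReal (K + 1) * (ENNReal.ofReal Wr * ENNReal.ofReal (SD 2 h x))
      ≤ ENNReal.ofReal ((K + 1) * (LS (n + 1) 2).card) * (ENNReal.ofReal Wr * AH γ q h x) := by
    calc _ ≤ ENNReal.ofReal (K + 1) * (ENNReal.ofReal Wr * (ENNReal.ofReal ((LS (n + 1) 2).card) * AH γ q h x)) := by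
          gcongr
          exact SD2_le_AH hq hG hh hxΩ
      _ = _ := by rw [ENNReal.ofReal_mul (by positivity)]; ring
  rw [ENNReal.ofReal_add (by positivity : 0 ≤ 4 * ((n : ℝ) + 1)) (by positivity), add_mul]
  calc _ ≤ (ENNReal.ofReal (4 * (n + 1)) * (ENNReal.ofReal Wr * AH γ q h x) + ENNReal.ofReal (2 / κ) * I)
        + ENNReal.ofReal (4 * (n + 1) / κ) * ENNReal.ofReal (EE h D x)
        + ENNReal.ofReal ((K + 1) * (LS (n + 1) 2).card) * (ENNReal.ofReal Wr * AH γ q h x) := by gcongr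
    _ = _ := by ring

/-- Constant in the boundary term. -/
def cB (n : ℕ) (K : ℝ) : ℝ := 4 * (n + 1) + (K + 1) * (LS (n + 1) 2).card

theorem boundary_term (hG : GB γ K) {p : ℝ≥0∞} (hp1 : 1 ≤ p) (hp : p ≠ ⊤) {u : EV (n + 1) → ℝ}
    {D : List (Fin (n + 1)) → EV (n + 1) → ℝ} (hD : IsSobDerivs (halfSpace γ) 3 p u D)
    (hN : NeumannBC (halfSpace γ) (1 : Matrix (Fin (n + 1)) (Fin (n + 1)) ℝ) p u)
    {h : EV (n + 1) → ℝ} (hh : ContDiff ℝ 3 h)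
    {β ε C κ : ℝ} (hβ : 0 < β) (hε : 0 < ε) (hC : 0 ≤ C) (hκ : 0 < κ) :
    LN p.toReal ((volume.restrict (halfSpace γ)).restrict {x | κ < tf γ x}) (fun x =>
      ENNReal.ofReal (C * wt β (tf γ x / 2 / ε) * (2 / tf γ x * |inner ℝ (gradV h x) (nuV γ x)|
        + K * ‖fderiv ℝ h x‖ + ‖fderiv ℝ (fderiv ℝ h) x‖)))
      ≤ ENNReal.ofReal C * (ENNReal.ofReal (cB n K) * (ENNReal.ofReal (2 * (2 * ε / β) ^ (1 / p.toReal)) *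
          WNormD 3 p (volume.restrict (halfSpace γ)) (fun l => partialDList l h))
        + ENNReal.ofReal (2 / κ) * (ENNReal.ofReal (2 * ε / β) * (ENNReal.ofReal (2 * (n + 1)) * EN γ p h D))
        + ENNReal.ofReal (4 * (n + 1) / κ) * EN γ p h D) := by
  have hq := one_le_toReal hp1 hp
  obtain ⟨g, hgm, hg0, hge, hu⟩ := hardy hG hp1 hp hD hN
  have hΩm : MeasurableSet (halfSpace γ) := (isOpen_halfSpace hG.cont).measurableSet
  have htm : Measurable (tf γ) := (tf_continuous hG.cont).measurable
  have hSm : MeasurableSet {x : EV (n + 1) | κ < tf γ x} := measurableSet_lt measurable_const htm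
  refine (LN_mono_ae hq (g := fun x => ENNReal.ofReal C * (ENNReal.ofReal (cB n K) *
          (ENNReal.ofReal (wt β (tf γ x / 2 / ε)) * AH γ p.toReal h x)
        + ENNReal.ofReal (2 / κ) * (∫⁻ σ in Set.Ioi (0 : ℝ), ENNReal.ofReal (wt β (σ / 2 / ε)) *
          (halfSpace γ).indicator (fun y => ‖g y - GDn γ (fun l => partialDList l h) y‖ₑ) (x + (-σ) • eL n))
        + ENNReal.ofReal (4 * (n + 1) / κ) * ENNReal.ofReal (EE h D x))) ?_).trans
    ((LN_measure_mono hq Measure.restrict_le_self _).trans ?_)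
  · rw [ae_restrict_iff' hSm]
    filter_upwards [hu] with x hx hxκ
    exact boundary_pt hG hq hh hβ hε hC hκ hgm hg0 hxκ hx
  have hm1 : Measurable fun x => ENNReal.ofReal (wt β (tf γ x / 2 / ε)) * AH γ p.toReal h x :=
    ((wt_measurable β).comp ((htm.div_const 2).div_const ε)).ennreal_ofReal.mul (AH_meas hG hh _)
  have hkm : Measurable ((halfSpace γ).indicator (fun y => ‖g y - GDn γ (fun l => partialDList l h) y‖ₑ)) :=
    (hgm.sub (GDn_meas hG hh).measurable).enorm.indicator hΩm
  have hm2 : Measurable fun x => ∫⁻ σ in Set.Ioi (0 : ℝ), ENNReal.ofReal (wt β (σ / 2 / ε)) *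
          (halfSpace γ).indicator (fun y => ‖g y - GDn γ (fun l => partialDList l h) y‖ₑ) (x + (-σ) • eL n) := by
    have hwm : Measurable fun a : EV (n + 1) × ℝ => ENNReal.ofReal (wt β (a.2 / 2 / ε)) :=
      ((wt_measurable β).comp (by fun_prop)).ennreal_ofReal
    exact Measurable.lintegral_prod_right' (ν := volume.restrict (Set.Ioi (0 : ℝ)))
      (hwm.mul (hkm.comp (by fun_prop : Measurable fun q : EV (n + 1) × ℝ => q.1 + (-q.2) • eL n)))
  have hm3 := EE_aem hD hh
  rw [LN_const_mul hq ENNReal.ofReal_ne_top]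
  gcongr
  refine (LN_add_le hq ((hm1.const_mul _).add (hm2.const_mul _)).aemeasurable (hm3.const_mul _)).trans ?_
  refine add_le_add ((LN_add_le hq (hm1.const_mul _).aemeasurable (hm2.const_mul _).aemeasurable).trans
    (add_le_add ?_ ?_)) ?_
  · rw [LN_const_mul hq ENNReal.ofReal_ne_top]
    gcongr
    exact AH_layer hG hp1 hp hβ hε hh
  · rw [LN_const_mul hq ENNReal.ofReal_ne_top]
    gcongr
    exact weighted_err hG hp1 hp hD hh hβ hε hgm hge
  · rw [LN_const_mul hq ENNReal.ofReal_ne_top]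
    gcongr
    exact EE_LN hp1 hp hD hh

end
end

noncomputable section
set_option maxSynthPendingDepth 3
section
variable {n : ℕ} {γ : EV n → ℝ} {K : ℝ}

theorem LN_indicator {X : Type*} [MeasurableSpace X] {μ : Measure X} {q : ℝ} (hq : 1 ≤ q) {s : Set X}
    (hs : MeasurableSet s) (f : X → ℝ≥0∞) : LN q μ (s.indicator f) = LN q (μ.restrict s) f := by
  have hq0 : 0 < q := by linarith
  unfold LN
  rw [← lintegral_indicator hs]
  congr 1
  refine lintegral_congr fun x => ?_
  by_cases hx : x ∈ s
  · rw [Set.indicator_of_mem hx, Set.indicator_of_mem hx]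
  · rw [Set.indicator_of_notMem hx, Set.indicator_of_notMem hx, ENNReal.zero_rpow_of_pos hq0]

theorem LN_rpow {X : Type*} [MeasurableSpace X] {μ : Measure X} {q : ℝ} (hq : 1 ≤ q) (f : X → ℝ≥0∞) :
    ∫⁻ x, f x ^ q ∂μ = LN q μ f ^ q := by
  unfold LN
  rw [← ENNReal.rpow_mul, one_div, inv_mul_cancel₀ (by linarith : q ≠ 0), ENNReal.rpow_one]

theorem FD_LN {p : ℝ≥0∞} (hp1 : 1 ≤ p) (hp : p ≠ ⊤) {h : EV (n + 1) → ℝ} (hh : ContDiff ℝ 3 h)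
    (μ : Measure (EV (n + 1))) :
    LN p.toReal μ (fun x => ENNReal.ofReal (FD h x)) ≤ 3 * WNormD 3 p μ (fun l => partialDList l h) := by
  have hq := one_le_toReal hp1 hp
  calc _ ≤ LN p.toReal μ (fun x => 3 * ENNReal.ofReal (SD 3 h x)) := by
        refine LN_mono_ae hq (ae_of_all _ fun x => ?_)
        rw [← ENNReal.ofReal_ofNat, ← ENNReal.ofReal_mul (by norm_num)]
        exact ENNReal.ofReal_le_ofReal (FD_le_SD hh x)
    _ = 3 * LN p.toReal μ (fun x => ENNReal.ofReal (SD 3 h x)) := LN_const_mul hq (by simp)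
    _ ≤ _ := by gcongr; exact SD_LN hp1 hp hh _

variable {J : EV (n + 1) → ℝ} {ε β C : ℝ}

theorem FI_meas (hG : GB γ K) {f : EV (n + 1) → ℝ} (hf : Continuous f) :
    Measurable ((halfSpace γ).indicator (fun y => ENNReal.ofReal (f y))) :=
  hf.measurable.ennreal_ofReal.indicator (isOpen_halfSpace hG.cont).measurableSet

theorem cpath_cont1 (hγ : Continuous γ) (x : EV (n + 1)) :
    Continuous (fun q : EV (n + 1) × ℝ => cpath γ q.1 q.2 x) := by
  have h := continuous_firstCoords n
  unfold cpath kap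
  fun_prop

theorem cpath_cont2 (hγ : Continuous γ) :
    Continuous (fun q : (EV (n + 1) × EV (n + 1)) × ℝ => cpath γ q.1.2 q.2 q.1.1) := by
  have h := continuous_firstCoords n
  unfold cpath kap
  fun_prop

theorem taylor_term (hG : GB γ K) (hK : KB J ε β C) (hε : 0 < ε) {p : ℝ≥0∞} (hp1 : 1 ≤ p) (hp : p ≠ ⊤)
    {h : EV (n + 1) → ℝ} (hh : ContDiff ℝ 3 h) :
    LN p.toReal (volume.restrict (halfSpace γ)) (fun x =>
      ∫⁻ z, ∫⁻ τ in Set.Icc (0 : ℝ) 1, ENNReal.ofReal (27 * K * (J z * ‖z‖ ^ 3))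
            * (halfSpace γ).indicator (fun y => ENNReal.ofReal (FD h y)) (cpath γ z τ x))
      ≤ ENNReal.ofReal (27 * K * (C * ε)) *
        (3 * WNormD 3 p (volume.restrict (halfSpace γ)) (fun l => partialDList l h)) := by
  have hq := one_le_toReal hp1 hp
  have hq0 : 0 < p.toReal := by linarith
  have hK0 := hG.K0
  have hΩm : MeasurableSet (halfSpace γ) := (isOpen_halfSpace hG.cont).measurableSet
  have hFm := FI_meas hG (FD_continuous hh)
  set FI := (halfSpace γ).indicator (fun y => ENNReal.ofReal (FD h y)) with hFI
  set A := 3 * WNormD 3 p (volume.restrict (halfSpace γ)) (fun l => partialDList l h) with hA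
  have hJm := hK.meas
  have hρm : Measurable fun z : EV (n + 1) => ENNReal.ofReal (27 * K * (J z * ‖z‖ ^ 3)) := by fun_prop
  have hfm : Measurable fun q : EV (n + 1) × EV (n + 1) × ℝ => FI (cpath γ q.2.1 q.2.2 q.1) :=
    hFm.comp (cpath_continuous hG.cont).measurable
  have hFA : LN p.toReal volume FI ≤ A := by
    rw [hFI, LN_indicator hq hΩm]
    exact FD_LN hp1 hp hh _
  have hmink := LN_minkowski hq (μ := volume.restrict (halfSpace γ))
    (ν := (volume.withDensity (fun z : EV (n + 1) => ENNReal.ofReal (27 * K * (J z * ‖z‖ ^ 3)))).prod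
      (volume.restrict (Set.Icc (0 : ℝ) 1)))
    (f := fun x (y : EV (n + 1) × ℝ) => FI (cpath γ y.1 y.2 x)) hfm (A := A)
    (ae_of_all _ fun y => by
      refine (lintegral_mono' Measure.restrict_le_self le_rfl).trans ?_
      rw [(cpath_mp hG.cont y.1 y.2).lintegral_comp (hFm.pow_const p.toReal), LN_rpow hq]
      exact ENNReal.rpow_le_rpow hFA hq0.le)
  have e2 : ∀ x : EV (n + 1), ∫⁻ y : EV (n + 1) × ℝ, FI (cpath γ y.1 y.2 x)
        ∂((volume.withDensity (fun z : EV (n + 1) => ENNReal.ofReal (27 * K * (J z * ‖z‖ ^ 3)))).prod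
      (volume.restrict (Set.Icc (0 : ℝ) 1)))
      = ∫⁻ z, ∫⁻ τ in Set.Icc (0 : ℝ) 1, ENNReal.ofReal (27 * K * (J z * ‖z‖ ^ 3)) * FI (cpath γ z τ x) := by
    intro x
    have hm : Measurable fun y : EV (n + 1) × ℝ => FI (cpath γ y.1 y.2 x) :=
      hFm.comp (cpath_cont1 hG.cont x).measurable
    rw [lintegral_prod _ hm.aemeasurable,
      lintegral_withDensity_eq_lintegral_mul _ hρm hm.lintegral_prod_right']
    refine lintegral_congr fun z => ?_
    rw [lintegral_const_mul' _ _ ENNReal.ofReal_ne_top]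
    rfl
  simp only [e2] at hmink
  refine hmink.trans ?_
  gcongr
  rw [← Set.univ_prod_univ, Measure.prod_prod, Measure.restrict_apply_univ, Real.volume_Icc, sub_zero,
    ENNReal.ofReal_one, mul_one, withDensity_apply _ MeasurableSet.univ, Measure.restrict_univ]
  calc _ = ∫⁻ z, ENNReal.ofReal (27 * K) * ENNReal.ofReal (J z * ‖z‖ ^ 3) := by
        refine lintegral_congr fun z => ?_
        rw [ENNReal.ofReal_mul (by positivity)]
    _ = ENNReal.ofReal (27 * K) * ∫⁻ z, ENNReal.ofReal (J z * ‖z‖ ^ 3) := lintegral_const_mul' _ _ ENNReal.ofReal_ne_top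
    _ ≤ ENNReal.ofReal (27 * K) * ENNReal.ofReal (C * ε) := by gcongr; exact hK.third
    _ = _ := by rw [← ENNReal.ofReal_mul (by positivity)]

theorem taylor_meas (hG : GB γ K) (hK : KB J ε β C) {h : EV (n + 1) → ℝ} (hh : ContDiff ℝ 3 h) :
    Measurable (fun x => ∫⁻ z, ∫⁻ τ in Set.Icc (0 : ℝ) 1, ENNReal.ofReal (27 * K * (J z * ‖z‖ ^ 3))
            * (halfSpace γ).indicator (fun y => ENNReal.ofReal (FD h y)) (cpath γ z τ x)) := by
  have hFm := FI_meas hG (FD_continuous hh)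
  have hJm := hK.meas
  have h1 : Measurable fun q : (EV (n + 1) × EV (n + 1)) × ℝ => ENNReal.ofReal (27 * K * (J q.1.2 * ‖q.1.2‖ ^ 3))
      * (halfSpace γ).indicator (fun y => ENNReal.ofReal (FD h y)) (cpath γ q.1.2 q.2 q.1.1) := by
    exact Measurable.mul (by fun_prop) (hFm.comp (cpath_cont2 hG.cont).measurable)
  have h2 : Measurable fun q : EV (n + 1) × EV (n + 1) => ∫⁻ τ in Set.Icc (0 : ℝ) 1,
      ENNReal.ofReal (27 * K * (J q.2 * ‖q.2‖ ^ 3))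
      * (halfSpace γ).indicator (fun y => ENNReal.ofReal (FD h y)) (cpath γ q.2 τ q.1) :=
    Measurable.lintegral_prod_right' (ν := volume.restrict (Set.Icc (0 : ℝ) 1)) h1
  exact Measurable.lintegral_prod_right' (ν := (volume : Measure (EV (n + 1)))) h2

/-- The tail mass of the kernel. -/
def tailM (J : EV (n + 1) → ℝ) (r : ℝ) : ℝ≥0∞ := ∫⁻ z in {z : EV (n + 1) | r ≤ ‖z‖}, ENNReal.ofReal (J z)

theorem tailM_lt (hK : KB J ε β C) {r : ℝ} (hr : 0 < r) : tailM J r ≠ ⊤ := by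
  have h := hK.integrableOn_zero hr
  unfold tailM
  rw [← ofReal_integral_eq_lintegral_ofReal h (ae_of_all _ hK.nonneg)]
  exact ENNReal.ofReal_ne_top

theorem tail_term (hG : GB γ K) (hK : KB J ε β C) {p : ℝ≥0∞} (hp1 : 1 ≤ p) (hp : p ≠ ⊤)
    {w : EV (n + 1) → ℝ} (hw : Continuous w) (r : ℝ) :
    LN p.toReal (volume.restrict (halfSpace γ)) (fun x =>
      ∫⁻ z in {z : EV (n + 1) | r ≤ ‖z‖}, ENNReal.ofReal (J z)
            * (halfSpace γ).indicator (fun y => ENNReal.ofReal |w y|) (x + z))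
      ≤ tailM J r * eLpNorm w p (volume.restrict (halfSpace γ)) := by
  have hq := one_le_toReal hp1 hp
  have hq0 : 0 < p.toReal := by linarith
  have hΩm : MeasurableSet (halfSpace γ) := (isOpen_halfSpace hG.cont).measurableSet
  have hFm := FI_meas hG hw.abs
  set FI := (halfSpace γ).indicator (fun y => ENNReal.ofReal |w y|) with hFI
  have hJm := hK.meas
  have hFA : LN p.toReal volume FI = eLpNorm w p (volume.restrict (halfSpace γ)) := by
    rw [hFI, LN_indicator hq hΩm, eLpNorm_eq_LN hp1 hp]
    simp only [Real.enorm_eq_ofReal_abs]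
  have hmink := LN_minkowski hq (μ := volume.restrict (halfSpace γ))
    (ν := (volume.restrict {z : EV (n + 1) | r ≤ ‖z‖}).withDensity (fun z : EV (n + 1) => ENNReal.ofReal (J z)))
    (f := fun x z => FI (x + z)) (hFm.comp (by fun_prop : Measurable fun q : EV (n + 1) × EV (n + 1) => q.1 + q.2))
    (A := eLpNorm w p (volume.restrict (halfSpace γ)))
    (ae_of_all _ fun z => by
      refine (lintegral_mono' Measure.restrict_le_self le_rfl).trans ?_
      rw [lintegral_add_right_eq_self (fun x => FI x ^ p.toReal), LN_rpow hq, hFA])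
  have e2 : ∀ x : EV (n + 1), ∫⁻ z, FI (x + z)
        ∂((volume.restrict {z : EV (n + 1) | r ≤ ‖z‖}).withDensity (fun z : EV (n + 1) => ENNReal.ofReal (J z)))
      = ∫⁻ z in {z : EV (n + 1) | r ≤ ‖z‖}, ENNReal.ofReal (J z) * FI (x + z) := by
    intro x
    have hm : Measurable fun z : EV (n + 1) => FI (x + z) := hFm.comp (by fun_prop)
    rw [lintegral_withDensity_eq_lintegral_mul _ hJm.ennreal_ofReal hm]
    rfl
  simp only [e2] at hmink
  refine hmink.trans (le_of_eq ?_)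
  rw [withDensity_apply _ MeasurableSet.univ, Measure.restrict_univ]
  rfl

theorem tail_meas (hG : GB γ K) (hK : KB J ε β C) {w : EV (n + 1) → ℝ} (hw : Continuous w) (r : ℝ) :
    Measurable (fun x => ∫⁻ z in {z : EV (n + 1) | r ≤ ‖z‖}, ENNReal.ofReal (J z)
            * (halfSpace γ).indicator (fun y => ENNReal.ofReal |w y|) (x + z)) := by
  have hJm := hK.meas
  have h1 : Measurable fun q : EV (n + 1) × EV (n + 1) => ENNReal.ofReal (J q.2)
      * (halfSpace γ).indicator (fun y => ENNReal.ofReal |w y|) (q.1 + q.2) :=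
    Measurable.mul (by fun_prop) ((FI_meas hG hw.abs).comp (by fun_prop))
  exact Measurable.lintegral_prod_right' (ν := volume.restrict {z : EV (n + 1) | r ≤ ‖z‖}) h1

end
end

noncomputable section
set_option maxSynthPendingDepth 3
section

theorem weak_lin {d : ℕ} {Ω : Set (EV d)} {p : ℝ≥0∞} (hp1 : 1 ≤ p) {i : Fin d} {u v u' v' : EV d → ℝ}
    (hu : MemLp u p (volume.restrict Ω)) (hv : MemLp v p (volume.restrict Ω))
    (hu' : MemLp u' p (volume.restrict Ω)) (hv' : MemLp v' p (volume.restrict Ω))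
    (h : WeakDerivOn Ω i u v) (h' : WeakDerivOn Ω i u' v') (a b : ℝ) :
    WeakDerivOn Ω i (fun x => a * u x + b * u' x) (fun x => a * v x + b * v' x) := by
  intro φ hφ hc hs
  have hφc := hφ.continuous
  have hdc : Continuous (partialD i φ) := (partialDList_cd 0 [i] (hφ.of_le (by exact_mod_cast le_top))).continuous
  have hdh := partialD_hcs i hc
  have I1 : Integrable (fun x => partialD i φ x * u x) (volume.restrict Ω) := integrable_b hp1 hdc hdh hu
  have I2 : Integrable (fun x => partialD i φ x * u' x) (volume.restrict Ω) := integrable_b hp1 hdc hdh hu'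
  have I3 : Integrable (fun x => φ x * v x) (volume.restrict Ω) := integrable_b hp1 hφc hc hv
  have I4 : Integrable (fun x => φ x * v' x) (volume.restrict Ω) := integrable_b hp1 hφc hc hv'
  have e1 := h φ hφ hc hs
  have e2 := h' φ hφ hc hs
  have c1 : ∀ x, (a * u x + b * u' x) * partialD i φ x = a * (partialD i φ x * u x) + b * (partialD i φ x * u' x) := fun x => by ring
  have c2 : ∀ x, (a * v x + b * v' x) * φ x = a * (φ x * v x) + b * (φ x * v' x) := fun x => by ring
  simp only [c1, c2]
  rw [integral_add (I1.const_mul a) (I2.const_mul b), integral_add (I3.const_mul a) (I4.const_mul b),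
    integral_const_mul, integral_const_mul, integral_const_mul, integral_const_mul]
  simp only [mul_comm (u _), mul_comm (v _), mul_comm (u' _), mul_comm (v' _)] at e1 e2
  rw [e1, e2]; ring

theorem sob_lin {d : ℕ} {Ω : Set (EV d)} {p : ℝ≥0∞} (hp1 : 1 ≤ p) {k : ℕ} {u u' : EV d → ℝ}
    {D D' : List (Fin d) → EV d → ℝ} (hD : IsSobDerivs Ω k p u D) (hD' : IsSobDerivs Ω k p u' D') (a b : ℝ) :
    IsSobDerivs Ω k p (fun x => a * u x + b * u' x) (fun l x => a * D l x + b * D' l x) := by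
  refine ⟨?_, fun l hl i => ?_, fun l hl => ?_⟩
  · funext x
    simp only [hD.1, hD'.1]
  · exact weak_lin hp1 (hD.2.2 _ hl.le) (hD.2.2 _ (by simpa using hl)) (hD'.2.2 _ hl.le)
      (hD'.2.2 _ (by simpa using hl)) (hD.2.1 l hl i) (hD'.2.1 l hl i) a b
  · exact ((hD.2.2 l hl).const_mul a).add ((hD'.2.2 l hl).const_mul b)

theorem neumann_sub {d : ℕ} {Ω : Set (EV d)} {p : ℝ≥0∞} (hp1 : 1 ≤ p) {u u' : EV d → ℝ}
    {D' : List (Fin d) → EV d → ℝ} (hD' : IsSobDerivs Ω 2 p u' D') {Mm : Matrix (Fin d) (Fin d) ℝ}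
    (h : NeumannBC Ω Mm p u) (h' : NeumannBC Ω Mm p u') :
    NeumannBC Ω Mm p (fun x => 1 * u x + (-1) * u' x) := by
  intro E hE φ hφ hc
  have hs := sob_lin hp1 hE hD' 1 1
  have e0 : (fun x => 1 * (1 * u x + (-1) * u' x) + 1 * u' x) = u := by funext x; ring
  rw [e0] at hs
  have q1 := h _ hs φ hφ hc
  have q2 := h' _ hD' φ hφ hc
  have hφc := hφ.continuous
  have c1 : ∀ i j, ∫ x in Ω, (1 * E [i, j] x + 1 * D' [i, j] x) * φ x
      = (∫ x in Ω, E [i, j] x * φ x) + ∫ x in Ω, D' [i, j] x * φ x := by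
    intro i j
    have I1 : Integrable (fun x => φ x * E [i, j] x) (volume.restrict Ω) := integrable_b hp1 hφc hc (hE.2.2 _ (by simp))
    have I2 : Integrable (fun x => φ x * D' [i, j] x) (volume.restrict Ω) := integrable_b hp1 hφc hc (hD'.2.2 _ (by simp))
    simp only [mul_comm _ (φ _)]
    rw [← integral_add I1 I2]
    refine integral_congr_ae (ae_of_all _ fun x => ?_)
    ring
  have c2 : ∀ i j, ∫ x in Ω, (1 * E [j] x + 1 * D' [j] x) * partialD i φ x
      = (∫ x in Ω, E [j] x * partialD i φ x) + ∫ x in Ω, D' [j] x * partialD i φ x := by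
    intro i j
    have hdc : Continuous (partialD i φ) := (partialDList_cd 0 [i] (hφ.of_le (by exact_mod_cast le_top))).continuous
    have hdh := partialD_hcs i hc
    have I1 : Integrable (fun x => partialD i φ x * E [j] x) (volume.restrict Ω) := integrable_b hp1 hdc hdh (hE.2.2 _ (by simp))
    have I2 : Integrable (fun x => partialD i φ x * D' [j] x) (volume.restrict Ω) := integrable_b hp1 hdc hdh (hD'.2.2 _ (by simp))
    simp only [mul_comm _ (partialD i φ _)]
    rw [← integral_add I1 I2]
    refine integral_congr_ae (ae_of_all _ fun x => ?_)
    ring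
  simp only [c1, c2, mul_add, Finset.sum_add_distrib] at q1
  linarith

end
end

noncomputable section
set_option maxSynthPendingDepth 3
section
variable {n : ℕ} {γ : EV n → ℝ} {K : ℝ} {J : EV (n + 1) → ℝ} {ε β C : ℝ}

/-- The final constant. -/
def cF (n : ℕ) (K C β q : ℝ) : ℝ := C * (cB n K * (2 * (2 / β) ^ (1 / q))) + 162 * K * C

theorem cB_nonneg (n : ℕ) {K : ℝ} (hK : 0 ≤ K) : 0 ≤ cB n K := by unfold cB; positivity

theorem bdry_meas (hG : GB γ K) {h : EV (n + 1) → ℝ} (hh : ContDiff ℝ 3 h) (C β ε : ℝ) :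
    Measurable fun x => ENNReal.ofReal (C * wt β (tf γ x / 2 / ε) * (2 / tf γ x * |inner ℝ (gradV h x) (nuV γ x)|
        + K * ‖fderiv ℝ h x‖ + ‖fderiv ℝ (fderiv ℝ h) x‖)) := by
  have htm : Measurable (tf γ) := (tf_continuous hG.cont).measurable
  have h2 : ContDiff ℝ 2 (fderiv ℝ h) := hh.fderiv_right (m := 2) (by norm_num)
  have h1 : ContDiff ℝ 1 (fderiv ℝ (fderiv ℝ h)) := h2.fderiv_right (m := 1) (by norm_num)
  have m1 : Measurable fun x => wt β (tf γ x / 2 / ε) :=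
    (wt_measurable β).comp ((htm.div_const 2).div_const ε)
  have m2 : Continuous fun x => inner ℝ (gradV h x) (nuV γ x) := by
    simp only [inner_sumE]
    refine continuous_finsetSum _ fun i _ => ?_
    have h3 : ContDiff ℝ 2 (partialDList [i] h) := partialDList_cd 2 [i] (hh.of_le (by norm_num))
    exact h3.continuous.mul (nuV_cd hG i).continuous
  have m3 := h2.continuous.norm.measurable
  have m4 := h1.continuous.norm.measurable
  have m5 : Measurable fun x => |inner ℝ (gradV h x) (nuV γ x)| := m2.abs.measurable
  have m6 : Measurable fun x => 2 / tf γ x * |inner ℝ (gradV h x) (nuV γ x)| := (htm.const_div 2).mul m5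
  have m7 : Measurable fun x => K * ‖fderiv ℝ h x‖ := m3.const_mul K
  exact ((m1.const_mul C).mul ((m6.add m7).add m4)).ennreal_ofReal

theorem const_bound (hε : 0 < ε) (hε1 : ε ≤ 1) (hβ : 0 < β) (hC : 0 ≤ C) (hK : 0 ≤ K) {q : ℝ} (hq : 1 ≤ q) :
    C * (cB n K * (2 * (2 * ε / β) ^ (1 / q))) + 162 * K * C * ε ≤ cF n K C β q * ε ^ (1 / q) := by
  have e : (2 * ε / β) ^ (1 / q) = (2 / β) ^ (1 / q) * ε ^ (1 / q) := by
    rw [← Real.mul_rpow (by positivity) hε.le]; congr 1; ring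
  have h1 : ε ≤ ε ^ (1 / q) := by
    calc ε = ε ^ (1 : ℝ) := (Real.rpow_one _).symm
      _ ≤ _ := Real.rpow_le_rpow_of_exponent_ge hε hε1 (by rw [div_le_one (by linarith)]; exact hq)
  have h2 : 162 * K * C * ε ≤ 162 * K * C * ε ^ (1 / q) := by gcongr
  unfold cF
  rw [e]
  calc _ ≤ C * (cB n K * (2 * ((2 / β) ^ (1 / q) * ε ^ (1 / q)))) + 162 * K * C * ε ^ (1 / q) := by linarith
    _ = _ := by ring

/-- The constant in front of the approximation error. -/
def cE (n : ℕ) (C β ε κ : ℝ) : ℝ≥0∞ :=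
  ENNReal.ofReal C * (ENNReal.ofReal (2 / κ) * (ENNReal.ofReal (2 * ε / β) * ENNReal.ofReal (2 * (n + 1)))
    + ENNReal.ofReal (4 * (n + 1) / κ))

theorem smooth_bound (hG : GB γ K) (hK : KB J ε β C) (hε : 0 < ε) (hε1 : ε ≤ 1) (hβ : 0 < β) (hC : 0 ≤ C)
    {p : ℝ≥0∞} (hp1 : 1 ≤ p) (hp : p ≠ ⊤) {u : EV (n + 1) → ℝ}
    {D : List (Fin (n + 1)) → EV (n + 1) → ℝ} (hD : IsSobDerivs (halfSpace γ) 3 p u D)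
    (hN : NeumannBC (halfSpace γ) (1 : Matrix (Fin (n + 1)) (Fin (n + 1)) ℝ) p u)
    {h w : EV (n + 1) → ℝ} (hh : ContDiff ℝ 3 h) (hhc : HasCompactSupport h) (hw : Continuous w)
    (hwc : HasCompactSupport w) {κ : ℝ} (hκ : 0 < κ) (hw0 : ∀ y, κ / 2 ≤ tf γ y → w y = 0)
    {Lf : EV (n + 1) → ℝ}
    (hl : ∀ᵐ x ∂(volume.restrict (halfSpace γ)),
      Tendsto (fun r : ℝ => ∫ y in halfSpace γ ∩ {y | r ≤ dist x y},
      J (x - y) * ((h x - w x) - (h y - w y))) (𝓝[>] 0) (𝓝 (Lf x))) :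
    LN p.toReal ((volume.restrict (halfSpace γ)).restrict {x | κ < tf γ x})
        (fun x => ENNReal.ofReal |Lf x + lap h x|)
      ≤ ENNReal.ofReal (cF n K C β p.toReal * ε ^ (1 / p.toReal)) *
          WNormD 3 p (volume.restrict (halfSpace γ)) (fun l => partialDList l h)
        + cE n C β ε κ * EN γ p h D + tailM J (κ / 4) * eLpNorm w p (volume.restrict (halfSpace γ)) := by
  have hq := one_le_toReal hp1 hp
  have hK0 := hG.K0
  have hcB := cB_nonneg n hK0
  set μ := volume.restrict (halfSpace γ) with hμ
  have htm : Measurable (tf γ) := (tf_continuous hG.cont).measurable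
  have hSm : MeasurableSet {x : EV (n + 1) | κ < tf γ x} := measurableSet_lt measurable_const htm
  set S := {x : EV (n + 1) | κ < tf γ x} with hS
  have hle : LN p.toReal (μ.restrict S) (fun x => ENNReal.ofReal |Lf x + lap h x|)
      ≤ LN p.toReal (μ.restrict S) (fun x => ENNReal.ofReal (C * wt β (tf γ x / 2 / ε) * (2 / tf γ x * |inner ℝ (gradV h x) (nuV γ x)|
            + K * ‖fderiv ℝ h x‖ + ‖fderiv ℝ (fderiv ℝ h) x‖))
        + (∫⁻ z, ∫⁻ τ in Set.Icc (0 : ℝ) 1, ENNReal.ofReal (27 * K * (J z * ‖z‖ ^ 3))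
            * (halfSpace γ).indicator (fun y => ENNReal.ofReal (FD h y)) (cpath γ z τ x))
        + ENNReal.ofReal (27 * K * C * ε * FD h x)
        + (∫⁻ z in {z : EV (n + 1) | κ / 4 ≤ ‖z‖}, ENNReal.ofReal (J z)
            * (halfSpace γ).indicator (fun y => ENNReal.ofReal |w y|) (x + z))) := by
    refine LN_mono_ae hq ?_
    rw [ae_restrict_iff' hSm]
    filter_upwards [hl] with x hx hxκ
    exact pointwise_est hG hK hε hβ hC hh hhc hw hwc hκ x hxκ hw0 hx
  refine hle.trans ?_
  have m1 := bdry_meas hG hh C β ε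
  have m2 := taylor_meas hG hK hh
  have m3 : Measurable fun x => ENNReal.ofReal (27 * K * C * ε * FD h x) :=
    ((FD_continuous hh).measurable.const_mul _).ennreal_ofReal
  have m4 := tail_meas hG hK hw (κ / 4)
  have B1 := boundary_term hG hp1 hp hD hN hh hβ hε hC hκ
  have B2 := (LN_measure_mono hq (Measure.restrict_le_self (s := S)) _).trans (taylor_term hG hK hε hp1 hp hh)
  have B4 := (LN_measure_mono hq (Measure.restrict_le_self (s := S)) _).trans (tail_term hG hK hp1 hp hw (κ / 4))
  have B3 : LN p.toReal (μ.restrict S) (fun x => ENNReal.ofReal (27 * K * C * ε * FD h x))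
      ≤ ENNReal.ofReal (27 * K * C * ε) * (3 * WNormD 3 p μ (fun l => partialDList l h)) := by
    refine (LN_measure_mono hq (Measure.restrict_le_self (s := S)) _).trans ?_
    have e : (fun x => ENNReal.ofReal (27 * K * C * ε * FD h x)) =
        fun x => ENNReal.ofReal (27 * K * C * ε) * ENNReal.ofReal (FD h x) := by
      funext x; rw [ENNReal.ofReal_mul (by positivity)]
    rw [e, LN_const_mul hq ENNReal.ofReal_ne_top]
    gcongr
    exact FD_LN hp1 hp hh _
  refine (LN_add_le hq ((m1.add m2).add m3).aemeasurable m4.aemeasurable).trans ?_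
  refine (add_le_add ((LN_add_le hq (m1.add m2).aemeasurable m3.aemeasurable).trans
    (add_le_add ((LN_add_le hq m1.aemeasurable m2.aemeasurable).trans (add_le_add B1 B2)) B3)) B4).trans ?_
  set W := WNormD 3 p μ (fun l => partialDList l h) with hW
  refine add_le_add ?_ le_rfl
  have hcb := const_bound (n := n) hε hε1 hβ hC hK0 hq
  have hc2 := ENNReal.ofReal_le_ofReal hcb
  have e3 : ENNReal.ofReal (C * (cB n K * (2 * (2 * ε / β) ^ (1 / p.toReal))) + 162 * K * C * ε)
      = ENNReal.ofReal C * (ENNReal.ofReal (cB n K) * ENNReal.ofReal (2 * (2 * ε / β) ^ (1 / p.toReal)))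
        + ENNReal.ofReal (27 * K * (C * ε)) * 3 + ENNReal.ofReal (27 * K * C * ε) * 3 := by
    rw [ENNReal.ofReal_add (by positivity) (by positivity), ENNReal.ofReal_mul hC, ENNReal.ofReal_mul hcB, add_assoc]
    congr 1
    rw [← ENNReal.ofReal_ofNat, ← ENNReal.ofReal_mul (by positivity), ← ENNReal.ofReal_mul (by positivity),
      ← ENNReal.ofReal_add (by positivity) (by positivity)]
    congr 1; ring
  calc _ = (ENNReal.ofReal C * (ENNReal.ofReal (cB n K) * ENNReal.ofReal (2 * (2 * ε / β) ^ (1 / p.toReal)))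
        + ENNReal.ofReal (27 * K * (C * ε)) * 3 + ENNReal.ofReal (27 * K * C * ε) * 3) * W
        + cE n C β ε κ * EN γ p h D := by unfold cE; ring
    _ ≤ _ := by
      rw [← e3]
      gcongr

end
end

noncomputable section
set_option maxSynthPendingDepth 3
section
variable {n : ℕ} {γ : EV n → ℝ} {K : ℝ} {ρ : EV (n + 1) → ℝ} {ε β C : ℝ}

theorem LS_mono23 {d : ℕ} : LS d 2 ⊆ LS d 3 := fun l hl => mem_LS.2 ((mem_LS.1 hl).trans (by norm_num))

theorem approx_bound (hG : GB γ K) (hK : KB (kernelJ (scaled ρ ε)) ε β C) (hε : 0 < ε) (hε1 : ε ≤ 1)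
    (hβ : 0 < β) (hC : 0 ≤ C)
    {p : ℝ≥0∞} (hp1 : 1 ≤ p) (hp : p ≠ ⊤) {u : EV (n + 1) → ℝ}
    {D : List (Fin (n + 1)) → EV (n + 1) → ℝ} (hD : IsSobDerivs (halfSpace γ) 3 p u D)
    (hN : NeumannBC (halfSpace γ) (1 : Matrix (Fin (n + 1)) (Fin (n + 1)) ℝ) p u)
    {κ : ℝ} (hκ : 0 < κ) {c : ℝ} {L : (EV (n + 1) → ℝ) → EV (n + 1) → ℝ}
    (hL : IsNLExtOn (halfSpace γ) (1 : Matrix (Fin (n + 1)) (Fin (n + 1)) ℝ) ρ p ε c L) {η : ℝ} (hη : 0 < η) :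
    LN p.toReal ((volume.restrict (halfSpace γ)).restrict {x | κ < tf γ x})
        (fun x => ‖L u x + ∑ i : Fin (n + 1), D [i, i] x‖ₑ)
      ≤ ENNReal.ofReal (cF n K C β p.toReal * ε ^ (1 / p.toReal)) * WNormD 3 p (volume.restrict (halfSpace γ)) D
        + (ENNReal.ofReal c * (2 * (LS (n + 1) 3).card)
          + ENNReal.ofReal (cF n K C β p.toReal * ε ^ (1 / p.toReal)) * (LS (n + 1) 3).card
          + cE n C β ε κ * (LS (n + 1) 3).card + tailM (kernelJ (scaled ρ ε)) (κ / 4)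
          + (n + 1 : ℕ) * (LS (n + 1) 3).card) * ENNReal.ofReal η := by
  have hq := one_le_toReal hp1 hp
  obtain ⟨h, w, hh, hhc, hw, hwc, hw0, hmem, hhD, hwD⟩ := approx_pair hG hp1 hp hD hN hκ hη
  obtain ⟨Lpv, Llin, Lmem, Lbd⟩ := hL
  have hh3 : ContDiff ℝ 3 h := hh.of_le three_le_top
  have hh2 : ContDiff ℝ 2 h := hh3.of_le (by norm_num)
  set μ := volume.restrict (halfSpace γ) with hμ
  set v : EV (n + 1) → ℝ := fun x => h x - w x with hv
  have hv2 : ContDiff ℝ 2 v := hh2.sub hw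
  have hvc : HasCompactSupport v := hcs_sub hhc hwc
  have hpv := Lpv v hv2 hvc hmem
  have SB := smooth_bound hG hK hε hε1 hβ hC hp1 hp hD hN hh3 hhc hw.continuous hwc hκ hw0 (Lf := L v) hpv
  -- the operator difference
  have hD2 : IsSobDerivs (halfSpace γ) 2 p u D := hD.mono (by norm_num)
  have hv2' : ContDiff ℝ ((2 : ℕ) : WithTop ℕ∞) v := by exact_mod_cast hv2
  have hDv : IsSobDerivs (halfSpace γ) 2 p v (fun l => partialDList l v) := sob_of_classical hv2' hvc
  have hu : MemWN (halfSpace γ) (1 : Matrix (Fin (n + 1)) (Fin (n + 1)) ℝ) 2 p u := ⟨⟨D, hD2⟩, hN⟩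
  have hDd := sob_lin hp1 hD2 hDv 1 (-1)
  have hNd : NeumannBC (halfSpace γ) (1 : Matrix (Fin (n + 1)) (Fin (n + 1)) ℝ) p (fun x => 1 * u x + (-1) * v x) :=
    neumann_sub hp1 hDv hN hmem.2
  have Bd := Lbd _ _ ⟨⟨_, hDd⟩, hNd⟩ hDd
  have hlin := Llin u v hu hmem 1 (-1)
  rw [eLpNorm_congr_ae hlin, eLpNorm_eq_LN hp1 hp, WNormD_eq] at Bd
  have hEN : EN γ p h D ≤ (LS (n + 1) 3).card * ENNReal.ofReal η := by
    unfold EN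
    exact (Finset.sum_le_sum hhD).trans (by simp)
  have hEN2 : ∑ l ∈ LS (n + 1) 2, eLpNorm (fun x => 1 * D l x + (-1) * partialDList l v x) p μ
      ≤ 2 * (LS (n + 1) 3).card * ENNReal.ofReal η := by
    have : ∀ l ∈ LS (n + 1) 2, eLpNorm (fun x => 1 * D l x + (-1) * partialDList l v x) p μ
        ≤ ENNReal.ofReal η + ENNReal.ofReal η := by
      intro l hl
      have hl2 := mem_LS.1 hl
      have c1 : ContDiff ℝ l.length h := hh2.of_le (by exact_mod_cast hl2)
      have c2 : ContDiff ℝ l.length w := hw.of_le (by exact_mod_cast hl2)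
      have m1 := diff_aesm hD hh3 (LS_mono23 hl)
      have m2 : AEStronglyMeasurable (partialDList l w) μ := by
        have : ContDiff ℝ 0 (partialDList l w) := partialDList_cd 0 l (by simpa using c2)
        exact this.continuous.aestronglyMeasurable
      have e : (fun x => 1 * D l x + (-1) * partialDList l v x)
          = (-fun x => partialDList l h x - D l x) + partialDList l w := by
        funext x
        rw [hv, partialDList_sub l c1 c2]
        simp only [Pi.add_apply, Pi.neg_apply]
        ring
      rw [e]
      refine (eLpNorm_add_le m1.neg m2 hp1).trans ?_
      rw [eLpNorm_neg]
      exact add_le_add (hhD l (LS_mono23 hl)) (hwD l hl)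
    refine (Finset.sum_le_sum this).trans ?_
    rw [Finset.sum_const, nsmul_eq_mul]
    have hc : ((LS (n + 1) 2).card : ℝ≥0∞) ≤ (LS (n + 1) 3).card := by
      exact_mod_cast Finset.card_le_card LS_mono23
    calc _ ≤ ((LS (n + 1) 3).card : ℝ≥0∞) * (ENNReal.ofReal η + ENNReal.ofReal η) := by gcongr
      _ = _ := by ring
  have hWN : WNormD 3 p μ (fun l => partialDList l h) ≤ WNormD 3 p μ D + (LS (n + 1) 3).card * ENNReal.ofReal η := by
    rw [WNormD_eq, WNormD_eq]
    refine le_trans ?_ (add_le_add le_rfl hEN)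
    unfold EN
    rw [← Finset.sum_add_distrib]
    refine Finset.sum_le_sum fun l hl => ?_
    have m1 := diff_aesm hD hh3 hl
    have m2 := (hD.2.2 l (mem_LS.1 hl)).1
    have e : partialDList l h = D l + (fun x => partialDList l h x - D l x) := by
      funext x; simp
    calc eLpNorm (partialDList l h) p μ = eLpNorm (D l + (fun x => partialDList l h x - D l x)) p μ := by rw [← e]
      _ ≤ _ := eLpNorm_add_le m2 m1 hp1
  have hw' : eLpNorm w p μ ≤ ENNReal.ofReal η := hwD [] (mem_LS.2 (by simp))
  -- pointwise
  have hpt : ∀ x, ‖L u x + ∑ i : Fin (n + 1), D [i, i] x‖ₑ ≤ ‖1 * L u x + (-1) * L v x‖ₑ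
      + ENNReal.ofReal |L v x + lap h x| + (n + 1 : ℕ) * ENNReal.ofReal (EE h D x) := by
    intro x
    have e : L u x + ∑ i : Fin (n + 1), D [i, i] x = (1 * L u x + (-1) * L v x) + (L v x + lap h x)
        + -∑ i : Fin (n + 1), (partialDList [i, i] h x - D [i, i] x) := by
      rw [Finset.sum_sub_distrib]; unfold lap; ring
    rw [e]
    refine (enorm_add_le _ _).trans (add_le_add ((enorm_add_le _ _).trans (add_le_add le_rfl ?_)) ?_)
    · rw [Real.enorm_eq_ofReal_abs]
    · rw [Real.enorm_eq_ofReal_abs, abs_neg, ← ENNReal.ofReal_natCast, ← ENNReal.ofReal_mul (by positivity)]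
      refine ENNReal.ofReal_le_ofReal ((Finset.abs_sum_le_sum_abs _ _).trans ?_)
      calc ∑ i : Fin (n + 1), |partialDList [i, i] h x - D [i, i] x| ≤ ∑ i : Fin (n + 1), EE h D x := by
            refine Finset.sum_le_sum fun i _ => ?_
            exact Finset.single_le_sum (f := fun l => |partialDList l h x - D l x|) (fun _ _ => abs_nonneg _)
              (mem_LS.2 (by simp : [i, i].length ≤ 3))
        _ = _ := by simp
  set S := {x : EV (n + 1) | κ < tf γ x} with hS
  have a1 : AEMeasurable (fun x => ‖1 * L u x + (-1) * L v x‖ₑ) (μ.restrict S) :=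
    (((Lmem u hu).1.const_mul 1).add ((Lmem v hmem).1.const_mul (-1))).enorm.mono_measure Measure.restrict_le_self
  have a2 : AEMeasurable (fun x => ENNReal.ofReal |L v x + lap h x|) (μ.restrict S) := by
    have hlap : Continuous (lap h) := by
      unfold lap
      refine continuous_finsetSum _ fun i _ => ?_
      have : ContDiff ℝ 0 (partialDList [i, i] h) := partialDList_cd 0 [i, i] (hh2.of_le (by norm_num))
      exact this.continuous
    have := ((Lmem v hmem).1.add hlap.aestronglyMeasurable).enorm.mono_measure
      (Measure.restrict_le_self (s := S))
    refine this.congr (Eventually.of_forall fun x => ?_)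
    exact Real.enorm_eq_ofReal_abs _
  have a3 : AEMeasurable (fun x => ((n + 1 : ℕ) : ℝ≥0∞) * ENNReal.ofReal (EE h D x)) (μ.restrict S) :=
    ((EE_aem hD hh3).const_mul _).mono_measure Measure.restrict_le_self
  have T1 := (LN_measure_mono hq (Measure.restrict_le_self (s := S)) _).trans (Bd.trans (mul_le_mul_right hEN2 _))
  have T3 : LN p.toReal (μ.restrict S) (fun x => ((n + 1 : ℕ) : ℝ≥0∞) * ENNReal.ofReal (EE h D x))
      ≤ (n + 1 : ℕ) * ((LS (n + 1) 3).card * ENNReal.ofReal η) := by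
    rw [LN_const_mul hq (ENNReal.natCast_ne_top _)]
    gcongr
    exact (LN_measure_mono hq (Measure.restrict_le_self (s := S)) _).trans ((EE_LN hp1 hp hD hh3).trans hEN)
  have T2 := SB.trans (add_le_add (add_le_add (mul_le_mul_right hWN _) (mul_le_mul_right hEN _)) (mul_le_mul_right hw' _))
  refine (LN_mono_ae hq (Eventually.of_forall hpt)).trans ?_
  refine (LN_add_le hq (a1.add a2) a3).trans ?_
  refine (add_le_add ((LN_add_le hq a1 a2).trans (add_le_add T1 T2)) T3).trans (le_of_eq ?_)
  ring

theorem bound_kappa (hG : GB γ K) (hK : KB (kernelJ (scaled ρ ε)) ε β C) (hε : 0 < ε) (hε1 : ε ≤ 1)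
    (hβ : 0 < β) (hC : 0 ≤ C)
    {p : ℝ≥0∞} (hp1 : 1 ≤ p) (hp : p ≠ ⊤) {u : EV (n + 1) → ℝ}
    {D : List (Fin (n + 1)) → EV (n + 1) → ℝ} (hD : IsSobDerivs (halfSpace γ) 3 p u D)
    (hN : NeumannBC (halfSpace γ) (1 : Matrix (Fin (n + 1)) (Fin (n + 1)) ℝ) p u)
    {κ : ℝ} (hκ : 0 < κ) {c : ℝ} {L : (EV (n + 1) → ℝ) → EV (n + 1) → ℝ}
    (hL : IsNLExtOn (halfSpace γ) (1 : Matrix (Fin (n + 1)) (Fin (n + 1)) ℝ) ρ p ε c L) :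
    LN p.toReal ((volume.restrict (halfSpace γ)).restrict {x | κ < tf γ x})
        (fun x => ‖L u x + ∑ i : Fin (n + 1), D [i, i] x‖ₑ)
      ≤ ENNReal.ofReal (cF n K C β p.toReal * ε ^ (1 / p.toReal)) *
        WNormD 3 p (volume.restrict (halfSpace γ)) D := by
  have key := fun (η : ℝ) (hη : 0 < η) => approx_bound hG hK hε hε1 hβ hC hp1 hp hD hN hκ hL hη
  have ht : tailM (kernelJ (scaled ρ ε)) (κ / 4) ≠ ⊤ := tailM_lt hK (by positivity)
  set M0 : ℝ≥0∞ := ENNReal.ofReal c * (2 * (LS (n + 1) 3).card)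
          + ENNReal.ofReal (cF n K C β p.toReal * ε ^ (1 / p.toReal)) * (LS (n + 1) 3).card
          + cE n C β ε κ * (LS (n + 1) 3).card + tailM (kernelJ (scaled ρ ε)) (κ / 4)
          + (n + 1 : ℕ) * (LS (n + 1) 3).card with hM0
  have hM : M0 ≠ ⊤ := by
    have hcE : cE n C β ε κ ≠ ⊤ := by
      unfold cE
      finiteness
    rw [hM0]
    finiteness
  have hlim : Tendsto (fun η : ℝ => ENNReal.ofReal (cF n K C β p.toReal * ε ^ (1 / p.toReal)) *
        WNormD 3 p (volume.restrict (halfSpace γ)) D + M0 * ENNReal.ofReal η) (𝓝[>] 0)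
      (𝓝 (ENNReal.ofReal (cF n K C β p.toReal * ε ^ (1 / p.toReal)) *
        WNormD 3 p (volume.restrict (halfSpace γ)) D + M0 * ENNReal.ofReal 0)) := by
    refine Tendsto.add tendsto_const_nhds ?_
    refine ENNReal.Tendsto.const_mul ?_ (Or.inr hM)
    exact (ENNReal.continuous_ofReal.tendsto 0).mono_left nhdsWithin_le_nhds
  rw [ENNReal.ofReal_zero, mul_zero, add_zero] at hlim
  refine ge_of_tendsto hlim ?_
  filter_upwards [self_mem_nhdsWithin] with η hη
  exact key η hη

theorem bound_all (hG : GB γ K) (hK : KB (kernelJ (scaled ρ ε)) ε β C) (hε : 0 < ε) (hε1 : ε ≤ 1)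
    (hβ : 0 < β) (hC : 0 ≤ C)
    {p : ℝ≥0∞} (hp1 : 1 ≤ p) (hp : p ≠ ⊤) {u : EV (n + 1) → ℝ}
    {D : List (Fin (n + 1)) → EV (n + 1) → ℝ} (hD : IsSobDerivs (halfSpace γ) 3 p u D)
    (hN : NeumannBC (halfSpace γ) (1 : Matrix (Fin (n + 1)) (Fin (n + 1)) ℝ) p u)
    {c : ℝ} {L : (EV (n + 1) → ℝ) → EV (n + 1) → ℝ}
    (hL : IsNLExtOn (halfSpace γ) (1 : Matrix (Fin (n + 1)) (Fin (n + 1)) ℝ) ρ p ε c L) :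
    eLpNorm (fun x => L u x + ∑ i : Fin (n + 1), D [i, i] x) p (volume.restrict (halfSpace γ))
      ≤ ENNReal.ofReal (cF n K C β p.toReal * ε ^ (1 / p.toReal)) *
        WNormD 3 p (volume.restrict (halfSpace γ)) D := by
  have hq := one_le_toReal hp1 hp
  have hq0 : 0 < p.toReal := by linarith
  rw [eLpNorm_eq_LN hp1 hp]
  set R := ENNReal.ofReal (cF n K C β p.toReal * ε ^ (1 / p.toReal)) *
        WNormD 3 p (volume.restrict (halfSpace γ)) D with hR
  set f : EV (n + 1) → ℝ≥0∞ := fun x => ‖L u x + ∑ i : Fin (n + 1), D [i, i] x‖ₑ with hf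
  set μ := volume.restrict (halfSpace γ) with hμ
  have hct := tf_continuous hG.cont
  have hΩm : MeasurableSet (halfSpace γ) := by
    have : halfSpace γ = {x | 0 < tf γ x} := by
      ext x
      simp only [halfSpace, tf, Set.mem_ofPred_eq, sub_pos]
    rw [this]
    exact measurableSet_lt measurable_const hct.measurable
  let s : ℕ → Set (EV (n + 1)) := fun j => {x | 1 / ((j : ℝ) + 1) < tf γ x}
  have hmono : Monotone s := by
    intro i j hij x hx
    have hij' : (i : ℝ) ≤ j := by exact_mod_cast hij
    have h1 : 1 / ((j : ℝ) + 1) ≤ 1 / ((i : ℝ) + 1) :=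
      one_div_le_one_div_of_le (by positivity) (by linarith)
    exact lt_of_le_of_lt h1 hx
  have hsm : ∀ j, MeasurableSet (s j) := fun j => measurableSet_lt measurable_const hct.measurable
  have e1 : μ = μ.restrict (⋃ j, s j) := by
    symm
    apply Measure.restrict_eq_self_of_ae_mem
    filter_upwards [ae_restrict_mem hΩm] with x hx
    have hx0 : 0 < tf γ x := sub_pos.2 hx
    obtain ⟨j, hj⟩ := exists_nat_one_div_lt hx0
    exact Set.mem_iUnion.2 ⟨j, hj⟩
  have hb : ∫⁻ x, f x ^ p.toReal ∂μ ≤ R ^ p.toReal := by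
    rw [e1, setLIntegral_iUnion_of_directed _ hmono.directed_le]
    refine iSup_le fun j => ?_
    have hj := bound_kappa hG hK hε hε1 hβ hC hp1 hp hD hN (κ := 1 / ((j : ℝ) + 1)) (by positivity) hL
    rw [LN_rpow hq]
    exact ENNReal.rpow_le_rpow hj hq0.le
  unfold LN
  calc _ ≤ (R ^ p.toReal) ^ (1 / p.toReal) := ENNReal.rpow_le_rpow hb (by positivity)
    _ = R := by rw [← ENNReal.rpow_mul, mul_one_div_cancel hq0.ne', ENNReal.rpow_one]

end
end

/-- convergence rate on a curved half space: let `γ ∈ C³_b(ℝ^{n-1})`,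
`p ∈ [1,∞)`, and let `ρ` satisfy (A1) and (A2) with `M = I`, with `‖γ‖_{C¹_b}`
sufficiently small. Then there is `C_γ > 0`, depending only on `γ`, `ρ` and `p`, such
that for all `ε ∈ (0,1]` and all `u ∈ W^{3,p}_I(ℝⁿ_γ)`:
`‖L_ε^{ℝⁿ_γ} u + Δu‖_{L^p(ℝⁿ_γ)} ≤ C_γ ε^{1/p} ‖u‖_{W^{3,p}(ℝⁿ_γ)}`.
Here `L_ε^{ℝⁿ_γ}` is (any choice of) the bounded linear extension of the nonlocal
operator, and `Δu = ∑ᵢ ∂ᵢ∂ᵢ u` is expressed through the weak derivatives `D`. -/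
theorem nlOp_rate_half_space (n : ℕ) (ρ : EV (n + 1) → ℝ)
    (hρ1 : A1 ρ) (hρ2 : A2 ρ) (hM : momentum ρ = 1)
    (p : ℝ≥0∞) (hp1 : 1 ≤ p) (hp : p ≠ ⊤) :
    ∃ δ : ℝ, 0 < δ ∧ ∀ γ : EV n → ℝ, Ckb 3 γ →
      (∀ x : EV n, |γ x| ≤ δ ∧ ‖fderiv ℝ γ x‖ ≤ δ) →
      ∀ L : ℝ → (EV (n + 1) → ℝ) → EV (n + 1) → ℝ,
        (∀ ε : ℝ, 0 < ε → ε ≤ 1 → ∃ c : ℝ, 0 < c ∧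
          IsNLExtOn (halfSpace γ) (1 : Matrix (Fin (n + 1)) (Fin (n + 1)) ℝ) ρ p ε c (L ε)) →
        ∃ C : ℝ, 0 < C ∧ ∀ ε : ℝ, 0 < ε → ε ≤ 1 →
          ∀ (u : EV (n + 1) → ℝ) (D : List (Fin (n + 1)) → EV (n + 1) → ℝ),
            NeumannBC (halfSpace γ) (1 : Matrix (Fin (n + 1)) (Fin (n + 1)) ℝ) p u →
            IsSobDerivs (halfSpace γ) 3 p u D →
            eLpNorm (fun x => L ε u x + ∑ i : Fin (n + 1), D [i, i] x) p
                (volume.restrict (halfSpace γ))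
              ≤ ENNReal.ofReal (C * ε ^ (1 / p.toReal))
                  * WNormD 3 p (volume.restrict (halfSpace γ)) D := by
  refine ⟨1, one_pos, fun γ hγ hγ1 L hL => ?_⟩
  obtain ⟨K, hG⟩ := exists_GB hγ fun x => (hγ1 x).2
  obtain ⟨β, C, hβ, hC, hKB⟩ := exists_KB hρ1 hρ2 hM
  have hcF : 0 ≤ cF n K C β p.toReal := by
    have h1 := cB_nonneg n hG.K0
    have h2 := hG.K0
    unfold cF
    positivity
  refine ⟨cF n K C β p.toReal + 1, by linarith, fun ε hε hε1 u D hN hD => ?_⟩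
  obtain ⟨c, -, hc⟩ := hL ε hε hε1
  refine (bound_all hG (hKB ε hε) hε hε1 hβ hC.le hp1 hp hD hN hc).trans ?_
  gcongr
  linarith
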